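/- Let f be a transcendental entire function in the Eremenko–Lyubich class B such that S(f) ∪ f(ℝ) ⊂ ℝ. Suppose there are constants r, K > 0 such that |f′(x)|/|f(x)| ≤ K · log|f(x)| / |x| whenever x ∈ ℝ satisfies |x| > r and |f(x)| > r. Then f does not have a wandering domain. -/

import Mathlib

/-!
Formalization of: "Absence of wandering domains for functions in class B whose
singular values escape uniformly, under a thickness condition along an invariant set A."
-/

open Set Metric Filter Topology

/-- The chordal (spherical) distance between two finite points of the Riemann sphere. -/
noncomputable def sphericalDist (z w : ℂ) : ℝ :=
  2 * dist z w / (Real.sqrt (1 + ‖z‖ ^ 2) * Real.sqrt (1 + ‖w‖ ^ 2))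

/-- A transcendental entire function: entire and not a polynomial. -/
def TranscendentalEntire (f : ℂ → ℂ) : Prop :=
  Differentiable ℂ f ∧ ¬∃ p : Polynomial ℂ, ∀ z : ℂ, f z = p.eval z

/-- `S` is the set of singular values of `f`: the smallest closed set `S ⊆ ℂ` such that
`f : ℂ ∖ f⁻¹(S) → ℂ ∖ S` is a covering map. -/
def IsSingularValueSet (f : ℂ → ℂ) (S : Set ℂ) : Prop :=
  IsClosed S ∧ IsCoveringMapOn f Sᶜ ∧
    ∀ T : Set ℂ, IsClosed T → IsCoveringMapOn f Tᶜ → S ⊆ T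

/-- The Fatou set of an entire function: points having a neighbourhood on which the family of
iterates is equicontinuous with respect to the spherical metric. -/
def FatouSet (f : ℂ → ℂ) : Set ℂ :=
  {z : ℂ | ∃ N : Set ℂ, IsOpen N ∧ z ∈ N ∧
    ∀ x ∈ N, ∀ ε > (0 : ℝ), ∃ δ > (0 : ℝ), ∀ y ∈ N, dist y x < δ →
      ∀ n : ℕ, sphericalDist (f^[n] y) (f^[n] x) < ε}

/-- A wandering domain: a connected component `W` of the Fatou set whose forward images are
pairwise disjoint. -/
def IsWanderingDomain (f : ℂ → ℂ) (W : Set ℂ) : Prop :=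
  (∃ z ∈ FatouSet f, W = connectedComponentIn (FatouSet f) z) ∧
    ∀ m n : ℕ, m ≠ n → f^[m] '' W ∩ f^[n] '' W = ∅

namespace RealClassB

section

theorem deriv_ne_zero_of_local_inverse {p q : ℂ → ℂ} {c : ℂ} (hp : Differentiable ℂ p)
    (hq : ∀ᶠ y in 𝓝 (p c), ContinuousAt q y) (hpq : ∀ᶠ y in 𝓝 (p c), p (q y) = y)
    (hqp : ∀ᶠ z in 𝓝 c, q (p z) = z) : deriv p c ≠ 0 := by
  have hq0 : q (p c) = c := hqp.self_of_nhds
  have hqc : Tendsto q (𝓝 (p c)) (𝓝 c) := by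
    have := hq.self_of_nhds.tendsto
    rwa [hq0] at this
  have hda : AnalyticAt ℂ (deriv p) c := (hp.analyticAt c).deriv
  rcases hda.eventually_eq_zero_or_eventually_ne_zero with h0 | h0
  · exfalso
    obtain ⟨ε, hε, hb⟩ := Metric.eventually_nhds_iff_ball.1 (h0.and hqp)
    have hconst : ∀ z ∈ ball c ε, p z = p c := by
      intro z hz
      exact (convex_ball c ε).is_const_of_fderivWithin_eq_zero (𝕜 := ℂ)
        hp.differentiableOn (fun x hx => by
          rw [fderivWithin_of_isOpen isOpen_ball hx]
          ext
          simpa using (hb x hx).1) hz (mem_ball_self hε)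
    have h1 : c + (ε / 2 : ℝ) ∈ ball c ε := by
      rw [mem_ball, dist_eq_norm]
      simp only [add_sub_cancel_left, Complex.norm_real, Real.norm_eq_abs]
      rw [abs_of_pos] <;> linarith
    have h2 := (hb _ h1).2
    rw [hconst _ h1, hq0] at h2
    have h3 : ((ε / 2 : ℝ) : ℂ) = 0 := by linear_combination -h2
    rw [Complex.ofReal_eq_zero] at h3
    linarith
  · have h1 : ∀ᶠ y in 𝓝[≠] (p c), DifferentiableAt ℂ q y := by
      have h2 : ∀ᶠ z in 𝓝 c, z ≠ c → deriv p z ≠ 0 := by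
        simpa [eventually_nhdsWithin_iff] using h0
      rw [eventually_nhdsWithin_iff]
      filter_upwards [hqc.eventually h2, hq, hpq, hpq.eventually_nhds] with y hy hyc hyp hyn hne
      have hne' : q y ≠ c := fun h => hne (by rw [← hyp, h]; rfl)
      exact ((hp (q y)).hasDerivAt.of_local_left_inverse hyc (hy hne') hyn).differentiableAt
    have h2 : DifferentiableAt ℂ q (p c) := by
      obtain ⟨s, hs, hs'⟩ := eventually_nhdsWithin_iff.1 h1 |>.exists_mem
      refine (Complex.differentiableOn_compl_singleton_and_continuousAt_iff hs).1
        ⟨fun x hx => (hs' x hx.1 hx.2).differentiableWithinAt, hq.self_of_nhds⟩ |>.differentiableAt hs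
    have h3 : HasDerivAt (fun z => q (p z)) (deriv q (p c) * deriv p c) c :=
      HasDerivAt.comp c h2.hasDerivAt (hp c).hasDerivAt
    have h4 : HasDerivAt (fun z => q (p z)) 1 c :=
      (hasDerivAt_id c).congr_of_eventuallyEq hqp
    intro h5
    have := h3.unique h4
    rw [h5] at this
    simp at this

theorem deriv_ne_zero_of_covering {p : ℂ → ℂ} {T : Set ℂ} (hp : Differentiable ℂ p)
    (hcov : IsCoveringMapOn p T) {z : ℂ} (hz : p z ∈ T) : deriv p z ≠ 0 := by
  obtain ⟨q, hq1, hq2⟩ := hcov.isLocalHomeomorphOn z hz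
  subst hq2
  have hqz : q z ∈ q.target := q.map_source hq1
  refine deriv_ne_zero_of_local_inverse hp (q := q.symm) ?_ ?_ ?_
  · filter_upwards [q.open_target.mem_nhds hqz] with y hy using q.continuousAt_symm hy
  · filter_upwards [q.open_target.mem_nhds hqz] with y hy using q.right_inv hy
  · filter_upwards [q.open_source.mem_nhds hq1] with y hy using q.left_inv hy

theorem exists_holo_lift {p : ℂ → ℂ} {T : Set ℂ} (hp : Differentiable ℂ p)
    (hcov : IsCoveringMapOn p T) {X : Set ℂ} (hX : Convex ℝ X) (hXo : IsOpen X)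
    {e : ℂ → ℂ} (he : DifferentiableOn ℂ e X) (heT : MapsTo e X T) {x₀ z₀ : ℂ} (hx₀ : x₀ ∈ X)
    (hz₀ : p z₀ = e x₀) :
    ∃ G : ℂ → ℂ, DifferentiableOn ℂ G X ∧ (∀ x ∈ X, p (G x) = e x) ∧ G x₀ = z₀ := by
  classical
  have : ContractibleSpace X := hX.contractibleSpace ⟨x₀, hx₀⟩
  have := hXo.locallyPathConnectedSpace
  obtain ⟨F, ⟨hF0, hF⟩, -⟩ := hcov.existsUnique_continuousMap_lifts (A := X)
    ⟨X.domRestrict e, continuousOn_iff_continuous_domRestrict.1 he.continuousOn⟩ (a₀ := ⟨x₀, hx₀⟩)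
    (e₀ := z₀) hz₀ (fun a => heT a.2)
  let G : ℂ → ℂ := fun z => if h : z ∈ X then F ⟨z, h⟩ else 0
  have hGF : ∀ z (h : z ∈ X), G z = F ⟨z, h⟩ := fun z h => by simp [G, h]
  have hGc : ContinuousOn G X := by
    rw [continuousOn_iff_continuous_domRestrict]
    convert F.continuous using 1
    ext z
    exact hGF z z.2
  have hG : ∀ x ∈ X, p (G x) = e x := fun x hx => by
    rw [hGF x hx]
    exact congrFun hF ⟨x, hx⟩
  refine ⟨G, ?_, hG, by rw [hGF _ hx₀, hF0]⟩
  intro x hx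
  have hT : p (G x) ∈ T := by rw [hG x hx]; exact heT hx
  have hd := deriv_ne_zero_of_covering hp hcov hT
  have hsd : HasStrictDerivAt p (deriv p (G x)) (G x) := (hp.analyticAt (G x)).hasStrictDerivAt
  have h1 := hsd.eventually_left_inverse hd
  have hGx : ContinuousAt G x := hGc.continuousAt (hXo.mem_nhds hx)
  have h2 : ∀ᶠ y in 𝓝 x, G y = hsd.localInverse p _ _ hd (e y) := by
    filter_upwards [hGx.eventually h1, hXo.mem_nhds hx] with y hy hyX
    rw [← hG y hyX]; exact hy.symm
  have h3 : DifferentiableAt ℂ (hsd.localInverse p _ _ hd) (e x) := by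
    rw [← hG x hx]
    exact (hsd.to_localInverse hd).hasDerivAt.differentiableAt
  exact ((h3.comp x (he.differentiableAt (hXo.mem_nhds hx))).congr_of_eventuallyEq
    h2).differentiableWithinAt

theorem exists_holo_log {X : Set ℂ} (hX : Convex ℝ X) (hXo : IsOpen X)
    {e : ℂ → ℂ} (he : DifferentiableOn ℂ e X) (he0 : ∀ x ∈ X, e x ≠ 0) {x₀ z₀ : ℂ} (hx₀ : x₀ ∈ X)
    (hz₀ : Complex.exp z₀ = e x₀) :
    ∃ G : ℂ → ℂ, DifferentiableOn ℂ G X ∧ (∀ x ∈ X, Complex.exp (G x) = e x) ∧ G x₀ = z₀ :=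
  exists_holo_lift Complex.differentiable_exp Complex.isCoveringMapOn_exp hX hXo he
    (fun x hx => by simpa using he0 x hx) hx₀ hz₀

theorem exists_holo_sqrt {X : Set ℂ} (hX : Convex ℝ X) (hXo : IsOpen X)
    {e : ℂ → ℂ} (he : DifferentiableOn ℂ e X) (he0 : ∀ x ∈ X, e x ≠ 0) {x₀ z₀ : ℂ} (hx₀ : x₀ ∈ X)
    (hz₀ : z₀ ^ 2 = e x₀) :
    ∃ G : ℂ → ℂ, DifferentiableOn ℂ G X ∧ (∀ x ∈ X, G x ^ 2 = e x) ∧ G x₀ = z₀ := by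
  have hz0 : z₀ ≠ 0 := fun h => he0 x₀ hx₀ (by rw [← hz₀, h]; ring)
  obtain ⟨L, hL, hLe, hL0⟩ := exists_holo_log hX hXo he he0 hx₀ (z₀ := 2 * Complex.log z₀)
    (by rw [two_mul, Complex.exp_add, Complex.exp_log hz0, ← hz₀]; ring)
  refine ⟨fun x => Complex.exp (L x / 2), (hL.div_const 2).cexp, fun x hx => ?_, ?_⟩
  · rw [← Complex.exp_nat_mul, ← hLe x hx]
    congr 1
    push_cast
    ring
  · simp only [hL0]
    rw [mul_div_cancel_left₀ _ two_ne_zero, Complex.exp_log hz0]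

end

section

theorem norm_deriv_le_of_forall_ball {f : ℂ → ℂ} {c : ℂ} {ρ M : ℝ} (hρ : 0 < ρ)
    (hd : DifferentiableOn ℂ f (ball c ρ)) (hM : ∀ z ∈ ball c ρ, ‖f z‖ ≤ M) :
    ‖deriv f c‖ * ρ ≤ M := by
  have key : ∀ r ∈ Ioo 0 ρ, ‖deriv f c‖ * r ≤ M := by
    intro r hr
    have := Complex.norm_deriv_le_of_forall_mem_sphere_norm_le hr.1
      ((hd.mono (closedBall_subset_ball hr.2)).diffContOnCl_ball subset_rfl)
      (fun z hz => hM z (closedBall_subset_ball hr.2 (sphere_subset_closedBall hz)))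
    rwa [le_div_iff₀ hr.1] at this
  have hcl : Tendsto (fun r : ℝ => ‖deriv f c‖ * r) (𝓝[<] ρ) (𝓝 (‖deriv f c‖ * ρ)) :=
    ((continuous_const.mul continuous_id).tendsto ρ).mono_left nhdsWithin_le_nhds
  refine le_of_tendsto hcl ?_
  filter_upwards [Ioo_mem_nhdsLT hρ] with r hr using key r hr

theorem koebe {h : ℂ → ℂ} {c : ℂ} {ρ : ℝ} (hρ : 0 < ρ) (hd : DifferentiableOn ℂ h (ball c ρ))
    (hi : InjOn h (ball c ρ)) : ball (h c) (ρ * ‖deriv h c‖ / 20) ⊆ h '' ball c ρ := by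
  intro w hw
  by_contra hwn
  have hcD : c ∈ ball c ρ := mem_ball_self hρ
  have hDn : ball c ρ ∈ 𝓝 c := ball_mem_nhds c hρ
  have hd0 : deriv h c ≠ 0 := by
    intro h0
    rw [h0, norm_zero, mul_zero, zero_div, ball_zero] at hw
    exact hw
  set O := (h '' ball c ρ)ᶜ with hO
  have hOne : O.Nonempty := ⟨w, hwn⟩
  set δ := infDist (h c) O with hδ
  have hδw : δ ≤ dist (h c) w := infDist_le_dist_of_mem hwn
  have hδpos : 0 < δ := by
    have h1 : h '' ball c ρ ∈ 𝓝 (h c) := by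
      rw [← ((hd.analyticAt hDn).hasStrictDerivAt.map_nhds_eq hd0)]
      exact image_mem_map hDn
    obtain ⟨ε, hε, hεs⟩ := Metric.mem_nhds_iff.1 h1
    refine lt_of_lt_of_le hε ((le_infDist hOne).2 fun y hy => ?_)
    by_contra hlt
    exact hy (hεs (by rw [mem_ball, dist_comm]; exact not_le.1 hlt))
  have hδball : ∀ y, dist (h c) y < δ → y ∈ h '' ball c ρ := fun y hy => by
    by_contra hyn
    exact absurd (infDist_le_dist_of_mem (x := h c) (show y ∈ O from hyn)) (not_le.2 hy)
  obtain ⟨v, hvO, hv⟩ := (infDist_lt_iff hOne).1 (show infDist (h c) O < 1.01 * δ by linarith)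
  set d := dist (h c) v with hdd
  have hdδ : δ ≤ d := infDist_le_dist_of_mem hvO
  have hdpos : 0 < d := hδpos.trans_le hdδ
  have hne : ∀ x ∈ ball c ρ, h x - v ≠ 0 := fun x hx h0 => hvO ⟨x, hx, by linear_combination h0⟩
  obtain ⟨k, hkd, hk, -⟩ := exists_holo_sqrt (convex_ball c ρ) isOpen_ball (hd.sub_const v) hne hcD
    (z₀ := Complex.exp (Complex.log (h c - v) / 2)) (by
      rw [← Complex.exp_nat_mul]; push_cast
      rw [mul_div_cancel₀ _ (two_ne_zero), Complex.exp_log (hne c hcD)])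
  have hk0 : ∀ x ∈ ball c ρ, k x ≠ 0 := fun x hx h0 => hne x hx (by rw [← hk x hx, h0]; ring)
  have hkneg : ∀ x ∈ ball c ρ, ∀ y ∈ ball c ρ, k x ≠ - k y := by
    intro x hx y hy hxy
    have h1 : h x = h y := by
      have h1 := hk x hx
      have h2 := hk y hy
      rw [hxy] at h1
      linear_combination h2 - h1
    have h2 := hi hx hy h1
    subst h2
    exact hk0 x hx (by linear_combination hxy / 2)
  have hkderiv : deriv h c = 2 * k c * deriv k c := by
    have h1 : HasDerivAt (fun x => k x ^ 2) (2 * k c * deriv k c) c := by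
      simpa using ((hkd.differentiableAt hDn).hasDerivAt.fun_pow 2)
    have h2 : HasDerivAt (fun x => h x - v) (deriv h c) c :=
      ((hd.differentiableAt hDn).hasDerivAt.sub_const v)
    refine h2.unique (h1.congr_of_eventuallyEq ?_)
    filter_upwards [hDn] with x hx using (hk x hx).symm
  have hkd0 : deriv k c ≠ 0 := fun h0 => hd0 (by rw [hkderiv, h0, mul_zero])
  have hkopen : IsOpen (k '' ball c ρ) := by
    rcases (hkd.analyticOnNhd isOpen_ball).is_constant_or_isOpen (convex_ball c ρ).isPreconnected
      with ⟨a, ha⟩ | h1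
    · exfalso
      apply hkd0
      have : k =ᶠ[𝓝 c] fun _ => a := by filter_upwards [hDn] with x hx using ha x hx
      rw [this.deriv_eq, deriv_const]
    · exact h1 _ subset_rfl isOpen_ball
  set s := Real.sqrt d with hs
  have hspos : 0 < s := Real.sqrt_pos.2 hdpos
  have hss : s ^ 2 = d := Real.sq_sqrt hdpos.le
  have hkc : ‖k c‖ = s := by
    have : ‖k c‖ ^ 2 = d := by
      rw [← norm_pow, hk c hcD, ← dist_eq_norm]
    rw [hs, ← this, Real.sqrt_sq (norm_nonneg _)]
  have hcover : ball (k c) (0.41 * s) ⊆ k '' ball c ρ ∪ -(k '' ball c ρ) := by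
    intro ξ hξ
    rw [mem_ball, dist_eq_norm] at hξ
    have h1 : ‖ξ + k c‖ ≤ 2.41 * s := by
      have : ξ + k c = (ξ - k c) + 2 * k c := by ring
      rw [this]
      refine (norm_add_le _ _).trans ?_
      rw [norm_mul, hkc]
      simp only [Complex.norm_ofNat]
      linarith
    have h2 : dist (h c) (ξ ^ 2 + v) < δ := by
      rw [dist_comm, dist_eq_norm]
      have : ξ ^ 2 + v - h c = (ξ - k c) * (ξ + k c) := by
        have := hk c hcD
        linear_combination this
      rw [this, norm_mul]
      calc ‖ξ - k c‖ * ‖ξ + k c‖ ≤ (0.41 * s) * (2.41 * s) := by gcongr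
        _ = 0.9881 * d := by rw [← hss]; ring
        _ < δ := by linarith
    obtain ⟨x, hx, hxe⟩ := hδball _ h2
    have h3 : k x ^ 2 = ξ ^ 2 := by rw [hk x hx, hxe]; ring
    rcases sq_eq_sq_iff_eq_or_eq_neg.1 h3 with h4 | h4
    · exact Or.inl ⟨x, hx, h4⟩
    · right
      rw [Set.mem_neg]
      exact ⟨x, hx, h4⟩
  have hsub : ball (k c) (0.41 * s) ⊆ k '' ball c ρ := by
    refine (convex_ball _ _).isPreconnected.subset_left_of_subset_union hkopen hkopen.neg ?_ hcover
      ⟨k c, mem_ball_self (by positivity), c, hcD, rfl⟩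
    rw [Set.disjoint_left]
    rintro _ ⟨x, hx, rfl⟩ hy
    rw [Set.mem_neg] at hy
    obtain ⟨y, hy, hye⟩ := hy
    exact hkneg x hx y hy (by rw [hye]; ring)
  have hlow : ∀ x ∈ ball c ρ, 0.41 * s ≤ ‖k x + k c‖ := by
    intro x hx
    by_contra hlt
    have : - k x ∈ ball (k c) (0.41 * s) := by
      rw [mem_ball, dist_eq_norm, ← norm_neg]
      have : -(-k x - k c) = k x + k c := by ring
      rw [this]; exact not_le.1 hlt
    obtain ⟨y, hy, hye⟩ := hsub this
    exact hkneg y hy x hx hye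
  have hne2 : ∀ x ∈ ball c ρ, k x + k c ≠ 0 := fun x hx h0 => by
    have := hlow x hx
    rw [h0, norm_zero] at this
    nlinarith
  have hψ := norm_deriv_le_of_forall_ball (f := fun x => (k x + k c)⁻¹) (M := (0.41 * s)⁻¹) hρ
    ((hkd.add_const _).inv hne2) (fun z hz => by
      rw [norm_inv]
      exact inv_anti₀ (by positivity) (hlow z hz))
  have hψd : deriv (fun x => (k x + k c)⁻¹) c = -deriv k c / (k c + k c) ^ 2 :=
    ((hkd.differentiableAt hDn).hasDerivAt.add_const (k c)).inv (hne2 c hcD) |>.deriv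
  have e1 : ‖deriv h c‖ = 2 * s * ‖deriv k c‖ := by
    rw [hkderiv, norm_mul, norm_mul, hkc]; simp
  have e2 : ‖deriv (fun x => (k x + k c)⁻¹) c‖ = ‖deriv k c‖ / (4 * s ^ 2) := by
    rw [hψd, norm_div, norm_neg, norm_pow, ← two_mul, norm_mul, hkc]
    congr 1
    simp only [Complex.norm_ofNat]; ring
  rw [e2] at hψ
  have e3 : 0.41 * (‖deriv k c‖ * ρ) ≤ 4 * s := by
    rw [div_mul_eq_mul_div, div_le_iff₀ (by positivity)] at hψ
    have e4 : (0.41 * s)⁻¹ * (4 * s ^ 2) = 4 * s / 0.41 := by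
      field_simp
    rw [e4, le_div_iff₀ (by norm_num)] at hψ
    linarith
  have e5 : 0.41 * (‖deriv h c‖ * ρ) ≤ 8 * d := by
    rw [e1, ← hss]
    nlinarith
  rw [mem_ball, dist_comm] at hw
  have e6 : ρ * ‖deriv h c‖ / 20 ≤ δ := by linarith
  linarith

/-- Schwarz–Pick for maps from a disc to the right half-plane. -/
theorem schwarz_pick_ball_rhp {ψ : ℂ → ℂ} {c : ℂ} {ρ : ℝ}
    (hd : DifferentiableOn ℂ ψ (ball c ρ)) (hm : ∀ z ∈ ball c ρ, 0 < (ψ z).re) {z : ℂ}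
    (hz : z ∈ ball c ρ) :
    ‖ψ z - ψ c‖ ≤ dist z c / ρ * ‖ψ z + (starRingEnd ℂ) (ψ c)‖ := by
  have hρ : 0 < ρ := dist_nonneg.trans_lt hz
  have hc := hm c (mem_ball_self hρ)
  have hne : ∀ x ∈ ball c ρ, ψ x + (starRingEnd ℂ) (ψ c) ≠ 0 := fun x hx h0 => by
    have := congrArg Complex.re h0
    simp only [Complex.add_re, Complex.conj_re, Complex.zero_re] at this
    linarith [hm x hx]
  have hsq : ∀ x ∈ ball c ρ, ‖ψ x - ψ c‖ < ‖ψ x + (starRingEnd ℂ) (ψ c)‖ := by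
    intro x hx
    have h1 := hm x hx
    rw [Complex.norm_def, Complex.norm_def]
    apply Real.sqrt_lt_sqrt (Complex.normSq_nonneg _)
    simp only [Complex.normSq_apply, Complex.sub_re, Complex.sub_im, Complex.add_re,
      Complex.add_im, Complex.conj_re, Complex.conj_im]
    nlinarith [mul_pos h1 hc]
  have hφ := Complex.dist_le_div_mul_dist_of_mapsTo_ball
    (f := fun x => (ψ x - ψ c) / (ψ x + (starRingEnd ℂ) (ψ c))) (c := c) (R₁ := ρ) (R₂ := 1)
    ((hd.sub_const _).div (hd.add_const _) hne) (fun x hx => by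
      simp only [sub_self, zero_div, mem_closedBall, dist_zero_right, norm_div]
      exact (div_le_one (norm_pos_iff.2 (hne x hx))).2 (hsq x hx).le) hz
  simp only [sub_self, zero_div, dist_zero_right, norm_div] at hφ
  rw [div_le_iff₀ (norm_pos_iff.2 (hne z hz))] at hφ
  calc _ ≤ _ := hφ
    _ = _ := by ring

end

section

theorem rhp_norm_le {ψ : ℂ → ℂ} {c : ℂ} {ρ t : ℝ}
    (hd : DifferentiableOn ℂ ψ (ball c ρ)) (hm : ∀ z ∈ ball c ρ, 0 < (ψ z).re) {z : ℂ}
    (hz : z ∈ ball c ρ) (hzt : dist z c ≤ t * ρ) :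
    ‖ψ z‖ * (1 - t) ≤ ‖ψ c‖ * (1 + t) := by
  have hρ : 0 < ρ := dist_nonneg.trans_lt hz
  have h1 := schwarz_pick_ball_rhp hd hm hz
  have h2 : dist z c / ρ ≤ t := (div_le_iff₀ hρ).2 hzt
  have h0 : 0 ≤ t := (div_nonneg dist_nonneg hρ.le).trans h2
  have h3 : ‖ψ z‖ - ‖ψ c‖ ≤ ‖ψ z - ψ c‖ := norm_sub_norm_le _ _
  have h4 : ‖ψ z + (starRingEnd ℂ) (ψ c)‖ ≤ ‖ψ z‖ + ‖ψ c‖ := by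
    simpa using norm_add_le (ψ z) ((starRingEnd ℂ) (ψ c))
  have h5 : dist z c / ρ * ‖ψ z + (starRingEnd ℂ) (ψ c)‖ ≤ t * (‖ψ z‖ + ‖ψ c‖) := by gcongr
  linarith

theorem rhp_re_ge {ψ : ℂ → ℂ} {c : ℂ} {ρ t : ℝ}
    (hd : DifferentiableOn ℂ ψ (ball c ρ)) (hm : ∀ z ∈ ball c ρ, 0 < (ψ z).re) {z : ℂ}
    (hz : z ∈ ball c ρ) (hzt : dist z c ≤ t * ρ) (ht1 : t < 1) :
    (ψ c).re * (1 - t) ≤ (ψ z).re * (1 + t) := by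
  have hρ : 0 < ρ := dist_nonneg.trans_lt hz
  have h1 := schwarz_pick_ball_rhp hd hm hz
  have h2 : dist z c / ρ ≤ t := (div_le_iff₀ hρ).2 hzt
  have h0 : 0 ≤ t := (div_nonneg dist_nonneg hρ.le).trans h2
  have h3 : ‖ψ z - ψ c‖ ≤ t * ‖ψ z + (starRingEnd ℂ) (ψ c)‖ :=
    h1.trans (by gcongr)
  have hc := hm c (mem_ball_self hρ)
  have hz' := hm z hz
  have h4 : ‖ψ z - ψ c‖ ^ 2 ≤ t ^ 2 * ‖ψ z + (starRingEnd ℂ) (ψ c)‖ ^ 2 := by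
    rw [← mul_pow]; gcongr
  rw [Complex.sq_norm, Complex.sq_norm, Complex.normSq_apply, Complex.normSq_apply] at h4
  simp only [Complex.sub_re, Complex.sub_im, Complex.add_re,
      Complex.add_im, Complex.conj_re, Complex.conj_im] at h4
  set x := (ψ z).re
  set α := (ψ c).re
  set v := (ψ z).im - (ψ c).im with hv
  have h5 : (1 - t ^ 2) * (x - α) ^ 2 ≤ 4 * t ^ 2 * (x * α) := by
    have : (ψ z).im + -(ψ c).im = v := by ring
    rw [this] at h4
    have h6 : 0 ≤ (1 - t ^ 2) * (v * v) := mul_nonneg (by nlinarith) (mul_self_nonneg _)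
    nlinarith
  have h6 : (x * (1 + t) - α * (1 - t)) * (x * (1 - t) - α * (1 + t)) ≤ 0 := by nlinarith
  by_contra hlt
  have h7 : x * (1 + t) < α * (1 - t) := not_le.1 hlt
  have h8 : x * (1 - t) - α * (1 + t) < 0 := by nlinarith
  nlinarith

theorem rhp_deriv_le {ψ : ℂ → ℂ} {c : ℂ} {ρ : ℝ} (hρ : 0 < ρ)
    (hd : DifferentiableOn ℂ ψ (ball c ρ)) (hm : ∀ z ∈ ball c ρ, 0 < (ψ z).re) :
    ‖deriv ψ c‖ * ρ ≤ 2 * (ψ c).re := by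
  have hc := hm c (mem_ball_self hρ)
  have hne : ∀ x ∈ ball c ρ, ψ x + (starRingEnd ℂ) (ψ c) ≠ 0 := fun x hx h0 => by
    have := congrArg Complex.re h0
    simp only [Complex.add_re, Complex.conj_re, Complex.zero_re] at this
    linarith [hm x hx]
  have h1 := norm_deriv_le_of_forall_ball
    (f := fun x => (ψ x - ψ c) / (ψ x + (starRingEnd ℂ) (ψ c))) (M := 1) hρ
    ((hd.sub_const _).div (hd.add_const _) hne) (fun x hx => by
      rw [norm_div]
      refine (div_le_one (norm_pos_iff.2 (hne x hx))).2 ?_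
      refine (schwarz_pick_ball_rhp hd hm hx).trans ?_
      refine mul_le_of_le_one_left (norm_nonneg _) ((div_le_one hρ).2 hx.le))
  have hψ := (hd.differentiableAt (ball_mem_nhds c hρ)).hasDerivAt
  have h2 : HasDerivAt (fun x => (ψ x - ψ c) / (ψ x + (starRingEnd ℂ) (ψ c)))
      (deriv ψ c / (2 * (ψ c).re : ℝ)) c := by
    refine ((hψ.sub_const (ψ c)).fun_div (hψ.add_const ((starRingEnd ℂ) (ψ c)))
      (hne c (mem_ball_self hρ))).congr_deriv ?_
    rw [Complex.add_conj, sub_self, zero_mul, sub_zero]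
    have : ((2 * (ψ c).re : ℝ) : ℂ) ≠ 0 := by
      rw [Complex.ofReal_ne_zero]; positivity
    field_simp
  rw [h2.deriv, norm_div, Complex.norm_real, Real.norm_of_nonneg (by positivity),
    div_mul_eq_mul_div, div_le_one (by positivity)] at h1
  exact h1

theorem cayley_re_pos {w u : ℂ} (hw : 0 < w.re) (hu : u ∈ ball (0 : ℂ) 1) :
    1 - u ≠ 0 ∧ 0 < ((w + (starRingEnd ℂ) w * u) / (1 - u)).re := by
  rw [mem_ball_zero_iff] at hu
  have h1 : 1 - u ≠ 0 := fun h => by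
    have : u = 1 := by linear_combination -h
    rw [this, norm_one] at hu
    exact lt_irrefl _ hu
  refine ⟨h1, ?_⟩
  have h2 : u.re * u.re + u.im * u.im < 1 := by
    have : ‖u‖ ^ 2 < 1 := by nlinarith [norm_nonneg u]
    rwa [Complex.sq_norm, Complex.normSq_apply] at this
  have h3 : 0 < Complex.normSq (1 - u) := Complex.normSq_pos.2 h1
  rw [Complex.div_re, ← add_div]
  refine div_pos ?_ h3
  simp only [Complex.add_re, Complex.mul_re, Complex.conj_re, Complex.conj_im, Complex.sub_re,
    Complex.one_re, Complex.add_im, Complex.mul_im, Complex.sub_im, Complex.one_im]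
  nlinarith [mul_pos hw (sub_pos.2 h2)]

theorem cayley_inv {w z : ℂ} (hw : 0 < w.re) (hz : 0 < z.re) :
    z + (starRingEnd ℂ) w ≠ 0 ∧
    (z - w) / (z + (starRingEnd ℂ) w) ∈ ball (0 : ℂ) 1 ∧
    (w + (starRingEnd ℂ) w * ((z - w) / (z + (starRingEnd ℂ) w))) /
      (1 - (z - w) / (z + (starRingEnd ℂ) w)) = z := by
  have hne : z + (starRingEnd ℂ) w ≠ 0 := fun h0 => by
    have := congrArg Complex.re h0
    simp only [Complex.add_re, Complex.conj_re, Complex.zero_re] at this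
    linarith
  have hne2 : w + (starRingEnd ℂ) w ≠ 0 := fun h0 => by
    have := congrArg Complex.re h0
    simp only [Complex.add_re, Complex.conj_re, Complex.zero_re] at this
    linarith
  refine ⟨hne, ?_, ?_⟩
  · rw [mem_ball_zero_iff, norm_div, div_lt_one (norm_pos_iff.2 hne), Complex.norm_def,
      Complex.norm_def]
    apply Real.sqrt_lt_sqrt (Complex.normSq_nonneg _)
    simp only [Complex.normSq_apply, Complex.sub_re, Complex.sub_im, Complex.add_re,
      Complex.add_im, Complex.conj_re, Complex.conj_im]
    nlinarith [mul_pos hw hz]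
  · have : 1 - (z - w) / (z + (starRingEnd ℂ) w) =
        (w + (starRingEnd ℂ) w) / (z + (starRingEnd ℂ) w) := by
      field_simp; ring
    rw [this]
    have h3 : w + (starRingEnd ℂ) w * ((z - w) / (z + (starRingEnd ℂ) w)) =
      z * (w + (starRingEnd ℂ) w) / (z + (starRingEnd ℂ) w) := by
      field_simp; ring
    rw [h3, div_div_div_cancel_right₀ hne, mul_div_cancel_right₀ _ hne2]

theorem schwarz_pick_rhp {Q : ℂ → ℂ} (hd : DifferentiableOn ℂ Q {z | 0 < z.re})
    (hm : ∀ z : ℂ, 0 < z.re → 0 < (Q z).re) {z w : ℂ} (hz : 0 < z.re) (hw : 0 < w.re) :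
    ‖Q z - Q w‖ * ‖z + (starRingEnd ℂ) w‖ ≤ ‖z - w‖ * ‖Q z + (starRingEnd ℂ) (Q w)‖ := by
  obtain ⟨hne, hb, hinv⟩ := cayley_inv hw hz
  have h1 := schwarz_pick_ball_rhp (c := 0) (ρ := 1)
    (ψ := fun u => Q ((w + (starRingEnd ℂ) w * u) / (1 - u)))
    (hd.comp (DifferentiableOn.div (by fun_prop) (by fun_prop)
      (fun u hu => (cayley_re_pos hw hu).1)) (fun u hu => (cayley_re_pos hw hu).2))
    (fun u hu => hm _ (cayley_re_pos hw hu).2) hb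
  simp only [hinv, mul_zero, add_zero, sub_zero, div_one, dist_zero_right, norm_div] at h1
  have h2 : 0 < ‖z + (starRingEnd ℂ) w‖ := norm_pos_iff.2 hne
  rw [div_mul_eq_mul_div, le_div_iff₀ h2] at h1
  exact h1

/-- The rotation sending the half-plane `0 < σ * im` to the right half-plane. -/
theorem rot_re {σ : ℝ} (z : ℂ) : (-(σ : ℂ) * Complex.I * z).re = σ * z.im := by
  simp

theorem rot_im {σ : ℝ} (u : ℂ) : ((σ : ℂ) * Complex.I * u).im = σ * u.re := by
  simp

theorem rot_inv {σ : ℝ} (hσ : σ ^ 2 = 1) (z : ℂ) :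
    (σ : ℂ) * Complex.I * (-(σ : ℂ) * Complex.I * z) = z := by
  have h : (σ : ℂ) ^ 2 = 1 := by exact_mod_cast hσ
  linear_combination (-(σ : ℂ) ^ 2 * z) * Complex.I_sq + z * h

theorem rot_norm {σ : ℝ} (hσ : σ ^ 2 = 1) (z : ℂ) : ‖-(σ : ℂ) * Complex.I * z‖ = ‖z‖ := by
  have h : |σ| = 1 := by
    have := sq_abs σ
    rw [hσ] at this
    exact (pow_eq_one_iff_of_nonneg (abs_nonneg σ) two_ne_zero).1 this
  simp [h]

theorem rot_rhp {Q : ℂ → ℂ} {σ τ : ℝ} (hσ : σ ^ 2 = 1)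
    (hd : DifferentiableOn ℂ Q {z | 0 < σ * z.im})
    (hm : ∀ z : ℂ, 0 < σ * z.im → 0 < τ * (Q z).im) :
    DifferentiableOn ℂ (fun u => -(τ : ℂ) * Complex.I * Q (σ * Complex.I * u)) {z | 0 < z.re} ∧
    ∀ u : ℂ, 0 < u.re → 0 < (-(τ : ℂ) * Complex.I * Q (σ * Complex.I * u)).re := by
  have key : ∀ u : ℂ, 0 < u.re → 0 < σ * ((σ : ℂ) * Complex.I * u).im := fun u hu => by
    rw [rot_im, ← mul_assoc, ← sq, hσ, one_mul]; exact hu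
  refine ⟨?_, fun u hu => ?_⟩
  · have h : MapsTo (fun u : ℂ => (σ : ℂ) * Complex.I * u) {z : ℂ | 0 < z.re}
      {z : ℂ | 0 < σ * z.im} := key
    exact DifferentiableOn.const_mul (hd.comp (by fun_prop) h) _
  · rw [rot_re]; exact hm _ (key u hu)

theorem schwarz_pick_hp {Q : ℂ → ℂ} {σ τ : ℝ} (hσ : σ ^ 2 = 1) (hτ : τ ^ 2 = 1)
    (hd : DifferentiableOn ℂ Q {z | 0 < σ * z.im})
    (hm : ∀ z : ℂ, 0 < σ * z.im → 0 < τ * (Q z).im) {z w : ℂ}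
    (hz : 0 < σ * z.im) (hw : 0 < σ * w.im) :
    ‖Q z - Q w‖ * ‖z - (starRingEnd ℂ) w‖ ≤ ‖z - w‖ * ‖Q z - (starRingEnd ℂ) (Q w)‖ := by
  obtain ⟨hd', hm'⟩ := rot_rhp hσ hd hm
  have := schwarz_pick_rhp hd' hm' (z := -(σ : ℂ) * Complex.I * z) (w := -(σ : ℂ) * Complex.I * w)
    (by rw [rot_re]; exact hz) (by rw [rot_re]; exact hw)
  simp only [rot_inv hσ] at this
  simp only [map_mul, map_neg, Complex.conj_ofReal, Complex.conj_I] at this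
  have e1 : ∀ (σ : ℝ) (a b : ℂ), -(σ : ℂ) * Complex.I * a - -(σ : ℂ) * Complex.I * b =
    -(σ : ℂ) * Complex.I * (a - b) := fun σ a b => by ring
  have e2 : ∀ (σ : ℝ) (a b : ℂ), -(σ : ℂ) * Complex.I * a + -(σ : ℂ) * -Complex.I * b =
    -(σ : ℂ) * Complex.I * (a - b) := fun σ a b => by ring
  rw [e1, e1, e2, e2, rot_norm hσ, rot_norm hτ, rot_norm hσ, rot_norm hτ] at this
  exact this

end

section

/-- The plane slit along the complement of a set `J` of reals. -/
def slitDom (J : Set ℝ) : Set ℂ := {z | z.im ≠ 0 ∨ z.re ∈ J}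

/-- The angle under which the interval `(a, b)` is seen from `z`. -/
noncomputable def theta (a b : ℝ) (z : ℂ) : ℝ :=
  Real.arctan ((b - z.re) / |z.im|) - Real.arctan ((a - z.re) / |z.im|)

theorem isOpen_slitDom {J : Set ℝ} (hJ : IsOpen J) : IsOpen (slitDom J) :=
  (isOpen_ne.preimage Complex.continuous_im).union (hJ.preimage Complex.continuous_re)

/-- The Möbius map sending `a`, `b` to `0`, `∞`. -/
noncomputable def moeb (a b : ℝ) (z : ℂ) : ℂ := (z - a) / (b - z)

theorem slit_ne {a b : ℝ} {z : ℂ} (hz : z ∈ slitDom (Ioo a b)) : (b : ℂ) - z ≠ 0 := by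
  intro h
  have h1 : z = b := by linear_combination -h
  rcases hz with h2 | h2
  · rw [h1] at h2; simp at h2
  · rw [h1] at h2; simp at h2

theorem moeb_im {a b : ℝ} {z : ℂ} :
    (moeb a b z).im = z.im * (b - a) / Complex.normSq (b - z) := by
  rw [moeb, Complex.div_im]
  simp only [Complex.sub_re, Complex.sub_im, Complex.ofReal_re, Complex.ofReal_im]
  ring

theorem moeb_re {a b : ℝ} {z : ℂ} :
    (moeb a b z).re = ((z.re - a) * (b - z.re) - z.im ^ 2) / Complex.normSq (b - z) := by
  rw [moeb, Complex.div_re]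
  simp only [Complex.sub_re, Complex.sub_im, Complex.ofReal_re, Complex.ofReal_im]
  ring

theorem moeb_mem {a b : ℝ} (hab : a < b) {z : ℂ} (hz : z ∈ slitDom (Ioo a b)) :
    moeb a b z ∈ Complex.slitPlane := by
  have h0 := Complex.normSq_pos.2 (slit_ne hz)
  rw [Complex.mem_slitPlane_iff]
  by_cases hy : z.im = 0
  · left
    rcases hz with h2 | h2
    · exact absurd hy h2
    · rw [moeb_re, hy]
      have := mul_pos (sub_pos.2 h2.1) (sub_pos.2 h2.2)
      exact div_pos (by linarith) h0
  · right
    rw [moeb_im]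
    have hne := h0.ne'
    exact div_ne_zero (mul_ne_zero hy (by linarith)) hne

/-- The conformal map of the slit plane onto the right half-plane. -/
noncomputable def slitRoot (a b : ℝ) (z : ℂ) : ℂ := Complex.exp (Complex.log (moeb a b z) / 2)

theorem slitRoot_sq {a b : ℝ} (hab : a < b) {z : ℂ} (hz : z ∈ slitDom (Ioo a b)) :
    slitRoot a b z ^ 2 = moeb a b z := by
  rw [slitRoot, ← Complex.exp_nat_mul]
  push_cast
  rw [mul_div_cancel₀ _ two_ne_zero, Complex.exp_log (Complex.slitPlane_ne_zero (moeb_mem hab hz))]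

theorem exp_half_log_re_pos {v : ℂ} (hv : v ∈ Complex.slitPlane) :
    0 < (Complex.exp (Complex.log v / 2)).re := by
  rw [Complex.exp_re]
  refine mul_pos (Real.exp_pos _) (Real.cos_pos_of_mem_Ioo ?_)
  have h1 : (Complex.log v / 2).im = Complex.arg v / 2 := by
    rw [← Complex.log_im]
    exact Complex.div_ofNat_im _ 2
  rw [h1]
  have h2 := Complex.mem_slitPlane_iff_arg.1 hv
  have h3 := Complex.neg_pi_lt_arg v
  have h4 := lt_of_le_of_ne (Complex.arg_le_pi v) h2.1
  constructor <;> linarith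

theorem slitRoot_re {a b : ℝ} (hab : a < b) {z : ℂ} (hz : z ∈ slitDom (Ioo a b)) :
    0 < (slitRoot a b z).re := exp_half_log_re_pos (moeb_mem hab hz)

theorem differentiableOn_slitRoot {a b : ℝ} (hab : a < b) :
    DifferentiableOn ℂ (slitRoot a b) (slitDom (Ioo a b)) := by
  unfold slitRoot
  refine (DifferentiableOn.div_const (DifferentiableOn.clog ?_ fun z hz => moeb_mem hab hz) 2).cexp
  unfold moeb
  exact DifferentiableOn.div (by fun_prop) (by fun_prop) fun z hz => slit_ne hz

/-- The inverse of `slitRoot`. -/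
noncomputable def slitRootInv (a b : ℝ) (w : ℂ) : ℂ := (a + b * w ^ 2) / (1 + w ^ 2)

theorem one_add_sq_ne {w : ℂ} (hw : 0 < w.re) : 1 + w ^ 2 ≠ 0 := by
  intro h
  have h1 := congrArg Complex.re h
  have h2 := congrArg Complex.im h
  simp [sq] at h1 h2
  have h3 : w.im = 0 := by nlinarith
  rw [h3] at h1
  nlinarith

theorem slitRootInv_mem {a b : ℝ} (hab : a < b) {w : ℂ} (hw : 0 < w.re) :
    slitRootInv a b w ∈ slitDom (Ioo a b) ∧ moeb a b (slitRootInv a b w) = w ^ 2 := by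
  have h0 := one_add_sq_ne hw
  have hba : (b : ℂ) - a ≠ 0 := by
    rw [← Complex.ofReal_sub, Complex.ofReal_ne_zero]; linarith
  have e1 : slitRootInv a b w - a = (b - a) * w ^ 2 / (1 + w ^ 2) := by
    rw [slitRootInv]; field_simp; ring
  have e2 : b - slitRootInv a b w = (b - a) / (1 + w ^ 2) := by
    rw [slitRootInv]; field_simp; ring
  have h2 : moeb a b (slitRootInv a b w) = w ^ 2 := by
    rw [moeb, e1, e2]
    field_simp
  refine ⟨?_, h2⟩
  by_cases hy : w.im = 0
  · right
    have hwr : w = (w.re : ℂ) := Complex.ext rfl (by simpa using hy)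
    have h3 : slitRootInv a b w = (((a + b * w.re ^ 2) / (1 + w.re ^ 2) : ℝ) : ℂ) := by
      rw [slitRootInv, hwr]; push_cast; simp
    rw [h3, Complex.ofReal_re]
    have : 0 < w.re ^ 2 := by positivity
    constructor
    · rw [lt_div_iff₀ (by positivity)]; nlinarith
    · rw [div_lt_iff₀ (by positivity)]; nlinarith
  · left
    intro h3
    have h4 := moeb_im (a := a) (b := b) (z := slitRootInv a b w)
    rw [h3, h2] at h4
    simp [sq] at h4
    rcases h4 with h4
    have : w.re * w.im ≠ 0 := mul_ne_zero hw.ne' hy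
    apply this; linarith

theorem slitRootInv_slitRoot {a b : ℝ} (hab : a < b) {z : ℂ} (hz : z ∈ slitDom (Ioo a b)) :
    slitRootInv a b (slitRoot a b z) = z := by
  have h0 := slit_ne hz
  have hba : (b : ℂ) - a ≠ 0 := by
    rw [← Complex.ofReal_sub, Complex.ofReal_ne_zero]; linarith
  rw [slitRootInv, slitRoot_sq hab hz, moeb]
  have : 1 + (z - a) / (b - z) = (b - a) / (b - z) := by field_simp; ring
  rw [this, div_eq_iff (div_ne_zero hba h0)]
  field_simp
  ring

theorem differentiableOn_slitRootInv {a b : ℝ} :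
    DifferentiableOn ℂ (slitRootInv a b) {w | 0 < w.re} := by
  unfold slitRootInv
  exact DifferentiableOn.div (by fun_prop) (by fun_prop) fun w hw => one_add_sq_ne hw

theorem theta_mem {a b : ℝ} (hab : a < b) {z : ℂ} (hz : z.im ≠ 0) : theta a b z ∈ Ioo 0 Real.pi := by
  have h1 := Real.arctan_lt_pi_div_two ((b - z.re) / |z.im|)
  have h2 := Real.neg_pi_div_two_lt_arctan ((a - z.re) / |z.im|)
  have h3 : Real.arctan ((a - z.re) / |z.im|) < Real.arctan ((b - z.re) / |z.im|) := by
    apply Real.arctan_strictMono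
    have : 0 < |z.im| := abs_pos.2 hz
    gcongr
  constructor <;> · unfold theta; linarith

theorem cos_theta {a b : ℝ} {z : ℂ} (hz : z.im ≠ 0) :
    Real.cos (theta a b z) = -(moeb a b z).re / ‖moeb a b z‖ := by
  have hy : 0 < |z.im| := abs_pos.2 hz
  have key : ∀ c : ℝ, Real.sqrt (1 + ((c - z.re) / |z.im|) ^ 2) = ‖(c : ℂ) - z‖ / |z.im| := by
    intro c
    rw [Real.sqrt_eq_iff_mul_self_eq (by positivity) (by positivity), ← sq, div_pow, div_pow,
      Complex.sq_norm, Complex.normSq_apply]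
    simp only [Complex.sub_re, Complex.sub_im, Complex.ofReal_re, Complex.ofReal_im]
    rw [sq_abs]
    have : z.im ^ 2 ≠ 0 := by positivity
    field_simp
    ring
  have hne : ∀ c : ℝ, 0 < ‖(c : ℂ) - z‖ := fun c => norm_pos_iff.2 fun h => hz (by
    have := congrArg Complex.im h
    simpa using this)
  rw [theta, Real.cos_sub, Real.cos_arctan, Real.cos_arctan, Real.sin_arctan, Real.sin_arctan,
    key, key, moeb_re, moeb, norm_div, norm_sub_rev z a]
  have h1 : Complex.normSq (b - z) = ‖(b : ℂ) - z‖ ^ 2 := (Complex.sq_norm _).symm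
  rw [h1]
  have ha := hne a
  have hb := hne b
  have h2 : z.im ^ 2 = |z.im| ^ 2 := (sq_abs _).symm
  rw [h2]
  field_simp
  ring

theorem theta_le_of_maps {g : ℂ → ℂ} {a b a' b' : ℝ} (hab : a < b) (hab' : a' < b')
    (hd : DifferentiableOn ℂ g (slitDom (Ioo a b)))
    (hm : MapsTo g (slitDom (Ioo a b)) (slitDom (Ioo a' b')))
    (hr : ∀ x ∈ Ioo a b, (g (x : ℂ)).im = 0) {z : ℂ} (hz : z.im ≠ 0) (hgz : (g z).im ≠ 0) :
    theta a b z ≤ theta a' b' (g z) := by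
  set Q : ℂ → ℂ := fun w => slitRoot a' b' (g (slitRootInv a b w)) with hQ
  have hQd : DifferentiableOn ℂ Q {w | 0 < w.re} :=
    (differentiableOn_slitRoot hab').comp
      (hd.comp differentiableOn_slitRootInv fun w hw => (slitRootInv_mem hab hw).1)
      fun w hw => hm (slitRootInv_mem hab hw).1
  have hQm : ∀ w : ℂ, 0 < w.re → 0 < (Q w).re := fun w hw =>
    slitRoot_re hab' (hm (slitRootInv_mem hab hw).1)
  have hzs : z ∈ slitDom (Ioo a b) := Or.inl hz
  set w := slitRoot a b z with hw
  have hwre : 0 < w.re := slitRoot_re hab hzs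
  have hQw : Q w = slitRoot a' b' (g z) := by rw [hQ]; simp only; rw [slitRootInv_slitRoot hab hzs]
  set t : ℝ := ‖w‖ with ht
  have ht0 : 0 < t := norm_pos_iff.2 fun h => by rw [h] at hwre; simp at hwre
  have htre : 0 < ((t : ℝ) : ℂ).re := by simpa using ht0
  have hSP := schwarz_pick_rhp hQd hQm hwre htre
  set W := Q w with hW
  set T := Q t with hT
  have hTim : T.im = 0 := by
    obtain ⟨hmem, hmo⟩ := slitRootInv_mem hab htre
    have h1 : slitRootInv a b t = (((slitRootInv a b t).re : ℝ) : ℂ) := by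
      refine Complex.ext (Complex.ofReal_re _).symm ?_
      rw [Complex.ofReal_im]
      have h4 := moeb_im (a := a) (b := b) (z := slitRootInv a b t)
      rw [hmo] at h4
      have h5 := Complex.normSq_pos.2 (slit_ne hmem)
      rw [← Complex.ofReal_pow, Complex.ofReal_im, eq_comm, div_eq_zero_iff] at h4
      rcases h4 with h4 | h4
      · rcases mul_eq_zero.1 h4 with h4 | h4
        · exact h4
        · linarith
      · linarith
    have h2 : (slitRootInv a b t).re ∈ Ioo a b := by
      rcases hmem with h3 | h3
      · rw [h1] at h3; simp at h3
      · exact h3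
    have h3 : (g (slitRootInv a b t)).im = 0 := by rw [h1]; exact hr _ h2
    have h4 := hm hmem
    have h5 := slitRoot_sq hab' h4
    have h6 := slitRoot_re hab' h4
    have h7 := congrArg Complex.im h5
    rw [moeb_im, h3] at h7
    simp [sq] at h7
    change (slitRoot a' b' (g (slitRootInv a b t))).im = 0
    have h8 : (slitRoot a' b' (g (slitRootInv a b t))).re *
      (slitRoot a' b' (g (slitRootInv a b t))).im = 0 := by linarith
    rcases mul_eq_zero.1 h8 with h8 | h8
    · linarith
    · exact h8
  have hTre : 0 < T.re := hQm _ htre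
  have hWre : 0 < W.re := hQm _ hwre
  have hsq : ‖W - T‖ ^ 2 * ‖w + t‖ ^ 2 ≤ ‖w - t‖ ^ 2 * ‖W + T‖ ^ 2 := by
    rw [← mul_pow, ← mul_pow]
    have hTc : (starRingEnd ℂ) T = T := Complex.conj_eq_iff_im.2 hTim
    rw [Complex.conj_ofReal, hTc] at hSP
    gcongr
  have hw2 : t ^ 2 = w.re ^ 2 + w.im ^ 2 := by rw [ht, Complex.sq_norm, Complex.normSq_apply]; ring
  have hW2 : ‖W‖ ^ 2 = W.re ^ 2 + W.im ^ 2 := by rw [Complex.sq_norm, Complex.normSq_apply]; ring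
  have e1 : ‖W - T‖ ^ 2 = ‖W‖ ^ 2 + T.re ^ 2 - 2 * T.re * W.re := by
    rw [hW2, Complex.sq_norm, Complex.normSq_apply, Complex.sub_re, Complex.sub_im, hTim]; ring
  have e2 : ‖W + T‖ ^ 2 = ‖W‖ ^ 2 + T.re ^ 2 + 2 * T.re * W.re := by
    rw [hW2, Complex.sq_norm, Complex.normSq_apply, Complex.add_re, Complex.add_im, hTim]; ring
  have e3 : ‖w - t‖ ^ 2 = 2 * t * (t - w.re) := by
    rw [Complex.sq_norm, Complex.normSq_apply, Complex.sub_re, Complex.sub_im, Complex.ofReal_re,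
      Complex.ofReal_im]
    linear_combination -hw2
  have e4 : ‖w + t‖ ^ 2 = 2 * t * (t + w.re) := by
    rw [Complex.sq_norm, Complex.normSq_apply, Complex.add_re, Complex.add_im, Complex.ofReal_re,
      Complex.ofReal_im]
    linear_combination -hw2
  rw [e1, e2, e3, e4] at hsq
  have h1 : (‖W‖ ^ 2 + T.re ^ 2) * w.re ≤ 2 * T.re * W.re * t := by
    have : 2 * t * 2 * ((‖W‖ ^ 2 + T.re ^ 2) * w.re) ≤ 2 * t * 2 * (2 * T.re * W.re * t) := by
      linarith
    exact le_of_mul_le_mul_left this (by positivity)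
  have h2 : ‖W‖ * w.re ≤ W.re * t := by
    have h3 : 2 * T.re * ‖W‖ * w.re ≤ (‖W‖ ^ 2 + T.re ^ 2) * w.re := by
      gcongr; nlinarith [sq_nonneg (‖W‖ - T.re)]
    have : 2 * T.re * (‖W‖ * w.re) ≤ 2 * T.re * (W.re * t) := by linarith
    exact le_of_mul_le_mul_left this (by positivity)
  have hWn : 0 < ‖W‖ := norm_pos_iff.2 fun h => by rw [h] at hWre; simp at hWre
  have key : ∀ {a b : ℝ} {z : ℂ}, a < b → z.im ≠ 0 → Real.cos (theta a b z) =
      1 - 2 * ((slitRoot a b z).re / ‖slitRoot a b z‖) ^ 2 := by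
    intro a b z hab hz
    have hn : 0 < ‖slitRoot a b z‖ := norm_pos_iff.2 (Complex.exp_ne_zero _)
    rw [cos_theta hz, ← slitRoot_sq hab (Or.inl hz)]
    have : (slitRoot a b z ^ 2).re = 2 * (slitRoot a b z).re ^ 2 - ‖slitRoot a b z‖ ^ 2 := by
      rw [Complex.sq_norm, Complex.normSq_apply, sq, Complex.mul_re]; ring
    rw [this, norm_pow]
    field_simp
    ring
  have hcos : Real.cos (theta a' b' (g z)) ≤ Real.cos (theta a b z) := by
    rw [key hab hz, key hab' hgz, ← hQw, ← hw]
    have : w.re / ‖w‖ ≤ W.re / ‖W‖ := by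
      rw [div_le_div_iff₀ ht0 hWn]; linarith
    have h0 : 0 ≤ w.re / ‖w‖ := by positivity
    have := pow_le_pow_left₀ h0 this 2
    linarith
  by_contra hlt
  have h3 := theta_mem hab hz
  have h4 := theta_mem hab' hgz
  have := Real.strictAntiOn_cos (Ioo_subset_Icc_self h4) (Ioo_subset_Icc_self h3) (not_le.1 hlt)
  linarith

end

section

theorem norm_sub_conj (z : ℂ) : ‖z - (starRingEnd ℂ) z‖ = 2 * |z.im| := by
  rw [Complex.sub_conj, norm_mul, Complex.norm_I, mul_one, Complex.norm_real, Real.norm_eq_abs,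
    abs_mul, abs_two]

theorem isOpen_halfplane (σ : ℝ) : IsOpen {z : ℂ | 0 < σ * z.im} :=
  isOpen_lt continuous_const (continuous_const.mul Complex.continuous_im)

theorem convex_halfplane (σ : ℝ) : Convex ℝ {z : ℂ | 0 < σ * z.im} := by
  intro x hx y hy a b ha hb hab
  simp only [mem_ofPred_eq, Complex.add_im, Complex.real_smul, Complex.mul_im, Complex.ofReal_re,
    Complex.ofReal_im, zero_mul, add_zero] at *
  have : σ * (a * x.im + b * y.im) = a * (σ * x.im) + b * (σ * y.im) := by ring
  rw [this]
  rcases ha.eq_or_lt with h | h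
  · have hb1 : b = 1 := by linarith
    rw [← h, hb1]; linarith
  · have := mul_pos h hx
    have := mul_nonneg hb hy.le
    linarith

theorem schwarz_pick_deriv_hp {Q : ℂ → ℂ} {σ τ : ℝ} (hσ : σ ^ 2 = 1) (hτ : τ ^ 2 = 1)
    (hd : DifferentiableOn ℂ Q {z | 0 < σ * z.im})
    (hm : ∀ z : ℂ, 0 < σ * z.im → 0 < τ * (Q z).im) {w : ℂ} (hw : 0 < σ * w.im) :
    ‖deriv Q w‖ * |w.im| ≤ |(Q w).im| := by
  have hnh : {z : ℂ | 0 < σ * z.im} ∈ 𝓝 w := (isOpen_halfplane σ).mem_nhds hw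
  have hQ := (hd.differentiableAt hnh)
  have h1 : Tendsto (fun z => ‖slope Q w z‖ * ‖z - (starRingEnd ℂ) w‖) (𝓝[≠] w)
      (𝓝 (‖deriv Q w‖ * ‖w - (starRingEnd ℂ) w‖)) := by
    refine (hasDerivAt_iff_tendsto_slope.1 hQ.hasDerivAt).norm.mul ?_
    exact ((by fun_prop : Continuous fun z : ℂ => ‖z - (starRingEnd ℂ) w‖).tendsto w).mono_left
      nhdsWithin_le_nhds
  have h2 : Tendsto (fun z => ‖Q z - (starRingEnd ℂ) (Q w)‖) (𝓝[≠] w)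
      (𝓝 (‖Q w - (starRingEnd ℂ) (Q w)‖)) :=
    ((hQ.continuousAt.sub continuousAt_const).norm.tendsto).mono_left nhdsWithin_le_nhds
  have h3 := le_of_tendsto_of_tendsto h1 h2 (by
    filter_upwards [self_mem_nhdsWithin, mem_nhdsWithin_of_mem_nhds hnh] with z hz hz2
    have h4 := schwarz_pick_hp hσ hτ hd hm hz2 hw
    have h5 : 0 < ‖z - w‖ := norm_pos_iff.2 (sub_ne_zero.2 hz)
    rw [slope_def_field, norm_div, div_mul_eq_mul_div, div_le_iff₀ h5]
    linarith)
  rw [norm_sub_conj, norm_sub_conj] at h3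
  linarith

theorem image_superset_of_deriv_near_one {r : ℝ} (hr : r < 1) :
    ∃ ε > (0 : ℝ), ∀ φ : ℂ → ℂ, DifferentiableOn ℂ φ (ball 0 1) →
      MapsTo φ (ball 0 1) (ball 0 1) → φ 0 = 0 → 1 - ε ≤ ‖deriv φ 0‖ →
      ball 0 r ⊆ φ '' ball 0 1 := by
  rcases le_or_gt r 0 with hr0 | hr0
  · refine ⟨1, one_pos, fun φ _ _ _ _ => ?_⟩
    rw [ball_eq_empty.2 hr0]; exact empty_subset _
  set t := (1 + r) / 2 with ht
  have ht1 : t < 1 := by linarith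
  have hrt : r < t := by linarith
  have ht0 : 0 < t := by linarith
  refine ⟨(t - r) * (1 - t) / 8, by
    have := mul_pos (sub_pos.2 hrt) (sub_pos.2 ht1); positivity, ?_⟩
  set ε := (t - r) * (1 - t) / 8 with hε
  have hε0 : 0 < ε := by have := mul_pos (sub_pos.2 hrt) (sub_pos.2 ht1); positivity
  have hε1 : ε < 1 := by nlinarith
  intro φ hd hm h0 ha
  have hmem0 : (0 : ℂ) ∈ ball (0 : ℂ) 1 := mem_ball_self one_pos
  have hnh : ball (0 : ℂ) 1 ∈ 𝓝 (0 : ℂ) := ball_mem_nhds 0 one_pos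
  set a := deriv φ 0 with ha'
  have ha0 : a ≠ 0 := fun h => by rw [h, norm_zero] at ha; linarith
  set u : ℂ := (starRingEnd ℂ) a / ‖a‖ with hu
  have hna : 0 < ‖a‖ := norm_pos_iff.2 ha0
  have hun : ‖u‖ = 1 := by
    rw [hu, norm_div, Complex.norm_real, norm_norm, Complex.norm_conj, div_self hna.ne']
  have hua : u * a = ‖a‖ := by
    have hne : (‖a‖ : ℂ) ≠ 0 := by exact_mod_cast hna.ne'
    rw [hu, div_mul_eq_mul_div, mul_comm, Complex.mul_conj, Complex.normSq_eq_norm_sq,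
      div_eq_iff hne]
    push_cast; ring
  have hmc : MapsTo φ (ball 0 1) (closedBall (φ 0) 1) := fun z hz => by
    rw [h0]; exact ball_subset_closedBall (hm hz)
  have hsl : ∀ z ∈ ball (0 : ℂ) 1, ‖dslope φ 0 z‖ ≤ 1 := fun z hz => by
    simpa using Complex.norm_dslope_le_div_of_mapsTo_ball hd hmc hz
  have hdsl : DifferentiableOn ℂ (dslope φ 0) (ball 0 1) :=
    (Complex.differentiableOn_dslope hnh).2 hd
  have hre : ∀ z ∈ ball (0 : ℂ) 1, 0 < (1 + ε - u * dslope φ 0 z).re := by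
    intro z hz
    have h1 : (u * dslope φ 0 z).re ≤ 1 := (Complex.re_le_norm _).trans (by
      rw [norm_mul, hun, one_mul]; exact hsl z hz)
    simp only [Complex.sub_re, Complex.add_re, Complex.one_re, Complex.ofReal_re]
    linarith
  have hlow : ∀ z, ‖z‖ = t → r ≤ ‖φ z‖ := by
    intro z hz
    have hzb : z ∈ ball (0 : ℂ) 1 := by rw [mem_ball_zero_iff, hz]; exact ht1
    have h1 := rhp_norm_le (ψ := fun z => 1 + ε - u * dslope φ 0 z) (t := t)
      ((hdsl.const_mul u).const_sub _) hre hzb (by rw [dist_zero_right, hz]; linarith)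
    have ha1 : ‖a‖ ≤ 1 := by simpa using hsl 0 hmem0
    have h2 : ‖(1 + ε - u * dslope φ 0 0 : ℂ)‖ ≤ 2 * ε := by
      rw [dslope_same, ← ha', hua]
      have : (1 + ε - ‖a‖ : ℂ) = ((1 + ε - ‖a‖ : ℝ) : ℂ) := by push_cast; ring
      rw [this, Complex.norm_real, Real.norm_of_nonneg (by linarith)]
      linarith
    have h3 : ‖(1 + ε - u * dslope φ 0 z : ℂ)‖ ≤ (t - r) / 2 := by
      have h4 : ‖(1 + ε - u * dslope φ 0 z : ℂ)‖ * (1 - t) ≤ (t - r) / 2 * (1 - t) := by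
        refine h1.trans ((mul_le_mul_of_nonneg_right h2 (by linarith)).trans ?_)
        rw [hε]
        have := mul_pos (sub_pos.2 hrt) (sub_pos.2 ht1)
        nlinarith
      exact le_of_mul_le_mul_right h4 (by linarith)
    have h5 : 1 + ε - (t - r) / 2 ≤ ‖dslope φ 0 z‖ := by
      have h6 : ‖(1 + ε : ℂ)‖ ≤ ‖(1 + ε - u * dslope φ 0 z : ℂ)‖ + ‖u * dslope φ 0 z‖ := by
        have := norm_add_le (1 + ε - u * dslope φ 0 z : ℂ) (u * dslope φ 0 z)
        rwa [sub_add_cancel] at this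
      have h7 : ‖(1 + ε : ℂ)‖ = 1 + ε := by
        have : (1 + ε : ℂ) = ((1 + ε : ℝ) : ℂ) := by push_cast; ring
        rw [this, Complex.norm_real, Real.norm_of_nonneg (by linarith)]
      rw [norm_mul, hun, one_mul, h7] at h6
      linarith
    have hz0 : z ≠ 0 := fun h => by rw [h, norm_zero] at hz; linarith
    rw [dslope_of_ne _ hz0, slope_def_field, h0, sub_zero, sub_zero, norm_div, hz,
      le_div_iff₀ ht0] at h5
    nlinarith
  -- the image of the disc of radius `t` is relatively clopen in the disc of radius `r`
  have hcl : closedBall (0 : ℂ) t ⊆ ball 0 1 := closedBall_subset_ball ht1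
  have hopen : IsOpen (φ '' ball 0 t) := by
    rcases (hd.analyticOnNhd isOpen_ball).is_constant_or_isOpen (convex_ball 0 1).isPreconnected
      with ⟨b, hb⟩ | h1
    · exfalso
      apply ha0
      have : φ =ᶠ[𝓝 0] fun _ => b := by filter_upwards [hnh] with x hx using hb x hx
      rw [ha', this.deriv_eq, deriv_const]
    · exact h1 _ (ball_subset_closedBall.trans hcl) isOpen_ball
  have hclosed : IsClosed (φ '' closedBall 0 t) :=
    ((isCompact_closedBall (0 : ℂ) t).image_of_continuousOn (hd.continuousOn.mono hcl)).isClosed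
  have hsub : ball 0 r ⊆ φ '' ball 0 t := by
    refine (convex_ball (0 : ℂ) r).isPreconnected.subset_left_of_subset_union hopen
      hclosed.isOpen_compl ?_ ?_ ⟨0, mem_ball_self hr0, 0, mem_ball_self ht0, h0⟩
    · exact disjoint_compl_right.mono_left (image_mono ball_subset_closedBall)
    · intro y hy
      by_cases hyc : y ∈ φ '' closedBall 0 t
      · left
        obtain ⟨x, hx, rfl⟩ := hyc
        refine ⟨x, ?_, rfl⟩
        rw [mem_closedBall_zero_iff] at hx
        rw [mem_ball_zero_iff] at hy ⊢
        refine lt_of_le_of_ne hx fun h => ?_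
        linarith [hlow x h]
      · exact Or.inr hyc
  exact hsub.trans (image_mono (ball_subset_closedBall.trans hcl))

theorem image_superset_rhp {r : ℝ} (hr : r < 1) :
    ∃ ε > (0 : ℝ), ∀ (G : ℂ → ℂ), DifferentiableOn ℂ G {z | 0 < z.re} →
      (∀ z : ℂ, 0 < z.re → 0 < (G z).re) → ∀ w : ℂ, 0 < w.re →
      (1 - ε) * (G w).re ≤ ‖deriv G w‖ * w.re →
      ∀ z : ℂ, 0 < z.re → ‖z - G w‖ < r * ‖z + (starRingEnd ℂ) (G w)‖ →
        ∃ u : ℂ, 0 < u.re ∧ G u = z := by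
  obtain ⟨ε, hε, H⟩ := image_superset_of_deriv_near_one hr
  refine ⟨ε, hε, fun G hd hm w hw hdw z hz hzr => ?_⟩
  have hGw := hm w hw
  have hC : DifferentiableOn ℂ (fun u => (w + (starRingEnd ℂ) w * u) / (1 - u)) (ball 0 1) :=
    DifferentiableOn.div (by fun_prop) (by fun_prop) (fun u hu => (cayley_re_pos hw hu).1)
  have hGC : DifferentiableOn ℂ (fun u => G ((w + (starRingEnd ℂ) w * u) / (1 - u))) (ball 0 1) :=
    hd.comp hC (fun u hu => (cayley_re_pos hw hu).2)
  have hne : ∀ u ∈ ball (0 : ℂ) 1, G ((w + (starRingEnd ℂ) w * u) / (1 - u)) +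
      (starRingEnd ℂ) (G w) ≠ 0 := fun u hu =>
    (cayley_inv hGw (hm _ (cayley_re_pos hw hu).2)).1
  set φ : ℂ → ℂ := fun u => (G ((w + (starRingEnd ℂ) w * u) / (1 - u)) - G w) /
    (G ((w + (starRingEnd ℂ) w * u) / (1 - u)) + (starRingEnd ℂ) (G w)) with hφ
  have hnh : ball (0 : ℂ) 1 ∈ 𝓝 (0 : ℂ) := ball_mem_nhds 0 one_pos
  have hder : deriv φ 0 = deriv G w * w.re / (G w).re := by
    have hne1 : (1 : ℂ) - 0 ≠ 0 := by simp
    have h1 : HasDerivAt (fun u => (w + (starRingEnd ℂ) w * u) / (1 - u))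
        (2 * w.re : ℝ) 0 := by
      have := (((hasDerivAt_id (0 : ℂ)).const_mul ((starRingEnd ℂ) w)).const_add w).fun_div
        ((hasDerivAt_id (0 : ℂ)).const_sub 1) hne1
      refine this.congr_deriv ?_
      simp only [id, ← Complex.add_conj]
      simp; ring
    have hwn : {z : ℂ | 0 < z.re} ∈ 𝓝 w :=
      (isOpen_lt continuous_const Complex.continuous_re).mem_nhds hw
    have h2 : HasDerivAt (fun u => G ((w + (starRingEnd ℂ) w * u) / (1 - u)))
        (deriv G w * (2 * w.re : ℝ)) 0 := by
      have h3 : HasDerivAt G (deriv G w) ((w + (starRingEnd ℂ) w * 0) / (1 - 0)) := by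
        simpa using (hd.differentiableAt hwn).hasDerivAt
      exact h3.comp (0 : ℂ) h1
    have h4 := (h2.sub_const (G w)).fun_div (h2.add_const ((starRingEnd ℂ) (G w)))
      (hne 0 (mem_ball_self one_pos))
    rw [hφ, h4.deriv]
    simp only [mul_zero, add_zero, sub_zero, div_one, sub_self, zero_mul]
    rw [Complex.add_conj]
    have : ((G w).re : ℂ) ≠ 0 := by exact_mod_cast hGw.ne'
    push_cast
    field_simp
  have hsub := H φ ((hGC.sub_const _).div (hGC.add_const _) hne) (fun u hu =>
    (cayley_inv hGw (hm _ (cayley_re_pos hw hu).2)).2.1) (by simp [hφ]) (by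
      rw [hder, norm_div, norm_mul, Complex.norm_real, Complex.norm_real,
        Real.norm_of_nonneg hw.le, Real.norm_of_nonneg hGw.le, le_div_iff₀ hGw]
      exact hdw)
  obtain ⟨hzne, hzb, hzi⟩ := cayley_inv hGw hz
  obtain ⟨u, hu, hue⟩ := hsub (show (z - G w) / (z + (starRingEnd ℂ) (G w)) ∈ ball (0 : ℂ) r by
    rw [mem_ball_zero_iff, norm_div, div_lt_iff₀ (norm_pos_iff.2 hzne)]
    exact hzr)
  refine ⟨_, (cayley_re_pos hw hu).2, ?_⟩
  have h5 := (cayley_inv hGw (hm _ (cayley_re_pos hw hu).2)).2.2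
  change (G w + (starRingEnd ℂ) (G w) * φ u) / (1 - φ u) = _ at h5
  rw [hue, hzi] at h5
  exact h5.symm

theorem image_superset_hp {r : ℝ} (hr : r < 1) :
    ∃ ε > (0 : ℝ), ∀ (σ τ : ℝ) (G : ℂ → ℂ), σ ^ 2 = 1 → τ ^ 2 = 1 →
      DifferentiableOn ℂ G {z | 0 < σ * z.im} →
      (∀ z : ℂ, 0 < σ * z.im → 0 < τ * (G z).im) → ∀ w : ℂ, 0 < σ * w.im →
      (1 - ε) * |(G w).im| ≤ ‖deriv G w‖ * |w.im| →
      ∀ z : ℂ, 0 < τ * z.im → ‖z - G w‖ < r * ‖z - (starRingEnd ℂ) (G w)‖ →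
        ∃ u : ℂ, 0 < σ * u.im ∧ G u = z := by
  obtain ⟨ε, hε, H⟩ := image_superset_rhp hr
  refine ⟨ε, hε, fun σ τ G hσ hτ hd hm w hw hdw z hz hzr => ?_⟩
  obtain ⟨hd', hm'⟩ := rot_rhp hσ hd hm
  have habs : ∀ {σ x : ℝ}, σ ^ 2 = 1 → 0 < σ * x → |x| = σ * x := by
    intro σ x hσ hx
    rcases sq_eq_one_iff.1 hσ with h | h
    · rw [h] at hx ⊢; rw [one_mul] at *; exact abs_of_pos hx
    · rw [h] at hx ⊢; rw [abs_of_neg (by linarith)]; ring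
  have hder : ‖deriv (fun u => -(τ : ℂ) * Complex.I * G (σ * Complex.I * u))
      (-(σ : ℂ) * Complex.I * w)‖ = ‖deriv G w‖ := by
    have h1 : HasDerivAt G (deriv G w) ((σ : ℂ) * Complex.I * (-(σ : ℂ) * Complex.I * w)) := by
      rw [rot_inv hσ]
      exact (hd.differentiableAt ((isOpen_halfplane σ).mem_nhds hw)).hasDerivAt
    have h2 := (h1.comp (-(σ : ℂ) * Complex.I * w)
      ((hasDerivAt_id (-(σ : ℂ) * Complex.I * w)).const_mul ((σ : ℂ) * Complex.I))).const_mul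
      (-(τ : ℂ) * Complex.I)
    have h3 := h2.deriv
    simp only [Function.comp_def] at h3
    rw [h3, rot_norm hτ]
    have h4 : (σ : ℂ) * Complex.I * 1 = -(((-σ : ℝ) : ℂ) * Complex.I * 1) := by push_cast; ring
    have h5 := rot_norm (σ := -σ) (by rw [neg_sq, hσ]) 1
    push_cast at h5
    rw [neg_neg, norm_one] at h5
    rw [norm_mul, h5, mul_one]
  have e1 : ∀ (σ : ℝ) (a b : ℂ), -(σ : ℂ) * Complex.I * a - -(σ : ℂ) * Complex.I * b =
    -(σ : ℂ) * Complex.I * (a - b) := fun σ a b => by ring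
  have e2 : ∀ (σ : ℝ) (a b : ℂ), -(σ : ℂ) * Complex.I * a + -(σ : ℂ) * -Complex.I * b =
    -(σ : ℂ) * Complex.I * (a - b) := fun σ a b => by ring
  obtain ⟨u, hu, hue⟩ := H _ hd' hm' (-(σ : ℂ) * Complex.I * w) (by rw [rot_re]; exact hw) (by
      rw [hder, rot_inv hσ, rot_re, rot_re, ← habs hσ hw, ← habs hτ (hm w hw)]
      exact hdw) (-(τ : ℂ) * Complex.I * z) (by rw [rot_re]; exact hz) (by
      rw [rot_inv hσ]
      simp only [map_mul, map_neg, Complex.conj_ofReal, Complex.conj_I]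
      rw [e1, e2, rot_norm hτ, rot_norm hτ]
      exact hzr)
  refine ⟨(σ : ℂ) * Complex.I * u, by
    rw [rot_im, ← mul_assoc, ← sq, hσ, one_mul]; exact hu, ?_⟩
  rw [← rot_inv hτ (G _), hue, rot_inv hτ]

end

section

/-- A real entire function in the class `B`; `R₀` bounds the singular values and `f 0`. -/
structure RealB (f : ℂ → ℂ) (S : Set ℂ) (R₀ : ℝ) : Prop where
  diff : Differentiable ℂ f
  npoly : ¬∃ p : Polynomial ℂ, ∀ z : ℂ, f z = p.eval z
  cov : IsCoveringMapOn f Sᶜ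
  sing_real : ∀ z ∈ S, z.im = 0
  real : ∀ x : ℝ, (f x).im = 0
  sing_bdd : ∀ z ∈ S, ‖z‖ < R₀
  zero_bdd : ‖f 0‖ < R₀

variable {f : ℂ → ℂ} {S : Set ℂ} {R₀ : ℝ}

theorem RealB.pos (h : RealB f S R₀) : 0 < R₀ := (norm_nonneg _).trans_lt h.zero_bdd

theorem RealB.conj (h : RealB f S R₀) (z : ℂ) :
    f ((starRingEnd ℂ) z) = (starRingEnd ℂ) (f z) := by
  have hc : Differentiable ℂ ((starRingEnd ℂ) ∘ f ∘ (starRingEnd ℂ)) := fun z => by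
    rw [← Complex.conj_conj z]
    exact (h.diff ((starRingEnd ℂ) z)).conj_conj
  have hEq : (starRingEnd ℂ) ∘ f ∘ (starRingEnd ℂ) = f := by
    have hA : AnalyticOnNhd ℂ ((starRingEnd ℂ) ∘ f ∘ (starRingEnd ℂ)) univ :=
      fun z _ => hc.analyticAt z
    refine hA.eq_of_frequently_eq (z₀ := 0) (fun z _ => h.diff.analyticAt z) ?_
    have h1 : Tendsto (fun x : ℝ => (x : ℂ)) (𝓝[≠] 0) (𝓝[≠] 0) := by
      refine tendsto_nhdsWithin_iff.2 ⟨?_, ?_⟩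
      · exact (Complex.continuous_ofReal.tendsto' 0 0 Complex.ofReal_zero).mono_left
          nhdsWithin_le_nhds
      · filter_upwards [self_mem_nhdsWithin] with x hx
        simpa using hx
    refine h1.frequently (Eventually.frequently (Eventually.of_forall fun x => ?_))
    simp only [Function.comp, Complex.conj_ofReal]
    exact Complex.conj_eq_iff_im.2 (h.real x)
  have := congrFun hEq ((starRingEnd ℂ) z)
  simp only [Function.comp, Complex.conj_conj] at this
  exact this.symm

/-- The restriction of `f` to the real line. -/
noncomputable def rl (f : ℂ → ℂ) (x : ℝ) : ℝ := (f x).re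

theorem RealB.ofReal_rl (h : RealB f S R₀) (x : ℝ) : ((rl f x : ℝ) : ℂ) = f x :=
  Complex.ext (by simp [rl]) (by simp [h.real x])

theorem RealB.iterate_ofReal (h : RealB f S R₀) (n : ℕ) (x : ℝ) :
    f^[n] (x : ℂ) = (((rl f)^[n] x : ℝ) : ℂ) := by
  induction n generalizing x with
  | zero => rfl
  | succ n ih => rw [Function.iterate_succ_apply, Function.iterate_succ_apply, ← h.ofReal_rl, ih]

theorem RealB.conj_iterate (h : RealB f S R₀) (n : ℕ) (z : ℂ) :
    f^[n] ((starRingEnd ℂ) z) = (starRingEnd ℂ) (f^[n] z) := by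
  induction n generalizing z with
  | zero => rfl
  | succ n ih => rw [Function.iterate_succ_apply, Function.iterate_succ_apply, h.conj, ih]

theorem RealB.deriv_ne_zero (h : RealB f S R₀) {z : ℂ} (hz : f z ∉ S) : deriv f z ≠ 0 :=
  deriv_ne_zero_of_covering h.diff h.cov hz

theorem RealB.im_ne_zero (h : RealB f S R₀) {z : ℂ} (hz : (f z).im ≠ 0) : z.im ≠ 0 := by
  intro h0
  apply hz
  have := h.real z.re
  rwa [show ((z.re : ℝ) : ℂ) = z from Complex.ext (by simp) (by simp [h0])] at this

theorem RealB.im_iterate_ne_zero (h : RealB f S R₀) {n : ℕ} {z : ℂ} (hz : (f^[n] z).im ≠ 0) :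
    z.im ≠ 0 := by
  induction n generalizing z with
  | zero => exact hz
  | succ n ih => exact h.im_ne_zero (ih (by rwa [Function.iterate_succ_apply] at hz))

theorem RealB.differentiable_iterate (h : RealB f S R₀) (n : ℕ) : Differentiable ℂ f^[n] := by
  induction n with
  | zero => exact differentiable_id
  | succ n ih => rw [Function.iterate_succ]; exact ih.comp h.diff

theorem RealB.hasDerivAt_rl (h : RealB f S R₀) (x : ℝ) :
    HasDerivAt (rl f) (deriv f x).re x :=
  (h.diff x).hasDerivAt.real_of_complex

theorem RealB.ofReal_re_deriv (h : RealB f S R₀) (x : ℝ) :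
    (((deriv f x).re : ℝ) : ℂ) = deriv f x := by
  have h1 := (h.diff x).hasDerivAt.comp_ofReal
  have h2 : HasDerivAt (fun y : ℝ => f y) (((deriv f x).re : ℝ) : ℂ) x := by
    have := (h.hasDerivAt_rl x).ofReal_comp
    simpa only [h.ofReal_rl] using this
  exact h2.unique h1

theorem exists_local_inverse {f : ℂ → ℂ} {c : ℂ} (hf : AnalyticAt ℂ f c) (hc : deriv f c ≠ 0) :
    ∃ q : ℂ → ℂ, q (f c) = c ∧ AnalyticAt ℂ q (f c) ∧ (∀ᶠ y in 𝓝 (f c), f (q y) = y) ∧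
      ∀ᶠ z in 𝓝 c, q (f z) = z := by
  have hst := hf.hasStrictDerivAt
  have h1 := hst.eventually_left_inverse hc
  have h2 := hst.eventually_right_inverse hc
  refine ⟨_, h1.self_of_nhds, ?_, h2, h1⟩
  rw [Complex.analyticAt_iff_eventually_differentiableAt]
  have hq0 := (hst.to_localInverse hc).hasDerivAt.continuousAt
  have h3 := hf.deriv.continuousAt.eventually_ne hc
  have hq0' : Tendsto (hst.localInverse f _ c hc) (𝓝 (f c)) (𝓝 c) := by
    have := hq0.tendsto
    rwa [h1.self_of_nhds] at this
  have hd : ∀ᶠ z in 𝓝 c, HasStrictDerivAt f (deriv f z) z := by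
    filter_upwards [hf.eventually_analyticAt] with z hz using hz.hasStrictDerivAt
  filter_upwards [h2.eventually_nhds, hq0'.eventually h3, hq0'.eventually hd,
    hq0'.eventually h1.eventually_nhds] with y hy1 hy2 hy3 hy4
  have h5 := hy3.to_local_left_inverse hy2 hy4
  rw [hy1.self_of_nhds] at h5
  exact h5.hasDerivAt.differentiableAt

theorem deriv_ne_zero_of_right_inverse {f G : ℂ → ℂ} {y : ℂ} (hf : DifferentiableAt ℂ f (G y))
    (hG : DifferentiableAt ℂ G y) (hfG : ∀ᶠ z in 𝓝 y, f (G z) = z) :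
    deriv f (G y) * deriv G y = 1 := by
  have h4 : HasDerivAt (f ∘ G) 1 y := (hasDerivAt_id _).congr_of_eventuallyEq hfG
  exact (hf.hasDerivAt.comp y hG.hasDerivAt).unique h4

/-- A right inverse that is a left inverse at one point is a left inverse on any connected
open set that is mapped into its domain. -/
theorem inverse_comp_eq {f G : ℂ → ℂ} {V Ω : Set ℂ} (hf : DifferentiableOn ℂ f V)
    (hV : IsOpen V) (hVc : IsPreconnected V) (hΩ : IsOpen Ω) (hG : DifferentiableOn ℂ G Ω)
    (hVΩ : MapsTo f V Ω) (hfG : ∀ z ∈ Ω, f (G z) = z) {z₀ : ℂ} (hz₀ : z₀ ∈ V)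
    (h₀ : G (f z₀) = z₀) : ∀ z ∈ V, G (f z) = z := by
  have hGf : DifferentiableOn ℂ (fun z => G (f z)) V := hG.comp hf hVΩ
  have hfz := hf.analyticAt (hV.mem_nhds hz₀)
  have hΩz := hΩ.mem_nhds (hVΩ hz₀)
  have hne : deriv f z₀ ≠ 0 := by
    have h3 := deriv_ne_zero_of_right_inverse (f := f) (y := f z₀)
      (by rw [h₀]; exact hfz.differentiableAt) (hG.differentiableAt hΩz)
      (by filter_upwards [hΩz] with z hz using hfG z hz)
    rw [h₀] at h3
    exact left_ne_zero_of_mul_eq_one h3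
  obtain ⟨q, -, -, -, hq⟩ := exists_local_inverse hfz hne
  have hev : (fun z => G (f z)) =ᶠ[𝓝 z₀] id := by
    have ht : Tendsto (fun z => G (f z)) (𝓝 z₀) (𝓝 z₀) := by
      have := (hGf.differentiableAt (hV.mem_nhds hz₀)).continuousAt.tendsto
      rwa [h₀] at this
    filter_upwards [hq, ht.eventually hq, hV.mem_nhds hz₀] with z h1 h2 h3
    rw [hfG _ (hVΩ h3), h1] at h2
    exact h2.symm
  exact (hGf.analyticOnNhd hV).eqOn_of_preconnected_of_eventuallyEq
    (analyticOnNhd_id) hVc hz₀ hev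

/-- Two right inverses that agree at one point agree. -/
theorem right_inverse_unique {f G₁ G₂ : ℂ → ℂ} (hf : Differentiable ℂ f) {V : Set ℂ}
    (hV : IsOpen V) (hVc : IsPreconnected V) (h1 : DifferentiableOn ℂ G₁ V)
    (h2 : DifferentiableOn ℂ G₂ V) (hi1 : ∀ z ∈ V, f (G₁ z) = z) (hi2 : ∀ z ∈ V, f (G₂ z) = z)
    {y : ℂ} (hy : y ∈ V) (he : G₁ y = G₂ y) : EqOn G₁ G₂ V := by
  have hVy := hV.mem_nhds hy
  have hne : deriv f (G₁ y) ≠ 0 := left_ne_zero_of_mul_eq_one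
    (deriv_ne_zero_of_right_inverse (hf _) (h1.differentiableAt hVy)
      (by filter_upwards [hVy] with z hz using hi1 z hz))
  obtain ⟨q, -, -, -, hq⟩ := exists_local_inverse (hf.analyticAt _) hne
  have t1 := (h1.differentiableAt hVy).continuousAt.tendsto.eventually hq
  have t2 := (h2.differentiableAt hVy).continuousAt.tendsto.eventually (he ▸ hq)
  refine (h1.analyticOnNhd hV).eqOn_of_preconnected_of_eventuallyEq (h2.analyticOnNhd hV) hVc hy ?_
  filter_upwards [t1, t2, hVy] with z a b c
  rw [hi1 z c] at a
  rw [hi2 z c] at b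
  rw [← a, b]

/-- Inverse branches on half planes. -/
theorem RealB.exists_branch (h : RealB f S R₀) {σ : ℝ} {z₀ : ℂ} (hz₀ : 0 < σ * (f z₀).im) :
    ∃ G : ℂ → ℂ, DifferentiableOn ℂ G {z | 0 < σ * z.im} ∧
      (∀ z : ℂ, 0 < σ * z.im → f (G z) = z) ∧ G (f z₀) = z₀ := by
  refine exists_holo_lift h.diff h.cov (convex_halfplane σ) (isOpen_halfplane σ)
    differentiableOn_id (fun z hz hzS => ?_) hz₀ rfl
  have : 0 < σ * z.im := hz
  rw [h.sing_real z hzS] at this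
  simp at this

/-- The sign of the imaginary part. -/
theorem exists_side {z : ℂ} (hz : z.im ≠ 0) : ∃ σ : ℝ, σ ^ 2 = 1 ∧ 0 < σ * z.im := by
  rcases hz.lt_or_gt with h | h
  · exact ⟨-1, by norm_num, by linarith⟩
  · exact ⟨1, by norm_num, by linarith⟩

end

section
variable {f : ℂ → ℂ} {S : Set ℂ} {R₀ : ℝ}

theorem ofReal_re_of_im_eq_zero {z : ℂ} (hz : z.im = 0) : ((z.re : ℝ) : ℂ) = z :=
  Complex.ext (by simp) (by simp [hz])

theorem RealB.re_deriv_ne_zero (h : RealB f S R₀) {x : ℝ} (hx : deriv f x ≠ 0) :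
    (deriv f x).re ≠ 0 := by
  intro h0
  apply hx
  rw [← h.ofReal_re_deriv, h0, Complex.ofReal_zero]

theorem RealB.continuous_rl (h : RealB f S R₀) : Continuous (rl f) :=
  continuous_iff_continuousAt.2 fun x => (h.hasDerivAt_rl x).continuousAt

theorem RealB.injOn_rl (h : RealB f S R₀) {J : Set ℝ} (hJ : J.OrdConnected)
    (hne : ∀ x ∈ J, deriv f x ≠ 0) : InjOn (rl f) J := by
  have key : ∀ x ∈ J, ∀ y ∈ J, x < y → rl f x ≠ rl f y := by
    intro x hx y hy hxy he
    obtain ⟨c, hc, hc0⟩ := exists_hasDerivAt_eq_zero hxy h.continuous_rl.continuousOn he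
      (fun t _ => h.hasDerivAt_rl t)
    exact h.re_deriv_ne_zero (hne c (hJ.out hx hy (Ioo_subset_Icc_self hc))) hc0
  intro x hx y hy he
  rcases lt_trichotomy x y with hxy | hxy | hxy
  · exact absurd he (key x hx y hy hxy)
  · exact hxy
  · exact absurd he.symm (key y hy x hx hxy)

/-- An inverse branch on a half plane that extends the local inverse near the image of `x`. -/
def Adapted (f : ℂ → ℂ) (σ : ℝ) (G : ℂ → ℂ) (x : ℂ) : Prop :=
  DifferentiableOn ℂ G {z | 0 < σ * z.im} ∧ (∀ z : ℂ, 0 < σ * z.im → f (G z) = z) ∧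
    ∀ᶠ z in 𝓝 x, 0 < σ * (f z).im → G (f z) = z

theorem frequently_side {σ : ℝ} (hσ : σ ^ 2 = 1) {y : ℂ} (hy : y.im = 0) :
    ∃ᶠ z in 𝓝 y, 0 < σ * z.im := by
  have h1 : Tendsto (fun t : ℝ => y + (t : ℂ) * (σ * Complex.I)) (𝓝[>] 0) (𝓝 y) := by
    have : Continuous (fun t : ℝ => y + (t : ℂ) * (σ * Complex.I)) := by fun_prop
    exact (this.tendsto' 0 y (by simp)).mono_left nhdsWithin_le_nhds
  refine h1.frequently (Eventually.frequently ?_)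
  filter_upwards [self_mem_nhdsWithin] with t ht
  have ht' : (0 : ℝ) < t := ht
  simp [hy]
  nlinarith

theorem RealB.exists_adapted (h : RealB f S R₀) {σ : ℝ} (hσ : σ ^ 2 = 1) {x : ℂ}
    (hx : (f x).im = 0) (hne : deriv f x ≠ 0) : ∃ G, Adapted f σ G x := by
  obtain ⟨q, hq0, hqa, hq1, hq2⟩ := exists_local_inverse (h.diff.analyticAt x) hne
  obtain ⟨r, hr, hb⟩ := Metric.eventually_nhds_iff_ball.1
    (hq1.and ((Complex.analyticAt_iff_eventually_differentiableAt).1 hqa))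
  obtain ⟨y, hyσ, hyb⟩ := ((frequently_side hσ hx).and_eventually (ball_mem_nhds _ hr)).exists
  have hV : IsOpen ({z : ℂ | 0 < σ * z.im} ∩ ball (f x) r) :=
    (isOpen_halfplane σ).inter isOpen_ball
  have hVc := ((convex_halfplane σ).inter (convex_ball (f x) r)).isPreconnected
  obtain ⟨G, hG, hfG, hGy⟩ := h.exists_branch (σ := σ) (z₀ := q y) (by rw [(hb y hyb).1]; exact hyσ)
  rw [(hb y hyb).1] at hGy
  refine ⟨G, hG, hfG, ?_⟩
  have hEq := right_inverse_unique h.diff hV hVc (hG.mono inter_subset_left)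
    (fun z hz => (hb z hz.2).2.differentiableWithinAt) (fun z hz => hfG z hz.1)
    (fun z hz => (hb z hz.2).1) ⟨hyσ, hyb⟩ hGy
  filter_upwards [hq2, h.diff.continuous.continuousAt.preimage_mem_nhds (ball_mem_nhds (f x) hr)]
    with z hz1 hz2 hz3
  rw [hEq ⟨hz3, hz2⟩, hz1]

theorem Adapted.eqOn {σ : ℝ} (hσ : σ ^ 2 = 1) {G₁ G₂ : ℂ → ℂ} {x : ℂ}
    (hf : Differentiable ℂ f) (hx : (f x).im = 0) (hne : deriv f x ≠ 0)
    (h1 : Adapted f σ G₁ x) (h2 : Adapted f σ G₂ x) : EqOn G₁ G₂ {z | 0 < σ * z.im} := by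
  have hmap : map f (𝓝 x) = 𝓝 (f x) := (hf.analyticAt x).hasStrictDerivAt.map_nhds_eq hne
  have hfr := frequently_side hσ hx
  rw [← hmap, frequently_map] at hfr
  obtain ⟨z, hz, hz1, hz2⟩ := (hfr.and_eventually (h1.2.2.and h2.2.2)).exists
  exact right_inverse_unique hf (isOpen_halfplane σ) (convex_halfplane σ).isPreconnected
    h1.1 h2.1 h1.2.1 h2.2.1 (y := f z) hz ((hz1 hz).trans (hz2 hz).symm)

theorem RealB.exists_adapted_on (h : RealB f S R₀) {σ : ℝ} (hσ : σ ^ 2 = 1) {J : Set ℝ}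
    (hJ : IsPreconnected J) {x₀ : ℝ} (hx₀ : x₀ ∈ J) (hne : ∀ x ∈ J, deriv f x ≠ 0) :
    ∃ G, ∀ x ∈ J, Adapted f σ G x := by
  obtain ⟨G, hG⟩ := h.exists_adapted hσ (h.real x₀) (hne x₀ hx₀)
  refine ⟨G, fun x hx => ?_⟩
  have key := hJ.induction₂ (fun x y => x ∈ J → y ∈ J → ∀ G, Adapted f σ G x ↔ Adapted f σ G y)
    (fun x hx => ?_) (fun x y z hx hy hz h1 h2 hx hz G => (h1 hx hy G).trans (h2 hy hz G))
    (fun x y hx hy h1 hy hx G => (h1 hx hy G).symm) hx₀ hx hx₀ hx G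
  · exact key.1 hG
  · obtain ⟨Gx, hGx⟩ := h.exists_adapted hσ (h.real x) (hne x hx)
    have h1 : ∀ᶠ y : ℝ in 𝓝 x, Adapted f σ Gx y := by
      have := hGx.2.2.eventually_nhds
      have h2 := (Complex.continuous_ofReal.tendsto x).eventually this
      filter_upwards [h2] with y hy using ⟨hGx.1, hGx.2.1, hy⟩
    filter_upwards [nhdsWithin_le_nhds h1] with y hy hx hyJ G
    have congr' : ∀ {G₁ G₂ : ℂ → ℂ} {x : ℂ}, EqOn G₁ G₂ {z | 0 < σ * z.im} → Adapted f σ G₁ x →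
        Adapted f σ G₂ x := by
      intro G₁ G₂ x he ha
      refine ⟨ha.1.congr he.symm, fun z hz => ?_, ?_⟩
      · rw [← he hz]; exact ha.2.1 z hz
      · filter_upwards [ha.2.2] with z hz hz'
        rw [← he hz', hz hz']
    constructor
    · intro hG
      exact congr' (hGx.eqOn hσ h.diff (h.real x) (hne x hx) hG) hy
    · intro hG
      exact congr' (hy.eqOn hσ h.diff (h.real y) (hne y hyJ) hG) hGx

/-- Inverse branch along a real interval without critical points. -/
theorem RealB.glue (h : RealB f S R₀) {J : Set ℝ} (hJo : IsOpen J) (hJ : J.OrdConnected)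
    (hJn : J.Nonempty) (hne : ∀ x ∈ J, deriv f x ≠ 0) :
    ∃ g : ℂ → ℂ, DifferentiableOn ℂ g (slitDom (rl f '' J)) ∧
      (∀ y ∈ slitDom (rl f '' J), f (g y) = y) ∧ ∀ x ∈ J, g (f x) = x := by
  classical
  obtain ⟨x₀, hx₀⟩ := hJn
  obtain ⟨G₁, h1⟩ := h.exists_adapted_on (σ := 1) (by norm_num) hJ.isPreconnected hx₀ hne
  obtain ⟨G₂, h2⟩ := h.exists_adapted_on (σ := -1) (by norm_num) hJ.isPreconnected hx₀ hne
  obtain ⟨hd1, hi1, -⟩ := h1 x₀ hx₀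
  obtain ⟨hd2, hi2, -⟩ := h2 x₀ hx₀
  have hinj := h.injOn_rl hJ hne
  set g : ℂ → ℂ := fun y => if 0 < y.im then G₁ y else if y.im < 0 then G₂ y else
    ((Function.invFunOn (rl f) J y.re : ℝ) : ℂ) with hg
  have g1 : ∀ y : ℂ, 0 < y.im → g y = G₁ y := fun y hy => by simp [hg, hy]
  have g2 : ∀ y : ℂ, y.im < 0 → g y = G₂ y := fun y hy => by simp [hg, hy, not_lt.2 hy.le]
  have g3 : ∀ x ∈ J, g (f x) = x := fun x hx => by
    simp only [hg, h.real x, lt_irrefl, if_false]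
    have := hinj.leftInvOn_invFunOn hx
    rw [show (f x).re = rl f x from rfl, this]
  refine ⟨g, fun y hy => ?_, fun y hy => ?_, g3⟩
  · apply DifferentiableAt.differentiableWithinAt
    rcases lt_trichotomy y.im 0 with hi | hi | hi
    · have hmem : {z : ℂ | 0 < -1 * z.im} ∈ 𝓝 y :=
        (isOpen_halfplane (-1)).mem_nhds (show 0 < -1 * y.im by linarith)
      refine (hd2.differentiableAt hmem).congr_of_eventuallyEq ?_
      filter_upwards [hmem] with z hz
      exact g2 z (by have : 0 < -1 * z.im := hz
                     linarith)
    · rcases hy with hy | ⟨x, hx, hxy⟩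
      · exact absurd hi hy
      have hyx : f x = y := by
        rw [← h.ofReal_rl, hxy, ofReal_re_of_im_eq_zero hi]
      subst hyx
      obtain ⟨q, hq0, hqa, hq1, hq2⟩ := exists_local_inverse (h.diff.analyticAt x) (hne x hx)
      refine hqa.differentiableAt.congr_of_eventuallyEq ?_
      have hqt : Tendsto q (𝓝 (f x)) (𝓝 (x : ℂ)) := by
        have := hqa.continuousAt.tendsto
        rwa [hq0] at this
      have hJx : ∀ᶠ z : ℂ in 𝓝 (x : ℂ), z.re ∈ J :=
        Complex.continuous_re.continuousAt.eventually
          (by simpa using hJo.mem_nhds hx)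
      have hcj : Tendsto (starRingEnd ℂ) (𝓝 (x : ℂ)) (𝓝 (x : ℂ)) := by
        have := Complex.continuous_conj.tendsto (x : ℂ)
        rwa [Complex.conj_ofReal] at this
      have hev : ∀ᶠ z in 𝓝 (x : ℂ), g (f z) = z := by
        filter_upwards [(h1 x hx).2.2, (h2 x hx).2.2, hJx, hq2, hcj.eventually hq2]
          with z a1 a2 a3 a4 a5
        rcases lt_trichotomy (f z).im 0 with hi | hi | hi
        · rw [g2 _ hi]; exact a2 (by linarith)
        · have hzc : (starRingEnd ℂ) z = z := by
            rw [h.conj, Complex.conj_eq_iff_im.2 hi, a4] at a5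
            exact a5.symm
          have hz0 := ofReal_re_of_im_eq_zero (Complex.conj_eq_iff_im.1 hzc)
          rw [← hz0]; exact g3 _ a3
        · rw [g1 _ hi]; exact a1 (by linarith)
      filter_upwards [hq1, hqt.eventually hev] with w b1 b2
      rw [b1] at b2
      exact b2
    · have hmem : {z : ℂ | 0 < 1 * z.im} ∈ 𝓝 y :=
        (isOpen_halfplane 1).mem_nhds (show 0 < 1 * y.im by linarith)
      refine (hd1.differentiableAt hmem).congr_of_eventuallyEq ?_
      filter_upwards [hmem] with z hz
      exact g1 z (by have : 0 < 1 * z.im := hz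
                     linarith)
  · rcases lt_trichotomy y.im 0 with hi | hi | hi
    · rw [g2 y hi]; exact hi2 y (by linarith)
    · rcases hy with hy | ⟨x, hx, hxy⟩
      · exact absurd hi hy
      have hyx : f x = y := by
        rw [← h.ofReal_rl, hxy, ofReal_re_of_im_eq_zero hi]
      rw [← hyx, g3 x hx]
    · rw [g1 y hi]; exact hi1 y (by linarith)

theorem RealB.branch_mem_slitDom (h : RealB f S R₀) {J X : Set ℝ} {g : ℂ → ℂ}
    (hXJ : X ⊆ J)
    (hfg : ∀ y ∈ slitDom (rl f '' J), f (g y) = y) (hg : ∀ x ∈ J, g (f x) = x) :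
    MapsTo g (slitDom (rl f '' X)) (slitDom X) := by
  intro y hy
  by_cases hi : y.im = 0
  · rcases hy with hy | ⟨x, hx, hxy⟩
    · exact absurd hi hy
    have hyx : f x = y := by
      rw [← h.ofReal_rl, hxy, ofReal_re_of_im_eq_zero hi]
    rw [← hyx, hg x (hXJ hx)]
    exact Or.inr (by simpa using hx)
  · left
    apply h.im_ne_zero
    rw [hfg y (Or.inl hi)]
    exact hi

end

section
variable {f : ℂ → ℂ} {S : Set ℂ} {R₀ : ℝ}

theorem sphericalDist_le (z w : ℂ) : sphericalDist z w ≤ 2 * dist z w := by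
  unfold sphericalDist
  apply div_le_self (by positivity)
  have h1 : ∀ z : ℂ, 1 ≤ √(1 + ‖z‖ ^ 2) := fun z => Real.one_le_sqrt.2 (by nlinarith [sq_nonneg ‖z‖])
  nlinarith [h1 z, h1 w]

theorem norm_add_mul_I_sq {σ : ℝ} (hσ : σ ^ 2 = 1) (w : ℂ) :
    ‖w + σ * Complex.I‖ ^ 2 = ‖w‖ ^ 2 + 1 + 2 * (σ * w.im) := by
  rw [← Complex.normSq_eq_norm_sq, ← Complex.normSq_eq_norm_sq, Complex.normSq_apply,
    Complex.normSq_apply]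
  simp
  nlinarith

theorem add_mul_I_ne_zero {σ : ℝ} (hσ : σ ^ 2 = 1) {w : ℂ} (hw : 0 < σ * w.im) :
    w + σ * Complex.I ≠ 0 := by
  rw [← norm_pos_iff]
  have := norm_add_mul_I_sq hσ w
  nlinarith [norm_nonneg (w + σ * Complex.I), sq_nonneg ‖w‖]

theorem norm_moebius_le {σ : ℝ} (hσ : σ ^ 2 = 1) {w : ℂ} (hw : 0 < σ * w.im) :
    ‖(w - σ * Complex.I) / (w + σ * Complex.I)‖ ≤ 1 := by
  rw [norm_div, div_le_one (norm_pos_iff.2 (add_mul_I_ne_zero hσ hw))]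
  apply le_of_sq_le_sq _ (norm_nonneg _)
  have h1 := norm_add_mul_I_sq hσ w
  have h2 := norm_add_mul_I_sq (σ := -σ) (by rw [neg_sq, hσ]) w
  push_cast at h2
  rw [neg_mul, ← sub_eq_add_neg] at h2
  rw [h1, h2]
  linarith

theorem sphericalDist_le_moebius {σ : ℝ} (hσ : σ ^ 2 = 1) {z w : ℂ} (hz : 0 < σ * z.im)
    (hw : 0 < σ * w.im) :
    sphericalDist z w ≤ 2 * ‖(z - σ * Complex.I) / (z + σ * Complex.I) -
      (w - σ * Complex.I) / (w + σ * Complex.I)‖ := by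
  have hz0 := add_mul_I_ne_zero hσ hz
  have hw0 := add_mul_I_ne_zero hσ hw
  have e : (z - σ * Complex.I) / (z + σ * Complex.I) - (w - σ * Complex.I) / (w + σ * Complex.I)
      = 2 * (σ * Complex.I) * (z - w) / ((z + σ * Complex.I) * (w + σ * Complex.I)) := by
    field_simp
    ring
  have hsn : ‖(σ : ℂ)‖ = 1 := by
    rw [Complex.norm_real, Real.norm_eq_abs, ← sq_eq_sq₀ (abs_nonneg _) zero_le_one, sq_abs, hσ]
    norm_num
  have hb : ∀ z : ℂ, ‖z + σ * Complex.I‖ ≤ √2 * √(1 + ‖z‖ ^ 2) := by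
    intro z
    have h1 : ‖z + σ * Complex.I‖ ≤ ‖z‖ + 1 := (norm_add_le _ _).trans (by rw [norm_mul, hsn, Complex.norm_I, mul_one])
    rw [← Real.sqrt_mul (by norm_num)]
    apply Real.le_sqrt_of_sq_le
    nlinarith [sq_nonneg (‖z‖ - 1), norm_nonneg (z + σ * Complex.I), norm_nonneg z]
  rw [e, norm_div, norm_mul, norm_mul, norm_mul, norm_mul, hsn, Complex.norm_I]
  unfold sphericalDist
  rw [dist_eq_norm, mul_div_assoc, mul_div_assoc]
  have hs2 : √2 * √2 = 2 := Real.mul_self_sqrt (by norm_num)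
  have h1 : 0 < ‖z + σ * Complex.I‖ := norm_pos_iff.2 hz0
  have h2 : 0 < ‖w + σ * Complex.I‖ := norm_pos_iff.2 hw0
  have h3 : 0 < √(1 + ‖z‖ ^ 2) := Real.sqrt_pos.2 (by positivity)
  have h4 : 0 < √(1 + ‖w‖ ^ 2) := Real.sqrt_pos.2 (by positivity)
  have h5 : ‖z + σ * Complex.I‖ * ‖w + σ * Complex.I‖ ≤ 2 * (√(1 + ‖z‖ ^ 2) * √(1 + ‖w‖ ^ 2)) := by
    calc _ ≤ (√2 * √(1 + ‖z‖ ^ 2)) * (√2 * √(1 + ‖w‖ ^ 2)) :=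
          mul_le_mul (hb z) (hb w) h2.le (by positivity)
      _ = (√2 * √2) * (√(1 + ‖z‖ ^ 2) * √(1 + ‖w‖ ^ 2)) := by ring
      _ = _ := by rw [hs2]
  simp only [Complex.norm_ofNat, mul_one]
  gcongr 2 * ?_
  rw [div_le_iff₀ (mul_pos h3 h4)]
  rw [mul_assoc, div_mul_eq_mul_div, mul_div_assoc', le_div_iff₀ (mul_pos h1 h2)]
  nlinarith [mul_le_mul_of_nonneg_left h5 (norm_nonneg (z - w))]

theorem mem_fatou_of_lipschitz {N : Set ℂ} (hN : IsOpen N)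
    (h : ∀ x ∈ N, ∃ ρ > (0 : ℝ), ∃ C : ℝ, ∀ y ∈ ball x ρ, ∀ n : ℕ,
      sphericalDist (f^[n] y) (f^[n] x) ≤ C * dist y x) : N ⊆ FatouSet f := by
  intro z hz
  refine ⟨N, hN, hz, fun x hx ε hε => ?_⟩
  obtain ⟨ρ, hρ, C, hC⟩ := h x hx
  refine ⟨min ρ (ε / (|C| + 1)), lt_min hρ (by positivity), fun y _ hy n => ?_⟩
  refine (hC y (hy.trans_le (min_le_left _ _)) n).trans_lt ?_
  have h1 : dist y x < ε / (|C| + 1) := hy.trans_le (min_le_right _ _)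
  rw [lt_div_iff₀ (by positivity)] at h1
  nlinarith [le_abs_self C, dist_nonneg (x := y) (y := x)]

theorem norm_sub_le_of_bdd {φ : ℂ → ℂ} {x : ℂ} {ρ M : ℝ} (hd : DifferentiableOn ℂ φ (ball x ρ))
    (hM : ∀ z ∈ ball x ρ, ‖φ z‖ ≤ M) (hρ : 0 < ρ) {y : ℂ} (hy : y ∈ ball x (ρ / 2)) :
    ‖φ y - φ x‖ ≤ 2 * M / ρ * dist y x := by
  have hsub : ball x (ρ / 2) ⊆ ball x ρ := ball_subset_ball (by linarith)
  rw [dist_eq_norm]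
  refine (convex_ball x (ρ / 2)).norm_image_sub_le_of_norm_deriv_le
    (fun z hz => hd.differentiableAt (isOpen_ball.mem_nhds (hsub hz))) (fun z hz => ?_)
    (mem_ball_self (by linarith)) hy
  have hz2 : ball z (ρ / 2) ⊆ ball x ρ := by
    apply ball_subset_ball'
    have : dist z x < ρ / 2 := hz
    linarith
  have := norm_deriv_le_of_forall_ball (half_pos hρ) (hd.mono hz2) (fun w hw => hM w (hz2 hw))
  rw [le_div_iff₀ hρ]
  linarith

theorem RealB.subset_fatou_of_bdd (h : RealB f S R₀) {N : Set ℂ} (hN : IsOpen N) {M : ℝ}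
    (hM : ∀ z ∈ N, ∀ n : ℕ, ‖f^[n] z‖ ≤ M) : N ⊆ FatouSet f := by
  refine mem_fatou_of_lipschitz hN fun x hx => ?_
  obtain ⟨ρ, hρ, hb⟩ := Metric.isOpen_iff.1 hN x hx
  refine ⟨ρ / 2, half_pos hρ, 2 * (2 * M / ρ), fun y hy n => ?_⟩
  refine (sphericalDist_le _ _).trans ?_
  rw [dist_eq_norm, mul_assoc]
  gcongr
  exact norm_sub_le_of_bdd ((h.differentiable_iterate n).differentiableOn)
    (fun z hz => hM z (hb hz) n) hρ hy

theorem RealB.one_side (h : RealB f S R₀) {N : Set ℂ} (hN : IsPreconnected N) {n : ℕ}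
    (hI : ∀ z ∈ N, (f^[n] z).im ≠ 0) {x : ℂ} (hx : x ∈ N) {σ : ℝ}
    (hσ : 0 < σ * (f^[n] x).im) : ∀ y ∈ N, 0 < σ * (f^[n] y).im := by
  intro y hy
  have hc : ContinuousOn (fun z => σ * (f^[n] z).im) N :=
    (continuous_const.mul (Complex.continuous_im.comp
      (h.differentiable_iterate n).continuous)).continuousOn
  by_contra hneg
  obtain ⟨z, hz, hz0⟩ := hN.intermediate_value hy hx hc ⟨not_lt.1 hneg, hσ.le⟩
  have hσ0 : σ ≠ 0 := by rintro rfl; simp at hσ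
  exact hI z hz ((mul_eq_zero.1 hz0).resolve_left hσ0)

theorem RealB.subset_fatou_of_nonreal (h : RealB f S R₀) {N : Set ℂ} (hN : IsOpen N)
    (hI : ∀ z ∈ N, ∀ n : ℕ, (f^[n] z).im ≠ 0) : N ⊆ FatouSet f := by
  refine mem_fatou_of_lipschitz hN fun x hx => ?_
  obtain ⟨ρ, hρ, hb⟩ := Metric.isOpen_iff.1 hN x hx
  refine ⟨ρ / 2, half_pos hρ, 2 * (2 * 1 / ρ), fun y hy n => ?_⟩
  obtain ⟨σ, hσ, hσx⟩ := exists_side (hI x hx n)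
  have hside := h.one_side (convex_ball x ρ).isPreconnected (fun z hz => hI z (hb hz) n)
    (mem_ball_self hρ) hσx
  have hyb : y ∈ ball x ρ := ball_subset_ball (by linarith) hy
  refine (sphericalDist_le_moebius hσ (hside y hyb) hσx).trans ?_
  rw [mul_assoc]
  gcongr
  refine norm_sub_le_of_bdd (φ := fun z => (f^[n] z - σ * Complex.I) / (f^[n] z + σ * Complex.I))
    (M := 1) ?_ (fun z hz => norm_moebius_le hσ (hside z hz)) hρ hy
  exact (((h.differentiable_iterate n).sub_const _).differentiableOn).div
    (((h.differentiable_iterate n).add_const _).differentiableOn)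
    (fun z hz => add_mul_I_ne_zero hσ (hside z hz))

theorem isOpen_fatouSet : IsOpen (FatouSet f) := by
  rw [isOpen_iff_mem_nhds]
  rintro z ⟨N, hN, hz, H⟩
  exact mem_of_superset (hN.mem_nhds hz) fun y hy => ⟨N, hN, hy, H⟩

theorem RealB.mem_fatou_of_apply (h : RealB f S R₀) {z : ℂ} (hz : f z ∈ FatouSet f) :
    z ∈ FatouSet f := by
  obtain ⟨N, hN, hzN, H⟩ := hz
  refine ⟨f ⁻¹' N, hN.preimage h.diff.continuous, hzN, fun x hx ε hε => ?_⟩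
  obtain ⟨δ, hδ, hH⟩ := H (f x) hx ε hε
  obtain ⟨δ', hδ', hc⟩ := Metric.continuous_iff.1 h.diff.continuous x δ hδ
  refine ⟨min δ' (ε / 2), lt_min hδ' (half_pos hε), fun y hy hyx n => ?_⟩
  cases n with
  | zero =>
    have := sphericalDist_le y x
    have h2 : dist y x < ε / 2 := hyx.trans_le (min_le_right _ _)
    simp only [Function.iterate_zero, id]
    linarith
  | succ n =>
    rw [Function.iterate_succ_apply, Function.iterate_succ_apply]
    exact hH (f y) hy (hc y (hyx.trans_le (min_le_left _ _))) n

theorem RealB.isOpenMap (h : RealB f S R₀) : IsOpenMap f := by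
  have hA : AnalyticOnNhd ℂ f univ := fun z _ => h.diff.analyticAt z
  rcases hA.is_constant_or_isOpen isPreconnected_univ with ⟨w, hw⟩ | ho
  · exact absurd ⟨Polynomial.C w, fun z => by simpa using hw z (mem_univ z)⟩ h.npoly
  · exact fun s hs => ho s (subset_univ s) hs

theorem RealB.isOpenMap_iterate (h : RealB f S R₀) (n : ℕ) : IsOpenMap f^[n] := by
  induction n with
  | zero => exact IsOpenMap.id
  | succ n ih => rw [Function.iterate_succ]; exact ih.comp h.isOpenMap

theorem RealB.apply_mem_fatou (h : RealB f S R₀) {z : ℂ} (hz : z ∈ FatouSet f) :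
    f z ∈ FatouSet f := by
  obtain ⟨N, hN, hzN, H⟩ := hz
  refine ⟨f '' N, h.isOpenMap N hN, ⟨z, hzN, rfl⟩, ?_⟩
  rintro _ ⟨x, hx, rfl⟩ ε hε
  obtain ⟨δ, hδ, hH⟩ := H x hx ε hε
  have hO : IsOpen (f '' (N ∩ ball x δ)) := h.isOpenMap _ (hN.inter isOpen_ball)
  obtain ⟨δ', hδ', hb⟩ := Metric.isOpen_iff.1 hO (f x) ⟨x, ⟨hx, mem_ball_self hδ⟩, rfl⟩
  refine ⟨δ', hδ', fun y _ hy n => ?_⟩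
  obtain ⟨u, ⟨huN, hu⟩, rfl⟩ := hb hy
  have := hH u huN hu (n + 1)
  rwa [Function.iterate_succ_apply, Function.iterate_succ_apply] at this

theorem RealB.iterate_mem_fatou (h : RealB f S R₀) {z : ℂ} (n : ℕ) :
    f^[n] z ∈ FatouSet f ↔ z ∈ FatouSet f := by
  induction n generalizing z with
  | zero => rfl
  | succ n ih =>
    rw [Function.iterate_succ_apply, ih]
    exact ⟨h.mem_fatou_of_apply, h.apply_mem_fatou⟩

theorem RealB.conj_mem_fatou (h : RealB f S R₀) {z : ℂ} (hz : z ∈ FatouSet f) :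
    (starRingEnd ℂ) z ∈ FatouSet f := by
  obtain ⟨N, hN, hzN, H⟩ := hz
  refine ⟨(starRingEnd ℂ) ⁻¹' N, hN.preimage Complex.continuous_conj,
    by simpa using hzN, fun x hx ε hε => ?_⟩
  obtain ⟨δ, hδ, hH⟩ := H _ hx ε hε
  refine ⟨δ, hδ, fun y hy hyx n => ?_⟩
  have := hH _ hy (by rwa [Complex.dist_conj_conj]) n
  rwa [h.conj_iterate, h.conj_iterate, sphericalDist, Complex.dist_conj_conj, Complex.norm_conj,
    Complex.norm_conj] at this

end

section
variable {f : ℂ → ℂ} {S : Set ℂ} {R₀ : ℝ}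

/-- The Fatou component of `z`. -/
abbrev comp (f : ℂ → ℂ) (z : ℂ) : Set ℂ := connectedComponentIn (FatouSet f) z

theorem isOpen_comp (z : ℂ) : IsOpen (comp f z) := isOpen_fatouSet.connectedComponentIn

theorem comp_subset (z : ℂ) : comp f z ⊆ FatouSet f := connectedComponentIn_subset _ _

theorem isPreconnected_comp (z : ℂ) : IsPreconnected (comp f z) := isPreconnected_connectedComponentIn

theorem mem_comp {z : ℂ} (hz : z ∈ FatouSet f) : z ∈ comp f z := mem_connectedComponentIn hz

theorem comp_eq {z w : ℂ} (h : w ∈ comp f z) : comp f w = comp f z := (connectedComponentIn_eq h).symm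

theorem subset_comp {A : Set ℂ} (hA : IsPreconnected A) (hAF : A ⊆ FatouSet f) {w z : ℂ}
    (hw : w ∈ A) (hwz : w ∈ comp f z) : A ⊆ comp f z := by
  rw [← comp_eq hwz]
  exact hA.subset_connectedComponentIn hw hAF

theorem RealB.image_comp (h : RealB f S R₀) (n : ℕ) {z : ℂ} (hz : z ∈ FatouSet f) :
    f^[n] '' comp f z ⊆ comp f (f^[n] z) := by
  refine subset_comp ((isPreconnected_comp z).image _ (h.differentiable_iterate n).continuous.continuousOn)
    ?_ ⟨z, mem_comp hz, rfl⟩ (mem_comp ((h.iterate_mem_fatou n).2 hz))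
  rintro _ ⟨w, hw, rfl⟩
  exact (h.iterate_mem_fatou n).2 (comp_subset _ hw)

theorem RealB.conj_mem_comp (h : RealB f S R₀) {z w : ℂ} (hw : w ∈ comp f z) :
    (starRingEnd ℂ) w ∈ comp f ((starRingEnd ℂ) z) := by
  have hz : z ∈ FatouSet f := by
    by_contra hz
    rw [comp, connectedComponentIn_eq_empty hz] at hw
    exact hw
  refine subset_comp (A := (starRingEnd ℂ) '' comp f z)
    ((isPreconnected_comp z).image _ Complex.continuous_conj.continuousOn)
    ?_ ⟨z, mem_comp hz, rfl⟩ (mem_comp (h.conj_mem_fatou hz)) ⟨w, hw, rfl⟩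
  rintro _ ⟨w, hw, rfl⟩
  exact h.conj_mem_fatou (comp_subset _ hw)

/-- Inverse branches of iterates on half planes. -/
theorem RealB.exists_branch_iterate (h : RealB f S R₀) {σ : ℝ} (n : ℕ) {z₀ : ℂ}
    (hz₀ : 0 < σ * (f^[n] z₀).im) :
    ∃ G : ℂ → ℂ, DifferentiableOn ℂ G {z | 0 < σ * z.im} ∧
      (∀ z : ℂ, 0 < σ * z.im → f^[n] (G z) = z) ∧ G (f^[n] z₀) = z₀ := by
  induction n generalizing z₀ with
  | zero => exact ⟨id, differentiableOn_id, fun _ _ => rfl, rfl⟩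
  | succ n ih =>
    rw [Function.iterate_succ_apply] at hz₀ ⊢
    obtain ⟨G, hG, hfG, hG0⟩ := ih hz₀
    have hn0 : (f^[n] (f z₀)).im ≠ 0 := by rintro h0; rw [h0] at hz₀; simp at hz₀
    obtain ⟨τ, hτ, hτ0⟩ := exists_side (h.im_iterate_ne_zero hn0)
    obtain ⟨G', hG', hfG', hG'0⟩ := h.exists_branch hτ0
    have hmaps : MapsTo G {z | 0 < σ * z.im} {z | 0 < τ * z.im} := by
      have hside : ∀ w ∈ G '' {z | 0 < σ * z.im}, 0 < τ * w.im := by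
        refine h.one_side (n := 0) ((convex_halfplane σ).isPreconnected.image _ hG.continuousOn)
          ?_ ⟨_, hz₀, rfl⟩ (by rw [hG0]; exact hτ0)
        rintro _ ⟨z, hz, rfl⟩
        apply h.im_iterate_ne_zero (n := n)
        rw [show f^[0] (G z) = G z from rfl, hfG z hz]
        rintro h0
        have : 0 < σ * z.im := hz
        rw [h0] at this
        simp at this
      exact fun z hz => hside _ ⟨z, hz, rfl⟩
    refine ⟨G' ∘ G, hG'.comp hG hmaps, fun z hz => ?_, ?_⟩
    · rw [Function.iterate_succ_apply, Function.comp, hfG' _ (hmaps hz), hfG z hz]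
    · rw [Function.comp, hG0, hG'0]

theorem half_connected {Y A : Set ℂ} (hYo : IsOpen Y) (hYc : IsPreconnected Y) {σ : ℝ}
    (hσ : σ ^ 2 = 1)
    (hsym : (∀ z ∈ Y, z.im ≠ 0) ∨ ∀ z ∈ Y, (starRingEnd ℂ) z ∈ Y)
    (hA : ∀ x r, ball x r ⊆ Y → (∃ z ∈ ball x r, 0 < σ * z.im ∧ z ∈ A) →
      ∀ z ∈ ball x r, 0 < σ * z.im → z ∈ A)
    {x y : ℂ} (hx : x ∈ Y) (hy : y ∈ Y) (hxσ : 0 < σ * x.im) (hyσ : 0 < σ * y.im) (hxA : x ∈ A) :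
    y ∈ A := by
  set T := Y ∩ {z : ℂ | 0 ≤ σ * z.im} with hT
  have hTc : IsPreconnected T := by
    rcases hsym with hs | hs
    · have : T = Y := by
        refine inter_eq_left.2 fun z hz => ?_
        by_contra hneg
        have hneg' : σ * z.im < 0 := not_le.1 hneg
        obtain ⟨w, hw, hw0⟩ := hYc.intermediate_value hz hx
          ((continuous_const.mul Complex.continuous_im).continuousOn (s := Y))
          ⟨hneg'.le, hxσ.le⟩
        have hσ0 : σ ≠ 0 := by rintro rfl; simp at hσ
        exact hs w hw ((mul_eq_zero.1 hw0).resolve_left hσ0)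
      rwa [this]
    · have : T = (fun z : ℂ => (z.re : ℂ) + (σ * |z.im| : ℝ) * Complex.I) '' Y := by
        ext z
        constructor
        · rintro ⟨hz, hz0⟩
          refine ⟨z, hz, ?_⟩
          have hz0' : 0 ≤ σ * z.im := hz0
          have : σ * |z.im| = z.im := by
            rcases sq_eq_one_iff.1 hσ with h1 | h1 <;> rw [h1] at hz0' ⊢
            · rw [abs_of_nonneg (by linarith)]; ring
            · rw [abs_of_nonpos (by linarith)]; ring
          simp only [this]
          exact Complex.re_add_im z
        · rintro ⟨w, hw, rfl⟩
          constructor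
          · rcases le_total 0 (σ * w.im) with h0 | h0
            · have : σ * |w.im| = w.im := by
                rcases sq_eq_one_iff.1 hσ with h1 | h1 <;> rw [h1] at h0 ⊢
                · rw [abs_of_nonneg (by linarith)]; ring
                · rw [abs_of_nonpos (by linarith)]; ring
              simp only [this]
              rwa [Complex.re_add_im]
            · have : σ * |w.im| = -w.im := by
                rcases sq_eq_one_iff.1 hσ with h1 | h1 <;> rw [h1] at h0 ⊢
                · rw [abs_of_nonpos (by linarith)]; ring
                · rw [abs_of_nonneg (by linarith)]; ring
              simp only [this]
              have h2 := hs w hw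
              rwa [show (starRingEnd ℂ) w = (w.re : ℂ) + (-w.im : ℝ) * Complex.I from
                Complex.ext (by simp) (by simp)] at h2
          · show 0 ≤ σ * _
            simp
            nlinarith [abs_nonneg w.im]
      rw [this]
      apply hYc.image
      apply Continuous.continuousOn
      have := Complex.continuous_im
      have := Complex.continuous_re
      fun_prop
  have key := hTc.induction₂
    (fun x y => y ∈ T → ((∀ᶠ z in 𝓝 x, 0 < σ * z.im → z ∈ A) ↔ ∀ᶠ z in 𝓝 y, 0 < σ * z.im → z ∈ A))
    (fun x hx => ?_) (fun x y z hx hy hz h1 h2 hz' => (h1 hy).trans (h2 hz'))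
    (fun x y hx hy h1 hx' => (h1 hy).symm) ⟨hx, hxσ.le⟩ ⟨hy, hyσ.le⟩ ⟨hy, hyσ.le⟩
  · have hev : ∀ᶠ z in 𝓝 x, 0 < σ * z.im → z ∈ A := by
      obtain ⟨r, hr, hb⟩ := Metric.isOpen_iff.1 hYo x hx
      filter_upwards [ball_mem_nhds x hr] with z hz
      exact hA x r hb ⟨x, mem_ball_self hr, hxσ, hxA⟩ z hz
    exact (key.1 hev).self_of_nhds hyσ
  · obtain ⟨r, hr, hb⟩ := Metric.isOpen_iff.1 hYo x hx.1
    have hball : ∀ y ∈ ball x r ∩ {z : ℂ | 0 ≤ σ * z.im},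
        ((∀ᶠ z in 𝓝 y, 0 < σ * z.im → z ∈ A) ↔ ∀ z ∈ ball x r, 0 < σ * z.im → z ∈ A) := by
      rintro y ⟨hy, hy0⟩
      constructor
      · intro hev
        have hy0' : 0 ≤ σ * y.im := hy0
        have hfr : ∃ᶠ z in 𝓝 y, 0 < σ * z.im := by
          have h1 : Tendsto (fun t : ℝ => y + (t : ℂ) * (σ * Complex.I)) (𝓝[>] 0) (𝓝 y) := by
            have : Continuous (fun t : ℝ => y + (t : ℂ) * (σ * Complex.I)) := by fun_prop
            exact (this.tendsto' 0 y (by simp)).mono_left nhdsWithin_le_nhds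
          refine h1.frequently (Eventually.frequently ?_)
          filter_upwards [self_mem_nhdsWithin] with t ht
          have ht' : (0 : ℝ) < t := ht
          simp
          nlinarith
        obtain ⟨z, hz1, hz2, hz3⟩ := (hfr.and_eventually
          (hev.and (isOpen_ball.mem_nhds hy))).exists
        exact hA x r hb ⟨z, hz3, hz1, hz2 hz1⟩
      · intro hall
        filter_upwards [isOpen_ball.mem_nhds hy] with z hz using hall z hz
    have hnb : ∀ᶠ y in 𝓝[T] x, y ∈ ball x r := nhdsWithin_le_nhds (ball_mem_nhds x hr)
    filter_upwards [hnb] with y hy hyT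
    exact (hball x ⟨mem_ball_self hr, hx.2⟩).trans (hball y ⟨hy, hyT.2⟩).symm

/-- A point whose forward images lie in pairwise distinct Fatou components. -/
def Wand (f : ℂ → ℂ) (z : ℂ) : Prop :=
  z ∈ FatouSet f ∧ ∀ m n : ℕ, m ≠ n → f^[n] z ∉ comp f (f^[m] z)

theorem RealB.wand_of_isWanderingDomain (h : RealB f S R₀) {W : Set ℂ}
    (hW : IsWanderingDomain f W) : ∃ z, Wand f z := by
  obtain ⟨⟨z, hz, hWz⟩, hdisj⟩ := hW
  have hWo : IsOpen W := by rw [hWz]; exact isOpen_comp z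
  have key : ∀ m k : ℕ, k ≠ 0 → f^[m + k] z ∉ comp f (f^[m] z) := by
    intro m k hk hmem
    set Y := comp f (f^[m] z) with hY
    have hYk : f^[k] '' Y ⊆ Y := by
      have h1 := h.image_comp k ((h.iterate_mem_fatou m).2 hz)
      rw [← Function.iterate_add_apply, add_comm, comp_eq hmem] at h1
      exact h1
    have hAi : ∀ i : ℕ, f^[m + i * k] '' W ⊆ Y := by
      intro i
      induction i with
      | zero => rw [hWz, zero_mul, add_zero]; exact h.image_comp m hz
      | succ i ih =>
        rintro _ ⟨w, hw, rfl⟩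
        have := hYk ⟨_, ih ⟨w, hw, rfl⟩, rfl⟩
        rwa [← Function.iterate_add_apply,
          show k + (m + i * k) = m + (i + 1) * k by ring] at this
    have hball : ∀ (j : ℕ) (σ : ℝ) x r, ball x r ⊆ Y →
        (∃ w ∈ ball x r, 0 < σ * w.im ∧ w ∈ f^[j] '' W) →
        ∀ w ∈ ball x r, 0 < σ * w.im → w ∈ f^[j] '' W := by
      rintro j σ x r hb ⟨_, hub, huσ, ⟨u, huW, rfl⟩⟩ w hw hwσ
      obtain ⟨G, hG, hfG, hG0⟩ := h.exists_branch_iterate j huσ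
      have hconn : IsPreconnected (G '' (ball x r ∩ {z : ℂ | 0 < σ * z.im})) :=
        ((convex_ball x r).inter (convex_halfplane σ)).isPreconnected.image _
          (hG.continuousOn.mono inter_subset_right)
      have hsub : G '' (ball x r ∩ {z : ℂ | 0 < σ * z.im}) ⊆ W := by
        rw [hWz]
        refine subset_comp hconn ?_ ⟨_, ⟨hub, huσ⟩, hG0⟩ (by rw [hWz] at huW; exact huW)
        rintro _ ⟨v, ⟨hv, hvσ⟩, rfl⟩
        rw [← h.iterate_mem_fatou j, hfG v hvσ]
        exact comp_subset _ (hb hv)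
      exact ⟨G w, hsub ⟨w, ⟨hw, hwσ⟩, rfl⟩, hfG w hwσ⟩
    have hsym : (∀ z ∈ Y, z.im ≠ 0) ∨ ∀ z ∈ Y, (starRingEnd ℂ) z ∈ Y := by
      by_cases hr : ∀ z ∈ Y, z.im ≠ 0
      · exact Or.inl hr
      · right
        push Not at hr
        obtain ⟨p, hp, hp0⟩ := hr
        intro w hw
        have h1 : w ∈ comp f p := by rw [comp_eq hp]; exact hw
        have h2 := h.conj_mem_comp h1
        rwa [Complex.conj_eq_iff_im.2 hp0, comp_eq hp] at h2
    have hside : ∀ i : ℕ, ∃ σ : ℝ, σ ^ 2 = 1 ∧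
        ∃ w ∈ f^[m + i * k] '' W, 0 < σ * w.im := by
      intro i
      have hO : IsOpen (f^[m + i * k] '' W) := h.isOpenMap_iterate _ _ hWo
      have hmem : f^[m + i * k] z ∈ f^[m + i * k] '' W := ⟨z, by rw [hWz]; exact mem_comp hz, rfl⟩
      by_cases h0 : (f^[m + i * k] z).im = 0
      · obtain ⟨w, hw1, hw2⟩ := ((frequently_side (σ := 1) (by norm_num) h0).and_eventually
          (hO.mem_nhds hmem)).exists
        exact ⟨1, by norm_num, w, hw2, hw1⟩
      · obtain ⟨σ, hσ, hσ0⟩ := exists_side h0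
        exact ⟨σ, hσ, _, hmem, hσ0⟩
    choose s hs w hw hws using hside
    have hne : ∀ i j : ℕ, i ≠ j → s i ≠ s j := by
      intro i j hij hsij
      have h1 : w j ∈ f^[m + i * k] '' W :=
        half_connected (isOpen_comp _) (isPreconnected_comp _) (hs i) hsym (hball _ (s i))
          (hAi i (hw i)) (hAi j (hw j)) (hws i) (by rw [hsij]; exact hws j) (hw i)
      have h2 := hdisj (m + i * k) (m + j * k) (by simpa [hk] using hij)
      exact (h2.subset ⟨h1, hw j⟩ : w j ∈ (∅ : Set ℂ))
    have h01 := hne 0 1 (by norm_num)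
    have h02 := hne 0 2 (by norm_num)
    have h12 := hne 1 2 (by norm_num)
    rcases sq_eq_one_iff.1 (hs 0) with a | a <;> rcases sq_eq_one_iff.1 (hs 1) with b | b <;>
      rcases sq_eq_one_iff.1 (hs 2) with c | c <;> simp_all
  refine ⟨z, hz, fun m n hmn hmem => ?_⟩
  rcases hmn.lt_or_gt with hlt | hlt
  · obtain ⟨k, rfl⟩ := Nat.exists_eq_add_of_lt hlt
    exact key m (k + 1) (by omega) hmem
  · obtain ⟨k, rfl⟩ := Nat.exists_eq_add_of_lt hlt
    refine key n (k + 1) (by omega) ?_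
    rw [← add_assoc, comp_eq hmem]
    exact mem_comp ((h.iterate_mem_fatou _).2 hz)

theorem RealB.wand_iterate (h : RealB f S R₀) {z : ℂ} (hz : Wand f z) (k : ℕ) :
    Wand f (f^[k] z) := by
  refine ⟨(h.iterate_mem_fatou k).2 hz.1, fun m n hmn => ?_⟩
  rw [← Function.iterate_add_apply, ← Function.iterate_add_apply]
  exact hz.2 _ _ (by omega)

theorem RealB.wand_of_mem_comp (h : RealB f S R₀) {z w : ℂ} (hz : Wand f z) (hw : w ∈ comp f z) :
    Wand f w := by
  have key : ∀ n, f^[n] w ∈ comp f (f^[n] z) := fun n => h.image_comp n hz.1 ⟨w, hw, rfl⟩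
  refine ⟨comp_subset _ hw, fun m n hmn hmem => hz.2 m n hmn ?_⟩
  rw [comp_eq (key m)] at hmem
  rw [← comp_eq hmem, comp_eq (key n)]
  exact mem_comp ((h.iterate_mem_fatou _).2 hz.1)

theorem RealB.conj_not_mem_comp (h : RealB f S R₀) {z : ℂ} (hz : Wand f z) {m n : ℕ}
    (hmn : m ≠ n) : (starRingEnd ℂ) (f^[n] z) ∉ comp f (f^[m] z) := by
  have key : ∀ m k : ℕ, k ≠ 0 → (starRingEnd ℂ) (f^[m + k] z) ∉ comp f (f^[m] z) := by
    intro m k hk hmem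
    have h1 := h.image_comp k ((h.iterate_mem_fatou m).2 hz.1) ⟨_, hmem, rfl⟩
    rw [h.conj_iterate, ← Function.iterate_add_apply, ← Function.iterate_add_apply] at h1
    have h2 := h.conj_mem_comp h1
    rw [Complex.conj_conj, add_comm k m, comp_eq hmem, ← add_assoc, add_comm k m] at h2
    exact hz.2 m _ (by omega) h2
  intro hmem
  rcases hmn.lt_or_gt with hlt | hlt
  · obtain ⟨k, rfl⟩ := Nat.exists_eq_add_of_lt hlt
    exact key m (k + 1) (by omega) hmem
  · obtain ⟨k, rfl⟩ := Nat.exists_eq_add_of_lt hlt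
    refine key n (k + 1) (by omega) ?_
    rw [← add_assoc]
    have h1 : f^[n + k + 1] z ∈ comp f ((starRingEnd ℂ) (f^[n] z)) := by
      rw [comp_eq hmem]; exact mem_comp ((h.iterate_mem_fatou _).2 hz.1)
    have h2 := h.conj_mem_comp h1
    rwa [Complex.conj_conj] at h2

/-- A connected subset of the Fatou set contains at most one point of the orbit. -/
theorem wand_eq {z : ℂ} (hz : Wand f z) {D : Set ℂ}
    (hD : IsPreconnected D) (hDF : D ⊆ FatouSet f) {m n : ℕ} (hm : f^[m] z ∈ D)
    (hn : f^[n] z ∈ D) : m = n := by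
  by_contra hmn
  exact hz.2 m n hmn (subset_comp hD hDF hm (mem_comp (hDF hm)) hn)

theorem RealB.wand_conj_ne (h : RealB f S R₀) {z : ℂ} (hz : Wand f z) {D : Set ℂ}
    (hD : IsPreconnected D) (hDF : D ⊆ FatouSet f) {m n : ℕ} (hm : f^[m] z ∈ D)
    (hn : (starRingEnd ℂ) (f^[n] z) ∈ D) : m = n := by
  by_contra hmn
  exact h.conj_not_mem_comp hz hmn (subset_comp hD hDF hm (mem_comp (hDF hm)) hn)

end

section
variable {f : ℂ → ℂ} {S : Set ℂ} {R₀ : ℝ} {z₀ : ℂ} {δ : ℝ}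

/-- A wandering orbit with a neighbourhood whose forward images avoid the real line. -/
structure Orb (f : ℂ → ℂ) (z₀ : ℂ) (δ : ℝ) : Prop where
  wand : Wand f z₀
  pos : 0 < δ
  nonreal : ∀ z ∈ ball z₀ δ, ∀ n : ℕ, (f^[n] z).im ≠ 0

theorem Orb.im_ne_zero (o : Orb f z₀ δ) (n : ℕ) : (f^[n] z₀).im ≠ 0 :=
  o.nonreal z₀ (mem_ball_self o.pos) n

theorem Orb.abs_im_pos (o : Orb f z₀ δ) (n : ℕ) : 0 < |(f^[n] z₀).im| :=
  abs_pos.2 (o.im_ne_zero n)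

theorem abs_eq_side {σ x : ℝ} (hσ : σ ^ 2 = 1) (hx : 0 < σ * x) : |x| = σ * x := by
  rcases sq_eq_one_iff.1 hσ with h | h
  · rw [h] at hx ⊢; rw [one_mul] at *; exact abs_of_pos hx
  · rw [h] at hx ⊢; rw [abs_of_neg (by linarith)]; ring

theorem RealB.branch_facts (h : RealB f S R₀) {w : ℂ} {k : ℕ} (hw : (f^[k] w).im ≠ 0) :
    ∃ (σ τ : ℝ) (G : ℂ → ℂ), σ ^ 2 = 1 ∧ τ ^ 2 = 1 ∧ 0 < σ * (f^[k] w).im ∧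
      DifferentiableOn ℂ G {z | 0 < σ * z.im} ∧ (∀ z : ℂ, 0 < σ * z.im → f^[k] (G z) = z) ∧
      (∀ z : ℂ, 0 < σ * z.im → 0 < τ * (G z).im) ∧ G (f^[k] w) = w ∧
      ‖deriv f^[k] w‖ * ‖deriv G (f^[k] w)‖ = 1 := by
  obtain ⟨σ, hσ, hσw⟩ := exists_side hw
  obtain ⟨τ, hτ, hτw⟩ := exists_side (h.im_iterate_ne_zero hw)
  obtain ⟨G, hG, hfG, hGw⟩ := h.exists_branch_iterate k hσw
  refine ⟨σ, τ, G, hσ, hτ, hσw, hG, hfG, fun z hz => ?_, hGw, ?_⟩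
  · refine h.one_side (n := 0) (N := G '' {z | 0 < σ * z.im}) (x := w)
      ((convex_halfplane σ).isPreconnected.image _ hG.continuousOn) ?_ ⟨_, hσw, hGw⟩ hτw _
      ⟨z, hz, rfl⟩
    rintro _ ⟨u, hu, rfl⟩
    apply h.im_iterate_ne_zero (n := k)
    rw [show f^[0] (G u) = G u from rfl, hfG u hu]
    rintro h0
    have : 0 < σ * u.im := hu
    rw [h0] at this
    simp at this
  · have hmem := (isOpen_halfplane σ).mem_nhds (show f^[k] w ∈ {z : ℂ | 0 < σ * z.im} from hσw)
    have := deriv_ne_zero_of_right_inverse (f := f^[k]) (y := f^[k] w)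
      (h.differentiable_iterate k _) (hG.differentiableAt hmem)
      (by filter_upwards [hmem] with z hz using hfG z hz)
    rw [hGw] at this
    rw [← norm_mul, this, norm_one]

theorem RealB.deriv_iterate_add (h : RealB f S R₀) (k m : ℕ) (z : ℂ) :
    deriv f^[k + m] z = deriv f^[k] (f^[m] z) * deriv f^[m] z := by
  rw [Function.iterate_add]
  exact deriv_comp z (h.differentiable_iterate k _) (h.differentiable_iterate m _)

theorem Orb.norm_deriv_le (h : RealB f S R₀) (o : Orb f z₀ δ) (n : ℕ) :
    ‖deriv f^[n] z₀‖ * δ ≤ 2 * |(f^[n] z₀).im| := by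
  obtain ⟨σ, hσ, hσz⟩ := exists_side (o.im_ne_zero n)
  have hs := h.one_side (convex_ball z₀ δ).isPreconnected (fun z hz => o.nonreal z hz n)
    (mem_ball_self o.pos) hσz
  have hd : DifferentiableOn ℂ (fun z => -(σ : ℂ) * Complex.I * f^[n] z) (ball z₀ δ) :=
    ((h.differentiable_iterate n).const_mul _).differentiableOn
  have := rhp_deriv_le (ψ := fun z => -(σ : ℂ) * Complex.I * f^[n] z) o.pos hd
    (fun z hz => by rw [rot_re]; exact hs z hz)
  rw [deriv_const_mul _ (h.differentiable_iterate n _), rot_norm hσ, rot_re] at this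
  rwa [abs_eq_side hσ hσz]

/-- Along the orbit the inverse branches are asymptotically hyperbolic isometries. -/
theorem Orb.asymptotic_isometry (h : RealB f S R₀) (o : Orb f z₀ δ) {ε : ℝ} (hε : 0 < ε) :
    ∃ N : ℕ, ∀ m ≥ N, ∀ k : ℕ, (1 - ε) * |(f^[m] z₀).im| * ‖deriv f^[k] (f^[m] z₀)‖ ≤
      |(f^[m + k] z₀).im| := by
  set D : ℕ → ℝ := fun n => |(f^[n] z₀).im| / ‖deriv f^[n] z₀‖ with hD
  have hpos : ∀ m k, 0 < ‖deriv f^[k] (f^[m] z₀)‖ := by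
    intro m k
    obtain ⟨σ, τ, G, -, -, -, -, -, -, -, h1⟩ := h.branch_facts (w := f^[m] z₀) (k := k)
      (by rw [← Function.iterate_add_apply]; exact o.im_ne_zero _)
    exact (norm_nonneg _).lt_of_ne' (left_ne_zero_of_mul_eq_one h1)
  have hpos0 : ∀ k, 0 < ‖deriv f^[k] z₀‖ := fun k => hpos 0 k
  have hDlow : ∀ n, δ / 2 ≤ D n := by
    intro n
    have := o.norm_deriv_le h n
    rw [hD]
    simp only
    rw [le_div_iff₀ (hpos0 n)]
    linarith
  have hstep : ∀ m k, D (m + k) = |(f^[m + k] z₀).im| /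
      (‖deriv f^[k] (f^[m] z₀)‖ * ‖deriv f^[m] z₀‖) := by
    intro m k
    simp only [hD]
    rw [add_comm m k, h.deriv_iterate_add, norm_mul]
  have hanti : Antitone D := by
    refine antitone_nat_of_succ_le fun m => ?_
    rw [hstep]
    obtain ⟨σ, τ, G, hσ, hτ, hσw, hG, hfG, hm, hGw, h1⟩ := h.branch_facts (w := f^[m] z₀) (k := 1)
      (by rw [← Function.iterate_add_apply]; exact o.im_ne_zero _)
    have h2 := schwarz_pick_deriv_hp hσ hτ hG hm hσw
    rw [hGw, ← Function.iterate_add_apply, add_comm 1 m] at h2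
    rw [← Function.iterate_add_apply, add_comm 1 m] at h1
    simp only [hD]
    rw [div_le_div_iff₀ (mul_pos (hpos _ _) (hpos0 _)) (hpos0 _)]
    have h3 : |(f^[m + 1] z₀).im| ≤ |(f^[m] z₀).im| * ‖deriv f^[1] (f^[m] z₀)‖ := by
      have := mul_le_mul_of_nonneg_left h2 (norm_nonneg (deriv f^[1] (f^[m] z₀)))
      rw [← mul_assoc, h1, one_mul] at this
      linarith
    nlinarith [hpos0 m]
  have hbdd : BddBelow (range D) := ⟨δ / 2, by rintro _ ⟨n, rfl⟩; exact hDlow n⟩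
  have hlim := tendsto_atTop_ciInf hanti hbdd
  set I := ⨅ n, D n with hI
  have hI0 : 0 < I := lt_of_lt_of_le (half_pos o.pos) (le_ciInf hDlow)
  have hIle : ∀ n, I ≤ D n := fun n => ciInf_le hbdd n
  by_cases hε1 : 1 ≤ ε
  · refine ⟨0, fun m _ k => ?_⟩
    have := mul_nonneg (abs_nonneg (f^[m] z₀).im) (norm_nonneg (deriv f^[k] (f^[m] z₀)))
    nlinarith [abs_nonneg (f^[m + k] z₀).im]
  push Not at hε1
  have hev : ∀ᶠ n in atTop, D n < I / (1 - ε) := hlim.eventually_lt_const (by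
    rw [lt_div_iff₀ (by linarith)]; nlinarith)
  obtain ⟨N, hN⟩ := eventually_atTop.1 hev
  refine ⟨N, fun m hm k => ?_⟩
  have h1 := hN m hm
  rw [lt_div_iff₀ (by linarith)] at h1
  have h2 := h1.le.trans (hIle (m + k))
  rw [hstep] at h2
  simp only [hD] at h2
  rw [div_mul_eq_mul_div, div_le_div_iff₀ (hpos0 _) (mul_pos (hpos _ _) (hpos0 _))] at h2
  have h3 := hpos0 m
  have h4 : ((1 - ε) * |(f^[m] z₀).im| * ‖deriv f^[k] (f^[m] z₀)‖) * ‖deriv f^[m] z₀‖ ≤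
      |(f^[m + k] z₀).im| * ‖deriv f^[m] z₀‖ := by linarith
  exact le_of_mul_le_mul_right h4 h3

theorem Orb.deriv_iterate_le (h : RealB f S R₀) (o : Orb f z₀ δ) :
    ∃ N : ℕ, ∀ m ≥ N, ∀ k : ℕ, ‖deriv f^[k] (f^[m] z₀)‖ * |(f^[m] z₀).im| ≤
      2 * |(f^[m + k] z₀).im| := by
  obtain ⟨N, hN⟩ := o.asymptotic_isometry h (ε := 1 / 2) (by norm_num)
  exact ⟨N, fun m hm k => by linarith [hN m hm k]⟩

theorem Orb.pseudoball (h : RealB f S R₀) (o : Orb f z₀ δ) {r : ℝ} (hr : r < 1) :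
    ∃ N : ℕ, ∀ m ≥ N, ∀ w : ℂ, 0 < w.im * (f^[m] z₀).im →
      ‖w - f^[m] z₀‖ < r * ‖w - (starRingEnd ℂ) (f^[m] z₀)‖ → ∀ k, (f^[k] w).im ≠ 0 := by
  obtain ⟨ε, hε, H⟩ := image_superset_hp hr
  obtain ⟨N, hN⟩ := o.asymptotic_isometry h hε
  refine ⟨N, fun m hm w hw hwr k => ?_⟩
  obtain ⟨σ, τ, G, hσ, hτ, hσw, hG, hfG, hmG, hGw, h1⟩ := h.branch_facts (w := f^[m] z₀) (k := k)
      (by rw [← Function.iterate_add_apply]; exact o.im_ne_zero _)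
  have hτw : 0 < τ * (f^[m] z₀).im := by have := hmG _ hσw; rwa [hGw] at this
  have hτ' : 0 < τ * w.im := by
    rcases sq_eq_one_iff.1 hτ with h0 | h0 <;> rw [h0] at hτw ⊢
    · have : 0 < (f^[m] z₀).im := by linarith
      rw [one_mul]; by_contra hh; push Not at hh; nlinarith
    · have : (f^[m] z₀).im < 0 := by linarith
      have : w.im < 0 := by by_contra hh; push Not at hh; nlinarith
      linarith
  obtain ⟨u, hu, hGu⟩ := H σ τ G hσ hτ hG hmG (f^[k] (f^[m] z₀)) hσw (by
    have h2 := hN m hm k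
    rw [hGw, ← Function.iterate_add_apply, add_comm k m]
    rw [← Function.iterate_add_apply, add_comm k m] at h1
    have h3 := mul_le_mul_of_nonneg_right h2 (norm_nonneg (deriv G (f^[m + k] z₀)))
    rw [mul_assoc _ ‖_‖ ‖_‖, h1, mul_one] at h3
    linarith) w hτ' (by rwa [hGw])
  rw [← hGu, hfG u hu]
  rintro h0
  rw [h0] at hu
  simp at hu

theorem Orb.box (h : RealB f S R₀) (o : Orb f z₀ δ) (C H : ℝ) {ε : ℝ} (hε : 0 < ε) :
    ∃ N : ℕ, ∀ m ≥ N, ∀ w : ℂ, |w.re - (f^[m] z₀).re| ≤ C * |(f^[m] z₀).im| →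
      ε * |(f^[m] z₀).im| ≤ |w.im| → |w.im| ≤ H * |(f^[m] z₀).im| → ∀ k, (f^[k] w).im ≠ 0 := by
  set q := 2 * ε / (C ^ 2 + (H + 1) ^ 2 + 2 * ε) with hq
  have hden : 0 < C ^ 2 + (H + 1) ^ 2 + 2 * ε := by positivity
  have hq0 : 0 < q := by positivity
  have hq1 : q ≤ 1 := by rw [hq, div_le_one hden]; nlinarith [sq_nonneg C, sq_nonneg (H + 1)]
  obtain ⟨N, hN⟩ := o.pseudoball h (r := √(1 - q)) (by
    rw [Real.sqrt_lt' one_pos]; linarith)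
  refine ⟨N, fun m hm => ?_⟩
  set z := f^[m] z₀ with hz
  have hspos : 0 < |z.im| := o.abs_im_pos m
  have main : ∀ w : ℂ, 0 < w.im * z.im → |w.re - z.re| ≤ C * |z.im| →
      ε * |z.im| ≤ |w.im| → |w.im| ≤ H * |z.im| → ∀ k, (f^[k] w).im ≠ 0 := by
    intro w hw h1 h2 h3
    apply hN m hm w hw
    have e1 : ‖w - z‖ ^ 2 = (w.re - z.re) ^ 2 + (|w.im| - |z.im|) ^ 2 := by
      rw [← Complex.normSq_eq_norm_sq, Complex.normSq_apply]
      have : |w.im| * |z.im| = w.im * z.im := by rw [← abs_mul, abs_of_pos hw]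
      simp only [Complex.sub_re, Complex.sub_im]
      nlinarith [sq_abs w.im, sq_abs z.im]
    have e2 : ‖w - (starRingEnd ℂ) z‖ ^ 2 = (w.re - z.re) ^ 2 + (|w.im| + |z.im|) ^ 2 := by
      rw [← Complex.normSq_eq_norm_sq, Complex.normSq_apply]
      have : |w.im| * |z.im| = w.im * z.im := by rw [← abs_mul, abs_of_pos hw]
      simp only [Complex.sub_re, Complex.sub_im, Complex.conj_re, Complex.conj_im]
      nlinarith [sq_abs w.im, sq_abs z.im]
    apply lt_of_pow_lt_pow_left₀ 2 (by positivity)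
    rw [mul_pow, Real.sq_sqrt (by linarith), e1, e2]
    have hx : (w.re - z.re) ^ 2 ≤ C ^ 2 * |z.im| ^ 2 := by
      rw [← mul_pow, ← sq_abs]; gcongr
    have hb : (w.re - z.re) ^ 2 + (|w.im| + |z.im|) ^ 2 ≤ (C ^ 2 + (H + 1) ^ 2 + 2 * ε) * |z.im| ^ 2 := by
      have : (|w.im| + |z.im|) ^ 2 ≤ ((H + 1) * |z.im|) ^ 2 := by
        gcongr; linarith
      nlinarith [sq_nonneg |z.im|]
    have hq2 : q * ((w.re - z.re) ^ 2 + (|w.im| + |z.im|) ^ 2) ≤ 2 * ε * |z.im| ^ 2 := by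
      calc _ ≤ q * ((C ^ 2 + (H + 1) ^ 2 + 2 * ε) * |z.im| ^ 2) := by gcongr
        _ = _ := by rw [hq]; field_simp
    nlinarith [mul_le_mul_of_nonneg_right h2 hspos.le, mul_pos hε (mul_pos hspos hspos)]
  intro w h1 h2 h3
  have hw0 : w.im ≠ 0 := by
    intro h0; rw [h0, abs_zero] at h2; nlinarith [mul_pos hε hspos]
  rcases (mul_ne_zero hw0 (o.im_ne_zero m)).lt_or_gt with hneg | hpos
  · intro k
    have := main ((starRingEnd ℂ) w) (by simp; exact hneg) (by simpa using h1) (by simpa using h2)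
      (by simpa using h3) k
    rw [h.conj_iterate, Complex.conj_im] at this
    exact fun h0 => this (by rw [h0, neg_zero])
  · exact main w hpos h1 h2 h3

theorem Orb.box_eq (h : RealB f S R₀) (o : Orb f z₀ δ) (C H : ℝ) {ε : ℝ} (hε : 0 < ε) :
    ∃ N : ℕ, ∀ m ≥ N, ∀ n : ℕ, |(f^[n] z₀).re - (f^[m] z₀).re| ≤ C * |(f^[m] z₀).im| →
      ε * |(f^[m] z₀).im| ≤ |(f^[n] z₀).im| → |(f^[n] z₀).im| ≤ H * |(f^[m] z₀).im| → n = m := by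
  obtain ⟨N, hN⟩ := o.box h (|C| + 1) (max H 1 + 1) (ε := min ε 1 / 2) (by positivity)
  refine ⟨N, fun m hm n h1 h2 h3 => ?_⟩
  set z := f^[m] z₀ with hz
  have hs := o.abs_im_pos m
  rw [← hz] at hs
  obtain ⟨σ, hσ, hσz⟩ := exists_side (o.im_ne_zero m)
  rw [← hz] at hσz
  have hsz := abs_eq_side hσ hσz
  set D : Set ℂ := {w | |w.re - z.re| < (|C| + 1) * |z.im| ∧
    min ε 1 / 2 * |z.im| < σ * w.im ∧ σ * w.im < (max H 1 + 1) * |z.im|} with hD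
  have hDo : IsOpen D := by
    have h1 : Continuous fun w : ℂ => |w.re - z.re| :=
      (Complex.continuous_re.sub continuous_const).abs
    have h2 : Continuous fun w : ℂ => σ * w.im := continuous_const.mul Complex.continuous_im
    exact (isOpen_lt h1 continuous_const).inter
      ((isOpen_lt continuous_const h2).inter (isOpen_lt h2 continuous_const))
  have hDF : D ⊆ FatouSet f := h.subset_fatou_of_nonreal hDo fun w hw => by
    have hpos : 0 < σ * w.im := lt_trans (by positivity) hw.2.1
    have hab := abs_eq_side hσ hpos
    exact hN m hm w hw.1.le (by rw [hab]; exact hw.2.1.le) (by rw [hab]; exact hw.2.2.le)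
  have hDc : IsPreconnected D := by
    apply Convex.isPreconnected
    have hre : IsLinearMap ℝ Complex.re := Complex.reLm.isLinear
    have him : IsLinearMap ℝ (fun w : ℂ => σ * w.im) := (σ • Complex.imLm).isLinear
    have : D = ({w : ℂ | w.re < z.re + (|C| + 1) * |z.im|} ∩ {w : ℂ | z.re - (|C| + 1) * |z.im| < w.re}) ∩
      ({w | min ε 1 / 2 * |z.im| < σ * w.im} ∩ {w | σ * w.im < (max H 1 + 1) * |z.im|}) := by
      ext w
      simp only [hD, mem_ofPred_eq, mem_inter_iff, abs_lt]
      constructor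
      · rintro ⟨⟨a, b⟩, c⟩; exact ⟨⟨by linarith, by linarith⟩, c⟩
      · rintro ⟨⟨a, b⟩, c⟩; exact ⟨⟨by linarith, by linarith⟩, c⟩
    rw [this]
    exact ((convex_halfSpace_lt hre _).inter (convex_halfSpace_gt hre _)).inter
      ((convex_halfSpace_gt him _).inter (convex_halfSpace_lt him _))
  have hmD : z ∈ D := by
    refine ⟨by rw [sub_self, abs_zero]; positivity, ?_, ?_⟩ <;> rw [← hsz]
    · have : min ε 1 ≤ 1 := min_le_right _ _
      nlinarith
    · have : 1 ≤ max H 1 := le_max_right _ _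
      nlinarith
  have hn : ∀ w : ℂ, w.re = (f^[n] z₀).re → σ * w.im = |(f^[n] z₀).im| → w ∈ D := by
    intro w hw1 hw2
    refine ⟨?_, ?_, ?_⟩
    · rw [hw1]
      nlinarith [le_abs_self C]
    · rw [hw2]
      have : min ε 1 ≤ ε := min_le_left _ _
      nlinarith
    · rw [hw2]
      have : H ≤ max H 1 := le_max_left _ _
      nlinarith
  rcases (mul_ne_zero (a := σ) (by rintro rfl; simp at hσz) (o.im_ne_zero n)).lt_or_gt with hneg | hpos
  · refine (h.wand_conj_ne o.wand hDc hDF hmD (hn ((starRingEnd ℂ) (f^[n] z₀)) (by simp) ?_)).symm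
    rw [Complex.conj_im, ← abs_neg]
    exact (abs_eq_side hσ (by linarith)).symm
  · exact (wand_eq o.wand hDc hDF hmD (hn _ rfl (abs_eq_side hσ hpos).symm)).symm

theorem Orb.tendsto_im (h : RealB f S R₀) (o : Orb f z₀ δ) {B : ℝ} (hB : ∀ n, ‖f^[n] z₀‖ ≤ B) :
    Tendsto (fun n => |(f^[n] z₀).im|) atTop (𝓝 0) := by
  rw [Metric.tendsto_atTop]
  intro ε hε
  have hB0 : 0 ≤ B := (norm_nonneg _).trans (hB 0)
  obtain ⟨N, hN⟩ := o.box_eq h (2 * B / ε) (B / ε) (ε := ε / (B + 1)) (by positivity)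
  have him : ∀ n, |(f^[n] z₀).im| ≤ B := fun n => (Complex.abs_im_le_norm _).trans (hB n)
  have hre : ∀ n, |(f^[n] z₀).re| ≤ B := fun n => (Complex.abs_re_le_norm _).trans (hB n)
  have key : ∀ m ≥ N, ∀ n, ε ≤ |(f^[m] z₀).im| → ε ≤ |(f^[n] z₀).im| → n = m := by
    intro m hm n h1 h2
    refine hN m hm n ?_ ?_ ?_
    · have a := abs_sub (f^[n] z₀).re (f^[m] z₀).re
      have b : 2 * B ≤ 2 * B / ε * |(f^[m] z₀).im| := by
        rw [div_mul_eq_mul_div, le_div_iff₀ hε]; gcongr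
      linarith [hre n, hre m]
    · rw [div_mul_eq_mul_div, div_le_iff₀ (by linarith)]
      nlinarith [him m]
    · have b : B ≤ B / ε * |(f^[m] z₀).im| := by
        rw [div_mul_eq_mul_div, le_div_iff₀ hε]; gcongr
      linarith [him n]
  by_cases hex : ∃ m ≥ N, ε ≤ |(f^[m] z₀).im|
  · obtain ⟨m, hm, hm1⟩ := hex
    refine ⟨m + 1, fun n hn => ?_⟩
    rw [Real.dist_eq, sub_zero, abs_abs]
    by_contra hcon
    have := key m hm n hm1 (not_lt.1 hcon)
    omega
  · push Not at hex
    refine ⟨N, fun n hn => ?_⟩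
    rw [Real.dist_eq, sub_zero, abs_abs]
    exact hex n hn

end

section
variable {f : ℂ → ℂ} {S : Set ℂ} {R₀ : ℝ} {z₀ : ℂ} {δ : ℝ}

theorem RealB.exists_pow_factor (h : RealB f S R₀) (c : ℝ) (hc : deriv f c = 0) :
    ∃ (d : ℕ) (g : ℂ → ℂ), 2 ≤ d ∧ ContinuousAt g c ∧ g c ≠ 0 ∧ (g c).im = 0 ∧
      ∀ᶠ z in 𝓝 (c : ℂ), f z = f c + (z - c) ^ d * g z := by
  have hA : AnalyticAt ℂ (fun z => f z - f c) c :=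
    (h.diff.analyticAt (c : ℂ)).sub analyticAt_const
  have hne : ¬∀ᶠ z in 𝓝 (c : ℂ), f z - f c = 0 := by
    intro h0
    refine h.npoly ⟨Polynomial.C (f c), fun z => ?_⟩
    have h1 := (show AnalyticOnNhd ℂ f univ from fun z _ => h.diff.analyticAt z).eq_of_eventuallyEq
      (g := fun _ => f c) analyticOnNhd_const (z₀ := (c : ℂ))
      (by filter_upwards [h0] with z hz using sub_eq_zero.1 hz)
    rw [Polynomial.eval_C]; exact congrFun h1 z
  obtain ⟨d, g, hg, hg0, hev⟩ := (hA.exists_eventuallyEq_pow_smul_nonzero_iff).2 hne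
  have hev' : ∀ᶠ z in 𝓝 (c : ℂ), f z = f c + (z - c) ^ d * g z := by
    filter_upwards [hev] with z hz
    rw [smul_eq_mul] at hz; rw [← hz]; ring
  refine ⟨d, g, ?_, hg.continuousAt, hg0, ?_, hev'⟩
  · by_contra hd
    have hd' : d = 0 ∨ d = 1 := by omega
    rcases hd' with rfl | rfl
    · have := hev'.self_of_nhds
      simp at this; exact hg0 this
    · have h1 : HasDerivAt f (g c) c := by
        have h2 : HasDerivAt (fun z : ℂ => f c + (z - c) ^ 1 * g z) (g c) c := by
          have := ((((hasDerivAt_id (c : ℂ)).sub_const (c : ℂ)).fun_pow 1).fun_mul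
            hg.differentiableAt.hasDerivAt).const_add (f c)
          exact this.congr_deriv (by simp)
        exact h2.congr_of_eventuallyEq hev'
      exact hg0 (by rw [← h1.deriv, hc])
  · have ht : Tendsto (fun x : ℝ => (g x).im) (𝓝[≠] c) (𝓝 (g c).im) := by
      have := (Complex.continuous_im.continuousAt.comp
        (hg.continuousAt.comp Complex.continuous_ofReal.continuousAt) : ContinuousAt (fun x : ℝ => (g x).im) c)
      exact this.tendsto.mono_left nhdsWithin_le_nhds
    have ht0 : Tendsto (fun x : ℝ => (g x).im) (𝓝[≠] c) (𝓝 0) := by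
      refine Tendsto.congr' ?_ tendsto_const_nhds
      have hr := (Complex.continuous_ofReal.tendsto c).eventually hev'
      filter_upwards [hr.filter_mono nhdsWithin_le_nhds, self_mem_nhdsWithin] with x hx hxc
      have hxc' : ((x - c : ℝ) ^ d) ≠ 0 := pow_ne_zero _ (sub_ne_zero.2 hxc)
      have h3 : f x - f c = (((x - c : ℝ) ^ d : ℝ) : ℂ) * g x := by rw [hx]; push_cast; ring
      have := congrArg Complex.im h3
      rw [Complex.im_ofReal_mul, Complex.sub_im, h.real, h.real, sub_zero] at this
      exact ((mul_eq_zero.1 this.symm).resolve_left hxc').symm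
    exact tendsto_nhds_unique ht ht0

theorem Orb.far_from_critical (h : RealB f S R₀) (o : Orb f z₀ δ)
    (hs : Tendsto (fun n => |(f^[n] z₀).im|) atTop (𝓝 0)) {c : ℝ} (hc : deriv f c = 0) (M : ℝ) :
    ∃ N : ℕ, ∀ j ≥ N, M * |(f^[j] z₀).im| ≤ |(f^[j] z₀).re - c| := by
  obtain ⟨d, g, hd, hg, hg0, hgi, hev⟩ := h.exists_pow_factor c hc
  have hd0 : (0 : ℝ) < d := by positivity
  have hd2 : (2 : ℝ) ≤ d := by exact_mod_cast hd
  have hpi := Real.pi_pos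
  set θ₁ := Real.pi / (2 * d) with hθ₁
  set θ₂ := 3 * Real.pi / (2 * d) with hθ₂
  have h12 : θ₁ ≤ θ₂ := by rw [hθ₁, hθ₂]; gcongr; linarith
  have h1 : 0 < θ₁ := by positivity
  have h2 : θ₂ < Real.pi := by
    rw [hθ₂, div_lt_iff₀ (by positivity)]; nlinarith
  obtain ⟨θm, hθm, hmin⟩ := isCompact_Icc.exists_isMinOn (nonempty_Icc.2 h12)
    Real.continuous_sin.continuousOn
  set ε := Real.sin θm with hε
  have hεp : 0 < ε := Real.sin_pos_of_pos_of_lt_pi (lt_of_lt_of_le h1 hθm.1) (lt_of_le_of_lt hθm.2 h2)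
  obtain ⟨N₁, hN₁⟩ := o.box h (M + 1) 1 hεp
  -- the two endpoint functions
  have hend : ∀ θ : ℝ, ∀ τ : ℝ, Complex.exp (d * θ * Complex.I) = τ * Complex.I →
      ∀ᶠ s : ℝ in 𝓝[>] 0, 0 < (f (c + s * Complex.exp (θ * Complex.I))).im * (τ * (g c).re) ∨ τ = 0 := by
    intro θ τ hτ
    by_cases hτ0 : τ = 0
    · exact Eventually.of_forall fun _ => Or.inr hτ0
    have hcont : ContinuousAt (fun s : ℝ => (c : ℂ) + s * Complex.exp (θ * Complex.I)) 0 := by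
      fun_prop
    have hv : (c : ℂ) + ((0 : ℝ) : ℂ) * Complex.exp (θ * Complex.I) = c := by simp
    have ht : Tendsto (fun s : ℝ => (c : ℂ) + s * Complex.exp (θ * Complex.I)) (𝓝[>] 0) (𝓝 c) := by
      have := hcont.tendsto
      rw [hv] at this
      exact this.mono_left nhdsWithin_le_nhds
    have hgt := (Complex.continuous_re.tendsto _).comp (hg.tendsto.comp ht)
    have hgre : (g c).re ≠ 0 := fun h0 => hg0 (Complex.ext h0 hgi)
    have hpos : ∀ᶠ s : ℝ in 𝓝[>] 0,
        0 < (g (c + s * Complex.exp (θ * Complex.I))).re * (g c).re := by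
      have := hgt.mul_const (g c).re
      exact this.eventually (lt_mem_nhds (mul_self_pos.2 hgre))
    filter_upwards [ht.eventually hev, hpos, self_mem_nhdsWithin] with s hs1 hs2 hs3
    left
    have hs3 : 0 < s := hs3
    rw [hs1]
    have e1 : ((c : ℂ) + s * Complex.exp (θ * Complex.I) - c) ^ d = ((s ^ d * τ : ℝ) : ℂ) * Complex.I := by
      rw [add_sub_cancel_left, mul_pow, ← Complex.exp_nat_mul, ← mul_assoc, hτ]
      push_cast; ring
    rw [e1, Complex.add_im, h.real, mul_assoc, Complex.im_ofReal_mul, Complex.I_mul_im]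
    have : 0 < s ^ d := by positivity
    have ht2 : 0 < τ ^ 2 := by positivity
    have := mul_pos (mul_pos this ht2) hs2
    linarith
  have hdc : (d : ℂ) ≠ 0 := by exact_mod_cast hd0.ne'
  have e1 := hend θ₁ 1 (by
    have : ((d : ℂ) * (θ₁ : ℝ) * Complex.I) = (Real.pi / 2 : ℂ) * Complex.I := by
      rw [hθ₁]; push_cast; field_simp
    rw [this, Complex.exp_pi_div_two_mul_I]; simp)
  have e2 := hend θ₂ (-1) (by
    have : ((d : ℂ) * (θ₂ : ℝ) * Complex.I) = Real.pi * Complex.I + (Real.pi / 2 : ℂ) * Complex.I := by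
      rw [hθ₂]; push_cast; field_simp; ring
    rw [this, Complex.exp_add, Complex.exp_pi_div_two_mul_I, Complex.exp_pi_mul_I]; simp)
  have hs' : Tendsto (fun n => |(f^[n] z₀).im|) atTop (𝓝[>] 0) :=
    tendsto_nhdsWithin_iff.2 ⟨hs, Eventually.of_forall fun n => o.abs_im_pos n⟩
  obtain ⟨N₂, hN₂⟩ := eventually_atTop.1 (hs'.eventually (e1.and e2))
  refine ⟨max N₁ N₂, fun j hj => ?_⟩
  by_contra hcon
  push Not at hcon
  obtain ⟨p1, p2⟩ := hN₂ j (le_trans (le_max_right _ _) hj)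
  have p1 := p1.resolve_right one_ne_zero
  have p2 := p2.resolve_right (by norm_num)
  have hsp := o.abs_im_pos j
  set s := |(f^[j] z₀).im| with hsdef
  have hcont : Continuous fun θ : ℝ => (f (c + s * Complex.exp (θ * Complex.I))).im := by
    have := h.diff.continuous
    fun_prop
  have hzero : ∃ θ ∈ Icc θ₁ θ₂, (f (c + s * Complex.exp (θ * Complex.I))).im = 0 := by
    by_cases hsg : 0 < (g c).re
    · have := intermediate_value_Icc' h12 hcont.continuousOn (a := θ₁)
      exact this ⟨by nlinarith, by nlinarith⟩
    · have := intermediate_value_Icc h12 hcont.continuousOn (a := θ₁)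
      exact this ⟨by nlinarith, by nlinarith⟩
  obtain ⟨θ, hθ, hθ0⟩ := hzero
  have hre : ((c : ℂ) + s * Complex.exp (θ * Complex.I)).re = c + s * Real.cos θ := by
    rw [Complex.add_re, Complex.re_ofReal_mul, Complex.exp_ofReal_mul_I_re, Complex.ofReal_re]
  have him : ((c : ℂ) + s * Complex.exp (θ * Complex.I)).im = s * Real.sin θ := by
    rw [Complex.add_im, Complex.im_ofReal_mul, Complex.exp_ofReal_mul_I_im, Complex.ofReal_im, zero_add]
  have hsin : ε ≤ Real.sin θ := hmin hθ
  refine hN₁ j (le_trans (le_max_left _ _) hj) (c + s * Complex.exp (θ * Complex.I)) ?_ ?_ ?_ 1 hθ0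
  · rw [hre]
    have a1 : |s * Real.cos θ| ≤ s := by
      rw [abs_mul, abs_of_pos hsp]; nlinarith [Real.abs_cos_le_one θ]
    rw [abs_lt] at hcon; rw [abs_le] at a1 ⊢
    constructor <;> nlinarith
  · rw [him, abs_mul, abs_of_pos hsp, abs_of_pos (show 0 < Real.sin θ by linarith)]; nlinarith
  · rw [him, abs_mul, abs_of_pos hsp, abs_of_pos (show 0 < Real.sin θ by linarith)]; nlinarith [Real.sin_le_one θ]

theorem Orb.affine_local (h : RealB f S R₀) (o : Orb f z₀ δ)
    (hs : Tendsto (fun n => |(f^[n] z₀).im|) atTop (𝓝 0)) (c ρ : ℝ) {η : ℝ} (hη : 0 < η)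
    (hη1 : η < 1) :
    ∃ r > 0, ∃ N : ℕ, ∀ j ≥ N, |(f^[j] z₀).re - c| < r →
      ∀ w : ℂ, ‖w - (f^[j] z₀).re‖ ≤ ρ * |(f^[j] z₀).im| →
        deriv f (f^[j] z₀).re ≠ 0 ∧
        ‖deriv f w - deriv f (f^[j] z₀).re‖ ≤ η * ‖deriv f (f^[j] z₀).re‖ := by
  have hA : AnalyticAt ℂ (deriv f) c := (h.diff.analyticAt (c : ℂ)).deriv
  have hne : ¬∀ᶠ z in 𝓝 (c : ℂ), deriv f z = 0 := by
    intro h0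
    have h1 := (show AnalyticOnNhd ℂ (deriv f) univ from fun z _ => (h.diff.analyticAt z).deriv).eq_of_eventuallyEq
      (g := fun _ => 0) analyticOnNhd_const (z₀ := (c : ℂ)) h0
    refine h.npoly ⟨Polynomial.C (f 0), fun z => ?_⟩
    rw [Polynomial.eval_C]
    exact is_const_of_deriv_eq_zero h.diff (congrFun h1) z 0
  obtain ⟨d, g, hg, hg0, hev⟩ := (hA.exists_eventuallyEq_pow_smul_nonzero_iff).2 hne
  -- choose tolerances
  have hcont : ContinuousAt (fun p : ℂ × ℂ => (1 + p.1) ^ d * (1 + p.2)) (0, 0) := by fun_prop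
  obtain ⟨κ, hκ, hκ'⟩ := Metric.continuousAt_iff.1 hcont η hη
  have hgc := hg.continuousAt
  have hg1 : ∀ᶠ z in 𝓝 (c : ℂ), ‖g z - g c‖ < min (‖g c‖ / 2) (κ * ‖g c‖ / 4) := by
    have hgp : 0 < ‖g c‖ := norm_pos_iff.2 hg0
    have := Metric.continuousAt_iff'.1 hgc (min (‖g c‖ / 2) (κ * ‖g c‖ / 4)) (by positivity)
    simpa [dist_eq_norm] using this
  obtain ⟨r, hr, hr'⟩ := Metric.eventually_nhds_iff.1 (hev.and hg1)
  obtain ⟨N₁, hN₁⟩ : ∃ N : ℕ, ∀ j ≥ N, ρ * |(f^[j] z₀).im| < r / 2 := by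
    have : Tendsto (fun n => ρ * |(f^[n] z₀).im|) atTop (𝓝 (ρ * 0)) := hs.const_mul ρ
    rw [mul_zero] at this
    exact eventually_atTop.1 (this.eventually (gt_mem_nhds (by positivity)))
  have hgp : 0 < ‖g c‖ := norm_pos_iff.2 hg0
  obtain ⟨N₂, hN₂⟩ : ∃ N : ℕ, d ≠ 0 → ∀ j ≥ N,
      ((2 * |ρ| / κ + 1) * |(f^[j] z₀).im| ≤ |(f^[j] z₀).re - c|) := by
    by_cases hd : d = 0
    · exact ⟨0, fun h0 => absurd hd h0⟩
    · have hc0 : deriv f c = 0 := by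
        have := hev.self_of_nhds
        rw [sub_self, zero_pow hd, zero_smul] at this; exact this
      obtain ⟨N, hN⟩ := o.far_from_critical h hs hc0 (2 * |ρ| / κ + 1)
      exact ⟨N, fun _ => hN⟩
  refine ⟨r / 2, by positivity, max N₁ N₂, fun j hj hjr w hw => ?_⟩
  set x : ℝ := (f^[j] z₀).re with hx
  have hsp := o.abs_im_pos j
  set s := |(f^[j] z₀).im| with hsdef
  have hxr : dist (x : ℂ) c < r := by
    rw [Complex.dist_eq, ← Complex.ofReal_sub, Complex.norm_real, Real.norm_eq_abs]; linarith
  have hwr : dist w c < r := by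
    calc dist w c ≤ dist w x + dist (x : ℂ) c := dist_triangle _ _ _
      _ < r := by
        have := hN₁ j (le_trans (le_max_left _ _) hj)
        rw [dist_eq_norm, Complex.dist_eq, ← Complex.ofReal_sub, Complex.norm_real, Real.norm_eq_abs]; linarith
  obtain ⟨hx1, hx2⟩ := hr' hxr
  obtain ⟨hw1, hw2⟩ := hr' hwr
  rw [smul_eq_mul] at hx1 hw1
  have hgx : ‖g c‖ / 2 ≤ ‖g x‖ := by
    have := (lt_min_iff.1 hx2).1
    have := norm_sub_norm_le (g c) (g x)
    rw [norm_sub_rev] at this; linarith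
  have hgx0 : g x ≠ 0 := norm_pos_iff.1 (by linarith)
  have hxc : d ≠ 0 → (x : ℂ) - c ≠ 0 := by
    intro hd h0
    have h1 := hN₂ hd j (le_trans (le_max_right _ _) hj)
    rw [← Complex.ofReal_sub, Complex.ofReal_eq_zero] at h0
    rw [h0, abs_zero] at h1
    have : 0 < (2 * |ρ| / κ + 1) * s := by positivity
    linarith
  have hne0 : deriv f x ≠ 0 := by
    rw [hx1]
    refine mul_ne_zero ?_ hgx0
    by_cases hd : d = 0
    · rw [hd, pow_zero]; exact one_ne_zero
    · exact pow_ne_zero _ (hxc hd)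
  refine ⟨hne0, ?_⟩
  set u := (g w - g x) / g x with hu
  set t : ℂ := if d = 0 then 0 else (w - x) / (x - c) with ht
  have hut : deriv f w = ((1 + t) ^ d * (1 + u)) * deriv f x := by
    have e2 : 1 + u = g w / g x := by rw [hu]; field_simp; ring
    by_cases hd : d = 0
    · rw [hw1, hx1, e2, hd]; field_simp
    · have := hxc hd
      have e3 : 1 + t = (w - c) / (x - c) := by rw [ht, if_neg hd]; field_simp; ring
      rw [hw1, hx1, e2, e3, div_pow]; field_simp
  have hub : ‖u‖ < κ := by
    rw [hu, norm_div, div_lt_iff₀ (by linarith)]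
    have a1 := (lt_min_iff.1 hx2).2
    have a2 := (lt_min_iff.1 hw2).2
    have := norm_sub_le (g w - g c) (g x - g c)
    rw [sub_sub_sub_cancel_right] at this
    nlinarith
  have htb : ‖t‖ < κ := by
    rw [ht]
    split_ifs with hd
    · simpa using hκ
    · have h1 := hN₂ hd j (le_trans (le_max_right _ _) hj)
      rw [norm_div, div_lt_iff₀ (norm_pos_iff.2 (hxc hd)), ← Complex.ofReal_sub, Complex.norm_real, Real.norm_eq_abs]
      have h3 : κ * ((2 * |ρ| / κ + 1) * s) = 2 * |ρ| * s + κ * s := by field_simp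
      have h4 : κ * ((2 * |ρ| / κ + 1) * s) ≤ κ * |x - c| := by gcongr
      have h5 : ρ * s ≤ |ρ| * s := by gcongr; exact le_abs_self _
      have h6 : 0 ≤ |ρ| * s := by positivity
      have h7 : 0 < κ * s := by positivity
      linarith
  have := @hκ' (t, u) (by
    rw [Prod.dist_eq]; simp only [dist_zero_right]; exact max_lt htb hub)
  rw [hut]
  have e5 : (1 + t) ^ d * (1 + u) * deriv f x - deriv f x = ((1 + t) ^ d * (1 + u) - 1) * deriv f x := by ring
  rw [e5, norm_mul]
  gcongr
  rw [dist_eq_norm] at this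
  simp only [add_zero, one_pow, mul_one] at this
  exact this.le

theorem Orb.affine (h : RealB f S R₀) (o : Orb f z₀ δ)
    (hs : Tendsto (fun n => |(f^[n] z₀).im|) atTop (𝓝 0)) {B : ℝ}
    (hB : ∀ n, ‖f^[n] z₀‖ ≤ B) (ρ : ℝ) {η : ℝ} (hη : 0 < η) (hη1 : η < 1) :
    ∃ N : ℕ, ∀ j ≥ N, ∀ w : ℂ, ‖w - (f^[j] z₀).re‖ ≤ ρ * |(f^[j] z₀).im| →
        deriv f (f^[j] z₀).re ≠ 0 ∧
        ‖deriv f w - deriv f (f^[j] z₀).re‖ ≤ η * ‖deriv f (f^[j] z₀).re‖ := by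
  choose r hr N hN using fun c => o.affine_local h hs c ρ hη hη1
  obtain ⟨t, -, ht⟩ := (isCompact_Icc (a := -B) (b := B)).elim_nhds_subcover (fun c => ball c (r c))
    fun c _ => ball_mem_nhds c (hr c)
  refine ⟨t.sup N, fun j hj w hw => ?_⟩
  have hx : (f^[j] z₀).re ∈ Icc (-B) B := abs_le.1 ((Complex.abs_re_le_norm _).trans (hB j))
  obtain ⟨c, hc, hxc⟩ := mem_iUnion₂.1 (ht hx)
  exact hN c j (le_trans (Finset.le_sup hc) hj) (by simpa [Real.dist_eq] using hxc) w hw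

end

section
variable {f : ℂ → ℂ} {S : Set ℂ} {R₀ : ℝ} {z₀ : ℂ} {δ : ℝ}

/-- The angular coordinate of the real point `t` seen from the point `x + i s`. -/
noncomputable def ang (x s t : ℝ) : ℝ := Real.arctan ((t - x) / s)

/-- The real-dynamics data extracted from a bounded orbit. -/
structure Frame (φ : ℝ → ℝ) (x s a b ε : ℕ → ℝ) (C : Finset ℝ) (P : ℝ) (N : ℕ) : Prop where
  cont : Continuous φ
  s_pos : ∀ j, 0 < s j
  mem_a : ∀ j ≥ N, a j ∈ C
  mem_b : ∀ j ≥ N, b j ∈ C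
  sq : ∀ j, ε j ^ 2 = 1
  lt : ∀ j ≥ N, a j < b j
  mono : ∀ j ≥ N, StrictMonoOn (fun t => ε j * φ t) (Icc (a j) (b j))
  cut_a : ∀ j ≥ N, P * s (j + 1) ≤ ε j * (x (j + 1) - φ (a j))
  cut_b : ∀ j ≥ N, P * s (j + 1) ≤ ε j * (φ (b j) - x (j + 1))
  ang_le : ∀ j ≥ N, ∀ u ∈ Icc (a j) (b j), ∀ v ∈ Icc (a j) (b j),
    |ang (x (j + 1)) (s (j + 1)) (φ v) - ang (x (j + 1)) (s (j + 1)) (φ u)| ≤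
      |ang (x j) (s j) v - ang (x j) (s j) u|

theorem RealB.exists_crit (h : RealB f S R₀) {B : ℝ} (hB : 0 ≤ B) :
    ∃ C : Finset ℝ, (∀ c ∈ C, deriv f (c : ℂ) = 0 ∨ |c| = B + 1) ∧ -(B + 1) ∈ C ∧ B + 1 ∈ C ∧
      ∀ c : ℝ, |c| < B + 1 → deriv f (c : ℂ) = 0 → c ∈ C := by
  have hfin : {c : ℝ | c ∈ Icc (-(B + 1)) (B + 1) ∧ deriv f (c : ℂ) = 0}.Finite := by
    have hA : AnalyticOnNhd ℂ (deriv f) univ := fun z _ => (h.diff.analyticAt z).deriv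
    obtain ⟨w, hw⟩ : ∃ w, deriv f w ≠ 0 := by
      by_contra hcon
      push Not at hcon
      exact h.npoly ⟨Polynomial.C (f 0), fun z => by
        rw [Polynomial.eval_C]; exact is_const_of_deriv_eq_zero h.diff hcon z 0⟩
    have hK := isCompact_closedBall (0 : ℂ) (B + 1)
    have hfin := hK.finite_sdiff_of_mem_codiscreteWithin
      (codiscreteWithin_mono (subset_univ _) (hA.preimage_zero_mem_codiscrete hw))
    refine (hfin.preimage (f := fun x : ℝ => (x : ℂ)) Complex.ofReal_injective.injOn).subset ?_
    rintro c ⟨hc, hc0⟩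
    refine ⟨?_, fun h0 => h0 hc0⟩
    simpa [abs_le] using hc
  classical
  refine ⟨hfin.toFinset ∪ {-(B + 1), B + 1}, ?_, by simp, by simp, ?_⟩
  · intro c hc
    simp only [Finset.mem_union, Finite.mem_toFinset, Finset.mem_insert, Finset.mem_singleton] at hc
    rcases hc with hc | rfl | rfl
    · exact Or.inl hc.2
    · right; rw [abs_neg, abs_of_nonneg (by linarith)]
    · right; rw [abs_of_nonneg (by linarith)]
  · intro c hc hc0
    rw [Finset.mem_union]; left
    exact hfin.mem_toFinset.2 ⟨⟨(abs_lt.1 hc).1.le, (abs_lt.1 hc).2.le⟩, hc0⟩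

theorem exists_adjacent {C : Finset ℝ} {x p q : ℝ} (hp : p ∈ C) (hq : q ∈ C) (hpx : p < x)
    (hqx : x < q) (hx : x ∉ C) :
    ∃ a ∈ C, ∃ b ∈ C, a < x ∧ x < b ∧ ∀ c ∈ C, c ≤ a ∨ b ≤ c := by
  obtain ⟨a, ha, ha'⟩ := (C.filter (· < x)).exists_max_image id ⟨p, by simp [hp, hpx]⟩
  obtain ⟨b, hb, hb'⟩ := (C.filter (x < ·)).exists_min_image id ⟨q, by simp [hq, hqx]⟩
  simp only [Finset.mem_filter, id] at ha hb ha' hb'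
  refine ⟨a, ha.1, b, hb.1, ha.2, hb.2, fun c hc => ?_⟩
  rcases lt_trichotomy c x with h | h | h
  · exact Or.inl (ha' c ⟨hc, h⟩)
  · exact absurd (h ▸ hc) hx
  · exact Or.inr (hb' c ⟨hc, h⟩)

/-- One step of the dynamics along an almost affine stretch of the orbit. -/
theorem RealB.step (h : RealB f S R₀) {z : ℂ} {x s a b ρ : ℝ} (hx : x = z.re) (hs : s = |z.im|)
    (hz : z.im ≠ 0) (hρ : 2 ≤ ρ)
    (haff : ∀ w : ℂ, ‖w - x‖ ≤ ρ * s → deriv f x ≠ 0 ∧ ‖deriv f w - deriv f x‖ ≤ 1 / 10 * ‖deriv f x‖)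
    (ha : a ≤ x - ρ * s) (hb : x + ρ * s ≤ b) (hne : ∀ t ∈ Ioo a b, deriv f (t : ℂ) ≠ 0) :
    ∃ ε : ℝ, ε ^ 2 = 1 ∧ StrictMonoOn (fun t => ε * rl f t) (Icc a b) ∧
      ρ / 2 * |(f z).im| ≤ ε * ((f z).re - rl f a) ∧
      ρ / 2 * |(f z).im| ≤ ε * (rl f b - (f z).re) ∧
      ∃ g : ℂ → ℂ, DifferentiableOn ℂ g (slitDom (rl f '' Ioo a b)) ∧
        (∀ y ∈ slitDom (rl f '' Ioo a b), f (g y) = y) ∧ (∀ t ∈ Ioo a b, g (f (t : ℂ)) = t) ∧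
        g (f z) = z := by
  have hsp : 0 < s := by rw [hs]; exact abs_pos.2 hz
  have hD0 : deriv f x ≠ 0 := (haff x (by rw [sub_self, norm_zero]; positivity)).1
  set D : ℝ := (deriv f x).re with hD
  have hDc : deriv f (x : ℂ) = (D : ℂ) := (h.ofReal_re_deriv x).symm
  have hDn : ‖deriv f (x : ℂ)‖ = |D| := by rw [hDc, Complex.norm_real, Real.norm_eq_abs]
  have hD1 : D ≠ 0 := h.re_deriv_ne_zero hD0
  have hDp : 0 < |D| := abs_pos.2 hD1
  have hmv : ∀ w ∈ closedBall (x : ℂ) (ρ * s), ∀ v ∈ closedBall (x : ℂ) (ρ * s),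
      ‖f w - f v - D * (w - v)‖ ≤ 1 / 10 * |D| * ‖w - v‖ := by
    intro w hw v hv
    have := (convex_closedBall (x : ℂ) (ρ * s)).norm_image_sub_le_of_norm_hasDerivWithin_le
      (f := fun u => f u - D * u) (f' := fun u => deriv f u - D) (C := 1 / 10 * |D|)
      (fun u _ => by
        have := ((h.diff u).hasDerivAt.sub ((hasDerivAt_id u).const_mul (D : ℂ)))
        simpa using! this.hasDerivWithinAt)
      (fun u hu => by
        have := (haff u (by simpa [dist_eq_norm] using hu)).2
        rwa [hDn, hDc] at this) hv hw
    have e : f w - f v - D * (w - v) = f w - D * w - (f v - D * v) := by ring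
    rw [e]; exact this
  have hxJ : x ∈ Ioo a b := ⟨by nlinarith, by nlinarith⟩
  have hx0 : (x : ℂ) ∈ closedBall (x : ℂ) (ρ * s) := mem_closedBall_self (by positivity)
  -- the sign of the derivative
  obtain ⟨ε, hε, hεD⟩ : ∃ ε : ℝ, ε ^ 2 = 1 ∧ ε * D = |D| := by
    rcases hD1.lt_or_gt with h0 | h0
    · exact ⟨-1, by norm_num, by rw [abs_of_neg h0]; ring⟩
    · exact ⟨1, by norm_num, by rw [abs_of_pos h0]; ring⟩
  have hε1 : |ε| = 1 := by
    rcases sq_eq_one_iff.1 hε with h0 | h0 <;> rw [h0] <;> norm_num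
  have hcd : Continuous fun t : ℝ => (deriv f (t : ℂ)).re := by
    have : Continuous (deriv f) := (h.diff.contDiff (n := 1)).continuous_deriv le_rfl
    fun_prop
  have hsign : ∀ t ∈ Ioo a b, 0 < ε * (deriv f (t : ℂ)).re := by
    intro t ht
    by_contra hcon
    push Not at hcon
    have hpc : IsPreconnected (Ioo a b) := isPreconnected_Ioo
    obtain ⟨u, hu, hu0⟩ := hpc.intermediate_value ht hxJ
      (f := fun t : ℝ => ε * (deriv f (t : ℂ)).re) (hcd.const_mul ε |>.continuousOn)
      (show (0 : ℝ) ∈ Icc _ _ from ⟨hcon, by rw [← hD, hεD]; exact hDp.le⟩)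
    have hε0 : ε ≠ 0 := by rintro rfl; norm_num at hε
    exact h.re_deriv_ne_zero (hne u hu) ((mul_eq_zero.1 hu0).resolve_left hε0)
  have hmono : StrictMonoOn (fun t => ε * rl f t) (Icc a b) := by
    refine strictMonoOn_of_deriv_pos (convex_Icc a b) (h.continuous_rl.const_mul ε).continuousOn ?_
    intro t ht
    rw [interior_Icc] at ht
    rw [((h.hasDerivAt_rl t).const_mul ε).deriv]
    exact hsign t ht
  -- position of the image of `z`
  have hzx : z - x = (z.im : ℂ) * Complex.I := by
    apply Complex.ext <;> simp [hx]
  have hzn : ‖z - x‖ = s := by rw [hzx]; simp [hs]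
  have hzb : z ∈ closedBall (x : ℂ) (ρ * s) := by
    rw [mem_closedBall, dist_eq_norm, hzn]; nlinarith
  have hmz := hmv z hzb x hx0
  rw [hzn] at hmz
  have hre := (Complex.abs_re_le_norm _).trans hmz
  have him := (Complex.abs_im_le_norm _).trans hmz
  have hre' : |(f z).re - rl f x| ≤ 1 / 10 * |D| * s := by
    have e : (f z - f x - D * (z - x)).re = (f z).re - rl f x := by
      rw [hzx]; simp [rl]
    rwa [e] at hre
  have him' : |(f z).im| ≤ 11 / 10 * |D| * s := by
    have e : (f z - f x - D * (z - x)).im = (f z).im - D * z.im := by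
      rw [hzx]; simp [h.real]
    rw [e] at him
    have a1 := abs_sub_abs_le_abs_sub (f z).im (D * z.im)
    rw [abs_mul, ← hs] at a1
    linarith
  have hpt : ∀ t : ℝ, |t| = 1 → |rl f (x + t * (ρ * s)) - rl f x - D * (t * (ρ * s))| ≤ 1 / 10 * |D| * (ρ * s) := by
    intro t ht
    have e0 : ‖((x + t * (ρ * s) : ℝ) : ℂ) - x‖ = ρ * s := by
      rw [← Complex.ofReal_sub, Complex.norm_real, Real.norm_eq_abs, add_sub_cancel_left, abs_mul, ht,
        one_mul, abs_of_pos (by positivity)]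
    have := hmv ((x + t * (ρ * s) : ℝ) : ℂ) (by rw [mem_closedBall, dist_eq_norm, e0]) x hx0
    rw [e0, ← h.ofReal_rl, ← h.ofReal_rl, ← Complex.ofReal_sub, ← Complex.ofReal_sub, ← Complex.ofReal_mul,
      ← Complex.ofReal_sub, Complex.norm_real, Real.norm_eq_abs, add_sub_cancel_left] at this
    exact this
  have hεabs : ∀ u : ℝ, -|u| ≤ ε * u ∧ ε * u ≤ |u| := fun u => by
    have := neg_abs_le (ε * u)
    have h2 := le_abs_self (ε * u)
    rw [abs_mul, hε1, one_mul] at this h2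
    exact ⟨this, h2⟩
  have hsc : 0 < |D| * s := by positivity
  have hρs : 2 * (|D| * s) ≤ ρ * (|D| * s) := by gcongr
  have hρi : ρ / 2 * |(f z).im| ≤ ρ / 2 * (11 / 10 * |D| * s) := by gcongr
  have h1 := hεabs ((f z).re - rl f x)
  refine ⟨ε, hε, hmono, ?_, ?_, ?_⟩
  · have hm1 : ε * rl f a ≤ ε * rl f (x + (-1) * (ρ * s)) :=
      hmono.monotoneOn ⟨le_rfl, (hxJ.1.trans hxJ.2).le⟩ ⟨by linarith, by nlinarith⟩ (by linarith)
    have h2 := hεabs (rl f (x + (-1) * (ρ * s)) - rl f x - D * ((-1) * (ρ * s)))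
    have h3 := hpt (-1) (by norm_num)
    have e2 : ε * (rl f (x + (-1) * (ρ * s)) - rl f x - D * ((-1) * (ρ * s))) =
      ε * rl f (x + (-1) * (ρ * s)) - ε * rl f x + |D| * (ρ * s) := by rw [← hεD]; ring
    rw [e2] at h2
    have e4 : 1 / 10 * |D| * (ρ * s) = 1 / 10 * (ρ * (|D| * s)) := by ring
    have e5 : |D| * (ρ * s) = ρ * (|D| * s) := by ring
    linarith
  · have hm1 : ε * rl f (x + 1 * (ρ * s)) ≤ ε * rl f b :=
      hmono.monotoneOn ⟨by nlinarith, by linarith⟩ ⟨(hxJ.1.trans hxJ.2).le, le_rfl⟩ (by linarith)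
    have h2 := hεabs (rl f (x + 1 * (ρ * s)) - rl f x - D * (1 * (ρ * s)))
    have h3 := hpt 1 (by norm_num)
    have e2 : ε * (rl f (x + 1 * (ρ * s)) - rl f x - D * (1 * (ρ * s))) =
      ε * rl f (x + 1 * (ρ * s)) - ε * rl f x - |D| * (ρ * s) := by rw [← hεD]; ring
    rw [e2] at h2
    have e4 : 1 / 10 * |D| * (ρ * s) = 1 / 10 * (ρ * (|D| * s)) := by ring
    have e5 : |D| * (ρ * s) = ρ * (|D| * s) := by ring
    linarith
  · obtain ⟨g, hg, hfg, hgf⟩ := h.glue isOpen_Ioo ordConnected_Ioo ⟨x, hxJ⟩ hne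
    refine ⟨g, hg, hfg, hgf, ?_⟩
    have hΩ : IsOpen (slitDom (rl f '' Ioo a b)) := by
      apply isOpen_slitDom
      rw [isOpen_iff_mem_nhds]
      rintro _ ⟨t, ht, rfl⟩
      have hst : HasStrictDerivAt (rl f) (deriv f (t : ℂ)).re t :=
        hasStrictDerivAt_of_hasDerivAt_of_continuousAt
          (Eventually.of_forall fun u => h.hasDerivAt_rl u) hcd.continuousAt
      have := hst.map_nhds_eq (h.re_deriv_ne_zero (hne t ht))
      rw [← this]
      exact image_mem_map (isOpen_Ioo.mem_nhds ht)
    refine inverse_comp_eq (f := f) (G := g) (V := ball (x : ℂ) (ρ * s)) h.diff.differentiableOn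
      isOpen_ball (convex_ball _ _).isPreconnected hΩ hg ?_ hfg (z₀ := (x : ℂ))
      (mem_ball_self (by positivity)) (hgf x hxJ) z ?_
    · intro w hw
      by_cases hwi : w.im = 0
      · right
        rw [← ofReal_re_of_im_eq_zero hwi] at hw ⊢
        refine ⟨w.re, ?_, rfl⟩
        rw [mem_ball, Complex.dist_eq, ← Complex.ofReal_sub, Complex.norm_real, Real.norm_eq_abs, abs_lt] at hw
        exact ⟨by linarith, by linarith⟩
      · left
        intro h0
        have hwb := ball_subset_closedBall hw
        have hrb : (w.re : ℂ) ∈ closedBall (x : ℂ) (ρ * s) := by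
          rw [mem_closedBall, dist_eq_norm] at hwb ⊢
          rw [← Complex.ofReal_sub, Complex.norm_real, Real.norm_eq_abs]
          exact le_trans (by simpa using Complex.abs_re_le_norm (w - x)) hwb
        have hww : w - (w.re : ℂ) = (w.im : ℂ) * Complex.I := by apply Complex.ext <;> simp
        have := (Complex.abs_im_le_norm _).trans (hmv w hwb _ hrb)
        rw [hww] at this
        have e : (f w - f (w.re : ℂ) - D * ((w.im : ℂ) * Complex.I)).im = -(D * w.im) := by
          simp [h.real, h0]
        rw [e, abs_neg, abs_mul] at this
        have hn : ‖(w.im : ℂ) * Complex.I‖ = |w.im| := by simp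
        rw [hn] at this
        have : 0 < |D| * |w.im| := mul_pos hDp (abs_pos.2 hwi)
        linarith
    · rw [mem_ball, dist_eq_norm, hzn]; nlinarith

end

section
variable {f : ℂ → ℂ} {S : Set ℂ} {R₀ : ℝ} {z₀ : ℂ} {δ : ℝ}
variable {φ : ℝ → ℝ} {x s a b ε : ℕ → ℝ} {C : Finset ℝ} {P : ℝ} {N : ℕ}

/-- The points of `[p, q]` stay in the monotonicity intervals for `k` steps from time `i` on. -/
def Stays (φ : ℝ → ℝ) (a b : ℕ → ℝ) (i k : ℕ) (p q : ℝ) : Prop :=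
  ∀ w ∈ Icc p q, ∀ t < k, φ^[t] w ∈ Icc (a (i + t)) (b (i + t))

/-- The image of `[p, q]` under the `k`-th iterate covers the interval about `y` of radius `ℓ`. -/
def Covers (φ : ℝ → ℝ) (k : ℕ) (p q y ℓ : ℝ) : Prop :=
  (φ^[k] p ≤ y - ℓ ∧ y + ℓ ≤ φ^[k] q) ∨ (φ^[k] q ≤ y - ℓ ∧ y + ℓ ≤ φ^[k] p)

theorem ang_strictMono (x : ℝ) {s : ℝ} (hs : 0 < s) : StrictMono (ang x s) := by
  intro u v huv
  apply Real.arctan_strictMono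
  gcongr

theorem Stays.mono {i k k' : ℕ} {p q p' q' : ℝ} (h : Stays φ a b i k p q) (hk : k' ≤ k)
    (hp : p ≤ p') (hq : q' ≤ q) : Stays φ a b i k' p' q' :=
  fun w hw t ht => h w ⟨hp.trans hw.1, hw.2.trans hq⟩ t (ht.trans_le hk)

theorem Frame.continuous_iterate (F : Frame φ x s a b ε C P N) (k : ℕ) : Continuous φ^[k] :=
  F.cont.iterate k

/-- The orientation of the `k`-th iterate at time `i`. -/
noncomputable def orient (ε : ℕ → ℝ) (i k : ℕ) : ℝ := ∏ t ∈ Finset.range k, ε (i + t)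

theorem orient_succ (ε : ℕ → ℝ) (i k : ℕ) : orient ε i (k + 1) = orient ε i k * ε (i + k) :=
  Finset.prod_range_succ _ _

theorem Frame.orient_sq (F : Frame φ x s a b ε C P N) (i k : ℕ) : orient ε i k ^ 2 = 1 := by
  rw [orient, ← Finset.prod_pow]
  exact Finset.prod_eq_one fun t _ => F.sq _

theorem Frame.strictMono_path (F : Frame φ x s a b ε C P N) {i : ℕ} (hi : N ≤ i) {p q : ℝ} {k : ℕ}
    (hst : Stays φ a b i k p q) : StrictMonoOn (fun t => orient ε i k * φ^[k] t) (Icc p q) := by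
  induction k with
  | zero => intro u _ v _ huv; simpa [orient] using huv
  | succ k ih =>
    have ih := ih (hst.mono (Nat.le_succ k) le_rfl le_rfl)
    intro u hu v hv huv
    have h1 := ih hu hv huv
    have hu' := hst u hu k (Nat.lt_succ_self k)
    have hv' := hst v hv k (Nat.lt_succ_self k)
    have hm := F.mono (i + k) (by omega)
    simp only [orient_succ, Function.iterate_succ_apply'] at h1 ⊢
    rcases sq_eq_one_iff.1 (F.orient_sq i k) with h0 | h0 <;> rw [h0] at h1 ⊢
    · have := hm hu' hv' (by linarith)
      simp only at this; linarith
    · have := hm hv' hu' (by linarith)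
      simp only at this; linarith

theorem Frame.mem_Ioo (F : Frame φ x s a b ε C P N) {i : ℕ} (hi : N ≤ i) {p q : ℝ} {k : ℕ}
    (hst : Stays φ a b i k p q) {w : ℝ} (hw : w ∈ Ioo p q) {t : ℕ} (ht : t < k) :
    φ^[t] w ∈ Ioo (a (i + t)) (b (i + t)) := by
  have hm := F.strictMono_path hi (hst.mono ht.le le_rfl le_rfl)
  have hpq := hw.1.trans hw.2
  have hp : p ∈ Icc p q := ⟨le_rfl, hpq.le⟩
  have hq : q ∈ Icc p q := ⟨hpq.le, le_rfl⟩
  have h1 := hm hp ⟨hw.1.le, hw.2.le⟩ hw.1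
  have h2 := hm ⟨hw.1.le, hw.2.le⟩ hq hw.2
  have h3 := hst p hp t ht
  have h4 := hst q hq t ht
  simp only at h1 h2
  rcases sq_eq_one_iff.1 (F.orient_sq i t) with h0 | h0 <;> rw [h0] at h1 h2
  · exact ⟨by linarith [h3.1], by linarith [h4.2]⟩
  · exact ⟨by linarith [h4.1], by linarith [h3.2]⟩

theorem image_Ioo_of_strictMono {φ : ℝ → ℝ} (hφ : Continuous φ) {ε u v : ℝ} (hε : ε ^ 2 = 1) (huv : u < v)
    (hm : StrictMonoOn (fun t => ε * φ t) (Icc u v)) :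
    φ '' Ioo u v = Ioo (min (φ u) (φ v)) (max (φ u) (φ v)) ∧
      min (φ u) (φ v) < max (φ u) (φ v) := by
  have hu : u ∈ Icc u v := ⟨le_rfl, huv.le⟩
  have hv : v ∈ Icc u v := ⟨huv.le, le_rfl⟩
  have h12 := hm hu hv huv
  simp only at h12
  rcases sq_eq_one_iff.1 hε with h0 | h0 <;> rw [h0] at h12 hm
  · have h12' : φ u < φ v := by linarith
    rw [min_eq_left h12'.le, max_eq_right h12'.le]
    refine ⟨Subset.antisymm ?_ (intermediate_value_Ioo huv.le hφ.continuousOn), h12'⟩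
    rintro _ ⟨w, hw, rfl⟩
    have h1 := hm hu ⟨hw.1.le, hw.2.le⟩ hw.1
    have h2 := hm ⟨hw.1.le, hw.2.le⟩ hv hw.2
    simp only at h1 h2
    exact ⟨by linarith, by linarith⟩
  · have h12' : φ v < φ u := by linarith
    rw [min_eq_right h12'.le, max_eq_left h12'.le]
    refine ⟨Subset.antisymm ?_ (intermediate_value_Ioo' huv.le hφ.continuousOn), h12'⟩
    rintro _ ⟨w, hw, rfl⟩
    have h1 := hm hu ⟨hw.1.le, hw.2.le⟩ hw.1
    have h2 := hm ⟨hw.1.le, hw.2.le⟩ hv hw.2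
    simp only at h1 h2
    exact ⟨by linarith, by linarith⟩

theorem RealB.ang_le_of_branch (h : RealB f S R₀) {z : ℂ} (hfz : (f z).im ≠ 0) {a b ε : ℝ}
    (hε : ε ^ 2 = 1) (hm : StrictMonoOn (fun t => ε * rl f t) (Icc a b)) {g : ℂ → ℂ}
    (hg : DifferentiableOn ℂ g (slitDom (rl f '' Ioo a b)))
    (hfg : ∀ y ∈ slitDom (rl f '' Ioo a b), f (g y) = y) (hgf : ∀ t ∈ Ioo a b, g (f (t : ℂ)) = t)
    (hgz : g (f z) = z) {u v : ℝ} (hu : u ∈ Icc a b) (hv : v ∈ Icc a b) :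
    |ang (f z).re |(f z).im| (rl f v) - ang (f z).re |(f z).im| (rl f u)| ≤
      |ang z.re |z.im| v - ang z.re |z.im| u| := by
  wlog huv : u ≤ v generalizing u v
  · rw [abs_sub_comm, abs_sub_comm (ang z.re |z.im| v)]
    exact this hv hu (le_of_not_ge huv)
  rcases huv.eq_or_lt with rfl | huv
  · simp
  have hsub : Icc u v ⊆ Icc a b := Icc_subset_Icc hu.1 hv.2
  have hsub' : Ioo u v ⊆ Ioo a b := Ioo_subset_Ioo hu.1 hv.2
  have him := h.im_ne_zero hfz
  obtain ⟨hi1, hi2⟩ := image_Ioo_of_strictMono h.continuous_rl hε huv (hm.mono hsub)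
  set α := min (rl f u) (rl f v) with hα
  set β := max (rl f u) (rl f v) with hβ
  have hsl : slitDom (Ioo α β) ⊆ slitDom (rl f '' Ioo a b) := by
    intro w hw
    exact hw.imp id fun h1 => image_mono hsub' (by rw [hi1]; exact h1)
  have hmaps := h.branch_mem_slitDom hsub' hfg hgf
  rw [hi1] at hmaps
  have key := theta_le_of_maps hi2 huv (hg.mono hsl) hmaps (fun y hy => by
    rw [← hi1] at hy
    obtain ⟨t, ht, rfl⟩ := hy
    rw [h.ofReal_rl, hgf t (hsub' ht), Complex.ofReal_im]) hfz (by rw [hgz]; exact him)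
  rw [hgz] at key
  have e1 : theta u v z = |ang z.re |z.im| v - ang z.re |z.im| u| := by
    rw [abs_of_pos (sub_pos.2 (ang_strictMono _ (abs_pos.2 him) huv))]; rfl
  have e2 : theta α β (f z) = |ang (f z).re |(f z).im| (rl f v) - ang (f z).re |(f z).im| (rl f u)| := by
    have hA := ang_strictMono (f z).re (abs_pos.2 hfz)
    rcases le_total (rl f u) (rl f v) with h1 | h1
    · rw [abs_of_nonneg (sub_nonneg.2 (hA.monotone h1)), hα, hβ, min_eq_left h1, max_eq_right h1]; rfl
    · rw [abs_sub_comm, abs_of_nonneg (sub_nonneg.2 (hA.monotone h1)), hα, hβ, min_eq_right h1, max_eq_left h1]; rfl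
  rwa [e1, e2] at key

/-- The composed inverse branch along a stretch of the orbit. -/
theorem RealB.exists_composed_branch (h : RealB f S R₀) {N : ℕ} {a b : ℕ → ℝ} (g : ℕ → ℂ → ℂ)
    (hg : ∀ j ≥ N, DifferentiableOn ℂ (g j) (slitDom (rl f '' Ioo (a j) (b j))))
    (hfg : ∀ j ≥ N, ∀ y ∈ slitDom (rl f '' Ioo (a j) (b j)), f (g j y) = y)
    (hgf : ∀ j ≥ N, ∀ t ∈ Ioo (a j) (b j), g j (f (t : ℂ)) = t)
    (hgz : ∀ j ≥ N, g j (f^[j + 1] z₀) = f^[j] z₀) (k : ℕ) :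
    ∀ i ≥ N, ∀ X : Set ℝ, (∀ w ∈ X, ∀ t < k, (rl f)^[t] w ∈ Ioo (a (i + t)) (b (i + t))) →
      ∃ G : ℂ → ℂ, DifferentiableOn ℂ G (slitDom ((rl f)^[k] '' X)) ∧
        (∀ y ∈ slitDom ((rl f)^[k] '' X), f^[k] (G y) = y) ∧ G (f^[i + k] z₀) = f^[i] z₀ ∧
        MapsTo G (slitDom ((rl f)^[k] '' X)) (slitDom X) := by
  induction k with
  | zero =>
    intro i _ X _
    refine ⟨id, differentiableOn_id, fun y _ => rfl, rfl, ?_⟩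
    rw [Function.iterate_zero, image_id]
    exact mapsTo_id _
  | succ k ih =>
    intro i hi X hX
    obtain ⟨G, hG, hfG, hGz, hGm⟩ := ih (i + 1) (by omega) (rl f '' X) (by
      rintro _ ⟨w, hw, rfl⟩ t ht
      have := hX w hw (t + 1) (by omega)
      rw [Function.iterate_succ_apply] at this
      rwa [show i + 1 + t = i + (t + 1) by ring])
    have hXJ : X ⊆ Ioo (a i) (b i) := fun w hw => hX w hw 0 (Nat.succ_pos k)
    have e : (rl f)^[k] '' (rl f '' X) = (rl f)^[k + 1] '' X := by
      rw [← Set.image_comp]; rfl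
    rw [e] at hG hfG hGm
    have hsl : slitDom (rl f '' X) ⊆ slitDom (rl f '' Ioo (a i) (b i)) :=
      fun w hw => hw.imp id fun h1 => image_mono hXJ h1
    refine ⟨fun y => g i (G y), (hg i hi).comp hG (hGm.mono_right hsl), fun y hy => ?_, ?_, ?_⟩
    · rw [Function.iterate_succ_apply, hfg i hi _ (hsl (hGm hy)), hfG y hy]
    · show g i (G _) = _
      rw [show i + (k + 1) = i + 1 + k by ring, hGz, hgz i hi]
    · exact (h.branch_mem_slitDom hXJ (hfg i hi) (hgf i hi)).comp hGm

theorem Orb.exists_frame (h : RealB f S R₀) (o : Orb f z₀ δ) {B : ℝ} (hB : ∀ n, ‖f^[n] z₀‖ ≤ B) :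
    ∃ C : Finset ℝ, ∀ P : ℝ, ∃ (N : ℕ) (a b ε : ℕ → ℝ),
      Frame (rl f) (fun j => (f^[j] z₀).re) (fun j => |(f^[j] z₀).im|) a b ε C P N ∧
      ∀ i ≥ N, ∀ (k : ℕ) (L p q : ℝ), 0 < L → p < q → Stays (rl f) a b i k p q →
        Covers (rl f) k p q (f^[i + k] z₀).re (L * |(f^[i + k] z₀).im|) →
        f^[k] '' ball (f^[i] z₀) (L * |(f^[i] z₀).im| / 40) ⊆
          ball (f^[i + k] z₀) (L * |(f^[i + k] z₀).im|) := by
  have hB0 : 0 ≤ B := (norm_nonneg _).trans (hB 0)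
  have hs0 := o.tendsto_im h hB
  obtain ⟨C, hC1, hCm, hCp, hC2⟩ := h.exists_crit hB0
  refine ⟨C, fun P => ?_⟩
  set ρ : ℝ := max 2 (2 * P) with hρ
  have hρ2 : 2 ≤ ρ := le_max_left _ _
  have hPρ : P ≤ ρ / 2 := by have := le_max_right 2 (2 * P); linarith
  obtain ⟨N₁, hN₁⟩ := o.affine h hs0 hB ρ (η := 1 / 10) (by norm_num) (by norm_num)
  obtain ⟨N₂, hN₂⟩ := o.deriv_iterate_le h
  have hfar : ∀ c : C, ∃ n : ℕ, ∀ j ≥ n, ρ * |(f^[j] z₀).im| ≤ |(f^[j] z₀).re - c| := by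
    rintro ⟨c, hc⟩
    rcases hC1 c hc with h0 | h0
    · exact o.far_from_critical h hs0 h0 ρ
    · have : Tendsto (fun n => ρ * |(f^[n] z₀).im|) atTop (𝓝 (ρ * 0)) := hs0.const_mul ρ
      rw [mul_zero] at this
      obtain ⟨n, hn⟩ := eventually_atTop.1 (this.eventually (gt_mem_nhds one_pos))
      refine ⟨n, fun j hj => (hn j hj).le.trans ?_⟩
      have h1 : |(f^[j] z₀).re| ≤ B := (Complex.abs_re_le_norm _).trans (hB j)
      have h2 := abs_sub_abs_le_abs_sub c (f^[j] z₀).re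
      rw [abs_sub_comm] at h2
      show 1 ≤ |(f^[j] z₀).re - c|
      linarith
  choose N₃ hN₃ using hfar
  set N := max (max N₁ N₂) (Finset.univ.sup N₃) with hN
  have hNb : ∀ j ≥ N, ∃ a ∈ C, ∃ b ∈ C, a ≤ (f^[j] z₀).re - ρ * |(f^[j] z₀).im| ∧
      (f^[j] z₀).re + ρ * |(f^[j] z₀).im| ≤ b ∧ ∀ c ∈ C, c ≤ a ∨ b ≤ c := by
    intro j hj
    have hsp := o.abs_im_pos j
    have hd : ∀ c ∈ C, ρ * |(f^[j] z₀).im| ≤ |(f^[j] z₀).re - c| := fun c hc =>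
      hN₃ ⟨c, hc⟩ j (le_trans (Finset.le_sup (f := N₃) (Finset.mem_univ _)) (le_trans (le_max_right _ _) hj))
    have h1 : |(f^[j] z₀).re| ≤ B := (Complex.abs_re_le_norm _).trans (hB j)
    rw [abs_le] at h1
    obtain ⟨a, ha, b, hb, hax, hxb, hab⟩ := exists_adjacent (x := (f^[j] z₀).re) hCm hCp
      (by linarith) (by linarith) (fun hc => by
        have := hd _ hc
        rw [sub_self, abs_zero] at this
        have : 0 < ρ * |(f^[j] z₀).im| := by positivity
        linarith)
    have e1 := hd a ha
    have e2 := hd b hb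
    rw [abs_of_pos (show 0 < (f^[j] z₀).re - a by linarith)] at e1
    rw [abs_of_neg (show (f^[j] z₀).re - b < 0 by linarith)] at e2
    exact ⟨a, ha, b, hb, by linarith, by linarith, hab⟩
  choose! a haC b hbC hax hxb hab using hNb
  have hlt : ∀ j ≥ N, a j < b j := fun j hj => by
    have := o.abs_im_pos j
    have h3 : 0 < ρ * |(f^[j] z₀).im| := by positivity
    linarith [hax j hj, hxb j hj]
  have hne : ∀ j ≥ N, ∀ t ∈ Ioo (a j) (b j), deriv f (t : ℂ) ≠ 0 := by
    intro j hj t ht h0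
    have hCB : ∀ c ∈ C, -(B + 1) ≤ a j ∧ b j ≤ B + 1 := by
      intro c _
      have h1 : |(f^[j] z₀).re| ≤ B := (Complex.abs_re_le_norm _).trans (hB j)
      have := o.abs_im_pos j
      have h3 : 0 < ρ * |(f^[j] z₀).im| := by positivity
      rw [abs_le] at h1
      constructor
      · rcases hab j hj _ hCm with h2 | h2
        · exact h2
        · linarith [hxb j hj]
      · rcases hab j hj _ hCp with h2 | h2
        · linarith [hax j hj]
        · exact h2
    have hc := hCB _ hCm
    have := hC2 t (abs_lt.2 ⟨by linarith [ht.1], by linarith [ht.2]⟩) h0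
    rcases hab j hj t this with h2 | h2
    · linarith [ht.1]
    · linarith [ht.2]
  have hstep : ∀ j : ℕ, ∃ (ε : ℝ) (g : ℂ → ℂ), ε ^ 2 = 1 ∧ (N ≤ j →
      StrictMonoOn (fun t => ε * rl f t) (Icc (a j) (b j)) ∧
      ρ / 2 * |(f^[j + 1] z₀).im| ≤ ε * ((f^[j + 1] z₀).re - rl f (a j)) ∧
      ρ / 2 * |(f^[j + 1] z₀).im| ≤ ε * (rl f (b j) - (f^[j + 1] z₀).re) ∧
      DifferentiableOn ℂ g (slitDom (rl f '' Ioo (a j) (b j))) ∧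
      (∀ y ∈ slitDom (rl f '' Ioo (a j) (b j)), f (g y) = y) ∧
      (∀ t ∈ Ioo (a j) (b j), g (f (t : ℂ)) = t) ∧ g (f^[j + 1] z₀) = f^[j] z₀) := by
    intro j
    by_cases hj : N ≤ j
    · obtain ⟨ε, h1, h2, h3, h4, g, h5⟩ := h.step (z := f^[j] z₀) rfl rfl (o.im_ne_zero j) hρ2
        (hN₁ j (le_trans ((le_max_left _ _).trans (le_max_left _ _)) hj)) (hax j hj) (hxb j hj) (hne j hj)
      rw [← Function.iterate_succ_apply' f j z₀] at h3 h4 h5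
      exact ⟨ε, g, h1, fun _ => ⟨h2, h3, h4, h5⟩⟩
    · exact ⟨1, id, by norm_num, fun h0 => absurd h0 hj⟩
  choose ε g hε hstep using hstep
  have F : Frame (rl f) (fun j => (f^[j] z₀).re) (fun j => |(f^[j] z₀).im|) a b ε C P N :=
    { cont := h.continuous_rl
      s_pos := o.abs_im_pos
      mem_a := haC
      mem_b := hbC
      sq := hε
      lt := hlt
      mono := fun j hj => (hstep j hj).1
      cut_a := fun j hj => le_trans (by gcongr) (hstep j hj).2.1
      cut_b := fun j hj => le_trans (by gcongr) (hstep j hj).2.2.1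
      ang_le := fun j hj u hu v hv => by
        obtain ⟨h1, -, -, h2, h3, h4, h5⟩ := hstep j hj
        have := h.ang_le_of_branch (z := f^[j] z₀) (a := a j) (b := b j)
          (by rw [← Function.iterate_succ_apply' f j z₀]; exact o.im_ne_zero _) (hε j) h1 h2 h3 h4
          (by rw [← Function.iterate_succ_apply' f j z₀]; exact h5) hu hv
        rw [← Function.iterate_succ_apply' f j z₀] at this
        exact this }
  refine ⟨N, a, b, ε, F, fun i hi k L p q hL hpq hst hcov => ?_⟩
  obtain ⟨G, hG, hfG, hGz, -⟩ := h.exists_composed_branch g (fun j hj => (hstep j hj).2.2.2.1)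
    (fun j hj => (hstep j hj).2.2.2.2.1) (fun j hj => (hstep j hj).2.2.2.2.2.1)
    (fun j hj => (hstep j hj).2.2.2.2.2.2) k i hi (Ioo p q) (fun w hw t ht => F.mem_Ioo hi hst hw ht)
  set y := f^[i + k] z₀ with hy
  have hsy : 0 < |y.im| := o.abs_im_pos _
  have hsub : ball y (L * |y.im|) ⊆ slitDom ((rl f)^[k] '' Ioo p q) := by
    intro w hw
    by_cases hwi : w.im = 0
    · right
      have h1 : |w.re - y.re| < L * |y.im| := by
        rw [mem_ball, dist_eq_norm] at hw
        exact lt_of_le_of_lt (by simpa using Complex.abs_re_le_norm (w - y)) hw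
      rw [abs_lt] at h1
      have hc := (F.continuous_iterate k).continuousOn (s := Icc p q)
      rcases hcov with ⟨c1, c2⟩ | ⟨c1, c2⟩
      · exact intermediate_value_Ioo hpq.le hc ⟨by linarith, by linarith⟩
      · exact intermediate_value_Ioo' hpq.le hc ⟨by linarith, by linarith⟩
    · exact Or.inl hwi
  have hinj : InjOn G (ball y (L * |y.im|)) := fun u hu v hv huv => by
    rw [← hfG u (hsub hu), ← hfG v (hsub hv), huv]
  have hk := koebe (mul_pos hL hsy) (hG.mono hsub) hinj
  have hyb : y ∈ ball y (L * |y.im|) := mem_ball_self (mul_pos hL hsy)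
  have hdG := deriv_ne_zero_of_right_inverse (f := f^[k]) (G := G) (y := y)
    (h.differentiable_iterate k _)
    ((hG.mono hsub).differentiableAt (isOpen_ball.mem_nhds hyb))
    (by filter_upwards [isOpen_ball.mem_nhds hyb] with w hw using hfG w (hsub hw))
  rw [hGz] at hk hdG
  have h2 := hN₂ i (le_trans ((le_max_right _ _).trans (le_max_left _ _)) hi) k
  have h3 : ‖deriv f^[k] (f^[i] z₀)‖ * ‖deriv G y‖ = 1 := by rw [← norm_mul, hdG, norm_one]
  have h4 : |(f^[i] z₀).im| ≤ 2 * |y.im| * ‖deriv G y‖ := by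
    have h5 : ‖deriv f^[k] (f^[i] z₀)‖ * |(f^[i] z₀).im| * ‖deriv G y‖ ≤ 2 * |y.im| * ‖deriv G y‖ := by
      gcongr
    calc |(f^[i] z₀).im| = (‖deriv f^[k] (f^[i] z₀)‖ * ‖deriv G y‖) * |(f^[i] z₀).im| := by rw [h3, one_mul]
      _ = ‖deriv f^[k] (f^[i] z₀)‖ * |(f^[i] z₀).im| * ‖deriv G y‖ := by ring
      _ ≤ _ := h5
  rintro _ ⟨w, hw, rfl⟩
  have hwk : w ∈ ball (f^[i] z₀) (L * |y.im| * ‖deriv G y‖ / 20) := by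
    refine ball_subset_ball ?_ hw
    nlinarith
  obtain ⟨u, hu, rfl⟩ := hk hwk
  rw [hfG u (hsub hu)]
  exact hu

end

section
variable {f : ℂ → ℂ} {S : Set ℂ} {R₀ : ℝ} {z₀ : ℂ} {δ : ℝ}
variable {φ : ℝ → ℝ} {x s a b ε : ℕ → ℝ} {C : Finset ℝ} {P : ℝ} {N : ℕ}

theorem ang_lt (x s t : ℝ) : ang x s t < Real.pi / 2 := Real.arctan_lt_pi_div_two _

theorem neg_lt_ang (x s t : ℝ) : -(Real.pi / 2) < ang x s t := Real.neg_pi_div_two_lt_arctan _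

theorem ang_self (x s : ℝ) : ang x s x = 0 := by simp [ang]

theorem ang_reflect (x s t : ℝ) : ang x s (2 * x - t) = -ang x s t := by
  rw [ang, ang, ← Real.arctan_neg]; congr 1; ring

theorem le_ang {x s t K : ℝ} (hs : 0 < s) (hK : 0 < K) (h : x + K * s ≤ t) :
    Real.pi / 2 - 1 / K ≤ ang x s t := by
  have h1 : K ≤ (t - x) / s := by rw [le_div_iff₀ hs]; linarith
  have h2 := Real.arctan_strictMono.monotone h1
  have h3 := Real.arctan_inv_of_pos hK
  have h4 : Real.arctan K⁻¹ ≤ K⁻¹ := by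
    have h0 := Real.lt_tan (x := Real.arctan K⁻¹) (Real.arctan_pos.2 (by positivity)) (Real.arctan_lt_pi_div_two _)
    rw [Real.tan_arctan] at h0; exact h0.le
  rw [one_div]
  simp only [ang]; linarith

theorem ang_le' {x s t K : ℝ} (hs : 0 < s) (hK : 0 < K) (h : t ≤ x - K * s) :
    ang x s t ≤ -(Real.pi / 2) + 1 / K := by
  have := le_ang (x := x) (t := 2 * x - t) hs hK (by linarith)
  rw [ang_reflect] at this; linarith

theorem le_of_le_ang {x s t κ : ℝ} (hs : 0 < s) (hκ : 0 < κ) (hκ1 : κ ≤ 1 / 2)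
    (h : Real.pi / 2 - κ ≤ ang x s t) : x + 1 / (2 * κ) * s ≤ t := by
  have hpi := Real.pi_gt_three
  have h1 : Real.tan (Real.pi / 2 - κ) ≤ (t - x) / s := by
    have := Real.strictMonoOn_tan.monotoneOn (a := Real.pi / 2 - κ) (b := ang x s t)
      ⟨by linarith, by linarith⟩ ⟨neg_lt_ang _ _ _, ang_lt _ _ _⟩ h
    rwa [ang, Real.tan_arctan] at this
  rw [Real.tan_pi_div_two_sub] at h1
  have hc : 1 / 2 ≤ Real.cos κ := by
    have := Real.one_sub_sq_div_two_le_cos (x := κ)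
    nlinarith
  have hsn : Real.sin κ ≤ κ := Real.sin_le hκ.le
  have hs0 : 0 < Real.sin κ := Real.sin_pos_of_pos_of_lt_pi hκ (by linarith)
  have h2 : 1 / (2 * κ) ≤ (Real.tan κ)⁻¹ := by
    rw [Real.tan_eq_sin_div_cos, inv_div, div_le_div_iff₀ (by positivity) hs0]
    nlinarith
  have h3 := h2.trans h1
  rw [le_div_iff₀ hs] at h3
  linarith

theorem le_of_ang_le {x s t κ : ℝ} (hs : 0 < s) (hκ : 0 < κ) (hκ1 : κ ≤ 1 / 2)
    (h : ang x s t ≤ -(Real.pi / 2) + κ) : t ≤ x - 1 / (2 * κ) * s := by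
  have := le_of_le_ang (x := x) (t := 2 * x - t) hs hκ hκ1 (by rw [ang_reflect]; linarith)
  linarith

/-- The angle under which the `k`-th image of `[u, v]` is seen at time `i + k`. -/
noncomputable def gap (φ : ℝ → ℝ) (x s : ℕ → ℝ) (i k : ℕ) (u v : ℝ) : ℝ :=
  |ang (x (i + k)) (s (i + k)) (φ^[k] v) - ang (x (i + k)) (s (i + k)) (φ^[k] u)|

theorem gap_comm (i k : ℕ) (u v : ℝ) : gap φ x s i k u v = gap φ x s i k v u := abs_sub_comm _ _

theorem gap_triangle (i k : ℕ) (u v w : ℝ) :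
    gap φ x s i k u w ≤ gap φ x s i k u v + gap φ x s i k v w := by
  simp only [gap]; rw [add_comm (|_ - _|)]; exact abs_sub_le _ _ _

theorem gap_self (i k : ℕ) (u : ℝ) : gap φ x s i k u u = 0 := by simp [gap]

theorem gap_succ (i k : ℕ) (u v : ℝ) :
    gap φ x s i (k + 1) u v = gap φ x s (i + 1) k (φ u) (φ v) := by
  simp only [gap, Function.iterate_succ_apply, show i + (k + 1) = i + 1 + k by ring]

theorem gap_zero_of_le (i : ℕ) {u v : ℝ} (hs : 0 < s i) (huv : u ≤ v) :
    gap φ x s i 0 u v = ang (x i) (s i) v - ang (x i) (s i) u := by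
  simp only [gap, add_zero, show ∀ w, φ^[0] w = w from fun _ => rfl]
  exact abs_of_nonneg (sub_nonneg.2 ((ang_strictMono _ hs).monotone huv))

theorem Frame.gap_le (F : Frame φ x s a b ε C P N) {i k : ℕ} (hi : N ≤ i) {p q u v : ℝ}
    (hst : Stays φ a b i k p q) (hu : u ∈ Icc p q) (hv : v ∈ Icc p q) :
    gap φ x s i k u v ≤ gap φ x s i 0 u v := by
  induction k with
  | zero => exact le_rfl
  | succ k ih =>
    refine le_trans ?_ (ih (hst.mono (Nat.le_succ k) le_rfl le_rfl))
    have := F.ang_le (i + k) (by omega) _ (hst u hu k (Nat.lt_succ_self k)) _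
      (hst v hv k (Nat.lt_succ_self k))
    simp only [gap, Function.iterate_succ_apply']
    exact this

theorem covers_of_gap {i k : ℕ} {u v κ L : ℝ} (hs : 0 < s (i + k)) (hκ : 0 < κ) (hκ1 : κ ≤ 1 / 2)
    (hL : L ≤ 1 / (2 * κ)) (h : Real.pi - κ ≤ gap φ x s i k u v) :
    Covers φ k u v (x (i + k)) (L * s (i + k)) := by
  have hLs : L * s (i + k) ≤ 1 / (2 * κ) * s (i + k) := by gcongr
  have h1 := ang_lt (x (i + k)) (s (i + k)) (φ^[k] v)
  have h2 := ang_lt (x (i + k)) (s (i + k)) (φ^[k] u)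
  have h3 := neg_lt_ang (x (i + k)) (s (i + k)) (φ^[k] v)
  have h4 := neg_lt_ang (x (i + k)) (s (i + k)) (φ^[k] u)
  rw [gap] at h
  rcases le_total 0 (ang (x (i + k)) (s (i + k)) (φ^[k] v) - ang (x (i + k)) (s (i + k)) (φ^[k] u)) with h0 | h0
  · rw [abs_of_nonneg h0] at h
    have e1 := le_of_le_ang hs hκ hκ1 (t := φ^[k] v) (x := x (i + k)) (by linarith)
    have e2 := le_of_ang_le hs hκ hκ1 (t := φ^[k] u) (x := x (i + k)) (by linarith)
    exact Or.inl ⟨by linarith, by linarith⟩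
  · rw [abs_of_nonpos h0] at h
    have e1 := le_of_le_ang hs hκ hκ1 (t := φ^[k] u) (x := x (i + k)) (by linarith)
    have e2 := le_of_ang_le hs hκ hκ1 (t := φ^[k] v) (x := x (i + k)) (by linarith)
    exact Or.inr ⟨by linarith, by linarith⟩

/-- Pulling back an interval `[l, r]` about `y` along one monotone branch. -/
theorem exists_pullback {φ : ℝ → ℝ} (hφ : Continuous φ) {ε a b l r y c : ℝ} (hε : ε ^ 2 = 1) (hab : a < b)
    (hm : StrictMonoOn (fun t => ε * φ t) (Icc a b)) (ha : c ≤ ε * (y - φ a)) (hb : c ≤ ε * (φ b - y))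
    (hc : 0 < c) (hl : l < y) (hr : y < r) :
    ∃ pl pr p q, a ≤ pl ∧ pl < pr ∧ pr ≤ b ∧ MapsTo φ (Icc pl pr) (Icc l r) ∧
      (l ≤ p ∧ p < y ∧ y < q ∧ q ≤ r) ∧ (p = l ∨ p ≤ y - c) ∧ (q = r ∨ y + c ≤ q) ∧
      ((φ pl = p ∧ φ pr = q) ∨ (φ pl = q ∧ φ pr = p)) ∧
      (pl = a ∨ pr = b ∨ (p = l ∧ q = r)) := by
  have pos : ∀ {φ : ℝ → ℝ} {l r y : ℝ}, Continuous φ → StrictMonoOn φ (Icc a b) → c ≤ y - φ a →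
      c ≤ φ b - y → l < y → y < r →
      ∃ pl pr p q, a ≤ pl ∧ pl < pr ∧ pr ≤ b ∧ MapsTo φ (Icc pl pr) (Icc l r) ∧
      (l ≤ p ∧ p < y ∧ y < q ∧ q ≤ r) ∧ (p = l ∨ p ≤ y - c) ∧ (q = r ∨ y + c ≤ q) ∧
      (φ pl = p ∧ φ pr = q) ∧ (pl = a ∨ pr = b ∨ (p = l ∧ q = r)) := by
    intro φ l r y hφ hm ha hb hl hr
    have hφc := hφ.continuousOn (s := Icc a b)
    obtain ⟨pl, hpl, hpl1, hpl2⟩ : ∃ pl ∈ Icc a b, φ pl = max l (φ a) ∧ (pl = a ∨ max l (φ a) = l) := by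
      rcases le_total l (φ a) with h0 | h0
      · exact ⟨a, ⟨le_rfl, hab.le⟩, by rw [max_eq_right h0], Or.inl rfl⟩
      · obtain ⟨t, ht, ht'⟩ := intermediate_value_Icc hab.le hφc (show l ∈ Icc (φ a) (φ b) from ⟨h0, by linarith⟩)
        exact ⟨t, ht, by rw [max_eq_left h0, ht'], Or.inr (max_eq_left h0)⟩
    obtain ⟨pr, hpr, hpr1, hpr2⟩ : ∃ pr ∈ Icc a b, φ pr = min r (φ b) ∧ (pr = b ∨ min r (φ b) = r) := by
      rcases le_total r (φ b) with h0 | h0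
      · obtain ⟨t, ht, ht'⟩ := intermediate_value_Icc hab.le hφc (show r ∈ Icc (φ a) (φ b) from ⟨by linarith, h0⟩)
        exact ⟨t, ht, by rw [min_eq_left h0, ht'], Or.inr (min_eq_left h0)⟩
      · exact ⟨b, ⟨hab.le, le_rfl⟩, by rw [min_eq_right h0], Or.inl rfl⟩
    have hp : max l (φ a) < y := max_lt hl (by linarith)
    have hq : y < min r (φ b) := lt_min hr (by linarith)
    have hlt : pl < pr := by
      rw [← hm.lt_iff_lt hpl hpr, hpl1, hpr1]; linarith
    refine ⟨pl, pr, _, _, hpl.1, hlt, hpr.2, ?_, ⟨le_max_left _ _, hp, hq, min_le_left _ _⟩, ?_, ?_,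
      ⟨hpl1, hpr1⟩, ?_⟩
    · intro w hw
      have hw' : w ∈ Icc a b := ⟨hpl.1.trans hw.1, hw.2.trans hpr.2⟩
      have h1 := hm.monotoneOn hpl hw' hw.1
      have h2 := hm.monotoneOn hw' hpr hw.2
      rw [hpl1] at h1; rw [hpr1] at h2
      exact ⟨(le_max_left _ _).trans h1, h2.trans (min_le_left _ _)⟩
    · rcases le_total l (φ a) with h0 | h0
      · right; rw [max_eq_right h0]; linarith
      · left; exact max_eq_left h0
    · rcases le_total r (φ b) with h0 | h0
      · left; exact min_eq_left h0
      · right; rw [min_eq_right h0]; linarith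
    · tauto
  rcases sq_eq_one_iff.1 hε with rfl | rfl
  · simp only [one_mul] at hm ha hb
    obtain ⟨pl, pr, p, q, h1, h2, h3, h4, h5, h6, h7, h8, h9⟩ := pos hφ hm ha hb hl hr
    exact ⟨pl, pr, p, q, h1, h2, h3, h4, h5, h6, h7, Or.inl h8, h9⟩
  · obtain ⟨pl, pr, p, q, h1, h2, h3, h4, h5, h6, h7, h8, h9⟩ :=
      pos (φ := fun t => -1 * φ t) (l := -r) (r := -l) (y := -y) (by fun_prop) hm (by linarith) (by linarith)
        (by linarith) (by linarith)
    refine ⟨pl, pr, -q, -p, h1, h2, h3, ?_, ⟨by linarith, by linarith, by linarith, by linarith⟩, ?_, ?_, ?_, ?_⟩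
    · intro w hw
      have := h4 hw
      exact ⟨by linarith [this.2], by linarith [this.1]⟩
    · rcases h7 with h | h
      · left; linarith
      · right; linarith
    · rcases h6 with h | h
      · left; linarith
      · right; linarith
    · right; exact ⟨by linarith [h8.1], by linarith [h8.2]⟩
    · rcases h9 with h | h | h
      · exact Or.inl h
      · exact Or.inr (Or.inl h)
      · exact Or.inr (Or.inr ⟨by linarith [h.2], by linarith [h.1]⟩)

end

section
variable {φ : ℝ → ℝ} {x s a b ε : ℕ → ℝ} {C : Finset ℝ} {P : ℝ} {N : ℕ}

/-- An interval at a given time: the pullback `[pl, pr]`, its truncation `[l, r]`, and the number of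
truncations performed so far. -/
structure St where
  l : ℝ
  r : ℝ
  pl : ℝ
  pr : ℝ
  m : ℕ

/-- The state `v` at time `i` has the required properties up to time `n`. -/
structure Good (φ : ℝ → ℝ) (x s a b κ : ℕ → ℝ) (n i : ℕ) (v : St) : Prop where
  lt : v.l < v.r
  stays : Stays φ a b i (n - i) v.l v.r
  gap : ∀ k, i + k ≤ n → Real.pi - κ v.m ≤ gap φ x s i k v.l v.r

/-- The state `u` at time `i` is obtained by pulling back the state `v` at time `i + 1`. -/
structure Link (φ : ℝ → ℝ) (x s a b κ : ℕ → ℝ) (n i : ℕ) (u v : St) : Prop where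
  le₁ : a i ≤ u.pl
  le₂ : u.pl ≤ u.l
  lt : u.l < u.r
  le₃ : u.r ≤ u.pr
  le₄ : u.pr ≤ b i
  maps : MapsTo φ (Icc u.pl u.pr) (Icc v.l v.r)
  gap_pre : ∀ k, i + k ≤ n → Real.pi - 2 * κ v.m ≤ gap φ x s i k u.pl u.pr
  gap : ∀ k, i + k ≤ n → Real.pi - κ u.m ≤ gap φ x s i k u.l u.r
  event : u.m = v.m ∨ (u.m = v.m + 1 ∧ x i - 8 / κ u.m * s i ≤ u.l ∧
    u.r ≤ x i + 8 / κ u.m * s i ∧ (u.pl = a i ∨ u.pr = b i))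

theorem Link.stays_pre {κ : ℕ → ℝ} {n i : ℕ} {u v : St} (h : Link φ x s a b κ n i u v)
    (hv : Stays φ a b (i + 1) (n - (i + 1)) v.l v.r) : Stays φ a b i (n - i) u.pl u.pr := by
  rintro w hw (_ | t) ht
  · exact ⟨h.le₁.trans hw.1, hw.2.trans h.le₄⟩
  · have := hv _ (h.maps hw) t (by omega)
    rwa [show i + 1 + t = i + (t + 1) by ring] at this

theorem Link.good {κ : ℕ → ℝ} {n i : ℕ} {u v : St} (h : Link φ x s a b κ n i u v)
    (hv : Good φ x s a b κ n (i + 1) v) : Good φ x s a b κ n i u :=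
  ⟨h.lt, (h.stays_pre hv.stays).mono le_rfl h.le₂ h.le₃, h.gap⟩

theorem Frame.exists_link (F : Frame φ x s a b ε C P N) {κ : ℕ → ℝ} {n i : ℕ} (hi : N ≤ i) (hin : i < n)
    {v : St} (hv : Good φ x s a b κ n (i + 1) v) (hκ : 0 < κ v.m) (hκ' : 0 < κ (v.m + 1))
    (hκ1 : κ (v.m + 1) ≤ 1 / 2) (hκ2 : κ v.m ≤ κ (v.m + 1) ^ 2 / 10 ^ 7) (hP : 2 / κ v.m ≤ P) :
    ∃ u, Link φ x s a b κ n i u v := by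
  have hpi := Real.pi_gt_three
  have hκ3 : κ v.m ≤ κ (v.m + 1) / 10 ^ 6 := by nlinarith
  have hP0 : 0 < P := lt_of_lt_of_le (by positivity) hP
  have hPκ : 1 / P ≤ κ v.m / 2 := by
    rw [div_le_div_iff₀ hP0 two_pos, one_mul]
    rw [div_le_iff₀ hκ] at hP; linarith
  have hs1 := F.s_pos (i + 1)
  have hs0 := F.s_pos i
  set X := x (i + 1) with hX
  set s1 := s (i + 1) with hs1'
  have hg0 := hv.gap 0 (by omega)
  have hlx : v.l < X := by
    by_contra hcon
    push Not at hcon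
    have h1 := (ang_strictMono X hs1).monotone hcon
    rw [ang_self] at h1
    rw [gap_zero_of_le _ hs1 hv.lt.le] at hg0
    linarith [ang_lt X s1 v.r]
  have hxr : X < v.r := by
    by_contra hcon
    push Not at hcon
    have h1 := (ang_strictMono X hs1).monotone hcon
    rw [ang_self] at h1
    rw [gap_zero_of_le _ hs1 hv.lt.le] at hg0
    linarith [neg_lt_ang X s1 v.l]
  obtain ⟨pl, pr, p, q, hapl, hplr, hprb, hmaps, ⟨hlp, hpX, hXq, hqr⟩, hp, hq, hends, hev⟩ :=
    exists_pullback F.cont (F.sq i) (F.lt i hi) (F.mono i hi) (F.cut_a i hi) (F.cut_b i hi)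
      (mul_pos hP0 hs1) hlx hxr
  have hst1 : Stays φ a b i 1 pl pr := by
    intro w hw t ht
    obtain rfl : t = 0 := by omega
    exact ⟨hapl.trans hw.1, hw.2.trans hprb⟩
  -- the loss at the later times
  have hloss : ∀ k, i + 1 + k ≤ n → ∀ c, Real.pi - κ v.m - (gap φ x s (i + 1) 0 v.l p +
      gap φ x s (i + 1) 0 q v.r) = c → c ≤ gap φ x s i (k + 1) pl pr := by
    intro k hk c hc
    have e1 := hv.gap k hk
    have hst := hv.stays.mono (k' := k) (by omega) le_rfl le_rfl
    have hl : v.l ∈ Icc v.l v.r := ⟨le_rfl, hv.lt.le⟩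
    have hr : v.r ∈ Icc v.l v.r := ⟨hv.lt.le, le_rfl⟩
    have e2 := F.gap_le (by omega) hst hl ⟨hlp, by linarith⟩ (v := p)
    have e3 := F.gap_le (by omega) hst (show q ∈ Icc v.l v.r from ⟨by linarith, hqr⟩) hr
    have e4 := gap_triangle (φ := φ) (x := x) (s := s) (i + 1) k v.l p v.r
    have e5 := gap_triangle (φ := φ) (x := x) (s := s) (i + 1) k p q v.r
    have e6 : gap φ x s i (k + 1) pl pr = gap φ x s (i + 1) k p q := by
      rw [gap_succ]
      rcases hends with ⟨h1, h2⟩ | ⟨h1, h2⟩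
      · rw [h1, h2]
      · rw [h1, h2, gap_comm]
    linarith
  have hloss' : ∀ k, i + k ≤ n → ∀ c, Real.pi - κ v.m - (gap φ x s (i + 1) 0 v.l p +
      gap φ x s (i + 1) 0 q v.r) = c → c ≤ gap φ x s i k pl pr := by
    rintro (_ | k) hk c hc
    · exact (hloss 0 (by omega) c hc).trans
        (F.gap_le hi hst1 ⟨le_rfl, hplr.le⟩ ⟨hplr.le, le_rfl⟩)
    · exact hloss k (by omega) c hc
  have hgp : gap φ x s (i + 1) 0 v.l p ≤ 1 / P := by
    rcases hp with h0 | h0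
    · rw [h0, gap_self]; positivity
    · rw [gap_zero_of_le _ hs1 hlp]
      linarith [ang_le' hs1 hP0 h0, neg_lt_ang X s1 v.l]
  have hgq : gap φ x s (i + 1) 0 q v.r ≤ 1 / P := by
    rcases hq with h0 | h0
    · rw [h0, gap_self]; positivity
    · rw [gap_zero_of_le _ hs1 hqr]
      linarith [le_ang hs1 hP0 h0, ang_lt X s1 v.r]
  have hpre : ∀ k, i + k ≤ n → Real.pi - 2 * κ v.m ≤ gap φ x s i k pl pr := fun k hk => by
    have := hloss' k hk _ rfl
    linarith
  by_cases hno : p = v.l ∧ q = v.r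
  · refine ⟨⟨pl, pr, pl, pr, v.m⟩, hapl, le_rfl, hplr, le_rfl, hprb, hmaps, hpre, fun k hk => ?_,
      Or.inl rfl⟩
    have := hloss' k hk _ rfl
    rw [hno.1, hno.2, gap_self, gap_self] at this
    linarith
  · have hev : pl = a i ∨ pr = b i := by tauto
    set A := 8 / κ (v.m + 1) with hA
    have hA0 : 0 < A := by positivity
    have hAi : 1 / A = κ (v.m + 1) / 8 := by rw [hA, one_div, inv_div]
    have h0 := hpre 0 (by omega)
    rw [gap_zero_of_le _ hs0 hplr.le] at h0
    have hplx : pl < x i := by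
      by_contra hcon
      push Not at hcon
      have h1 := (ang_strictMono (x i) hs0).monotone hcon
      rw [ang_self] at h1
      linarith [ang_lt (x i) (s i) pr]
    have hxpr : x i < pr := by
      by_contra hcon
      push Not at hcon
      have h1 := (ang_strictMono (x i) hs0).monotone hcon
      rw [ang_self] at h1
      linarith [neg_lt_ang (x i) (s i) pl]
    have hAs : 0 < A * s i := by positivity
    set l' := max pl (x i - A * s i) with hl'
    set r' := min pr (x i + A * s i) with hr'
    have hl'x : l' < x i := max_lt hplx (by linarith)
    have hxr' : x i < r' := lt_min hxpr (by linarith)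
    refine ⟨⟨l', r', pl, pr, v.m + 1⟩, hapl, le_max_left _ _, hl'x.trans hxr', min_le_left _ _, hprb,
      hmaps, hpre, fun k hk => ?_, Or.inr ⟨rfl, le_max_right _ _, min_le_right _ _, hev⟩⟩
    have hstp : Stays φ a b i k pl pr := by
      rintro w hw (_ | t) ht
      · exact hst1 w hw 0 one_pos
      · have := hv.stays _ (hmaps hw) t (by omega)
        rwa [show i + 1 + t = i + (t + 1) by ring] at this
    have e1 := hpre k hk
    have e2 := F.gap_le hi hstp ⟨le_rfl, hplr.le⟩ (v := l') ⟨le_max_left _ _, by linarith⟩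
    have e3 := F.gap_le hi hstp (u := r') ⟨by linarith, min_le_left _ _⟩ ⟨hplr.le, le_rfl⟩
    have e4 := gap_triangle (φ := φ) (x := x) (s := s) i k pl l' pr
    have e5 := gap_triangle (φ := φ) (x := x) (s := s) i k l' r' pr
    have e6 : gap φ x s i 0 pl l' ≤ 1 / A := by
      rcases max_choice pl (x i - A * s i) with h1 | h1
      · rw [hl', h1, gap_self]; positivity
      · rw [gap_zero_of_le _ hs0 (le_max_left _ _), h1]
        linarith [ang_le' hs0 hA0 (le_refl (x i - A * s i)), neg_lt_ang (x i) (s i) pl]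
    have e7 : gap φ x s i 0 r' pr ≤ 1 / A := by
      rcases min_choice pr (x i + A * s i) with h1 | h1
      · rw [hr', h1, gap_self]; positivity
      · rw [gap_zero_of_le _ hs0 (min_le_left _ _), h1]
        linarith [le_ang hs0 hA0 (le_refl (x i + A * s i)), ang_lt (x i) (s i) pr]
    show Real.pi - κ (v.m + 1) ≤ gap φ x s i k l' r'
    rw [hAi] at e6 e7
    linarith
end

section
variable {φ : ℝ → ℝ} {x s a b ε : ℕ → ℝ} {C : Finset ℝ} {P : ℝ} {N : ℕ}
variable {κ : ℕ → ℝ} {K : ℝ} {M n j : ℕ} {st : ℕ → St}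

theorem orient_add (ε : ℕ → ℝ) (i k k' : ℕ) :
    orient ε i (k + k') = orient ε i k * orient ε (i + k) k' := by
  simp only [orient, Finset.prod_range_add, add_assoc]

theorem abs_sub_le_of_abs_ang_le {x s w : ℝ} (hs : 0 < s) (h1 : ang x s w ≤ 1 / 2)
    (h2 : -(1 / 2) ≤ ang x s w) : |w - x| ≤ s := by
  have hpi := Real.pi_gt_three
  have h3 : (w - x) / s < 1 := by
    rw [← Real.arctan_lt_arctan_iff, Real.arctan_one]
    rw [ang] at h1; linarith
  have h4 : -1 < (w - x) / s := by
    rw [← Real.arctan_lt_arctan_iff, Real.arctan_neg, Real.arctan_one]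
    rw [ang] at h2; linarith
  rw [div_lt_one hs] at h3
  rw [lt_div_iff₀ hs] at h4
  rw [abs_le]; constructor <;> linarith

theorem ends_of_gap {i k : ℕ} {u v c : ℝ} (hc : Real.pi - c ≤ gap φ x s i k u v) :
    (Real.pi / 2 - c ≤ ang (x (i + k)) (s (i + k)) (φ^[k] u) ∧
      ang (x (i + k)) (s (i + k)) (φ^[k] v) ≤ -(Real.pi / 2) + c) ∨
    (Real.pi / 2 - c ≤ ang (x (i + k)) (s (i + k)) (φ^[k] v) ∧
      ang (x (i + k)) (s (i + k)) (φ^[k] u) ≤ -(Real.pi / 2) + c) := by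
  have h1 := ang_lt (x (i + k)) (s (i + k)) (φ^[k] v)
  have h2 := ang_lt (x (i + k)) (s (i + k)) (φ^[k] u)
  have h3 := neg_lt_ang (x (i + k)) (s (i + k)) (φ^[k] v)
  have h4 := neg_lt_ang (x (i + k)) (s (i + k)) (φ^[k] u)
  rw [gap] at hc
  rcases abs_cases (ang (x (i + k)) (s (i + k)) (φ^[k] v) - ang (x (i + k)) (s (i + k)) (φ^[k] u))
    with ⟨h5, -⟩ | ⟨h5, -⟩
  · exact Or.inr ⟨by linarith, by linarith⟩
  · exact Or.inl ⟨by linarith, by linarith⟩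

theorem near_of_good (F : Frame φ x s a b ε C P N) {i : ℕ} (hi : N ≤ i) (hin : i ≤ n) {v : St}
    (hg : Good φ x s a b κ n i v) (hκ : κ v.m ≤ 1 / 2) {w : ℝ} (hw : w ∈ Icc v.l v.r)
    (hwn : φ^[n - i] w = x n) : |w - x i| ≤ s i := by
  have hpi := Real.pi_gt_three
  obtain ⟨k, rfl⟩ := Nat.exists_eq_add_of_le hin
  rw [Nat.add_sub_cancel_left] at hwn
  have hst := hg.stays
  rw [Nat.add_sub_cancel_left] at hst
  have hl : v.l ∈ Icc v.l v.r := ⟨le_rfl, hg.lt.le⟩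
  have hr : v.r ∈ Icc v.l v.r := ⟨hg.lt.le, le_rfl⟩
  have e1 := F.gap_le hi hst hl hw
  have e2 := F.gap_le hi hst hw hr
  rw [gap_zero_of_le _ (F.s_pos i) hw.1] at e1
  rw [gap_zero_of_le _ (F.s_pos i) hw.2] at e2
  rw [gap, hwn, ang_self] at e1 e2
  have e1' := neg_abs_le (0 - ang (x (i + k)) (s (i + k)) (φ^[k] v.l))
  have e1'' := le_abs_self (0 - ang (x (i + k)) (s (i + k)) (φ^[k] v.l))
  have e2' := neg_abs_le (ang (x (i + k)) (s (i + k)) (φ^[k] v.r) - 0)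
  have e2'' := le_abs_self (ang (x (i + k)) (s (i + k)) (φ^[k] v.r) - 0)
  have h3 := neg_lt_ang (x i) (s i) v.l
  have h4 := ang_lt (x i) (s i) v.r
  apply abs_sub_le_of_abs_ang_le (F.s_pos i)
  · rcases ends_of_gap (hg.gap k le_rfl) with ⟨h5, h6⟩ | ⟨h5, h6⟩ <;> linarith
  · rcases ends_of_gap (hg.gap k le_rfl) with ⟨h5, h6⟩ | ⟨h5, h6⟩ <;> linarith

theorem exists_tau (F : Frame φ x s a b ε C P N) {i : ℕ} (hin : i ≤ n) {v : St}
    (hg : Good φ x s a b κ n i v) (hκ : κ v.m ≤ 1 / 2) : ∃ w ∈ Icc v.l v.r, φ^[n - i] w = x n := by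
  have hpi := Real.pi_gt_three
  obtain ⟨k, rfl⟩ := Nat.exists_eq_add_of_le hin
  rw [Nat.add_sub_cancel_left]
  have hc := (F.continuous_iterate k).continuousOn (s := Icc v.l v.r)
  have hm := (ang_strictMono (x (i + k)) (F.s_pos (i + k)))
  have key : ∀ t, (0 ≤ ang (x (i + k)) (s (i + k)) t → x (i + k) ≤ t) ∧
      (ang (x (i + k)) (s (i + k)) t ≤ 0 → t ≤ x (i + k)) := fun t =>
    ⟨fun h => by rwa [← ang_self (x (i + k)) (s (i + k)), hm.le_iff_le] at h,
      fun h => by rwa [← ang_self (x (i + k)) (s (i + k)), hm.le_iff_le] at h⟩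
  rcases ends_of_gap (hg.gap k le_rfl) with ⟨h5, h6⟩ | ⟨h5, h6⟩
  · exact intermediate_value_Icc' hg.lt.le hc ⟨(key _).2 (by linarith), (key _).1 (by linarith)⟩
  · exact intermediate_value_Icc hg.lt.le hc ⟨(key _).2 (by linarith), (key _).1 (by linarith)⟩

/-- A chain of pullbacks from time `n` back to time `j`. -/
structure Trace (φ : ℝ → ℝ) (x s a b κ : ℕ → ℝ) (K : ℝ) (n j : ℕ) (st : ℕ → St) : Prop where
  le : j ≤ n
  good : ∀ i, j ≤ i → i ≤ n → Good φ x s a b κ n i (st i)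
  link : ∀ i, j ≤ i → i < n → Link φ x s a b κ n i (st i) (st (i + 1))
  init_l : (st n).l = x n - K * s n
  init_r : (st n).r = x n + K * s n
  init_m : (st n).m = 0

theorem Trace.maps (T : Trace φ x s a b κ K n j st) {i t : ℕ} (hi : j ≤ i) (ht : i + t ≤ n) :
    MapsTo φ^[t] (Icc (st i).l (st i).r) (Icc (st (i + t)).l (st (i + t)).r) := by
  induction t with
  | zero => exact mapsTo_id _
  | succ t ih =>
    rw [Function.iterate_succ']
    have hL := T.link (i + t) (by omega) (by omega)
    exact (hL.maps.mono_left (Icc_subset_Icc hL.le₂ hL.le₃)).comp (ih (by omega))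

theorem Trace.maps_pre (T : Trace φ x s a b κ K n j st) {i t : ℕ} (hi : j ≤ i) (ht0 : 1 ≤ t)
    (ht : i + t ≤ n) :
    MapsTo φ^[t] (Icc (st i).pl (st i).pr) (Icc (st (i + t)).l (st (i + t)).r) := by
  obtain ⟨t, rfl⟩ := Nat.exists_eq_add_of_le' ht0
  rw [Function.iterate_succ]
  have := (T.maps (i := i + 1) (t := t) (by omega) (by omega)).comp (T.link i hi (by omega)).maps
  rwa [show i + 1 + t = i + (t + 1) by ring] at this

theorem Trace.m_anti (T : Trace φ x s a b κ K n j st) {i t : ℕ} (hi : j ≤ i) (ht : i + t ≤ n) :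
    (st (i + t)).m ≤ (st i).m := by
  induction t with
  | zero => exact le_rfl
  | succ t ih =>
    refine le_trans ?_ (ih (by omega))
    rcases (T.link (i + t) (by omega) (by omega)).event with h | ⟨h, -⟩
    · exact h.ge
    · rw [← add_assoc]; omega

/-- The orbit is not attracted: no interval around an orbit point is mapped over a much smaller
neighbourhood of a later orbit point nearby. -/
def NotAttracted (φ : ℝ → ℝ) (x s a b : ℕ → ℝ) (N : ℕ) : Prop :=
  ∀ i ≥ N, ∀ (k : ℕ) (L p q : ℝ), 1 ≤ L → 1 ≤ k → p < q → Stays φ a b i k p q →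
    Covers φ k p q (x (i + k)) (L * s (i + k)) →
    |x i - x (i + k)| + s i + s (i + k) + L * s (i + k) ≤ L * s i / 40 → False

theorem Trace.tau_notMem (F : Frame φ x s a b ε C P N) (hA : NotAttracted φ x s a b N)
    (T : Trace φ x s a b κ K n j st) (hj : N ≤ j) (hK : 0 ≤ K)
    (hbox : ∀ i ≥ N, ∀ n, |x n - x i| ≤ (K + 1) * s i → 1 / (K + 1000) * s i ≤ s n → s n ≤ s i → n = i)
    (hrec : ∀ i ≥ N, i ≤ n → s n ≤ s i) (hκ : ∀ m, 0 < κ m) (hκ1 : ∀ m, κ m ≤ 1 / 10 ^ 4)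
    {i : ℕ} (hi : j ≤ i) (hin : i < n)
    {w : ℝ} (hw : w ∈ Icc (st i).l (st i).r) (hwn : φ^[n - i] w = x n) :
    w ∉ Icc (st n).l (st n).r := by
  intro hwT
  rw [T.init_l, T.init_r] at hwT
  have hg := T.good i hi hin.le
  have h1 := near_of_good F (hj.trans hi) hin.le hg ((hκ1 _).trans (by norm_num)) hw hwn
  have h2 := hrec i (hj.trans hi) hin.le
  have hs := F.s_pos i
  have hsn := F.s_pos n
  have h3 : |x n - x i| ≤ s i + K * s n := by
    rw [abs_le] at h1 ⊢
    constructor <;> linarith [hwT.1, hwT.2]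
  have h4 : K * s n ≤ K * s i := by gcongr
  by_cases h5 : 1 / (K + 1000) * s i ≤ s n
  · exact hin.ne' (hbox i (hj.trans hi) n (by linarith) h5 h2)
  · push Not at h5
    rw [one_div, inv_mul_eq_div, lt_div_iff₀ (by linarith)] at h5
    obtain ⟨k, rfl⟩ := Nat.exists_eq_add_of_le hin.le
    refine hA i (hj.trans hi) k 1000 _ _ (by norm_num) (by omega) hg.lt
      (by simpa using hg.stays) (covers_of_gap hsn (hκ _) ((hκ1 _).trans (by norm_num)) ?_ (hg.gap k le_rfl)) ?_
    · rw [le_div_iff₀ (by linarith [hκ (st i).m])]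
      linarith [hκ1 (st i).m]
    · rw [abs_sub_comm]
      nlinarith

theorem Trace.tau_notMem_pre (F : Frame φ x s a b ε C P N) (hA : NotAttracted φ x s a b N)
    (T : Trace φ x s a b κ K n j st) (hj : N ≤ j) (hK : 0 ≤ K)
    (hbox : ∀ i ≥ N, ∀ n, |x n - x i| ≤ (K + 1) * s i → 1 / (K + 1000) * s i ≤ s n → s n ≤ s i → n = i)
    (hrec : ∀ i ≥ N, i ≤ n → s n ≤ s i) (hκ : ∀ m, 0 < κ m) (hκ1 : ∀ m, κ m ≤ 1 / 10 ^ 4)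
    {i i' : ℕ} (hi : j ≤ i) (hii : i < i') (hin : i' < n)
    {w : ℝ} (hw : w ∈ Icc (st i).l (st i).r) (hwn : φ^[n - i] w = x n) :
    w ∉ Icc (st i').pl (st i').pr := by
  intro hwp
  have h1 := T.maps_pre (i := i') (t := n - i') (by omega) (by omega) (by omega) hwp
  rw [show i' + (n - i') = n by omega] at h1
  have h2 := T.maps (i := i) (t := n - i') hi (by omega) hw
  refine T.tau_notMem F hA hj hK hbox hrec hκ hκ1 (i := i + (n - i')) (by omega) (by omega) h2 ?_ h1
  rw [← Function.iterate_add_apply, show n - (i + (n - i')) + (n - i') = n - i by omega, hwn]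

/-- Two truncations with comparable data contradict `NotAttracted`. -/
theorem Trace.events_far (F : Frame φ x s a b ε C P N) (hA : NotAttracted φ x s a b N)
    (T : Trace φ x s a b κ K n j st) (hj : N ≤ j) (hκ : ∀ m, 0 < κ m) (hκ1 : ∀ m, κ m ≤ 1 / 10 ^ 4)
    (hκm : Monotone κ) (hκ2 : ∀ m ≤ M, κ m ≤ κ (m + 1) ^ 2 / 10 ^ 7)
    {i₁ i₂ : ℕ} (h2 : j ≤ i₂) (h21 : i₂ < i₁) (h1n : i₁ < n) (hM : (st (i₂ + 1)).m ≤ M)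
    (e1 : (st i₁).m = (st (i₁ + 1)).m + 1) (e2 : (st i₂).m = (st (i₂ + 1)).m + 1)
    (hx : |x i₁ - x i₂| ≤ (8 / κ (st i₂).m + 1) * s i₂ + 8 / κ (st i₁).m * s i₁)
    (hs : (1 / (4 * κ (st (i₁ + 1)).m) - 8 / κ (st i₁).m) * s i₁ ≤ (8 / κ (st i₂).m + 1) * s i₂) :
    False := by
  obtain ⟨k, rfl⟩ := Nat.exists_eq_add_of_le h21.le
  have hs1 := F.s_pos (i₂ + k)
  have hs2 := F.s_pos i₂
  have hm12 : (st (i₂ + k)).m ≤ (st i₂).m := T.m_anti h2 (by omega)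
  set μ₁ := (st (i₂ + k + 1)).m
  set μ₂ := (st (i₂ + 1)).m
  have hq1 := hκ2 μ₁ (by omega)
  have hq2 := hκ2 μ₂ hM
  rw [← e1] at hq1
  rw [← e2] at hq2
  set k₁ := κ (st (i₂ + k)).m
  set k₂ := κ (st i₂).m
  have hk1 : 0 < k₁ := hκ _
  have hk2 : 0 < k₂ := hκ _
  have hk12 : k₁ ≤ k₂ := hκm hm12
  have inv : ∀ q k : ℝ, 0 < q → 0 < k → q ≤ k ^ 2 / 10 ^ 7 → 2500000 * (1 / k) ^ 2 ≤ 1 / (4 * q) := by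
    intro q k hq hk h
    rw [div_pow, one_pow, mul_one_div, div_le_div_iff₀ (by positivity) (by positivity)]
    linarith
  have hI1 := inv _ _ (hκ _) hk1 hq1
  have hI2 := inv _ _ (hκ _) hk2 hq2
  have big : ∀ m, 10000 ≤ 1 / κ m := fun m => by
    rw [le_div_iff₀ (hκ m)]; linarith [hκ1 m]
  have hy := big (st (i₂ + k)).m
  have hz := big (st i₂).m
  have hzy : 1 / k₂ ≤ 1 / k₁ := one_div_le_one_div_of_le hk1 hk12
  have d1 : 8 / k₁ = 8 * (1 / k₁) := by ring
  have d2 : 8 / k₂ = 8 * (1 / k₂) := by ring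
  rw [d1, d2] at hs hx
  set y := 1 / k₁
  set z := 1 / k₂
  set s₁ := s (i₂ + k)
  set s₂ := s i₂
  have hys : 0 < y * s₁ := by positivity
  have hs12 : 100000 * (y * s₁) ≤ s₂ := by
    have h3 : (2500000 * y ^ 2 - 8 * y) * s₁ ≤ (8 * z + 1) * s₂ :=
      le_trans (by gcongr) hs
    have h4 : (8 * z + 1) * s₂ ≤ 9 * y * s₂ := by gcongr; linarith
    have h5 : 2000000 * (y * s₁) * y ≤ (2500000 * y ^ 2 - 8 * y) * s₁ := by nlinarith
    have h6 : (2000000 * (y * s₁)) * y ≤ (9 * s₂) * y := by linarith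
    have h7 := le_of_mul_le_mul_right h6 (by linarith)
    linarith
  have hst := (((T.link i₂ h2 (by omega)).stays_pre
    (T.good (i₂ + 1) (by omega) (by omega)).stays).mono (k' := k) (by omega) le_rfl le_rfl)
  have hL := T.link i₂ h2 (by omega)
  refine hA i₂ (hj.trans h2) k (1000 * (8 * z + 1)) _ _ (by linarith) (by omega)
    (hL.le₂.trans_lt (hL.lt.trans_le hL.le₃)) hst
    (covers_of_gap (κ := 2 * κ μ₂) hs1 (by linarith [hκ μ₂]) (by linarith [hκ1 μ₂]) ?_
      (hL.gap_pre k (by omega))) ?_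
  · rw [show 2 * (2 * κ μ₂) = 4 * κ μ₂ by ring]
    refine le_trans ?_ hI2
    nlinarith
  · rw [abs_sub_comm]
    have h6 : z * s₁ ≤ y * s₁ := by gcongr
    have h7 : s₁ ≤ y * s₁ := by nlinarith
    have h8 : 0 < z * s₂ := by positivity
    have e : 1000 * (8 * z + 1) * s₂ / 40 = 200 * (z * s₂) + 25 * s₂ := by ring
    have e' : 1000 * (8 * z + 1) * s₁ = 8000 * (z * s₁) + 1000 * s₁ := by ring
    have e'' : (8 * z + 1) * s₂ + 8 * y * s₁ = 8 * (z * s₂) + s₂ + 8 * (y * s₁) := by ring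
    rw [e'', ] at hx
    rw [e, e']
    linarith

end

section
variable {φ : ℝ → ℝ} {x s a b ε : ℕ → ℝ} {C : Finset ℝ} {P : ℝ} {N : ℕ}
variable {κ : ℕ → ℝ} {K : ℝ} {M n j : ℕ} {st : ℕ → St}

/-- Two orbit points that are comparable in position and height coincide, for times from `N` on. -/
def Boxed (x s : ℕ → ℝ) (K : ℝ) (N : ℕ) : Prop :=
  ∀ i ≥ N, ∀ n, |x n - x i| ≤ (K + 1) * s i → 1 / (K + 1000) * s i ≤ s n → s n ≤ s i → n = i

/-- A decreasing sequence of positive loss bounds, one for each number of truncations. -/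
structure Losses (κ : ℕ → ℝ) (M : ℕ) : Prop where
  pos : ∀ m, 0 < κ m
  le : ∀ m, κ m ≤ 1 / 10 ^ 4
  mono : Monotone κ
  sq : ∀ m ≤ M, κ m ≤ κ (m + 1) ^ 2 / 10 ^ 7

theorem Trace.three_right (F : Frame φ x s a b ε C P N) (hA : NotAttracted φ x s a b N)
    (T : Trace φ x s a b κ K n j st) (hj : N ≤ j) (hK : 0 ≤ K) (hbox : Boxed x s K N)
    (hrec : ∀ i ≥ N, i ≤ n → s n ≤ s i) (hκ : Losses κ M) {i₁ i₂ i₃ : ℕ} (h3 : j ≤ i₃) (h32 : i₃ < i₂)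
    (h21 : i₂ < i₁) (h1n : i₁ < n) (hM : (st (i₂ + 1)).m ≤ M)
    (e1 : (st i₁).m = (st (i₁ + 1)).m + 1) (e2 : (st i₂).m = (st (i₂ + 1)).m + 1)
    (ho : orient ε i₃ (i₂ - i₃) = 1) {c : ℝ} (c1 : (st i₁).pr = c) (c2 : (st i₂).pr = c)
    (c3 : (st i₃).pr = c) : False := by
  have half : ∀ m, κ m ≤ 1 / 2 := fun m => (hκ.le m).trans (by norm_num)
  have L1 := T.link i₁ (by omega) h1n
  have L2 := T.link i₂ (by omega) (by omega)
  have L3 := T.link i₃ h3 (by omega)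
  have G2 := T.good i₂ (by omega) (by omega)
  obtain ⟨τ₃, ht3, ht3n⟩ := exists_tau F (by omega) (T.good i₃ h3 (by omega)) (half _)
  obtain ⟨τ₂, ht2, ht2n⟩ := exists_tau F (by omega) G2 (half _)
  have n3 := T.tau_notMem_pre F hA hj hK hbox hrec hκ.pos hκ.le h3 h32 (by omega) ht3 ht3n
  have n2 := T.tau_notMem_pre F hA hj hK hbox hrec hκ.pos hκ.le (by omega) h21 h1n ht2 ht2n
  rw [mem_Icc, not_and_or, not_le, not_le] at n3 n2
  have p3 := L3.le₂; have q3 := L3.le₃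
  have p2 := L2.le₂; have q2 := L2.le₃
  have p1 := L1.le₂; have q1 := L1.le₃
  have l1 := L1.lt; have l2 := L2.lt; have l3 := L3.lt
  rw [c1] at q1 n2
  rw [c2] at q2 n3
  rw [c3] at q3
  have hτ2 : τ₂ < (st i₁).pl := by
    rcases n2 with h | h
    · exact h
    · linarith [ht2.2]
  have hτ3 : τ₃ < (st i₂).pl := by
    rcases n3 with h | h
    · exact h
    · linarith [ht3.2]
  have hF1c := T.maps_pre (i := i₂) (t := i₁ - i₂) (by omega) (by omega) (by omega)
    (show c ∈ Icc (st i₂).pl (st i₂).pr from ⟨by linarith, c2.ge⟩)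
  have hF2c := T.maps_pre (i := i₃) (t := i₂ - i₃) (by omega) (by omega) (by omega)
    (show c ∈ Icc (st i₃).pl (st i₃).pr from ⟨by linarith, c3.ge⟩)
  rw [show i₂ + (i₁ - i₂) = i₁ by omega] at hF1c
  rw [show i₃ + (i₂ - i₃) = i₂ by omega] at hF2c
  have hF12 := T.maps (i := i₂) (t := i₁ - i₂) (by omega) (by omega) hF2c
  rw [show i₂ + (i₁ - i₂) = i₁ by omega] at hF12
  have hst3 := (L3.stays_pre (T.good (i₃ + 1) (by omega) (by omega)).stays).mono (k' := i₂ - i₃)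
    (by omega) le_rfl le_rfl
  have hm := F.strictMono_path (hj.trans h3) hst3
  rw [ho, c3] at hm
  have h4 := hm.monotoneOn (a := φ^[i₁ - i₂] c) (b := c) ⟨by linarith [hF1c.1, ht3.1, ht2.1], by linarith [hF1c.2]⟩
    ⟨by linarith, le_rfl⟩ (by linarith [hF1c.2])
  simp only [one_mul] at h4
  rw [((Function.Commute.refl φ).iterate_iterate (i₂ - i₃) (i₁ - i₂)).eq c] at h4
  have hnear := near_of_good F (by omega) (by omega) G2 (half _) ht2 ht2n
  have g1 := L1.gap_pre 0 (by omega)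
  rw [c1, gap_zero_of_le _ (F.s_pos _) (by linarith)] at g1
  have hp1 := le_of_ang_le (F.s_pos i₁) (x := x i₁) (t := (st i₁).pl) (κ := 2 * κ (st (i₁ + 1)).m)
    (by linarith [hκ.pos (st (i₁ + 1)).m]) (by linarith [hκ.le (st (i₁ + 1)).m])
    (by linarith [ang_lt (x i₁) (s i₁) c])
  rw [show 2 * (2 * κ (st (i₁ + 1)).m) = 4 * κ (st (i₁ + 1)).m by ring] at hp1
  obtain ⟨-, A1, -, -⟩ := L1.event.resolve_left (by omega)
  obtain ⟨-, -, A2, -⟩ := L2.event.resolve_left (by omega)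
  have hk1 : 0 < 1 / (4 * κ (st (i₁ + 1)).m) * s i₁ :=
    mul_pos (by have := hκ.pos (st (i₁ + 1)).m; positivity) (F.s_pos _)
  have hA1 : 0 < 8 / κ (st i₁).m * s i₁ :=
    mul_pos (by have := hκ.pos (st i₁).m; positivity) (F.s_pos _)
  have hA2 : 0 < 8 / κ (st i₂).m * s i₂ :=
    mul_pos (by have := hκ.pos (st i₂).m; positivity) (F.s_pos _)
  have hs2 := F.s_pos i₂
  rw [abs_le] at hnear
  refine T.events_far F hA hj hκ.pos hκ.le hκ.mono hκ.sq (by omega) h21 h1n hM e1 e2 ?_ ?_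
  · rw [abs_le]
    constructor
    · linarith [hnear.1]
    · linarith [hF12.1, hF2c.2]
  · rw [sub_mul]
    linarith [hF12.1, hF2c.2, hnear.1]

theorem Trace.three_left (F : Frame φ x s a b ε C P N) (hA : NotAttracted φ x s a b N)
    (T : Trace φ x s a b κ K n j st) (hj : N ≤ j) (hK : 0 ≤ K) (hbox : Boxed x s K N)
    (hrec : ∀ i ≥ N, i ≤ n → s n ≤ s i) (hκ : Losses κ M) {i₁ i₂ i₃ : ℕ} (h3 : j ≤ i₃) (h32 : i₃ < i₂)
    (h21 : i₂ < i₁) (h1n : i₁ < n) (hM : (st (i₂ + 1)).m ≤ M)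
    (e1 : (st i₁).m = (st (i₁ + 1)).m + 1) (e2 : (st i₂).m = (st (i₂ + 1)).m + 1)
    (ho : orient ε i₃ (i₂ - i₃) = 1) {c : ℝ} (c1 : (st i₁).pl = c) (c2 : (st i₂).pl = c)
    (c3 : (st i₃).pl = c) : False := by
  have half : ∀ m, κ m ≤ 1 / 2 := fun m => (hκ.le m).trans (by norm_num)
  have L1 := T.link i₁ (by omega) h1n
  have L2 := T.link i₂ (by omega) (by omega)
  have L3 := T.link i₃ h3 (by omega)
  have G2 := T.good i₂ (by omega) (by omega)
  obtain ⟨τ₃, ht3, ht3n⟩ := exists_tau F (by omega) (T.good i₃ h3 (by omega)) (half _)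
  obtain ⟨τ₂, ht2, ht2n⟩ := exists_tau F (by omega) G2 (half _)
  have n3 := T.tau_notMem_pre F hA hj hK hbox hrec hκ.pos hκ.le h3 h32 (by omega) ht3 ht3n
  have n2 := T.tau_notMem_pre F hA hj hK hbox hrec hκ.pos hκ.le (by omega) h21 h1n ht2 ht2n
  rw [mem_Icc, not_and_or, not_le, not_le] at n3 n2
  have p3 := L3.le₂; have q3 := L3.le₃
  have p2 := L2.le₂; have q2 := L2.le₃
  have p1 := L1.le₂; have q1 := L1.le₃
  have l1 := L1.lt; have l2 := L2.lt; have l3 := L3.lt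
  rw [c1] at p1 n2
  rw [c2] at p2 n3
  rw [c3] at p3
  have hτ2 : (st i₁).pr < τ₂ := by
    rcases n2 with h | h
    · linarith [ht2.1]
    · exact h
  have hτ3 : (st i₂).pr < τ₃ := by
    rcases n3 with h | h
    · linarith [ht3.1]
    · exact h
  have hF1c := T.maps_pre (i := i₂) (t := i₁ - i₂) (by omega) (by omega) (by omega)
    (show c ∈ Icc (st i₂).pl (st i₂).pr from ⟨c2.le, by linarith⟩)
  have hF2c := T.maps_pre (i := i₃) (t := i₂ - i₃) (by omega) (by omega) (by omega)
    (show c ∈ Icc (st i₃).pl (st i₃).pr from ⟨c3.le, by linarith⟩)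
  rw [show i₂ + (i₁ - i₂) = i₁ by omega] at hF1c
  rw [show i₃ + (i₂ - i₃) = i₂ by omega] at hF2c
  have hF12 := T.maps (i := i₂) (t := i₁ - i₂) (by omega) (by omega) hF2c
  rw [show i₂ + (i₁ - i₂) = i₁ by omega] at hF12
  have hst3 := (L3.stays_pre (T.good (i₃ + 1) (by omega) (by omega)).stays).mono (k' := i₂ - i₃)
    (by omega) le_rfl le_rfl
  have hm := F.strictMono_path (hj.trans h3) hst3
  rw [ho, c3] at hm
  have h4 := hm.monotoneOn (a := c) (b := φ^[i₁ - i₂] c) ⟨le_rfl, by linarith⟩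
    ⟨by linarith [hF1c.1], by linarith [hF1c.2, ht2.2, ht3.2]⟩ (by linarith [hF1c.1])
  simp only [one_mul] at h4
  rw [((Function.Commute.refl φ).iterate_iterate (i₂ - i₃) (i₁ - i₂)).eq c] at h4
  have hnear := near_of_good F (by omega) (by omega) G2 (half _) ht2 ht2n
  have g1 := L1.gap_pre 0 (by omega)
  rw [c1, gap_zero_of_le _ (F.s_pos _) (by linarith)] at g1
  have hp1 := le_of_le_ang (F.s_pos i₁) (x := x i₁) (t := (st i₁).pr) (κ := 2 * κ (st (i₁ + 1)).m)
    (by linarith [hκ.pos (st (i₁ + 1)).m]) (by linarith [hκ.le (st (i₁ + 1)).m])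
    (by linarith [neg_lt_ang (x i₁) (s i₁) c])
  rw [show 2 * (2 * κ (st (i₁ + 1)).m) = 4 * κ (st (i₁ + 1)).m by ring] at hp1
  obtain ⟨-, -, A1, -⟩ := L1.event.resolve_left (by omega)
  obtain ⟨-, A2, -, -⟩ := L2.event.resolve_left (by omega)
  have hk1 : 0 < 1 / (4 * κ (st (i₁ + 1)).m) * s i₁ :=
    mul_pos (by have := hκ.pos (st (i₁ + 1)).m; positivity) (F.s_pos _)
  have hA1 : 0 < 8 / κ (st i₁).m * s i₁ :=
    mul_pos (by have := hκ.pos (st i₁).m; positivity) (F.s_pos _)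
  have hA2 : 0 < 8 / κ (st i₂).m * s i₂ :=
    mul_pos (by have := hκ.pos (st i₂).m; positivity) (F.s_pos _)
  have hs2 := F.s_pos i₂
  rw [abs_le] at hnear
  refine T.events_far F hA hj hκ.pos hκ.le hκ.mono hκ.sq (by omega) h21 h1n hM e1 e2 ?_ ?_
  · rw [abs_le]
    constructor
    · linarith [hF12.2, hF2c.1]
    · linarith [hnear.2]
  · rw [sub_mul]
    linarith [hF12.2, hF2c.1, hnear.2]

theorem le_card_filter_of_succ {m : ℕ → ℕ} {n j : ℕ} (hjn : j ≤ n) (hn : m n = 0)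
    (hm : ∀ i, j ≤ i → i < n → m i = m (i + 1) ∨ m i = m (i + 1) + 1) :
    m j ≤ ((Finset.Ico j n).filter fun i => m i = m (i + 1) + 1).card := by
  induction hjn using Nat.decreasingInduction with
  | self => simp [hn]
  | of_succ k hk ih =>
    have ih := ih fun i hi => hm i (by omega)
    rw [← Finset.insert_Ico_add_one_left_eq_Ico hk, Finset.filter_insert]
    split_ifs with h
    · rw [Finset.card_insert_of_notMem (by simp)]; omega
    · rcases hm k le_rfl hk with h1 | h1
      · omega
      · exact absurd h1 h

theorem Trace.m_le (F : Frame φ x s a b ε C P N) (hA : NotAttracted φ x s a b N)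
    (T : Trace φ x s a b κ K n j st) (hj : N ≤ j) (hK : 0 ≤ K) (hbox : Boxed x s K N)
    (hrec : ∀ i ≥ N, i ≤ n → s n ≤ s i) (hκ : Losses κ M) (hM : ∀ i > j, i ≤ n → (st i).m ≤ M) :
    (st j).m ≤ 8 * C.card := by
  classical
  set Ev := (Finset.Ico j n).filter fun i => (st i).m = (st (i + 1)).m + 1 with hEv
  have hcard : (st j).m ≤ Ev.card := le_card_filter_of_succ (m := fun i => (st i).m) T.le T.init_m
    fun i hi hin => (T.link i hi hin).event.imp id fun h => h.1
  refine hcard.trans ?_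
  by_contra! hcon
  set cls : ℕ → ℝ × Bool × ℝ := fun i =>
    if (st i).pr = b i then (b i, true, orient ε i (n - i)) else (a i, false, orient ε i (n - i))
    with hcls
  have hmaps : ∀ i ∈ Ev, cls i ∈ C ×ˢ (Finset.univ ×ˢ ({1, -1} : Finset ℝ)) := by
    intro i hi
    rw [hEv, Finset.mem_filter, Finset.mem_Ico] at hi
    have hor := sq_eq_one_iff.1 (F.orient_sq i (n - i))
    simp only [hcls]
    split_ifs
    · simp [F.mem_b i (by omega), hor]
    · simp [F.mem_a i (by omega), hor]
  obtain ⟨y, -, hy⟩ := Finset.exists_lt_card_fiber_of_mul_lt_card_of_maps_to (n := 2) hmaps (by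
    rw [Finset.card_product, Finset.card_product, Finset.card_univ, Fintype.card_bool,
      Finset.card_pair (by norm_num)]
    omega)
  have key : ∀ i₃ ∈ Ev, ∀ i₂ ∈ Ev, ∀ i₁ ∈ Ev, cls i₃ = y → cls i₂ = y → cls i₁ = y → i₃ < i₂ →
      i₂ < i₁ → False := by
    intro i₃ h3 i₂ h2 i₁ h1 y3 y2 y1 h32 h21
    rw [hEv, Finset.mem_filter, Finset.mem_Ico] at h1 h2 h3
    have ho3 : (cls i₃).2.2 = orient ε i₃ (n - i₃) := by simp only [hcls]; split_ifs <;> rfl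
    have ho2 : (cls i₂).2.2 = orient ε i₂ (n - i₂) := by simp only [hcls]; split_ifs <;> rfl
    have ho : orient ε i₃ (i₂ - i₃) = 1 := by
      have e := orient_add ε i₃ (i₂ - i₃) (n - i₂)
      rw [show i₂ - i₃ + (n - i₂) = n - i₃ by omega, show i₃ + (i₂ - i₃) = i₂ by omega, ← ho3, ← ho2,
        y3, y2] at e
      have hne : y.2.2 ≠ 0 := by
        rw [← y2, ho2]
        intro h0
        have := F.orient_sq i₂ (n - i₂)
        rw [h0] at this; norm_num at this
      exact mul_right_cancel₀ hne (by rw [← e, one_mul])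
    have ev : ∀ i, j ≤ i → i < n → (st i).m = (st (i + 1)).m + 1 → (st i).pl = a i ∨ (st i).pr = b i :=
      fun i h h' h'' => ((T.link i h h').event.resolve_left (by omega)).2.2.2
    rcases hb : y.2.1 with _ | _
    · have hl : ∀ i, j ≤ i → i < n → (st i).m = (st (i + 1)).m + 1 → cls i = y → (st i).pl = y.1 := by
        intro i h h' h'' hy
        by_cases hp : (st i).pr = b i
        · simp only [hcls, if_pos hp] at hy
          rw [← hy] at hb; exact absurd hb (by simp)
        · simp only [hcls, if_neg hp] at hy
          rw [← hy]
          exact (ev i h h' h'').resolve_right hp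
      exact T.three_left F hA hj hK hbox hrec hκ h3.1.1 h32 h21 h1.1.2 (hM _ (by omega) (by omega)) h1.2 h2.2
        ho (hl _ h1.1.1 h1.1.2 h1.2 y1) (hl _ h2.1.1 h2.1.2 h2.2 y2) (hl _ h3.1.1 h3.1.2 h3.2 y3)
    · have hl : ∀ i, cls i = y → (st i).pr = y.1 := by
        intro i hy
        by_cases hp : (st i).pr = b i
        · simp only [hcls, if_pos hp] at hy
          rw [← hy]; exact hp
        · simp only [hcls, if_neg hp] at hy
          rw [← hy] at hb; exact absurd hb (by simp)
      exact T.three_right F hA hj hK hbox hrec hκ h3.1.1 h32 h21 h1.1.2 (hM _ (by omega) (by omega)) h1.2 h2.2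
        ho (hl _ y1) (hl _ y2) (hl _ y3)
  obtain ⟨p, q, r, hp, hq, hr, hpq, hpr, hqr⟩ := Finset.two_lt_card_iff.1 hy
  rw [Finset.mem_filter] at hp hq hr
  rcases hpq.lt_or_gt with h1 | h1 <;> rcases hpr.lt_or_gt with h2 | h2 <;>
    rcases hqr.lt_or_gt with h3 | h3
  · exact key p hp.1 q hq.1 r hr.1 hp.2 hq.2 hr.2 h1 h3
  · exact key p hp.1 r hr.1 q hq.1 hp.2 hr.2 hq.2 h2 h3
  · omega
  · exact key r hr.1 p hp.1 q hq.1 hr.2 hp.2 hq.2 h2 h1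
  · exact key q hq.1 p hp.1 r hr.1 hq.2 hp.2 hr.2 h1 h2
  · omega
  · exact key q hq.1 r hr.1 p hp.1 hq.2 hr.2 hp.2 h3 h2
  · exact key r hr.1 q hq.1 p hp.1 hr.2 hq.2 hp.2 h3 h1

theorem Frame.exists_trace (F : Frame φ x s a b ε C P N) (hA : NotAttracted φ x s a b N)
    (hκ : Losses κ (8 * C.card)) (hK : K = 2 / κ 0) (hP : 2 / κ 0 ≤ P) (hbox : Boxed x s K N)
    (hrec : ∀ i ≥ N, i ≤ n → s n ≤ s i) (hj : N ≤ j) (hjn : j ≤ n) :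
    ∃ st, Trace φ x s a b κ K n j st ∧ ∀ i ≥ j, i ≤ n → (st i).m ≤ 8 * C.card := by
  have hK0 : 0 < K := by rw [hK]; have := hκ.pos 0; positivity
  induction hjn using Nat.decreasingInduction with
  | self =>
    have hs := F.s_pos n
    have hKs : 0 < K * s n := by positivity
    refine ⟨fun _ => ⟨x n - K * s n, x n + K * s n, x n - K * s n, x n + K * s n, 0⟩,
      ⟨le_rfl, fun i hi hin => ?_, fun i hi hin => absurd hin (by omega), rfl, rfl, rfl⟩,
      fun _ _ _ => Nat.zero_le _⟩
    obtain rfl : i = n := le_antisymm hin hi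
    refine ⟨by show x i - K * s i < x i + K * s i; linarith, fun w _ t ht => absurd ht (by omega),
      fun k hk => ?_⟩
    obtain rfl : k = 0 := by omega
    show Real.pi - κ 0 ≤ gap φ x s i 0 (x i - K * s i) (x i + K * s i)
    rw [gap_zero_of_le _ hs (by linarith)]
    have h1 := le_ang hs hK0 (le_refl (x i + K * s i))
    have h2 := ang_le' hs hK0 (le_refl (x i - K * s i))
    have h3 : 1 / K = κ 0 / 2 := by rw [hK, one_div, inv_div]
    linarith
  | of_succ k hk ih =>
    obtain ⟨st, T, hm⟩ := ih (by omega)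
    have hv := T.good (k + 1) le_rfl hk
    have hle := hm (k + 1) le_rfl hk
    obtain ⟨u, hu⟩ := F.exists_link hj hk hv (hκ.pos _) (hκ.pos _) ((hκ.le _).trans (by norm_num))
      (hκ.sq _ hle) (le_trans (by
        have := hκ.pos 0
        have := hκ.mono (Nat.zero_le (st (k + 1)).m)
        gcongr) hP)
    have e : ∀ i, k + 1 ≤ i → Function.update st k u i = st i := fun i hi =>
      Function.update_of_ne (by omega) _ _
    have e0 : Function.update st k u k = u := Function.update_self _ _ _
    have T' : Trace φ x s a b κ K n k (Function.update st k u) := by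
      refine ⟨hk.le, fun i hi hin => ?_, fun i hi hin => ?_, ?_, ?_, ?_⟩
      · rcases hi.eq_or_lt with rfl | h1
        · rw [e0]; exact hu.good hv
        · rw [e i h1]; exact T.good i h1 hin
      · rcases hi.eq_or_lt with rfl | h1
        · rw [e0, e _ le_rfl]; exact hu
        · rw [e i h1, e (i + 1) (by omega)]; exact T.link i h1 hin
      · rw [e n hk]; exact T.init_l
      · rw [e n hk]; exact T.init_r
      · rw [e n hk]; exact T.init_m
    have hm' : ∀ i > k, i ≤ n → (Function.update st k u i).m ≤ 8 * C.card := fun i hi hin => by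
      rw [e i hi]; exact hm i hi hin
    refine ⟨_, T', fun i hi hin => ?_⟩
    rcases hi.eq_or_lt with h1 | h1
    · rw [← h1]
      exact T'.m_le F hA hj hK0.le hbox hrec hκ hm'
    · exact hm' i h1 hin

theorem exists_losses {c : ℝ} (hc : 0 < c) (hc1 : c ≤ 1 / 10 ^ 4) (M : ℕ) :
    ∃ κ, Losses κ M ∧ ∀ m, κ m ≤ c := by
  set q : ℕ → ℝ := fun t => Nat.rec c (fun _ y => y ^ 2 / 10 ^ 7) t with hq
  have hs : ∀ t, q (t + 1) = q t ^ 2 / 10 ^ 7 := fun t => rfl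
  have hb : ∀ t, 0 < q t ∧ q t ≤ c := by
    intro t
    induction t with
    | zero => exact ⟨hc, le_rfl⟩
    | succ t ih => rw [hs]; exact ⟨by have := ih.1; positivity, by nlinarith [ih.1, ih.2]⟩
  have ha : Antitone q := antitone_nat_of_succ_le fun t => by
    rw [hs]; nlinarith [(hb t).1, (hb t).2]
  refine ⟨fun m => q (M + 1 - m), ⟨fun m => (hb _).1, fun m => (hb _).2.trans hc1,
    fun m m' h => ha (by omega), fun m hm => ?_⟩, fun m => (hb _).2⟩
  show q (M + 1 - m) ≤ q (M + 1 - (m + 1)) ^ 2 / 10 ^ 7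
  rw [← hs, show M + 1 - (m + 1) + 1 = M + 1 - m by omega]

/-- Long intervals follow the orbit from time `N` up to any record time. -/
theorem exists_long_interval (C : Finset ℝ) {c : ℝ} (hc : 0 < c) (hc1 : c ≤ 1 / 10 ^ 4) :
    ∃ P K : ℝ, 0 < K ∧ ∀ {φ : ℝ → ℝ} {x s a b ε : ℕ → ℝ} {N n : ℕ}, Frame φ x s a b ε C P N →
      NotAttracted φ x s a b N → Boxed x s K N → N ≤ n → (∀ i ≥ N, i ≤ n → s n ≤ s i) →
      ∃ p q, p < q ∧ Stays φ a b N (n - N) p q ∧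
        ∀ k, N + k ≤ n → Real.pi - c ≤ gap φ x s N k p q := by
  obtain ⟨κ, hκ, hκc⟩ := exists_losses hc hc1 (8 * C.card)
  refine ⟨2 / κ 0, 2 / κ 0, by have := hκ.pos 0; positivity, @fun φ x s a b ε N n F hA hbox hn hrec => ?_⟩
  obtain ⟨st, T, -⟩ := F.exists_trace hA hκ rfl le_rfl hbox hrec le_rfl hn
  have G := T.good _ le_rfl hn
  exact ⟨_, _, G.lt, G.stays, fun k hk => le_trans (by linarith [hκc (st N).m]) (G.gap k hk)⟩

end

section
variable {f : ℂ → ℂ} {S : Set ℂ} {R₀ : ℝ} {z₀ : ℂ} {δ : ℝ}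

theorem exists_record {s : ℕ → ℝ} (hs : ∀ n, 0 < s n) (h0 : Tendsto s atTop (𝓝 0)) {N M : ℕ}
    (hNM : N ≤ M) : ∃ n ≥ M, ∀ i ≥ N, i ≤ n → s n ≤ s i := by
  classical
  obtain ⟨j, hj, hjm⟩ := Finset.exists_min_image (Finset.Icc N M) s ⟨N, by simp [hNM]⟩
  have hex : ∃ n, M ≤ n ∧ s n < s j := by
    obtain ⟨n, hn1, hn2⟩ := ((eventually_ge_atTop M).and (h0.eventually (gt_mem_nhds (hs j)))).exists
    exact ⟨n, hn1, hn2⟩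
  refine ⟨Nat.find hex, (Nat.find_spec hex).1, fun i hi hin => ?_⟩
  rcases le_or_gt i M with him | him
  · exact (Nat.find_spec hex).2.le.trans (hjm i (by simp [hi, him]))
  · rcases hin.lt_or_eq with hlt | rfl
    · have := Nat.find_min hex hlt
      push Not at this
      exact (Nat.find_spec hex).2.le.trans (this him.le)
    · exact le_rfl

theorem RealB.ball_subset_fatou_of_mapsTo (h : RealB f S R₀) {c : ℂ} {ρ : ℝ} {k : ℕ} (hk : 1 ≤ k)
    (hm : MapsTo f^[k] (ball c ρ) (ball c ρ)) : ball c ρ ⊆ FatouSet f := by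
  have hbd : ∀ r : ℕ, ∃ M, ∀ z ∈ ball c ρ, ‖f^[r] z‖ ≤ M := fun r => by
    obtain ⟨M, hM⟩ := (isCompact_closedBall c ρ).exists_bound_of_continuousOn
      (h.differentiable_iterate r).continuous.continuousOn
    exact ⟨M, fun z hz => hM z (ball_subset_closedBall hz)⟩
  choose M hM using hbd
  refine h.subset_fatou_of_bdd isOpen_ball (M := ∑ r ∈ Finset.range k, |M r|) fun z hz n => ?_
  have h1 : f^[n] z = f^[n % k] ((f^[k])^[n / k] z) := by
    rw [← Function.iterate_mul, ← Function.iterate_add_apply, Nat.mod_add_div]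
  rw [h1]
  refine (hM _ _ (hm.iterate _ hz)).trans ((le_abs_self _).trans ?_)
  exact Finset.single_le_sum (f := fun r => |M r|) (fun _ _ => abs_nonneg _)
    (Finset.mem_range.2 (Nat.mod_lt _ hk))

theorem norm_sub_le_re_add_im (z w : ℂ) : ‖z - w‖ ≤ |z.re - w.re| + |z.im| + |w.im| := by
  have h1 := Complex.norm_le_abs_re_add_abs_im (z - w)
  have h2 := abs_sub z.im w.im
  simp only [Complex.sub_re, Complex.sub_im] at h1
  linarith

theorem Orb.ball_subset (h : RealB f S R₀) (o : Orb f z₀ δ) {B : ℝ} (hB : ∀ n, ‖f^[n] z₀‖ ≤ B)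
    {L : ℝ} (hL : 0 < L) (N₀ : ℕ) :
    ∃ N ≥ N₀, ball (f^[N] z₀) (L * |(f^[N] z₀).im|) ⊆ comp f (f^[N] z₀) := by
  obtain ⟨C, hC⟩ := o.exists_frame h hB
  set L0 := max (40 * L) 1 with hL0
  have hL01 : 1 ≤ L0 := le_max_right _ _
  have hL040 : 40 * L ≤ L0 := le_max_left _ _
  set c := min (1 / 10 ^ 4) (1 / (2 * L0)) with hc
  have hcpos : 0 < c := by positivity
  obtain ⟨P, K, hK, hlong⟩ := exists_long_interval C hcpos (min_le_left _ _)
  obtain ⟨N1, a, b, ε, hF, hball⟩ := hC P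
  obtain ⟨N2, hN2⟩ := o.box_eq h (K + 1) 1 (ε := 1 / (K + 1000)) (by positivity)
  set N := max N1 (max N2 N₀) with hN
  have hNN1 : N1 ≤ N := le_max_left _ _
  have hNN2 : N2 ≤ N := (le_max_left _ _).trans (le_max_right _ _)
  have hNN0 : N₀ ≤ N := (le_max_right _ _).trans (le_max_right _ _)
  have hF' : Frame (rl f) (fun j => (f^[j] z₀).re) (fun j => |(f^[j] z₀).im|) a b ε C P N :=
    { cont := hF.cont
      s_pos := hF.s_pos
      mem_a := fun j hj => hF.mem_a j (hNN1.trans hj)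
      mem_b := fun j hj => hF.mem_b j (hNN1.trans hj)
      sq := hF.sq
      lt := fun j hj => hF.lt j (hNN1.trans hj)
      mono := fun j hj => hF.mono j (hNN1.trans hj)
      cut_a := fun j hj => hF.cut_a j (hNN1.trans hj)
      cut_b := fun j hj => hF.cut_b j (hNN1.trans hj)
      ang_le := fun j hj => hF.ang_le j (hNN1.trans hj) }
  have hbox : Boxed (fun j => (f^[j] z₀).re) (fun j => |(f^[j] z₀).im|) K N := by
    intro i hi n h1 h2 h3
    exact hN2 i (hNN2.trans hi) n h1 h2 (by linarith)
  have hna : NotAttracted (rl f) (fun j => (f^[j] z₀).re) (fun j => |(f^[j] z₀).im|) a b N := by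
    intro i hi k L' p q hL' hk hpq hst hcov hle
    simp only at hcov hle
    have hsub := hball i (hNN1.trans hi) k L' p q (by linarith) hpq hst hcov
    have hpos := o.abs_im_pos (i + k)
    have hposi := o.abs_im_pos i
    have hdist : ‖f^[i] z₀ - f^[i + k] z₀‖ + L' * |(f^[i + k] z₀).im| ≤ L' * |(f^[i] z₀).im| / 40 := by
      have := norm_sub_le_re_add_im (f^[i] z₀) (f^[i + k] z₀)
      linarith
    have hW : ball (f^[i + k] z₀) (L' * |(f^[i + k] z₀).im|) ⊆
        ball (f^[i] z₀) (L' * |(f^[i] z₀).im| / 40) := by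
      refine ball_subset_ball' ?_
      rw [dist_comm, dist_eq_norm]; linarith
    have hmaps : MapsTo f^[k] (ball (f^[i] z₀) (L' * |(f^[i] z₀).im| / 40))
        (ball (f^[i] z₀) (L' * |(f^[i] z₀).im| / 40)) := fun z hz => hW (hsub ⟨z, hz, rfl⟩)
    have hF := h.ball_subset_fatou_of_mapsTo hk hmaps
    have := wand_eq o.wand (convex_ball _ _).isPreconnected hF (m := i) (n := i + k)
      (mem_ball_self (by positivity)) (hW (mem_ball_self (by positivity)))
    omega
  refine ⟨N, hNN0, ?_⟩
  have hposN := o.abs_im_pos N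
  have hsubs : ball (f^[N] z₀) (L * |(f^[N] z₀).im|) ⊆
      ball (f^[N] z₀) (L0 * |(f^[N] z₀).im| / 40) := ball_subset_ball (by nlinarith)
  refine hsubs.trans (subset_comp (convex_ball _ _).isPreconnected ?_
    (mem_ball_self (by positivity)) (mem_comp ((h.iterate_mem_fatou N).2 o.wand.1)))
  refine h.subset_fatou_of_bdd isOpen_ball (M := B + L0 * B) fun z hz k => ?_
  obtain ⟨n, hn, hrec⟩ := exists_record hF.s_pos (o.tendsto_im h hB) (N := N) (M := N + k) (by omega)
  obtain ⟨p, q, hpq, hst, hgap⟩ := hlong hF' hna hbox (by omega) hrec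
  have hst' : Stays (rl f) a b N k p q := fun w hw t ht => hst w hw t (by omega)
  have hcL : L0 ≤ 1 / (2 * c) := by
    have h1 : c ≤ 1 / (2 * L0) := min_le_right _ _
    rw [le_div_iff₀ (by positivity)] at h1 ⊢
    linarith
  have hcov := covers_of_gap (hF.s_pos (N + k)) hcpos
    ((min_le_left _ _).trans (by norm_num)) hcL (hgap k hn)
  have := hball N hNN1 k L0 p q (by linarith) hpq hst' hcov ⟨z, hz, rfl⟩
  rw [mem_ball, dist_eq_norm] at this
  have h1 := norm_add_le (f^[k] z - f^[N + k] z₀) (f^[N + k] z₀)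
  rw [sub_add_cancel] at h1
  have h2 := hB (N + k)
  have h3 := (Complex.abs_im_le_norm (f^[N + k] z₀)).trans h2
  have h4 : L0 * |(f^[N + k] z₀).im| ≤ L0 * B := by gcongr
  linarith

end

section
variable {f : ℂ → ℂ} {S : Set ℂ} {R₀ : ℝ}

theorem sphericalDist_comm (z w : ℂ) : sphericalDist z w = sphericalDist w z := by
  unfold sphericalDist
  rw [dist_comm, mul_comm (Real.sqrt _)]

theorem sqrt_le_add_norm_sub (z w : ℂ) : √(1 + ‖z‖ ^ 2) ≤ √(1 + ‖w‖ ^ 2) + ‖z - w‖ := by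
  apply Real.sqrt_le_iff.2 ⟨by positivity, ?_⟩
  have h1 : ‖z‖ ≤ ‖w‖ + ‖z - w‖ := by
    have := norm_add_le w (z - w); rwa [add_sub_cancel] at this
  have h2 : ‖w‖ ≤ √(1 + ‖w‖ ^ 2) := Real.le_sqrt_of_sq_le (by linarith)
  have h3 := Real.sq_sqrt (show 0 ≤ 1 + ‖w‖ ^ 2 by positivity)
  nlinarith [norm_nonneg z, norm_nonneg w, norm_nonneg (z - w)]

theorem sqrt_le_of_sphericalDist {z w : ℂ} (h : sphericalDist z w * √(1 + ‖w‖ ^ 2) ≤ 1) :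
    √(1 + ‖z‖ ^ 2) ≤ 2 * √(1 + ‖w‖ ^ 2) := by
  have hz : 0 < √(1 + ‖z‖ ^ 2) := Real.sqrt_pos.2 (by positivity)
  have hw : 0 < √(1 + ‖w‖ ^ 2) := Real.sqrt_pos.2 (by positivity)
  have h1 : sphericalDist z w * √(1 + ‖w‖ ^ 2) * √(1 + ‖z‖ ^ 2) = 2 * ‖z - w‖ := by
    unfold sphericalDist; rw [dist_eq_norm]; field_simp
  have h2 := sqrt_le_add_norm_sub z w
  nlinarith

theorem exists_ball_sphericalDist {x : ℂ} (hx : x ∈ FatouSet f) {ε : ℝ} (hε : 0 < ε) :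
    ∃ ρ > 0, ∀ y ∈ ball x ρ, ∀ n, sphericalDist (f^[n] y) (f^[n] x) < ε := by
  obtain ⟨N, hN, hxN, H⟩ := hx
  obtain ⟨δ, hδ, hd⟩ := H x hxN ε hε
  obtain ⟨ρ, hρ, hb⟩ := Metric.isOpen_iff.1 hN x hxN
  exact ⟨min ρ δ, lt_min hρ hδ, fun y hy n =>
    hd y (hb (ball_subset_ball (min_le_left _ _) hy)) (ball_subset_ball (min_le_right _ _) hy) n⟩

theorem exists_ball_bounded {x : ℂ} (hx : x ∈ FatouSet f) {M : ℝ} (hM : ∀ n, ‖f^[n] x‖ ≤ M) :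
    ∃ ρ > 0, ∃ M', ∀ y ∈ ball x ρ, ∀ n, ‖f^[n] y‖ ≤ M' := by
  have hV : 0 < √(1 + M ^ 2) := Real.sqrt_pos.2 (by positivity)
  obtain ⟨ρ, hρ, hb⟩ := exists_ball_sphericalDist hx (inv_pos.2 hV)
  refine ⟨ρ, hρ, 2 * √(1 + M ^ 2), fun y hy n => ?_⟩
  have h1 : √(1 + ‖f^[n] x‖ ^ 2) ≤ √(1 + M ^ 2) := by
    gcongr; exact hM n
  have h2 : sphericalDist (f^[n] y) (f^[n] x) * √(1 + ‖f^[n] x‖ ^ 2) ≤ 1 := by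
    calc _ ≤ (√(1 + M ^ 2))⁻¹ * √(1 + M ^ 2) := by gcongr; exact (hb y hy n).le
      _ = 1 := inv_mul_cancel₀ hV.ne'
  calc ‖f^[n] y‖ ≤ √(1 + ‖f^[n] y‖ ^ 2) := Real.le_sqrt_of_sq_le (by linarith)
    _ ≤ _ := (sqrt_le_of_sphericalDist h2).trans (by linarith)

theorem exists_ball_large {x : ℂ} (hx : x ∈ FatouSet f) {T : ℝ} (hT : 0 < T) :
    ∃ ρ > 0, ∃ T', ∀ n, T' ≤ ‖f^[n] x‖ → ∀ y ∈ ball x ρ, T ≤ ‖f^[n] y‖ := by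
  have hV : 0 < √(1 + T ^ 2) := Real.sqrt_pos.2 (by positivity)
  obtain ⟨ρ, hρ, hb⟩ := exists_ball_sphericalDist hx (inv_pos.2 hV)
  refine ⟨ρ, hρ, 2 * √(1 + T ^ 2), fun n hn y hy => ?_⟩
  by_contra hcon
  push Not at hcon
  have h1 : √(1 + ‖f^[n] y‖ ^ 2) < √(1 + T ^ 2) := by
    apply Real.sqrt_lt_sqrt (by positivity)
    gcongr
  have h2 : sphericalDist (f^[n] x) (f^[n] y) * √(1 + ‖f^[n] y‖ ^ 2) ≤ 1 := by
    rw [sphericalDist_comm]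
    calc _ ≤ (√(1 + T ^ 2))⁻¹ * √(1 + T ^ 2) := by gcongr; exact (hb y hy n).le
      _ = 1 := inv_mul_cancel₀ hV.ne'
  have h3 := sqrt_le_of_sphericalDist h2
  have h4 : ‖f^[n] x‖ ≤ √(1 + ‖f^[n] x‖ ^ 2) := Real.le_sqrt_of_sq_le (by linarith)
  linarith

/-- The orbit of `z` is bounded. -/
def BddOrbit (f : ℂ → ℂ) (z : ℂ) : Prop := ∃ M, ∀ n, ‖f^[n] z‖ ≤ M

theorem exists_log_norm {h : ℂ → ℂ} {c : ℂ} {ρ : ℝ} (hρ : 0 < ρ) (hd : DifferentiableOn ℂ h (ball c ρ))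
    (h0 : ∀ z ∈ ball c ρ, h z ≠ 0) :
    ∃ G : ℂ → ℂ, DifferentiableOn ℂ G (ball c ρ) ∧ (∀ z ∈ ball c ρ, Complex.exp (G z) = h z) ∧
      ∀ z ∈ ball c ρ, (G z).re = Real.log ‖h z‖ := by
  obtain ⟨G, hG, hGe, -⟩ := exists_holo_log (convex_ball c ρ) isOpen_ball hd h0 (mem_ball_self hρ)
    (Complex.exp_log (h0 c (mem_ball_self hρ)))
  refine ⟨G, hG, hGe, fun z hz => ?_⟩
  rw [← hGe z hz, Complex.norm_exp, Real.log_exp]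

theorem RealB.exists_ball_unbounded (h : RealB f S R₀) {x : ℂ} (hx : x ∈ FatouSet f)
    (hM : ¬ BddOrbit f x) : ∃ ρ > 0, ∀ y ∈ ball x ρ, ¬ BddOrbit f y := by
  obtain ⟨ρ, hρ, T', hT⟩ := exists_ball_large hx (T := 2) (by norm_num)
  refine ⟨ρ / 2, half_pos hρ, fun y hy ⟨M, hMy⟩ => hM ?_⟩
  refine ⟨max T' ((max M 2) ^ 3), fun n => ?_⟩
  rcases le_or_gt T' ‖f^[n] x‖ with hn | hn
  swap
  · exact hn.le.trans (le_max_left _ _)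
  refine le_trans ?_ (le_max_right _ _)
  have hlarge := hT n hn
  obtain ⟨G, hGd, hGe, hGr⟩ := exists_log_norm hρ (h.differentiable_iterate n).differentiableOn
    (c := x) (fun z hz h0 => by have := hlarge z hz; rw [h0, norm_zero] at this; linarith)
  have hyρ : y ∈ ball x ρ := ball_subset_ball (by linarith) hy
  have hxρ := mem_ball_self (x := x) hρ
  have hre := rhp_re_ge hGd (fun z hz => by
    rw [hGr z hz]; exact Real.log_pos (by linarith [hlarge z hz])) hyρ (t := 1 / 2)
    (by rw [mem_ball] at hy; linarith) (by norm_num)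
  rw [hGr x hxρ, hGr y hyρ] at hre
  have hx2 := hlarge x hxρ
  have hy2 := hlarge y hyρ
  have h1 : Real.log ‖f^[n] x‖ ≤ Real.log ((max M 2) ^ 3) := by
    rw [Real.log_pow]
    have : Real.log ‖f^[n] y‖ ≤ Real.log (max M 2) :=
      Real.log_le_log (by linarith) ((hMy n).trans (le_max_left _ _))
    push_cast; linarith
  exact (Real.log_le_log_iff (by linarith) (by positivity)).1 h1

theorem RealB.bddOrbit_of_mem_comp (h : RealB f S R₀) {z w : ℂ} (hz : BddOrbit f z)
    (hzF : z ∈ FatouSet f) (hw : w ∈ comp f z) : BddOrbit f w := by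
  by_contra hcon
  have hopen1 : IsOpen {x ∈ comp f z | BddOrbit f x} := by
    rw [Metric.isOpen_iff]
    rintro x ⟨hx, M, hM⟩
    obtain ⟨ρ, hρ, M', hb⟩ := exists_ball_bounded (comp_subset _ hx) hM
    obtain ⟨ρ', hρ', hb'⟩ := Metric.isOpen_iff.1 (isOpen_comp z) x hx
    exact ⟨min ρ ρ', lt_min hρ hρ', fun y hy => ⟨hb' (ball_subset_ball (min_le_right _ _) hy),
      M', hb y (ball_subset_ball (min_le_left _ _) hy)⟩⟩
  have hopen2 : IsOpen {x ∈ comp f z | ¬ BddOrbit f x} := by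
    rw [Metric.isOpen_iff]
    rintro x ⟨hx, hM⟩
    obtain ⟨ρ, hρ, hb⟩ := h.exists_ball_unbounded (comp_subset _ hx) hM
    obtain ⟨ρ', hρ', hb'⟩ := Metric.isOpen_iff.1 (isOpen_comp z) x hx
    exact ⟨min ρ ρ', lt_min hρ hρ', fun y hy => ⟨hb' (ball_subset_ball (min_le_right _ _) hy),
      hb y (ball_subset_ball (min_le_left _ _) hy)⟩⟩
  obtain ⟨x, -, hx1, hx2⟩ := isPreconnected_comp (f := f) z _ _ hopen1 hopen2
    (fun x hx => (em (BddOrbit f x)).imp (fun hb => ⟨hx, hb⟩) fun hb => ⟨hx, hb⟩)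
    ⟨z, mem_comp hzF, mem_comp hzF, hz⟩ ⟨w, hw, hw, hcon⟩
  exact hx2.2 hx1.2

theorem RealB.bdd_on_compact (h : RealB f S R₀) {z : ℂ} (hz : BddOrbit f z) (hzF : z ∈ FatouSet f)
    {K : Set ℂ} (hK : IsCompact K) (hKz : K ⊆ comp f z) : ∃ M, ∀ w ∈ K, ∀ n, ‖f^[n] w‖ ≤ M := by
  refine hK.induction_on (p := fun s => ∃ M, ∀ w ∈ s, ∀ n, ‖f^[n] w‖ ≤ M) ⟨0, by simp⟩
    (fun s t hst ⟨M, hM⟩ => ⟨M, fun w hw => hM w (hst hw)⟩)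
    (fun s t ⟨M, hM⟩ ⟨M', hM'⟩ => ⟨max M M', ?_⟩) fun x hx => ?_
  · rintro w (hw | hw) n
    · exact (hM w hw n).trans (le_max_left _ _)
    · exact (hM' w hw n).trans (le_max_right _ _)
  · obtain ⟨M, hM⟩ := h.bddOrbit_of_mem_comp hz hzF (hKz hx)
    obtain ⟨ρ, hρ, M', hb⟩ := exists_ball_bounded (comp_subset _ (hKz hx)) hM
    exact ⟨ball x ρ, mem_nhdsWithin_of_mem_nhds (ball_mem_nhds x hρ), M', hb⟩

end

section
variable {f : ℂ → ℂ} {S : Set ℂ} {R₀ : ℝ}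

/-- A functional on continuous functions that behaves like integration along a path from `p` to `q`
inside `U` with image `K` and length `C`. -/
structure PathInt (U : Set ℂ) (p q : ℂ) (K : Set ℂ) (C : ℝ) (Λ : (ℂ → ℂ) → ℂ) : Prop where
  compact : IsCompact K
  sub : K ⊆ U
  left : p ∈ K
  right : q ∈ K
  bound : ∀ h : ℂ → ℂ, ∀ M, ContinuousOn h K → (∀ z ∈ K, ‖h z‖ ≤ M) → ‖Λ h‖ ≤ C * M
  linear : ∀ (c : ℂ) (g h : ℂ → ℂ), ContinuousOn g K → ContinuousOn h K →
    Λ (fun z => c * g z + h z) = c * Λ g + Λ h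
  exact : ∀ H h : ℂ → ℂ, ContinuousOn h K → (∀ z ∈ K, HasDerivAt H (h z) z) → Λ h = H q - H p
  log : ∀ a ∉ K, Complex.exp (Λ fun z => (z - a)⁻¹) * (p - a) = q - a

theorem PathInt.of_segment {U : Set ℂ} {p q : ℂ} (h : segment ℝ p q ⊆ U) :
    PathInt U p q (segment ℝ p q) ‖q - p‖
      (fun h => ∫ t in (0 : ℝ)..1, h (p + t * (q - p)) * (q - p)) := by
  have hmem : ∀ t ∈ Icc (0 : ℝ) 1, p + t * (q - p) ∈ segment ℝ p q := by
    intro t ht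
    rw [segment_eq_image']
    exact ⟨t, ht, by simp⟩
  have hcont : ∀ h : ℂ → ℂ, ContinuousOn h (segment ℝ p q) →
      ContinuousOn (fun t : ℝ => h (p + t * (q - p)) * (q - p)) (uIcc 0 1) := by
    intro h hh
    rw [uIcc_of_le zero_le_one]
    exact (hh.comp (by fun_prop) hmem).mul continuousOn_const
  have hline : ∀ t : ℝ, HasDerivAt (fun t : ℝ => p + t * (q - p)) (q - p) t := fun t => by
    simpa using ((Complex.ofRealCLM.hasDerivAt (x := t)).mul_const (q - p)).const_add p
  refine ⟨?_, h, left_mem_segment _ _ _, right_mem_segment _ _ _, ?_, ?_, ?_, ?_⟩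
  · rw [segment_eq_image']
    exact isCompact_Icc.image (by fun_prop)
  · intro h M hh hM
    have := intervalIntegral.norm_integral_le_of_norm_le_const (a := (0 : ℝ)) (b := 1)
      (f := fun t : ℝ => h (p + t * (q - p)) * (q - p)) (C := ‖q - p‖ * M) (fun t ht => by
        rw [uIoc_of_le zero_le_one] at ht
        rw [norm_mul, mul_comm]
        gcongr
        exact hM _ (hmem t ⟨ht.1.le, ht.2⟩))
    simpa using this
  · intro c g h hg hh
    rw [← intervalIntegral.integral_const_mul, ← intervalIntegral.integral_add
      ((hcont g hg).intervalIntegrable.const_mul c) (hcont h hh).intervalIntegrable]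
    congr 1; ext t; ring
  · intro H h hh hH
    have := intervalIntegral.integral_eq_sub_of_hasDerivAt (a := (0 : ℝ)) (b := 1)
      (f := fun t : ℝ => H (p + t * (q - p)))
      (f' := fun t : ℝ => h (p + t * (q - p)) * (q - p)) (fun t ht => by
        rw [uIcc_of_le zero_le_one] at ht
        exact (hH _ (hmem t ht)).comp t (hline t)) (hcont h hh).intervalIntegrable
    rw [this]; simp
  · intro a ha
    have hpa : p - a ≠ 0 := sub_ne_zero.2 fun h => ha (h ▸ left_mem_segment _ _ _)
    have hslit : ∀ t ∈ Icc (0 : ℝ) 1, 1 + t * ((q - p) / (p - a)) ∈ Complex.slitPlane := by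
      intro t ht
      rw [Complex.mem_slitPlane_iff_not_le_zero]
      intro hle
      set u : ℂ := 1 + t * ((q - p) / (p - a)) with hu
      obtain ⟨hre, him⟩ := Complex.le_def.1 hle
      simp only [Complex.zero_re, Complex.zero_im] at hre him
      have hu' : u = (u.re : ℂ) := Complex.ext (by simp) (by simpa using him)
      have h1 : (u.re : ℂ) * (p - a) = (p - a) + t * (q - p) := by
        rw [← hu', hu]; field_simp
      have hlt : 0 < 1 - u.re := by linarith
      apply ha
      have h2 : a = p + ((t / (1 - u.re) : ℝ) : ℂ) * (q - p) := by
        have : (1 - (u.re : ℂ)) ≠ 0 := by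
          rw [← Complex.ofReal_one, ← Complex.ofReal_sub]; exact_mod_cast hlt.ne'
        push_cast
        field_simp
        linear_combination h1
      rw [h2]
      exact hmem _ ⟨div_nonneg ht.1 hlt.le, by rw [div_le_one hlt]; linarith [ht.2]⟩
    have key := intervalIntegral.integral_eq_sub_of_hasDerivAt (a := (0 : ℝ)) (b := 1)
      (f := fun t : ℝ => Complex.log (1 + t * ((q - p) / (p - a))))
      (f' := fun t : ℝ => (p + t * (q - p) - a)⁻¹ * (q - p)) (fun t ht => by
        rw [uIcc_of_le zero_le_one] at ht
        have hd : HasDerivAt (fun t : ℝ => (1 : ℂ) + t * ((q - p) / (p - a))) ((q - p) / (p - a)) t := by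
          simpa using ((Complex.ofRealCLM.hasDerivAt (x := t)).mul_const ((q - p) / (p - a))).const_add 1
        have hne : p + t * (q - p) - a ≠ 0 := sub_ne_zero.2 fun h => ha (h ▸ hmem t ht)
        refine ((Complex.hasDerivAt_log (hslit t ht)).comp t hd).congr_deriv ?_
        have e : (1 : ℂ) + t * ((q - p) / (p - a)) = (p + t * (q - p) - a) / (p - a) := by
          field_simp; ring
        rw [e]
        field_simp) (hcont (fun z => (z - a)⁻¹) (ContinuousOn.inv₀ (by fun_prop)
          fun z hz => sub_ne_zero.2 fun h => ha (h ▸ hz))).intervalIntegrable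
    have hne : 1 + (q - p) / (p - a) ≠ 0 := by
      simpa using Complex.slitPlane_ne_zero (hslit 1 (by simp))
    rw [key]
    simp only [Complex.ofReal_one, one_mul, Complex.ofReal_zero, zero_mul, add_zero, Complex.log_one, sub_zero]
    rw [Complex.exp_log hne]
    field_simp; ring

theorem PathInt.trans {U : Set ℂ} {p q r : ℂ} {K K' : Set ℂ} {C C' : ℝ} {Λ Λ' : (ℂ → ℂ) → ℂ}
    (h : PathInt U p q K C Λ) (h' : PathInt U q r K' C' Λ') :
    PathInt U p r (K ∪ K') (C + C') (fun g => Λ g + Λ' g) where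
  compact := h.compact.union h'.compact
  sub := union_subset h.sub h'.sub
  left := Or.inl h.left
  right := Or.inr h'.right
  bound g M hg hM := by
    have h1 := h.bound g M (hg.mono subset_union_left) fun z hz => hM z (Or.inl hz)
    have h2 := h'.bound g M (hg.mono subset_union_right) fun z hz => hM z (Or.inr hz)
    have := norm_add_le (Λ g) (Λ' g)
    linarith
  linear c g k hg hk := by
    rw [h.linear c g k (hg.mono subset_union_left) (hk.mono subset_union_left),
      h'.linear c g k (hg.mono subset_union_right) (hk.mono subset_union_right)]
    ring
  exact H k hk hH := by
    rw [h.exact H k (hk.mono subset_union_left) fun z hz => hH z (Or.inl hz),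
      h'.exact H k (hk.mono subset_union_right) fun z hz => hH z (Or.inr hz)]
    ring
  log a ha := by
    have h1 := h.log a fun hz => ha (Or.inl hz)
    have h2 := h'.log a fun hz => ha (Or.inr hz)
    rw [Complex.exp_add, mul_right_comm, h1, mul_comm, h2]

theorem exists_pathInt {U : Set ℂ} (hU : IsOpen U) (hc : IsPreconnected U) {p q : ℂ} (hp : p ∈ U)
    (hq : q ∈ U) : ∃ K C Λ, PathInt U p q K C Λ := by
  refine hc.induction₂' (fun p q => ∃ K C Λ, PathInt U p q K C Λ) (fun x hx => ?_)
    (fun x y z _ _ _ ⟨K, C, Λ, h⟩ ⟨K', C', Λ', h'⟩ => ⟨_, _, _, h.trans h'⟩) hp hq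
  obtain ⟨ρ, hρ, hb⟩ := Metric.isOpen_iff.1 hU x hx
  filter_upwards [mem_nhdsWithin_of_mem_nhds (ball_mem_nhds x hρ)] with y hy
  exact ⟨⟨_, _, _, PathInt.of_segment (((convex_ball x ρ).segment_subset (mem_ball_self hρ) hy).trans hb)⟩,
    ⟨_, _, _, PathInt.of_segment (((convex_ball x ρ).segment_subset hy (mem_ball_self hρ)).trans hb)⟩⟩

end

section
variable {f : ℂ → ℂ} {S : Set ℂ} {R₀ : ℝ}

/-- A symmetric plane domain containing two real points has the points between them in the hull of
one of its compact subsets. -/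
theorem exists_hull {U : Set ℂ} (hU : IsOpen U) (hc : IsPreconnected U)
    (hs : ∀ z ∈ U, (starRingEnd ℂ) z ∈ U) {p q a : ℝ} (hp : (p : ℂ) ∈ U) (hq : (q : ℂ) ∈ U)
    (hpa : p < a) (haq : a < q) (ha : (a : ℂ) ∉ U) :
    ∃ K ⊆ U, IsCompact K ∧ ∃ ρ > 0, ∀ b ∈ ball (a : ℂ) ρ, ∀ h : ℂ → ℂ, Differentiable ℂ h →
      ∀ M, (∀ z ∈ K, ‖h z‖ ≤ M) → ‖h b‖ ≤ M := by
  obtain ⟨K₀, C, Λ, P⟩ := exists_pathInt hU hc hp hq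
  set K := K₀ ∪ (starRingEnd ℂ) '' K₀ with hK
  have hKU : K ⊆ U := by
    rintro z (hz | ⟨w, hw, rfl⟩)
    · exact P.sub hz
    · exact hs _ (P.sub hw)
  have hKc : IsCompact K := P.compact.union (P.compact.image Complex.continuous_conj)
  have hpK : (p : ℂ) ∈ K := Or.inl P.left
  have hconjc : ∀ h : ℂ → ℂ, ContinuousOn h K →
      ContinuousOn (fun z => (starRingEnd ℂ) (h ((starRingEnd ℂ) z))) K₀ := fun h hh =>
    Complex.continuous_conj.comp_continuousOn
      (hh.comp Complex.continuous_conj.continuousOn fun z hz => Or.inr ⟨z, hz, rfl⟩)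
  have hC : 0 ≤ C := by
    have := P.bound (fun _ => 0) 1 continuousOn_const (by simp)
    linarith [norm_nonneg (Λ fun _ => 0)]
  set D : (ℂ → ℂ) → ℂ := fun h =>
    Λ h - (starRingEnd ℂ) (Λ fun z => (starRingEnd ℂ) (h ((starRingEnd ℂ) z))) with hD
  have Dbound : ∀ h M, ContinuousOn h K → (∀ z ∈ K, ‖h z‖ ≤ M) → ‖D h‖ ≤ 2 * C * M := by
    intro h M hh hM
    have h1 := P.bound h M (hh.mono subset_union_left) fun z hz => hM z (Or.inl hz)
    have h2 := P.bound _ M (hconjc h hh) fun z hz => by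
      rw [RCLike.norm_conj]; exact hM _ (Or.inr ⟨z, hz, rfl⟩)
    have h3 := norm_sub_le (Λ h)
      ((starRingEnd ℂ) (Λ fun z => (starRingEnd ℂ) (h ((starRingEnd ℂ) z))))
    rw [RCLike.norm_conj] at h3
    linarith
  have Dlin : ∀ (c : ℂ) (g h : ℂ → ℂ), ContinuousOn g K → ContinuousOn h K →
      D (fun z => c * g z + h z) = c * D g + D h := by
    intro c g h hg hh
    have h1 := P.linear c g h (hg.mono subset_union_left) (hh.mono subset_union_left)
    have h2 := P.linear ((starRingEnd ℂ) c) _ _ (hconjc g hg) (hconjc h hh)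
    simp only [hD, h1, map_add, map_mul]
    rw [h2]
    simp only [map_add, map_mul, Complex.conj_conj]
    ring
  have Dexact : ∀ e, Differentiable ℂ e → D e = 0 := by
    intro e he
    obtain ⟨E, hE⟩ := he.isExactOn_univ
    have h1 := P.exact E e he.continuous.continuousOn fun z _ => hE z trivial
    have h2 := P.exact (fun z => (starRingEnd ℂ) (E ((starRingEnd ℂ) z))) _
      (hconjc e he.continuous.continuousOn) fun z _ => by
        have := (hE ((starRingEnd ℂ) z) trivial).conj_conj
        rwa [Complex.conj_conj] at this
    simp only [hD, h1, h2, map_sub, Complex.conj_conj, Complex.conj_ofReal, sub_self]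
  have haK : (a : ℂ) ∉ K := fun h => ha (hKU h)
  set d := infDist (a : ℂ) K with hd
  have hd0 : 0 < d := (hKc.isClosed.notMem_iff_infDist_pos ⟨_, hpK⟩).1 haK
  have hdist : ∀ z ∈ K, d ≤ ‖z - a‖ := fun z hz => by
    rw [← dist_eq_norm, dist_comm]; exact infDist_le_dist_of_mem hz
  have hw : D (fun z => (z - a)⁻¹) ≠ 0 := by
    have h1 := P.log a fun h => haK (Or.inl h)
    set l := Λ fun z => (z - (a : ℂ))⁻¹ with hl
    have h2 : D (fun z => (z - a)⁻¹) = l - (starRingEnd ℂ) l := by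
      simp [hD, hl]
    intro h0
    rw [h2, sub_eq_zero, eq_comm, Complex.conj_eq_iff_re] at h0
    rw [← h0] at h1
    norm_cast at h1
    nlinarith [Real.exp_pos l.re]
  set w := D (fun z => (z - a)⁻¹) with hwdef
  have hwpos : 0 < ‖w‖ := norm_pos_iff.2 hw
  set ρ := min (d / 2) (‖w‖ * d ^ 2 / (8 * (C + 1))) with hρ
  refine ⟨K, hKU, hKc, ρ, by positivity, fun b hb h hh M hM => ?_⟩
  rw [mem_ball, dist_eq_norm] at hb
  have hb1 : ‖b - a‖ < d / 2 := hb.trans_le (min_le_left _ _)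
  have hb2 : ‖b - a‖ * (8 * (C + 1)) < ‖w‖ * d ^ 2 := by
    rw [← lt_div_iff₀ (by positivity)]; exact hb.trans_le (min_le_right _ _)
  have hdb : ∀ z ∈ K, d / 2 ≤ ‖z - b‖ := fun z hz => by
    have := norm_add_le (z - b) (b - a)
    rw [sub_add_sub_cancel] at this
    linarith [hdist z hz]
  have hne : ∀ z ∈ K, z - b ≠ 0 := fun z hz => norm_pos_iff.1 (by linarith [hdb z hz])
  have hnea : ∀ z ∈ K, z - a ≠ 0 := fun z hz => norm_pos_iff.1 (by linarith [hdist z hz])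
  have hcb : ContinuousOn (fun z : ℂ => (z - b)⁻¹) K := ContinuousOn.inv₀ (by fun_prop) hne
  have hca : ContinuousOn (fun z : ℂ => (z - a)⁻¹) K := ContinuousOn.inv₀ (by fun_prop) hnea
  set v := D (fun z => (z - b)⁻¹) with hv
  have hvpos : 0 < ‖v‖ := by
    have h1 := Dlin (-1) _ _ hca hcb
    have h2 := Dbound (fun z => -1 * (z - a)⁻¹ + (z - b)⁻¹) (‖b - a‖ * (2 / d ^ 2))
      ((continuousOn_const.mul hca).add hcb) fun z hz => by
        have e : -1 * (z - (a : ℂ))⁻¹ + (z - b)⁻¹ = (b - a) / ((z - a) * (z - b)) := by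
          field_simp [hne z hz, hnea z hz]; ring
        rw [e, norm_div, norm_mul, div_eq_mul_inv]
        gcongr
        rw [inv_le_comm₀ (mul_pos (norm_pos_iff.2 (hnea z hz)) (norm_pos_iff.2 (hne z hz))) (by positivity),
          inv_div]
        nlinarith [hdist z hz, hdb z hz]
    rw [h1, ← hv, ← hwdef] at h2
    by_contra hcon
    have hv0 : v = 0 := by simpa using hcon
    rw [hv0, add_zero, norm_mul, norm_neg, norm_one, one_mul] at h2
    have h3 : 2 * C * (‖b - a‖ * (2 / d ^ 2)) * d ^ 2 = 4 * C * ‖b - a‖ := by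
      field_simp; ring
    have h4 : ‖w‖ * d ^ 2 ≤ 4 * C * ‖b - a‖ := by
      rw [← h3]; gcongr
    nlinarith [norm_nonneg (b - a)]
  by_contra hcon
  push Not at hcon
  have hM0 : 0 ≤ M := (norm_nonneg _).trans (hM _ hpK)
  have hb0 : 0 < ‖h b‖ := by linarith
  have key : ∀ m : ℕ, ‖v‖ ≤ 2 * C * (2 / d) * (M / ‖h b‖) ^ m := by
    intro m
    have hg : Differentiable ℂ fun z => h z ^ m := hh.pow m
    have he : Differentiable ℂ (dslope (fun z => h z ^ m) b) := by
      rw [← differentiableOn_univ, Complex.differentiableOn_dslope univ_mem, differentiableOn_univ]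
      exact hg
    have h1 := Dlin (h b ^ m) _ _ hcb he.continuous.continuousOn
    rw [Dexact _ he, add_zero, ← hv] at h1
    have h2 := Dbound (fun z => h b ^ m * (z - b)⁻¹ + dslope (fun z => h z ^ m) b z) (M ^ m * (2 / d))
      ((continuousOn_const.mul hcb).add he.continuous.continuousOn) fun z hz => by
        rw [dslope_of_ne _ (sub_ne_zero.1 (hne z hz)), slope_def_field]
        have e : h b ^ m * (z - b)⁻¹ + (h z ^ m - h b ^ m) / (z - b) = h z ^ m * (z - b)⁻¹ := by
          field_simp [hne z hz]; ring
        rw [e, norm_mul, norm_pow, norm_inv]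
        gcongr
        · exact hM z hz
        · rw [inv_le_comm₀ (norm_pos_iff.2 (hne z hz)) (by positivity), inv_div]
          exact hdb z hz
    rw [h1, norm_mul, norm_pow] at h2
    rw [div_pow, mul_div_assoc', le_div_iff₀ (by positivity)]
    linarith
  have ht : Tendsto (fun m : ℕ => 2 * C * (2 / d) * (M / ‖h b‖) ^ m) atTop (𝓝 (2 * C * (2 / d) * 0)) :=
    (tendsto_pow_atTop_nhds_zero_of_lt_one (by positivity) (by rwa [div_lt_one hb0])).const_mul _
  have := ge_of_tendsto' ht key
  linarith [mul_zero (2 * C * (2 / d))]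

/-- A Fatou component with bounded orbits meets the real line in an interval. -/
theorem RealB.mem_comp_of_between (h : RealB f S R₀) {p q a : ℝ} (hpF : (p : ℂ) ∈ FatouSet f)
    (hpb : BddOrbit f p) (hq : (q : ℂ) ∈ comp f p) (hpa : p ≤ a) (haq : a ≤ q) :
    (a : ℂ) ∈ comp f p := by
  by_contra hcon
  have hmem : ∀ a : ℝ, p ≤ a → a ≤ q → (a : ℂ) ∈ FatouSet f := by
    intro a hpa haq
    by_cases ha : (a : ℂ) ∈ comp f p
    · exact comp_subset _ ha
    have h1 : p < a := lt_of_le_of_ne hpa fun e => ha (e ▸ mem_comp hpF)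
    have h2 : a < q := lt_of_le_of_ne haq fun e => ha (e ▸ hq)
    obtain ⟨K, hKU, hK, ρ, hρ, hb⟩ := exists_hull (isOpen_comp _) (isPreconnected_comp _)
      (fun z hz => by simpa using h.conj_mem_comp hz) (mem_comp hpF) hq h1 h2 ha
    obtain ⟨M, hM⟩ := h.bdd_on_compact hpb hpF hK hKU
    exact h.subset_fatou_of_bdd isOpen_ball (M := M) (fun z hz n =>
      hb z hz _ (h.differentiable_iterate n) M fun w hw => hM w hw n) (mem_ball_self hρ)
  refine hcon (subset_comp (A := Complex.ofReal '' Icc p q)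
    (isPreconnected_Icc.image _ Complex.continuous_ofReal.continuousOn) ?_
    ⟨p, ⟨le_rfl, hpa.trans haq⟩, rfl⟩ (mem_comp hpF) ⟨a, ⟨hpa, haq⟩, rfl⟩)
  rintro _ ⟨t, ht, rfl⟩
  exact hmem t ht.1 ht.2

end

section
variable {f : ℂ → ℂ} {S : Set ℂ} {R₀ : ℝ} {z₀ : ℂ} {δ : ℝ}

/-- The real points of the Fatou component of `z`. -/
def realComp (f : ℂ → ℂ) (z : ℂ) : Set ℝ := {t | (t : ℂ) ∈ comp f z}

theorem isOpen_realComp (z : ℂ) : IsOpen (realComp f z) :=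
  (isOpen_comp z).preimage Complex.continuous_ofReal

theorem RealB.ordConnected_realComp (h : RealB f S R₀) {z : ℂ} (hz : BddOrbit f z)
    (hzF : z ∈ FatouSet f) : (realComp f z).OrdConnected := by
  refine ⟨fun p hp q hq a ha => ?_⟩
  have e := comp_eq (f := f) (show (p : ℂ) ∈ comp f z from hp)
  show (a : ℂ) ∈ comp f z
  rw [← e]
  exact h.mem_comp_of_between (comp_subset _ hp) (h.bddOrbit_of_mem_comp hz hzF hp)
    (by rw [e]; exact hq) ha.1 ha.2

theorem mem_comp_of_mem_closure {z w : ℂ} (hw : w ∈ closure (comp f z)) (hwF : w ∈ FatouSet f) :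
    w ∈ comp f z := by
  obtain ⟨u, hu, huz⟩ := mem_closure_iff.1 hw _ (isOpen_comp w) (mem_comp hwF)
  rw [← comp_eq huz, comp_eq hu]
  exact mem_comp hwF

theorem RealB.image_realComp (h : RealB f S R₀) {p : ℝ} (hp : (p : ℂ) ∈ FatouSet f)
    (hb : BddOrbit f p) (hI : Bornology.IsBounded (realComp f p))
    (hne : ∀ x ∈ realComp f p, deriv f x ≠ 0) : rl f '' realComp f p = realComp f (f p) := by
  have hmaps : MapsTo (rl f) (realComp f p) (realComp f (f p)) := fun t ht => by
    show ((rl f t : ℝ) : ℂ) ∈ comp f (f p)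
    rw [h.ofReal_rl]
    exact h.image_comp 1 hp ⟨t, ht, rfl⟩
  refine Subset.antisymm hmaps.image_subset ?_
  have hb' : BddOrbit f (f p) := by
    obtain ⟨M, hM⟩ := hb
    exact ⟨M, fun n => by rw [← Function.iterate_succ_apply]; exact hM (n + 1)⟩
  have hconn : IsPreconnected (realComp f (f p)) :=
    (h.ordConnected_realComp hb' (h.apply_mem_fatou hp)).isPreconnected
  have hopen : IsOpen (rl f '' realComp f p) := by
    rw [isOpen_iff_mem_nhds]
    rintro _ ⟨t, ht, rfl⟩
    have hd : HasStrictDerivAt (rl f) (deriv f (t : ℂ)).re t := by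
      have hs : HasStrictDerivAt f (deriv f (t : ℂ)) (t : ℂ) :=
        (h.diff.analyticAt t).hasStrictDerivAt
      exact hs.real_of_complex
    rw [← hd.map_nhds_eq (h.re_deriv_ne_zero (hne t ht))]
    exact image_mem_map ((isOpen_realComp _).mem_nhds ht)
  have hcomp : IsCompact (rl f '' closure (realComp f p)) :=
    (hI.isCompact_closure).image h.continuous_rl
  refine hconn.subset_left_of_subset_union hopen hcomp.isClosed.isOpen_compl ?_ ?_ ?_
  · exact disjoint_compl_right.mono_left (image_mono subset_closure)
  · intro t ht
    by_cases htc : t ∈ rl f '' closure (realComp f p)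
    · left
      obtain ⟨u, hu, rfl⟩ := htc
      refine ⟨u, ?_, rfl⟩
      have hfu : f (u : ℂ) ∈ FatouSet f := by
        rw [← h.ofReal_rl]; exact comp_subset _ ht
      refine mem_comp_of_mem_closure ?_ (h.mem_fatou_of_apply hfu)
      exact map_mem_closure Complex.continuous_ofReal hu fun x hx => hx
    · exact Or.inr htc
  · exact ⟨rl f p, hmaps (mem_comp hp), p, mem_comp hp, rfl⟩

theorem mem_slitDom_realComp {z w : ℂ} (hw : w ∈ comp f z) : w ∈ slitDom (realComp f z) := by
  by_cases hi : w.im = 0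
  · right
    show ((w.re : ℝ) : ℂ) ∈ comp f z
    rwa [ofReal_re_of_im_eq_zero hi]
  · exact Or.inl hi

theorem RealB.exists_inverse_comp (h : RealB f S R₀) {p : ℝ} (hp : (p : ℂ) ∈ FatouSet f)
    (hb : BddOrbit f p) (hI : Bornology.IsBounded (realComp f p))
    (hne : ∀ x ∈ realComp f p, deriv f x ≠ 0) :
    ∃ g : ℂ → ℂ, DifferentiableOn ℂ g (slitDom (realComp f (f p))) ∧
      MapsTo g (slitDom (realComp f (f p))) (slitDom (realComp f p)) ∧
      (∀ x ∈ realComp f (f p), (g x).im = 0) ∧ ∀ z ∈ comp f p, g (f z) = z := by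
  obtain ⟨g, hgd, hfg, hg⟩ := h.glue (isOpen_realComp (f := f) (p : ℂ)) (h.ordConnected_realComp hb hp)
    ⟨p, mem_comp hp⟩ hne
  have hmaps := h.branch_mem_slitDom subset_rfl hfg hg
  have himg := h.image_realComp hp hb hI hne
  rw [himg] at hgd hmaps
  refine ⟨g, hgd, hmaps, ?_, ?_⟩
  · intro x hx
    rw [← himg] at hx
    obtain ⟨t, ht, rfl⟩ := hx
    rw [h.ofReal_rl, hg t ht, Complex.ofReal_im]
  · have hfm : MapsTo f (comp f p) (slitDom (realComp f (f p))) := fun z hz =>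
      mem_slitDom_realComp (h.image_comp 1 hp ⟨z, hz, rfl⟩)
    have hA : AnalyticOnNhd ℂ (fun z => g (f z)) (comp f p) :=
      (hgd.comp h.diff.differentiableOn hfm).analyticOnNhd (isOpen_comp _)
    refine hA.eqOn_of_preconnected_of_frequently_eq (z₀ := (p : ℂ)) (g := fun z => z)
      (fun z _ => analyticAt_id) (isPreconnected_comp _) (mem_comp hp) ?_
    have ht : Tendsto (fun t : ℝ => (t : ℂ)) (𝓝[≠] p) (𝓝[≠] (p : ℂ)) := by
      refine tendsto_nhdsWithin_iff.2 ⟨(Complex.continuous_ofReal.tendsto p).mono_left nhdsWithin_le_nhds, ?_⟩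
      filter_upwards [self_mem_nhdsWithin] with t ht
      exact fun hc => ht (Complex.ofReal_injective hc)
    refine ht.frequently (Eventually.frequently ?_)
    filter_upwards [mem_nhdsWithin_of_mem_nhds ((isOpen_realComp (f := f) (p : ℂ)).mem_nhds (mem_comp hp))]
      with t ht
    exact hg t ht

end

section
variable {f : ℂ → ℂ} {S : Set ℂ} {R₀ : ℝ} {z₀ : ℂ} {δ : ℝ}

theorem BddOrbit.iterate {z : ℂ} (hz : BddOrbit f z) (k : ℕ) : BddOrbit f (f^[k] z) := by
  obtain ⟨M, hM⟩ := hz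
  exact ⟨M, fun n => by rw [← Function.iterate_add_apply]; exact hM _⟩

/-- There is no wandering component with bounded orbits whose forward orbit avoids the real line. -/
theorem RealB.false_of_nonreal (h : RealB f S R₀) {z : ℂ} (hz : Wand f z) (hb : BddOrbit f z)
    (hI : ∀ n, ∀ w ∈ comp f (f^[n] z), w.im ≠ 0) : False := by
  obtain ⟨δ, hδ, hball⟩ := Metric.isOpen_iff.1 (isOpen_comp z) z (mem_comp hz.1)
  have o : Orb f z δ := ⟨hz, hδ, fun w hw n => hI n _ (h.image_comp n hz.1 ⟨w, hball hw, rfl⟩)⟩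
  obtain ⟨B, hB⟩ := hb
  obtain ⟨N, -, hN⟩ := o.ball_subset h hB (L := 2) two_pos 0
  have hs := o.abs_im_pos N
  refine hI N (((f^[N] z).re : ℝ) : ℂ) (hN ?_) (Complex.ofReal_im _)
  rw [mem_ball, dist_eq_norm]
  have := norm_sub_le_re_add_im (((f^[N] z).re : ℝ) : ℂ) (f^[N] z)
  simp only [Complex.ofReal_re, sub_self, abs_zero, Complex.ofReal_im, zero_add] at this
  linarith

theorem eq_Ioo_of_isOpen {I : Set ℝ} (ho : IsOpen I) (hc : I.OrdConnected) (hn : I.Nonempty) {B : ℝ}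
    (hB : I ⊆ Ioo (-B) B) : ∃ a b, a < b ∧ I = Ioo a b := by
  have hbb : BddBelow I := ⟨-B, fun t ht => (hB ht).1.le⟩
  have hba : BddAbove I := ⟨B, fun t ht => (hB ht).2.le⟩
  have hsub : I ⊆ Ioo (sInf I) (sSup I) := by
    intro t ht
    obtain ⟨ρ, hρ, hb⟩ := Metric.isOpen_iff.1 ho t ht
    have h1 : t - ρ / 2 ∈ I := hb (by rw [mem_ball, Real.dist_eq, abs_lt]; constructor <;> linarith)
    have h2 : t + ρ / 2 ∈ I := hb (by rw [mem_ball, Real.dist_eq, abs_lt]; constructor <;> linarith)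
    exact ⟨by linarith [csInf_le hbb h1], by linarith [le_csSup hba h2]⟩
  obtain ⟨t, ht⟩ := hn
  exact ⟨_, _, (hsub ht).1.trans (hsub ht).2,
    hsub.antisymm (IsConnected.Ioo_csInf_csSup_subset ⟨⟨t, ht⟩, hc.isPreconnected⟩ hbb hba)⟩

theorem eventually_notMem_comp {z c : ℂ} (hz : Wand f z) :
    ∀ᶠ n in atTop, c ∉ comp f (f^[n] z) := by
  by_cases hex : ∃ m, c ∈ comp f (f^[m] z)
  · obtain ⟨m, hm⟩ := hex
    filter_upwards [eventually_gt_atTop m] with n hn hcn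
    refine hz.2 m n hn.ne ?_
    rw [← comp_eq hm, comp_eq hcn]
    by_contra hcon
    have : f^[n] z ∈ FatouSet f := by
      by_contra hF
      rw [comp, connectedComponentIn_eq_empty hF] at hcn
      exact hcn
    exact hcon (mem_comp this)
  · exact Eventually.of_forall fun n hn => hex ⟨n, hn⟩

/-- Eventually the real points of a real wandering orbit form small intervals on which `f` is
locally injective. -/
theorem RealB.eventually_realComp (h : RealB f S R₀) {p : ℝ} (hp : Wand f p) (hb : BddOrbit f p) :
    ∃ B, ∀ᶠ n in atTop, realComp f (f^[n] p) ⊆ Ioo (-B) B ∧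
      ∀ x ∈ realComp f (f^[n] p), deriv f x ≠ 0 := by
  obtain ⟨B, hB⟩ := hb
  have hB0 : 0 ≤ B := (norm_nonneg _).trans (hB 0)
  obtain ⟨C, -, hC1, hC2, hC3⟩ := h.exists_crit hB0
  refine ⟨B + 1, ?_⟩
  have hev : ∀ᶠ n in atTop, ∀ c ∈ C, (c : ℂ) ∉ comp f (f^[n] p) :=
    (Finset.eventually_all C).2 fun c _ => eventually_notMem_comp hp
  filter_upwards [hev] with n hn
  have hF := (h.iterate_mem_fatou n).2 hp.1
  have hoc := h.ordConnected_realComp (BddOrbit.iterate ⟨B, hB⟩ n) hF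
  have hpn : (rl f)^[n] p ∈ realComp f (f^[n] p) := by
    show (((rl f)^[n] p : ℝ) : ℂ) ∈ comp f (f^[n] p)
    rw [← h.iterate_ofReal]; exact mem_comp hF
  have hpB : |(rl f)^[n] p| ≤ B := by
    have := hB n
    rwa [h.iterate_ofReal, Complex.norm_real] at this
  rw [abs_le] at hpB
  have hsub : realComp f (f^[n] p) ⊆ Ioo (-(B + 1)) (B + 1) := by
    intro t ht
    constructor
    · by_contra hcon
      exact hn _ hC1 (hoc.out ht hpn ⟨not_lt.1 hcon, by linarith⟩)
    · by_contra hcon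
      exact hn _ hC2 (hoc.out hpn ht ⟨by linarith, not_lt.1 hcon⟩)
  exact ⟨hsub, fun x hx h0 => hn x (hC3 x (abs_lt.2 (hsub hx)) h0) hx⟩

/-- A real point with bounded orbit is not in a wandering component. -/
theorem RealB.false_of_real (h : RealB f S R₀) {p : ℝ} (hp : Wand f p) (hb : BddOrbit f p) :
    False := by
  obtain ⟨B, hB⟩ := h.eventually_realComp hp hb
  obtain ⟨N, hN⟩ := eventually_atTop.1 hB
  have hF : ∀ n, f^[n] (p : ℂ) ∈ FatouSet f := fun n => (h.iterate_mem_fatou n).2 hp.1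
  have hg : ∀ n ≥ N, ∃ g : ℂ → ℂ, DifferentiableOn ℂ g (slitDom (realComp f (f^[n + 1] p))) ∧
      MapsTo g (slitDom (realComp f (f^[n + 1] p))) (slitDom (realComp f (f^[n] p))) ∧
      (∀ x ∈ realComp f (f^[n + 1] p), (g x).im = 0) ∧ ∀ z ∈ comp f (f^[n] p), g (f z) = z := by
    intro n hn
    obtain ⟨h1, h2⟩ := hN n hn
    have e : f^[n + 1] (p : ℂ) = f (((rl f)^[n] p : ℝ) : ℂ) := by
      rw [Function.iterate_succ_apply', h.iterate_ofReal]
    have hFn := hF n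
    have hbn := hb.iterate n
    rw [e]
    rw [h.iterate_ofReal n p] at h1 h2 hFn hbn ⊢
    exact h.exists_inverse_comp hFn hbn ((isBounded_Ioo _ _).subset h1) h2
  have hinter : ∀ n ≥ N, ∃ a b, a < b ∧ realComp f (f^[n] p) = Ioo a b := fun n hn => by
    refine eq_Ioo_of_isOpen (isOpen_realComp _) (h.ordConnected_realComp (hb.iterate n) (hF n)) ?_
      (hN n hn).1
    refine ⟨(rl f)^[n] p, ?_⟩
    show (((rl f)^[n] p : ℝ) : ℂ) ∈ comp f (f^[n] p)
    rw [← h.iterate_ofReal]; exact mem_comp (hF n)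
  choose! a b hab hIab using hinter
  have hnr : ∀ n ≥ N, ∀ z ∈ comp f (f^[n] p), z.im ≠ 0 → (f z).im ≠ 0 := by
    intro n hn z hz hz0 hfz
    obtain ⟨g, -, -, hgr, hgf⟩ := hg n hn
    have hmem : f z ∈ comp f (f^[n + 1] p) := by
      rw [Function.iterate_succ_apply']
      exact h.image_comp 1 (hF n) ⟨z, hz, rfl⟩
    have h1 := hgr (f z).re (show (((f z).re : ℝ) : ℂ) ∈ comp f (f^[n + 1] p) by
      rwa [ofReal_re_of_im_eq_zero hfz])
    rw [ofReal_re_of_im_eq_zero hfz, hgf z hz] at h1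
    exact hz0 h1
  obtain ⟨z', hz', hz'0⟩ : ∃ z' ∈ comp f (f^[N] p), z'.im ≠ 0 := by
    obtain ⟨ρ, hρ, hball⟩ := Metric.isOpen_iff.1 (isOpen_comp (f := f) (f^[N] p)) _ (mem_comp (hF N))
    refine ⟨f^[N] p + ((ρ / 2 : ℝ) : ℂ) * Complex.I, hball ?_, ?_⟩
    · rw [mem_ball, dist_eq_norm, add_sub_cancel_left, norm_mul, Complex.norm_I, mul_one,
        Complex.norm_real, Real.norm_eq_abs, abs_of_pos (by positivity)]
      linarith
    · rw [h.iterate_ofReal]; simp [hρ.ne']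
  have himg : ∀ n, ∀ z ∈ comp f (f^[N] p), f^[n] z ∈ comp f (f^[N + n] p) := fun n z hz => by
    rw [add_comm, Function.iterate_add_apply]
    exact h.image_comp n (hF N) ⟨z, hz, rfl⟩
  have hnrn : ∀ n, ∀ z ∈ comp f (f^[N] p), z.im ≠ 0 → (f^[n] z).im ≠ 0 := by
    intro n z hz hz0
    induction n with
    | zero => exact hz0
    | succ n ih =>
      rw [Function.iterate_succ_apply']
      exact hnr (N + n) (by omega) _ (himg n z hz) ih
  obtain ⟨δ, hδ, hball⟩ := Metric.isOpen_iff.1 ((isOpen_comp (f := f) (f^[N] p)).inter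
    (isOpen_ne.preimage Complex.continuous_im)) z' ⟨hz', hz'0⟩
  have o : Orb f z' δ := ⟨h.wand_of_mem_comp (h.wand_iterate hp N) hz', hδ,
    fun w hw n => hnrn n w (hball hw).1 (hball hw).2⟩
  obtain ⟨B', hB'⟩ := h.bddOrbit_of_mem_comp (hb.iterate N) (hF N) hz'
  have hang : ∀ n, theta (a (N + n)) (b (N + n)) (f^[n] z') ≤ theta (a N) (b N) z' := by
    intro n
    induction n with
    | zero => exact le_rfl
    | succ n ih =>
      refine le_trans ?_ ih
      obtain ⟨g, hgd, hgm, hgr, hgf⟩ := hg (N + n) (by omega)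
      rw [hIab (N + n) (by omega), show N + n + 1 = N + (n + 1) from rfl,
        hIab (N + (n + 1)) (by omega)] at hgm
      rw [show N + n + 1 = N + (n + 1) from rfl, hIab (N + (n + 1)) (by omega)] at hgd hgr
      have e : g (f^[n + 1] z') = f^[n] z' := by
        rw [Function.iterate_succ_apply']
        exact hgf _ (himg n z' hz')
      have := theta_le_of_maps (hab (N + (n + 1)) (by omega)) (hab (N + n) (by omega)) hgd hgm hgr
        (z := f^[n + 1] z') (hnrn (n + 1) z' hz' hz'0) (by rw [e]; exact hnrn n z' hz' hz'0)
      rwa [e] at this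
  set θ := theta (a N) (b N) z' with hθ
  obtain ⟨hθ0, hθπ⟩ : θ ∈ Ioo 0 Real.pi := theta_mem (hab N le_rfl) hz'0
  set T := Real.tan (θ / 2) with hT
  have hT0 : 0 < T := Real.tan_pos_of_pos_of_lt_pi_div_two (by linarith) (by linarith)
  obtain ⟨n, -, hn⟩ := o.ball_subset h hB' (L := T + 2) (by linarith) 0
  have hs := o.abs_im_pos n
  rw [comp_eq (himg n z' hz')] at hn
  have hreal : ∀ t : ℝ, |t - (f^[n] z').re| ≤ T * |(f^[n] z').im| → t ∈ Ioo (a (N + n)) (b (N + n)) := by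
    intro t ht
    rw [← hIab (N + n) (by omega)]
    apply hn
    rw [mem_ball, dist_eq_norm]
    have := norm_sub_le_re_add_im (t : ℂ) (f^[n] z')
    simp only [Complex.ofReal_re, Complex.ofReal_im, abs_zero, add_zero] at this
    linarith
  set x := (f^[n] z').re with hx
  set s := |(f^[n] z').im| with hs'
  have h1 := hreal (x - T * s) (by rw [sub_sub_cancel_left, abs_neg, abs_of_pos (by positivity)])
  have h2 := hreal (x + T * s) (by rw [add_sub_cancel_left, abs_of_pos (by positivity)])
  have harc : Real.arctan T = θ / 2 := Real.arctan_tan (by linarith) (by linarith)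
  have h3 : Real.arctan T < Real.arctan ((b (N + n) - x) / s) := Real.arctan_strictMono (by
    rw [lt_div_iff₀ hs]; linarith [h2.2])
  have h4 : Real.arctan ((a (N + n) - x) / s) < Real.arctan (-T) := Real.arctan_strictMono (by
    rw [div_lt_iff₀ hs]; linarith [h1.1])
  rw [Real.arctan_neg] at h4
  have h5 := hang n
  unfold theta at h5
  rw [← hx, ← hs'] at h5
  linarith

end

section
variable {f : ℂ → ℂ} {S : Set ℂ} {R₀ : ℝ} {z₀ : ℂ} {δ : ℝ}

/-- An entire function of polynomial growth is a polynomial. -/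
theorem exists_polynomial_of_growth (hf : Differentiable ℂ f) {C r : ℝ} {l : ℕ}
    (hC : ∀ z, r ≤ ‖z‖ → ‖f z‖ ≤ C * ‖z‖ ^ l) : ∃ p : Polynomial ℂ, ∀ z : ℂ, f z = p.eval z := by
  have hz : ∀ n, l < n → iteratedDeriv n f 0 = 0 := by
    intro n hn
    have hle : ∀ᶠ R : ℝ in atTop, ‖iteratedDeriv n f 0‖ ≤ n.factorial * |C| * R⁻¹ := by
      filter_upwards [eventually_ge_atTop r, eventually_ge_atTop 1] with R hR hR1
      have hR0 : 0 < R := by linarith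
      refine (Complex.norm_iteratedDeriv_le_of_forall_mem_sphere_norm_le n hR0
        hf.diffContOnCl (C := |C| * R ^ l) fun z hz => ?_).trans ?_
      · rw [mem_sphere_zero_iff_norm] at hz
        refine (hC z (by rw [hz]; exact hR)).trans ?_
        rw [hz]
        gcongr
        exact le_abs_self C
      · rw [← mul_assoc, div_le_iff₀ (by positivity), mul_assoc _ R⁻¹]
        gcongr
        obtain ⟨k, rfl⟩ := Nat.exists_eq_add_of_lt hn
        rw [pow_succ, mul_comm _ R, inv_mul_cancel_left₀ hR0.ne']
        exact pow_le_pow_right₀ hR1 (by omega)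
    have hlim : Tendsto (fun R : ℝ => (n.factorial : ℝ) * |C| * R⁻¹) atTop (𝓝 0) := by
      simpa using tendsto_inv_atTop_zero.const_mul ((n.factorial : ℝ) * |C|)
    exact norm_le_zero_iff.1 (ge_of_tendsto hlim hle)
  refine ⟨∑ n ∈ Finset.range (l + 1),
    Polynomial.C ((n.factorial : ℂ)⁻¹ * iteratedDeriv n f 0) * Polynomial.X ^ n, fun z => ?_⟩
  have hs := Complex.hasSum_taylorSeries_of_entire hf 0 z
  have hs' := hasSum_sum_of_ne_finset_zero (L := SummationFilter.unconditional ℕ)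
    (f := fun n : ℕ => ((n.factorial : ℂ)⁻¹ • (z - 0) ^ n • iteratedDeriv n f 0))
    (s := Finset.range (l + 1)) (fun n hn => by
      rw [Finset.mem_range, not_lt] at hn
      rw [hz n (by omega), smul_zero, smul_zero])
  rw [hs.unique hs', Polynomial.eval_finsetSum]
  refine Finset.sum_congr rfl fun n _ => ?_
  simp
  ring

theorem lift_unique {p G₁ G₂ : ℂ → ℂ} (hp : Differentiable ℂ p) {V : Set ℂ}
    (hV : IsOpen V) (hVc : IsPreconnected V) (h1 : DifferentiableOn ℂ G₁ V)
    (h2 : DifferentiableOn ℂ G₂ V) (hi : ∀ z ∈ V, p (G₁ z) = p (G₂ z))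
    {y : ℂ} (hy : y ∈ V) (hne : deriv p (G₁ y) ≠ 0) (he : G₁ y = G₂ y) : EqOn G₁ G₂ V := by
  have hVy := hV.mem_nhds hy
  obtain ⟨q, -, -, -, hq⟩ := exists_local_inverse (hp.analyticAt _) hne
  have t1 := (h1.differentiableAt hVy).continuousAt.tendsto.eventually hq
  have t2 := (h2.differentiableAt hVy).continuousAt.tendsto.eventually (he ▸ hq)
  refine (h1.analyticOnNhd hV).eqOn_of_preconnected_of_eventuallyEq (h2.analyticOnNhd hV) hVc hy ?_
  filter_upwards [t1, t2, hVy] with z a b c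
  rw [← a, ← b, hi z c]

/-- The right half plane on which `exp` takes values of modulus larger than `R₀`. -/
def logDom (R₀ : ℝ) : Set ℂ := {ω : ℂ | Real.log R₀ < ω.re}

theorem isOpen_logDom : IsOpen (logDom R₀) :=
  isOpen_lt continuous_const Complex.continuous_re

theorem convex_logDom : Convex ℝ (logDom R₀) := convex_halfSpace_re_gt _

theorem RealB.lt_norm_exp (h : RealB f S R₀) {ω : ℂ} (hω : ω ∈ logDom R₀) :
    R₀ < ‖Complex.exp ω‖ := by
  rw [Complex.norm_exp, ← Real.log_lt_iff_lt_exp h.pos]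
  exact hω

/-- A logarithmic tract lift is never periodic under the deck group of `exp`. -/
theorem RealB.not_periodic (h : RealB f S R₀) {E : ℂ → ℂ}
    (hE : DifferentiableOn ℂ E (logDom R₀)) (hfE : ∀ ω ∈ logDom R₀, f (E ω) = Complex.exp ω)
    {l : ℕ} (hl : 0 < l)
    (hper : ∀ ω ∈ logDom R₀, E (ω + 2 * Real.pi * Complex.I * l) = E ω) : False := by
  have hE0 : ∀ ω ∈ logDom R₀, E ω ≠ 0 := by
    intro ω hω h0
    have := h.lt_norm_exp hω
    rw [← hfE ω hω, h0] at this
    linarith [h.zero_bdd]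
  classical
  set F : ℂ → ℂ := fun τ => if Real.log R₀ < τ.im then (E (-Complex.I * τ))⁻¹ else 0 with hF
  set p : ℝ := 2 * Real.pi * l with hp
  have hl' : (0 : ℝ) < l := by exact_mod_cast hl
  have hp0 : 0 < p := by positivity
  have hmem : ∀ τ : ℂ, Real.log R₀ < τ.im → -Complex.I * τ ∈ logDom R₀ := by
    intro τ hτ
    simpa [logDom] using hτ
  have hFp : Function.Periodic F p := by
    intro τ
    simp only [hF, Complex.add_im, Complex.ofReal_im, add_zero]
    split_ifs with hτ
    · have hm : -Complex.I * (τ + p) ∈ logDom R₀ := by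
        simpa [logDom] using hτ
      rw [← hper _ hm]
      congr 2
      rw [hp]
      push_cast
      ring
    · rfl
  have hev : ∀ T : ℝ, ∀ᶠ τ in comap Complex.im atTop, T < τ.im := fun T =>
    (eventually_gt_atTop T).comap _
  have hhol : ∀ᶠ τ in comap Complex.im atTop, DifferentiableAt ℂ F τ := by
    filter_upwards [hev (Real.log R₀)] with τ hτ
    have : F =ᶠ[𝓝 τ] fun τ => (E (-Complex.I * τ))⁻¹ := by
      filter_upwards [(isOpen_lt continuous_const Complex.continuous_im).mem_nhds hτ] with y hy
      exact if_pos hy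
    refine DifferentiableAt.congr_of_eventuallyEq ?_ this
    exact (DifferentiableAt.comp (f := fun τ : ℂ => -Complex.I * τ) τ (hE.differentiableAt (isOpen_logDom.mem_nhds (hmem τ hτ)))
      (differentiableAt_id.const_mul (-Complex.I))).fun_inv (hE0 _ (hmem τ hτ))
  have hz : ZeroAtFilter (comap Complex.im atTop) F := by
    rw [ZeroAtFilter, Metric.tendsto_nhds]
    intro ε hε
    obtain ⟨M, hM⟩ := (isCompact_closedBall (0 : ℂ) ε⁻¹).exists_bound_of_continuousOn
      h.diff.continuous.continuousOn
    filter_upwards [hev (Real.log R₀), hev (Real.log (max M 1))] with τ hτ hτ'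
    rw [dist_zero_right]
    simp only [hF, if_pos hτ, norm_inv]
    refine inv_lt_of_inv_lt₀ hε ?_
    by_contra hcon
    have := hM (E (-Complex.I * τ)) (by rw [mem_closedBall_zero_iff]; exact not_lt.1 hcon)
    rw [hfE _ (hmem τ hτ), Complex.norm_exp] at this
    have h2 : max M 1 < Real.exp τ.im := by
      rwa [← Real.log_lt_iff_lt_exp (by positivity)]
    have h3 : (-Complex.I * τ).re = τ.im := by simp
    rw [h3] at this
    linarith [le_max_left M 1]
  have hc0 := Function.Periodic.cuspFunction_zero_of_zero_at_inf hp0 hz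
  have hd := Function.Periodic.differentiableAt_cuspFunction_zero hp0 hFp hhol hz.boundedAtFilter
  set g := Function.Periodic.cuspFunction p F with hg
  have hda : AnalyticAt ℂ g 0 := by
    refine Complex.analyticAt_of_differentiable_on_punctured_nhds_of_continuousAt ?_ hd.continuousAt
    exact Function.Periodic.eventually_differentiableAt_cuspFunction_nhds_ne_zero hp0 hFp hhol
  have hgq : ∀ q : ℂ, q ≠ 0 → g q = F (Function.Periodic.invQParam p q) := fun q hq =>
    Function.Periodic.cuspFunction_eq_of_nonzero _ _ hq
  have hsmall : ∀ᶠ q in 𝓝[≠] (0 : ℂ), Real.log R₀ < (Function.Periodic.invQParam p q).im :=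
    (Function.Periodic.invQParam_tendsto hp0).eventually (hev _)
  have hopen : 𝓝 (g 0) ≤ map g (𝓝 0) := by
    refine hda.eventually_constant_or_nhds_le_map_nhds.resolve_left fun hcon => ?_
    obtain ⟨q, h1, h2, h3⟩ :=
      ((hcon.filter_mono nhdsWithin_le_nhds).and (hsmall.and self_mem_nhdsWithin)).exists
    rw [hc0, hgq q h3] at h1
    simp only [hF, if_pos h2] at h1
    exact hE0 _ (hmem _ h2) (inv_eq_zero.1 h1)
  obtain ⟨c, hc⟩ := hd.isBigO_sub.bound
  have key : ∀ᶠ q in 𝓝 (0 : ℂ), q ≠ 0 → Real.log R₀ < (Function.Periodic.invQParam p q).im ∧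
      ‖g q‖ ≤ c * ‖q‖ := by
    have := eventually_nhdsWithin_iff.1 hsmall
    filter_upwards [this, hc] with q h1 h2 hq
    refine ⟨h1 hq, by simpa [hc0] using h2⟩
  have him : ∀ᶠ w in 𝓝 (0 : ℂ), ∃ q, g q = w ∧ (q ≠ 0 →
      Real.log R₀ < (Function.Periodic.invQParam p q).im ∧ ‖g q‖ ≤ c * ‖q‖) := by
    rw [hc0] at hopen
    have := hopen (image_mem_map key)
    filter_upwards [this] with w hw
    obtain ⟨q, hq, hqw⟩ := hw
    exact ⟨q, hqw, hq⟩
  obtain ⟨ρ, hρ, hb⟩ := Metric.eventually_nhds_iff.1 him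
  refine h.npoly (exists_polynomial_of_growth h.diff (C := |c| ^ l) (r := ρ⁻¹ + 1) (l := l)
    fun z hz => ?_)
  have hz0 : z ≠ 0 := norm_pos_iff.1 ((add_pos (inv_pos.2 hρ) one_pos).trans_le hz)
  obtain ⟨q, hqz, hq⟩ := hb (y := z⁻¹) (by
    rw [dist_zero_right, norm_inv]
    exact inv_lt_of_inv_lt₀ hρ (by linarith))
  have hq0 : q ≠ 0 := by
    rintro rfl
    rw [hc0] at hqz
    exact inv_ne_zero hz0 hqz.symm
  obtain ⟨hq1, hq2⟩ := hq hq0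
  have hzE : E (-Complex.I * Function.Periodic.invQParam p q) = z := by
    have := hgq q hq0
    rw [hqz] at this
    simp only [hF, if_pos hq1] at this
    exact (inv_injective this).symm
  rw [← hzE, hfE _ (hmem _ hq1), hzE, ← mul_pow, Complex.norm_exp]
  have h3 : (-Complex.I * Function.Periodic.invQParam p q).re
      = l * -Real.log ‖q‖ := by
    simp only [neg_mul, Complex.neg_re, Complex.I_mul_re, neg_neg]
    rw [Function.Periodic.im_invQParam, hp]
    field_simp
  have hqn : 0 < ‖q‖ := norm_pos_iff.2 hq0
  have hzn : 0 < ‖z‖ := norm_pos_iff.2 hz0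
  rw [h3, Real.exp_nat_mul, Real.exp_neg, Real.exp_log hqn]
  refine pow_le_pow_left₀ (by positivity) ?_ _
  rw [hqz, norm_inv] at hq2
  rw [inv_le_iff_one_le_mul₀ hqn]
  rw [inv_le_iff_one_le_mul₀ hzn] at hq2
  calc (1:ℝ) ≤ c * ‖q‖ * ‖z‖ := hq2
    _ ≤ |c| * ‖q‖ * ‖z‖ := by gcongr; exact le_abs_self c
    _ = |c| * ‖z‖ * ‖q‖ := by ring

end

section
variable {f : ℂ → ℂ} {S : Set ℂ} {R₀ : ℝ} {z₀ : ℂ} {δ : ℝ}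

theorem RealB.notMem_of_lt (h : RealB f S R₀) {z : ℂ} (hz : R₀ < ‖z‖) : z ∉ S :=
  fun hS => absurd (h.sing_bdd z hS) hz.not_gt

theorem RealB.deriv_ne_zero_of_lt (h : RealB f S R₀) {z : ℂ} (hz : R₀ < ‖f z‖) : deriv f z ≠ 0 :=
  h.deriv_ne_zero (h.notMem_of_lt hz)

theorem add_mem_logDom {ω : ℂ} (hω : ω ∈ logDom R₀) (l : ℕ) :
    ω + 2 * Real.pi * Complex.I * l ∈ logDom R₀ := by
  simpa [logDom] using hω

theorem RealB.tract_injective (h : RealB f S R₀) {H : ℂ → ℂ}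
    (hH : DifferentiableOn ℂ H (logDom R₀))
    (hfH : ∀ ω ∈ logDom R₀, f (Complex.exp (H ω)) = Complex.exp ω) {ω₁ ω₂ : ℂ}
    (h1 : ω₁ ∈ logDom R₀) (h2 : ω₂ ∈ logDom R₀)
    (he : Complex.exp (H ω₁) = Complex.exp (H ω₂)) : ω₁ = ω₂ := by
  have aux : ∀ ω ∈ logDom R₀, ∀ l : ℕ, 0 < l →
      Complex.exp (H (ω + 2 * Real.pi * Complex.I * l)) = Complex.exp (H ω) → False := by
    intro ω hω l hl hE
    have hEd : DifferentiableOn ℂ (fun ω => Complex.exp (H ω)) (logDom R₀) := hH.cexp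
    have hEd' : DifferentiableOn ℂ
        (fun ω => Complex.exp (H (ω + 2 * Real.pi * Complex.I * l))) (logDom R₀) :=
      hEd.comp (f := fun ω => ω + 2 * Real.pi * Complex.I * l)
        (differentiable_id.add_const _).differentiableOn (fun ω hω => add_mem_logDom hω l)
    refine h.not_periodic hEd hfH hl ?_
    refine lift_unique (p := f) h.diff isOpen_logDom convex_logDom.isPreconnected hEd' hEd
      (fun z hz => ?_) hω ?_ hE
    · show f (Complex.exp (H (z + _))) = f (Complex.exp (H z))
      rw [hfH _ (add_mem_logDom hz l), hfH _ hz]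
      refine Complex.exp_eq_exp_iff_exists_int.2 ⟨l, ?_⟩
      push_cast
      ring
    · refine h.deriv_ne_zero_of_lt ?_
      show R₀ < ‖f (Complex.exp (H (ω + _)))‖
      rw [hfH _ (add_mem_logDom hω l)]
      exact h.lt_norm_exp (add_mem_logDom hω l)
  have hexp : Complex.exp ω₁ = Complex.exp ω₂ := by rw [← hfH _ h1, ← hfH _ h2, he]
  obtain ⟨n, hn⟩ := Complex.exp_eq_exp_iff_exists_int.1 hexp
  rcases lt_trichotomy n 0 with hn0 | rfl | hn0
  · obtain ⟨l, rfl⟩ : ∃ l : ℕ, n = -l := ⟨n.natAbs, by omega⟩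
    refine (aux ω₁ h1 l (by omega) ?_).elim
    rw [he]
    congr 2
    rw [hn]; push_cast; ring
  · simpa using hn
  · obtain ⟨l, rfl⟩ : ∃ l : ℕ, n = l := ⟨n.natAbs, by omega⟩
    refine (aux ω₂ h2 l (by omega) ?_).elim
    rw [← he]
    congr 2
    rw [hn]; push_cast; ring

/-- Logarithmic coordinates over the complement of a disc containing the singular values. -/
theorem RealB.exists_tract (h : RealB f S R₀) {ζ ω : ℂ} (hω : ω ∈ logDom R₀)
    (hζ : f (Complex.exp ζ) = Complex.exp ω) :
    ∃ H : ℂ → ℂ, DifferentiableOn ℂ H (logDom R₀) ∧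
      (∀ ω ∈ logDom R₀, f (Complex.exp (H ω)) = Complex.exp ω) ∧ H ω = ζ := by
  obtain ⟨E, hE, hfE, hE0⟩ := exists_holo_lift h.diff h.cov convex_logDom isOpen_logDom
    (e := Complex.exp) Complex.differentiable_exp.differentiableOn
    (fun ω hω => h.notMem_of_lt (h.lt_norm_exp hω)) hω hζ
  obtain ⟨H, hH, hHe, hH0⟩ := exists_holo_log convex_logDom isOpen_logDom hE
    (fun ω hω h0 => by
      have := h.lt_norm_exp hω
      rw [← hfE ω hω, h0] at this
      linarith [h.zero_bdd]) hω hE0.symm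
  exact ⟨H, hH, fun ω hω => by rw [hHe ω hω, hfE ω hω], hH0⟩

theorem RealB.hasDerivAt_comp_exp (h : RealB f S R₀) (ζ : ℂ) :
    HasDerivAt (fun w => f (Complex.exp w)) (deriv f (Complex.exp ζ) * Complex.exp ζ) ζ :=
  (h.diff _).hasDerivAt.comp ζ (Complex.hasDerivAt_exp ζ)

theorem RealB.mem_logDom_log (h : RealB f S R₀) {z : ℂ} (hz : R₀ < ‖z‖) :
    Complex.log z ∈ logDom R₀ := by
  show Real.log R₀ < (Complex.log z).re
  rw [Complex.log_re]
  exact Real.log_lt_log h.pos hz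

/-- Every circle centred at the origin contains a point where `f` is small. -/
theorem RealB.exists_circle (h : RealB f S R₀) (x y : ℝ) :
    ∃ t ∈ Icc (0 : ℝ) 1, ‖f (Complex.exp (x + (y + 2 * Real.pi * t) * Complex.I))‖ ≤ R₀ := by
  by_contra! hcon
  set γ : ℝ → ℂ := fun t => x + (y + 2 * Real.pi * t) * Complex.I with hγ
  have hγc : Continuous γ := by fun_prop
  have hKc : IsCompact (γ '' Icc 0 1) := isCompact_Icc.image hγc
  have hKconv : Convex ℝ (γ '' Icc 0 1) := by
    rintro _ ⟨s, hs, rfl⟩ _ ⟨t, ht, rfl⟩ a b ha hb hab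
    refine ⟨a * s + b * t, convex_Icc 0 1 hs ht ha hb hab, ?_⟩
    simp only [hγ, Complex.real_smul]
    have : (b : ℂ) = 1 - a := by rw [← Complex.ofReal_one, ← hab]; push_cast; ring
    push_cast
    rw [this]
    ring
  have hUo : IsOpen {w : ℂ | R₀ < ‖f (Complex.exp w)‖} :=
    isOpen_lt continuous_const (h.diff.continuous.comp Complex.continuous_exp).norm
  obtain ⟨ε, hε, hsub⟩ := hKc.exists_thickening_subset_open hUo (by
    rintro _ ⟨t, ht, rfl⟩
    exact hcon t ht)
  set X := Metric.thickening ε (γ '' Icc 0 1) with hX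
  have hXc : Convex ℝ X := hKconv.thickening ε
  have hXo : IsOpen X := Metric.isOpen_thickening
  have hmX : ∀ t ∈ Icc (0 : ℝ) 1, γ t ∈ X := fun t ht =>
    Metric.self_subset_thickening hε _ ⟨t, ht, rfl⟩
  have h0 : γ 0 ∈ X := hmX 0 (by norm_num)
  have h1 : γ 1 ∈ X := hmX 1 (by norm_num)
  have hγ1 : Complex.exp (γ 1) = Complex.exp (γ 0) :=
    Complex.exp_eq_exp_iff_exists_int.2 ⟨1, by simp only [hγ]; push_cast; ring⟩
  have hγne : γ 1 ≠ γ 0 := by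
    intro he
    have := congrArg Complex.im he
    simp [hγ, Real.pi_ne_zero] at this
  have hXn : ∀ w ∈ X, f (Complex.exp w) ≠ 0 := fun w hw h0 => by
    have : R₀ < ‖f (Complex.exp w)‖ := hsub hw
    rw [h0, norm_zero] at this
    linarith [h.pos]
  obtain ⟨F, hF, hFe, -⟩ := exists_holo_log hXc hXo
    (h.diff.comp Complex.differentiable_exp).differentiableOn hXn h0
    (Complex.exp_log (hXn _ h0))
  have hFm : ∀ w ∈ X, F w ∈ logDom R₀ := by
    intro w hw
    have : R₀ < ‖f (Complex.exp w)‖ := hsub hw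
    rw [show f (Complex.exp w) = Complex.exp (F w) from (hFe w hw).symm, Complex.norm_exp,
      ← Real.log_lt_iff_lt_exp h.pos] at this
    exact this
  obtain ⟨H, hH, hfH, hH0⟩ := h.exists_tract (hFm _ h0) (hFe _ h0).symm
  have heq : EqOn (fun w => H (F w)) id X := by
    refine lift_unique (p := fun w => f (Complex.exp w))
      (h.diff.comp Complex.differentiable_exp) hXo hXc.isPreconnected
      (hH.comp hF hFm) differentiableOn_id (fun w hw => ?_) h0 ?_ hH0
    · show f (Complex.exp (H (F w))) = f (Complex.exp w)
      rw [hfH _ (hFm w hw), hFe w hw]; rfl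
    · rw [(h.hasDerivAt_comp_exp _).deriv]
      refine mul_ne_zero (h.deriv_ne_zero_of_lt ?_) (Complex.exp_ne_zero _)
      show R₀ < ‖f (Complex.exp (H (F (γ 0))))‖
      rw [hH0]
      exact hsub h0
  have e0 : H (F (γ 0)) = γ 0 := heq h0
  have e1 : H (F (γ 1)) = γ 1 := heq h1
  have hFF := h.tract_injective hH hfH (hFm _ h1) (hFm _ h0) (by rw [e0, e1, hγ1])
  exact hγne (by rw [← e0, ← e1, hFF])

/-- Koebe distortion in logarithmic coordinates. -/
theorem RealB.koebe_log (h : RealB f S R₀) {ζ w : ℂ} {r : ℝ} (hr : 0 < r)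
    (hrR : r ≤ Real.log ‖f (Complex.exp ζ)‖ - Real.log R₀) (hζ : R₀ < ‖f (Complex.exp ζ)‖)
    (hw : 20 * ‖w - ζ‖ * (‖deriv f (Complex.exp ζ)‖ * ‖Complex.exp ζ‖) <
      r * ‖f (Complex.exp ζ)‖) :
    f (Complex.exp w) ≠ 0 ∧
      |Real.log ‖f (Complex.exp w)‖ - Real.log ‖f (Complex.exp ζ)‖| < r := by
  have hf0 : f (Complex.exp ζ) ≠ 0 := norm_pos_iff.1 (h.pos.trans hζ)
  set ω := Complex.log (f (Complex.exp ζ)) with hω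
  have hωe : Complex.exp ω = f (Complex.exp ζ) := Complex.exp_log hf0
  have hωre : ω.re = Real.log ‖f (Complex.exp ζ)‖ := Complex.log_re _
  obtain ⟨H, hH, hfH, hH0⟩ := h.exists_tract (h.mem_logDom_log hζ) hωe.symm
  have hsub : ball ω r ⊆ logDom R₀ := by
    intro v hv
    rw [mem_ball, dist_eq_norm] at hv
    have := (Complex.abs_re_le_norm (v - ω)).trans_lt hv
    rw [Complex.sub_re, abs_lt] at this
    show Real.log R₀ < v.re
    linarith [this.1]
  have hk := koebe hr (hH.mono hsub) (fun a ha b hb hab =>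
    h.tract_injective hH hfH (hsub ha) (hsub hb) (by rw [hab]))
  have hωm := hsub (mem_ball_self hr)
  have hder : deriv f (Complex.exp ζ) * Complex.exp ζ * deriv H ω = f (Complex.exp ζ) := by
    have h1 := ((hH0 ▸ h.hasDerivAt_comp_exp ζ :
      HasDerivAt (fun w => f (Complex.exp w)) (deriv f (Complex.exp ζ) * Complex.exp ζ) (H ω))).comp
      ω (hH.differentiableAt (isOpen_logDom.mem_nhds hωm)).hasDerivAt
    have h2 : HasDerivAt Complex.exp (Complex.exp ω) ω := Complex.hasDerivAt_exp ω
    rw [← hωe]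
    refine h1.unique (h2.congr_of_eventuallyEq ?_)
    filter_upwards [isOpen_logDom.mem_nhds hωm] with v hv
    exact hfH v hv
  have hpos : 0 < ‖deriv f (Complex.exp ζ)‖ * ‖Complex.exp ζ‖ :=
    mul_pos (norm_pos_iff.2 (h.deriv_ne_zero_of_lt hζ)) (norm_pos_iff.2 (Complex.exp_ne_zero _))
  have hnorm := congrArg norm hder
  rw [norm_mul, norm_mul] at hnorm
  rw [← hnorm] at hw
  have hw' : w ∈ ball (H ω) (r * ‖deriv H ω‖ / 20) := by
    rw [hH0, mem_ball, dist_eq_norm]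
    nlinarith
  obtain ⟨v, hv, rfl⟩ := hk hw'
  rw [hfH v (hsub hv)]
  refine ⟨Complex.exp_ne_zero _, ?_⟩
  rw [Complex.norm_exp, Real.log_exp, ← hωre, ← Complex.sub_re]
  rw [mem_ball, dist_eq_norm] at hv
  exact (Complex.abs_re_le_norm _).trans_lt hv

theorem RealB.koebe_le (h : RealB f S R₀) {ζ w : ℂ} (hζ : R₀ < ‖f (Complex.exp ζ)‖)
    (hw : ‖f (Complex.exp w)‖ ≤ R₀) :
    (Real.log ‖f (Complex.exp ζ)‖ - Real.log R₀) * ‖f (Complex.exp ζ)‖ ≤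
      20 * ‖w - ζ‖ * (‖deriv f (Complex.exp ζ)‖ * ‖Complex.exp ζ‖) := by
  by_contra! hcon
  obtain ⟨h0, h1⟩ := h.koebe_log (sub_pos.2 (Real.log_lt_log h.pos hζ)) le_rfl hζ hcon
  have := Real.log_le_log (norm_pos_iff.2 h0) hw
  rw [abs_lt] at h1
  linarith [h1.1]

/-- The Eremenko–Lyubich inequality. -/
theorem RealB.eremenko_lyubich (h : RealB f S R₀) {z : ℂ} (hz : R₀ < ‖f z‖) (hz0 : z ≠ 0) :
    (Real.log ‖f z‖ - Real.log R₀) * ‖f z‖ ≤ 20 * Real.pi * (‖deriv f z‖ * ‖z‖) := by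
  set ζ := Complex.log z with hζ
  have hζz : Complex.exp ζ = z := Complex.exp_log hz0
  obtain ⟨t, ht, hft⟩ := h.exists_circle ζ.re (ζ.im - Real.pi)
  have := h.koebe_le (ζ := ζ) (by rwa [hζz]) hft
  rw [hζz] at this
  refine this.trans ?_
  gcongr
  have he : (ζ.re : ℂ) + (((ζ.im - Real.pi : ℝ) : ℂ) + 2 * Real.pi * t) * Complex.I - ζ
      = ((Real.pi * (2 * t - 1) : ℝ) : ℂ) * Complex.I := by
    push_cast
    linear_combination Complex.re_add_im ζ
  rw [he, norm_mul, Complex.norm_I, mul_one, Complex.norm_real, Real.norm_eq_abs, abs_mul,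
    abs_of_pos Real.pi_pos]
  have : |2 * t - 1| ≤ 1 := abs_le.2 ⟨by linarith [ht.1], by linarith [ht.2]⟩
  nlinarith [Real.pi_pos]

end

section
variable {f : ℂ → ℂ} {S : Set ℂ} {R₀ : ℝ} {z₀ : ℂ} {δ : ℝ}

theorem RealB.not_tendsto_aux (h : RealB f S R₀) {z : ℂ} (hz : z ∈ FatouSet f)
    (hR : ∀ n, R₀ < ‖f^[n] z‖) : ¬Tendsto (fun n => ‖f^[n] z‖) atTop atTop := by
  intro hT
  obtain ⟨ρ, hρ, T', hball⟩ := exists_ball_large hz (T := R₀ + 1) (by linarith [h.pos])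
  have hpos : ∀ n, 0 < ‖f^[n] z‖ := fun n => h.pos.trans (hR n)
  set A : ℕ → ℝ := fun n => Real.log ‖f^[n] z‖ - Real.log R₀ with hA
  have hA0 : ∀ n, 0 < A n := fun n => sub_pos.2 (Real.log_lt_log h.pos (hR n))
  set D : ℕ → ℝ := fun n => ‖deriv f^[n] z‖ / ‖f^[n] z‖ with hD
  have hstep : ∀ n, A (n + 1) * D n ≤ 20 * Real.pi * D (n + 1) := by
    intro n
    have hel := h.eremenko_lyubich (z := f^[n] z)
      (by rw [← Function.iterate_succ_apply' f n z]; exact hR (n + 1)) (norm_pos_iff.1 (hpos n))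
    rw [← Function.iterate_succ_apply' f n z] at hel
    have hder : ‖deriv f^[n + 1] z‖ = ‖deriv f (f^[n] z)‖ * ‖deriv f^[n] z‖ := by
      rw [add_comm, h.deriv_iterate_add 1 n, norm_mul, Function.iterate_one]
    simp only [hD, hder]
    rw [mul_div_assoc', mul_div_assoc', div_le_div_iff₀ (hpos n) (hpos (n + 1))]
    have := mul_le_mul_of_nonneg_right hel (norm_nonneg (deriv f^[n] z))
    simp only [hA]
    linarith
  have hup : ∀ n, T' ≤ ‖f^[n] z‖ → D n * ρ ≤ 2 * A n := by
    intro n hn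
    have hl := hball n hn
    have hn0 : ∀ y ∈ ball z ρ, f^[n] y ≠ 0 := fun y hy =>
      norm_pos_iff.1 (by linarith [hl y hy, h.pos])
    obtain ⟨G, hG, hGe, hGr⟩ := exists_log_norm hρ
      (h.differentiable_iterate n).differentiableOn hn0
    have hzb := mem_ball_self (x := z) hρ
    have hk := rhp_deriv_le hρ (ψ := fun y => G y - (Real.log R₀ : ℝ)) (hG.sub_const _)
      (fun y hy => by
        rw [Complex.sub_re, Complex.ofReal_re, hGr y hy, sub_pos]
        exact Real.log_lt_log h.pos (by linarith [hl y hy]))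
    rw [Complex.sub_re, Complex.ofReal_re, hGr z hzb, deriv_sub_const] at hk
    have hGd := (hG.differentiableAt (isOpen_ball.mem_nhds hzb)).hasDerivAt
    have h1 := hGd.cexp
    have h2 : HasDerivAt f^[n] (Complex.exp (G z) * deriv G z) z := by
      refine h1.congr_of_eventuallyEq ?_
      filter_upwards [isOpen_ball.mem_nhds hzb] with y hy
      exact (hGe y hy).symm
    have h3 : D n = ‖deriv G z‖ := by
      simp only [hD]
      rw [h2.deriv, hGe z hzb, norm_mul, mul_div_cancel_left₀ _ (hpos n).ne']
    rw [h3]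
    exact hk
  have hDpos : ∀ n, 0 < D n := by
    intro n
    induction n with
    | zero => simp only [hD]; exact div_pos (by simp) (hpos 0)
    | succ n ih =>
      have := hstep n
      have h1 := mul_pos (hA0 (n + 1)) ih
      by_contra hcon
      nlinarith [Real.pi_pos]
  have hAT : Tendsto A atTop atTop := tendsto_atTop_add_const_right _ _ (Real.tendsto_log_atTop.comp hT)
  obtain ⟨N, hN⟩ := eventually_atTop.1 ((hT.eventually_ge_atTop T').and
    (hAT.eventually_ge_atTop (40 * Real.pi)))
  have hb : ∀ n ≥ N, D n * ρ ≤ 40 * Real.pi := by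
    intro n hn
    have h1 := hup (n + 1) (hN (n + 1) (by omega)).1
    have h2 := hstep n
    have h3 := hA0 (n + 1)
    have : A (n + 1) * (D n * ρ) ≤ A (n + 1) * (40 * Real.pi) := by
      have := mul_le_mul_of_nonneg_right h2 hρ.le
      nlinarith [Real.pi_pos]
    exact le_of_mul_le_mul_left this h3
  have hg : ∀ k, 2 ^ k * D N ≤ D (N + k) := by
    intro k
    induction k with
    | zero => simp
    | succ k ih =>
      have h1 := hstep (N + k)
      have h2 := (hN (N + k + 1) (by omega)).2
      have h3 := mul_le_mul_of_nonneg_right h2 (hDpos (N + k)).le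
      rw [pow_succ, ← add_assoc]
      have : 2 * D (N + k) ≤ D (N + k + 1) := by
        have hpi := Real.pi_pos
        have : 20 * Real.pi * (2 * D (N + k)) ≤ 20 * Real.pi * D (N + k + 1) := by linarith
        exact le_of_mul_le_mul_left this (by positivity)
      linarith
  obtain ⟨k, hk⟩ := pow_unbounded_of_one_lt (40 * Real.pi / (D N * ρ)) (one_lt_two)
  rw [div_lt_iff₀ (mul_pos (hDpos N) hρ)] at hk
  have h1 := hb (N + k) (by omega)
  have h2 := mul_le_mul_of_nonneg_right (hg k) hρ.le
  linarith

/-- No orbit in the Fatou set escapes to infinity. -/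
theorem RealB.not_tendsto (h : RealB f S R₀) {z : ℂ} (hz : z ∈ FatouSet f) :
    ¬Tendsto (fun n => ‖f^[n] z‖) atTop atTop := by
  intro hT
  obtain ⟨N, hN⟩ := eventually_atTop.1 (hT.eventually_gt_atTop R₀)
  refine h.not_tendsto_aux (z := f^[N] z) ((h.iterate_mem_fatou N).2 hz) (fun n => ?_) ?_
  · rw [← Function.iterate_add_apply]; exact hN _ (by omega)
  · simp only [← Function.iterate_add_apply]
    exact hT.comp (tendsto_add_atTop_nat N)

end

section
variable {f : ℂ → ℂ} {S : Set ℂ} {R₀ : ℝ} {z₀ : ℂ} {δ : ℝ} {e : ℝ}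

/-- The real function `f` is unbounded along the half line in direction `e = ±1`. -/
def UEnd (f : ℂ → ℂ) (R₀ e : ℝ) : Prop := ∃ t > 0, R₀ < ‖f ((e * t : ℝ) : ℂ)‖

theorem RealB.norm_eq_rl (h : RealB f S R₀) (x : ℝ) : ‖f (x : ℂ)‖ = |rl f x| := by
  rw [← h.ofReal_rl, Complex.norm_real, Real.norm_eq_abs]

theorem RealB.hasDerivAt_ray (h : RealB f S R₀) (e t : ℝ) :
    HasDerivAt (fun t => rl f (e * t)) ((deriv f ((e * t : ℝ) : ℂ)).re * e) t := by
  have h1 := h.hasDerivAt_rl (e * t)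
  exact h1.comp t (by simpa using (hasDerivAt_id t).const_mul e)

theorem RealB.continuous_ray (h : RealB f S R₀) (e : ℝ) : Continuous fun t => rl f (e * t) :=
  h.continuous_rl.comp (continuous_const.mul continuous_id)

theorem ne_zero_of_sq_eq_one (he : e ^ 2 = 1) : e ≠ 0 := by
  rintro rfl
  norm_num at he

theorem RealB.end_mono (h : RealB f S R₀) (he : e ^ 2 = 1) {a b : ℝ} (ha : 0 < a) (hab : a ≤ b)
    (hfa : R₀ < ‖f ((e * a : ℝ) : ℂ)‖) : ‖f ((e * a : ℝ) : ℂ)‖ ≤ ‖f ((e * b : ℝ) : ℂ)‖ := by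
  obtain ⟨t, ht, hmax⟩ := isCompact_Icc.exists_isMaxOn ⟨a, ha.le, hab⟩
    ((h.continuous_ray e).pow 2).continuousOn
  have hle : ∀ s ∈ Icc 0 b, ‖f ((e * s : ℝ) : ℂ)‖ ≤ ‖f ((e * t : ℝ) : ℂ)‖ := by
    intro s hs
    rw [h.norm_eq_rl, h.norm_eq_rl]
    exact sq_le_sq.1 (hmax hs)
  have hta := hle a ⟨ha.le, hab⟩
  have ht0 : t ≠ 0 := by
    rintro rfl
    rw [mul_zero, Complex.ofReal_zero] at hta
    linarith [h.zero_bdd]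
  rcases ht.2.eq_or_lt with rfl | htb
  · exact hta
  exfalso
  have hloc := hmax.isLocalMax (Icc_mem_nhds (lt_of_le_of_ne ht.1 ht0.symm) htb)
  have hz := hloc.hasDerivAt_eq_zero ((h.hasDerivAt_ray e t).fun_pow 2)
  have hf' := h.deriv_ne_zero_of_lt (hfa.trans_le hta)
  rw [← h.ofReal_re_deriv] at hf'
  have h1 : (deriv f ((e * t : ℝ) : ℂ)).re ≠ 0 := fun h0 => hf' (by rw [h0]; simp)
  have h2 : rl f (e * t) ≠ 0 := fun h0 => by
    have := hfa.trans_le hta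
    rw [h.norm_eq_rl, h0, abs_zero] at this
    linarith [h.pos]
  exact (mul_ne_zero (mul_ne_zero (by norm_num) (pow_ne_zero _ h2))
    (mul_ne_zero h1 (ne_zero_of_sq_eq_one he))) hz

theorem RealB.end_sign (h : RealB f S R₀) (he : e ^ 2 = 1) (hu : UEnd f R₀ e) :
    ∃ T > 0, ∃ σ : ℝ, σ ^ 2 = 1 ∧ ∀ t ≥ T, R₀ < ‖f ((e * t : ℝ) : ℂ)‖ ∧
      0 < σ * rl f (e * t) := by
  obtain ⟨a, ha, hfa⟩ := hu
  have hbig : ∀ t ≥ a, R₀ < ‖f ((e * t : ℝ) : ℂ)‖ := fun t ht => hfa.trans_le (h.end_mono he ha ht hfa)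
  have hne : ∀ t ≥ a, rl f (e * t) ≠ 0 := fun t ht h0 => by
    have := hbig t ht
    rw [h.norm_eq_rl, h0, abs_zero] at this
    linarith [h.pos]
  obtain ⟨σ, hσ, hσa⟩ : ∃ σ : ℝ, σ ^ 2 = 1 ∧ 0 < σ * rl f (e * a) := by
    rcases (hne a le_rfl).lt_or_gt with h1 | h1
    · exact ⟨-1, by norm_num, by linarith⟩
    · exact ⟨1, by norm_num, by linarith⟩
  refine ⟨a, ha, σ, hσ, fun t ht => ⟨hbig t ht, ?_⟩⟩
  by_contra! hcon
  obtain ⟨s, hs, hs0⟩ := intermediate_value_Icc' ht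
    (continuous_const.mul (h.continuous_ray e)).continuousOn ⟨hcon, hσa.le⟩
  exact hne s hs.1 ((mul_eq_zero.1 hs0).resolve_left (ne_zero_of_sq_eq_one hσ))

theorem RealB.end_growth (h : RealB f S R₀) (he : e ^ 2 = 1) (hu : UEnd f R₀ e) (A : ℝ) :
    ∀ᶠ t in atTop, A * Real.log t ≤ Real.log ‖f ((e * t : ℝ) : ℂ)‖ := by
  obtain ⟨a, ha, σ, hσ, hT⟩ := h.end_sign he hu
  have hmono : ∀ s t : ℝ, a ≤ s → s ≤ t → ‖f ((e * s : ℝ) : ℂ)‖ ≤ ‖f ((e * t : ℝ) : ℂ)‖ :=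
    fun s t hs hst => h.end_mono he (ha.trans_le hs) hst (hT s hs).1
  set w : ℝ → ℝ := fun t => Real.log ‖f ((e * t : ℝ) : ℂ)‖ - Real.log R₀ with hw
  have hw0 : ∀ t ≥ a, 0 < w t := fun t ht => sub_pos.2 (Real.log_lt_log h.pos (hT t ht).1)
  have hrl0 : ∀ t ≥ a, rl f (e * t) ≠ 0 := fun t ht h0 => by
    have := (hT t ht).2
    rw [h0, mul_zero] at this
    exact this.false
  have hwd : ∀ t ≥ a, HasDerivAt w
      ((deriv f ((e * t : ℝ) : ℂ)).re * e / rl f (e * t)) t := by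
    intro t ht
    have := ((h.hasDerivAt_ray e t).log (hrl0 t ht)).sub_const (Real.log R₀)
    refine this.congr_of_eventuallyEq (Eventually.of_forall fun s => ?_)
    simp only [hw, h.norm_eq_rl, Real.log_abs]
  set c : ℝ := (20 * Real.pi)⁻¹ with hc
  have hc0 : 0 < c := by positivity
  have hlow : ∀ t > a, c * w t / t ≤ (deriv f ((e * t : ℝ) : ℂ)).re * e / rl f (e * t) := by
    intro t ht
    have ht0 : 0 < t := ha.trans ht
    have hnn : 0 ≤ (deriv f ((e * t : ℝ) : ℂ)).re * e / rl f (e * t) := by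
      refine (hwd t ht.le).hasDerivWithinAt.nonneg_of_monotoneOn (s := Ici a) ?_ ?_
      · rw [accPt_iff_frequently]
        refine (((eventually_gt_nhds ht).filter_mono nhdsWithin_le_nhds).and
          (self_mem_nhdsWithin (s := Ioi t))).frequently.filter_mono nhdsWithin_le_nhds |>.mono ?_
        rintro y ⟨h1, h2⟩
        exact ⟨ne_of_gt h2, le_of_lt h1⟩
      · intro x hx y hy hxy
        exact sub_le_sub_right (Real.log_le_log (h.pos.trans (hT x hx).1) (hmono x y hx hxy)) _
    have hel := h.eremenko_lyubich (hT t ht.le).1 (z := ((e * t : ℝ) : ℂ))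
      (by exact_mod_cast mul_ne_zero (ne_zero_of_sq_eq_one he) ht0.ne')
    have habs : |e| = 1 := by rw [← abs_one]; exact sq_eq_sq_iff_abs_eq_abs _ _ |>.1 (by rw [he]; norm_num)
    rw [← abs_of_nonneg hnn, abs_div, abs_mul, habs, mul_one, ← h.norm_eq_rl,
      div_le_div_iff₀ ht0 (h.pos.trans (hT t ht.le).1), hc]
    rw [Complex.norm_real, Real.norm_eq_abs, abs_mul, habs, one_mul, abs_of_pos ht0,
      ← h.ofReal_re_deriv, Complex.norm_real, Real.norm_eq_abs] at hel
    rw [mul_assoc, inv_mul_le_iff₀ (by positivity)]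
    exact hel
  have hmonog : MonotoneOn (fun t => Real.log (w t) - c * Real.log t) (Ici a) := by
    have hd : ∀ t ≥ a, HasDerivAt (fun t => Real.log (w t) - c * Real.log t)
        ((deriv f ((e * t : ℝ) : ℂ)).re * e / rl f (e * t) / w t - c * t⁻¹) t := fun t ht =>
      ((hwd t ht).log (hw0 t ht).ne').sub ((Real.hasDerivAt_log (ha.trans_le ht).ne').const_mul c)
    refine monotoneOn_of_deriv_nonneg (convex_Ici a)
      (fun t ht => (hd t ht).continuousAt.continuousWithinAt)
      (fun t ht => (hd t (interior_subset ht)).differentiableAt.differentiableWithinAt)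
      (fun t ht => ?_)
    rw [interior_Ici, mem_Ioi] at ht
    rw [(hd t ht.le).deriv, sub_nonneg, le_div_iff₀ (hw0 t ht.le)]
    refine le_trans (le_of_eq ?_) (hlow t ht)
    rw [div_eq_mul_inv]; ring
  set k : ℝ := Real.exp (Real.log (w a) - c * Real.log a) with hk
  have hge : ∀ t ≥ a, k * t ^ c ≤ w t := by
    intro t ht
    have h1 : Real.log (w a) - c * Real.log a ≤ Real.log (w t) - c * Real.log t :=
      hmonog (mem_Ici.2 le_rfl) ht ht
    rw [Real.rpow_def_of_pos (ha.trans_le ht), hk, ← Real.exp_add,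
      ← Real.le_log_iff_exp_le (hw0 t ht)]
    linarith
  have hlo := (isLittleO_log_rpow_atTop hc0).bound (c := k / (2 * (|A| + 1))) (by positivity)
  have hlim : Tendsto (fun t : ℝ => k * t ^ c) atTop atTop :=
    (tendsto_rpow_atTop hc0).const_mul_atTop (Real.exp_pos _)
  filter_upwards [hlo, eventually_ge_atTop a, eventually_ge_atTop 1,
    hlim.eventually_ge_atTop (2 * |Real.log R₀|)] with t h1 h2 h3 h4
  have h5 := hge t h2
  have hl0 : 0 ≤ Real.log t := Real.log_nonneg h3
  have hp : 0 ≤ t ^ c := Real.rpow_nonneg (by linarith) _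
  rw [Real.norm_of_nonneg hl0, Real.norm_of_nonneg hp, div_mul_eq_mul_div,
    le_div_iff₀ (by positivity)] at h1
  have h6 : A * Real.log t ≤ (|A| + 1) * Real.log t :=
    mul_le_mul_of_nonneg_right (by linarith [le_abs_self A]) hl0
  have h7 : w t = Real.log ‖f ((e * t : ℝ) : ℂ)‖ - Real.log R₀ := rfl
  linarith [neg_abs_le (Real.log R₀)]

end

section
variable {f : ℂ → ℂ} {S : Set ℂ} {R₀ : ℝ} {z₀ : ℂ} {δ : ℝ} {e : ℝ}

/-- A combinatorial principle: a sequence of sizes `ν` with signs given by `c`, whose growth is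
controlled by two ends, some of which (those in `U`) are unbounded, is bounded. -/
theorem bounded_of_ends {ν c : ℕ → ℝ} {U : ℝ → Prop} {σ : ℝ → ℝ} {R : ℝ} {n₀ : ℕ}
    (hσ : ∀ e, e ^ 2 = 1 → U e → σ e ^ 2 = 1)
    (hB : ∀ e, e ^ 2 = 1 → ¬U e → ∀ n ≥ n₀, 0 ≤ e * c n → ν (n + 1) ≤ R)
    (hU : ∀ e, e ^ 2 = 1 → U e → ∀ n ≥ n₀, R ≤ ν n → 0 ≤ e * c n →
      ν n ≤ ν (n + 1) ∧ 0 < σ e * c (n + 1))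
    (hM : ∀ M, ∃ M', ∀ n, ν n ≤ M → ν (n + 1) ≤ M')
    (hesc : ∀ m ≥ n₀, ¬∀ k ≥ m, R ≤ ν k ∧ ∃ e, e ^ 2 = 1 ∧ U e ∧ 0 ≤ e * c k) :
    ∃ M, ∀ n, ν n ≤ M := by
  by_contra! hcon
  have hbig : ∀ M, ∃ n ≥ n₀ + 2, M < ν n := by
    intro M
    obtain ⟨B, hB⟩ := ((finite_Iic (n₀ + 2)).image ν).bddAbove
    obtain ⟨n, hn⟩ := hcon (max M B)
    refine ⟨n, ?_, (le_max_left _ _).trans_lt hn⟩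
    by_contra! hlt
    exact absurd (hB (mem_image_of_mem ν hlt.le)) (not_le.2 ((le_max_right _ _).trans_lt hn))
  have hneg : ∀ e : ℝ, e ^ 2 = 1 → (-e) ^ 2 = 1 := fun e he => by rw [neg_sq, he]
  by_cases hall : ∀ e, e ^ 2 = 1 → U e
  · have hsgn : ∀ k, ∃ e, e ^ 2 = 1 ∧ U e ∧ 0 ≤ e * c k := by
      intro k
      rcases le_total 0 (c k) with h1 | h1
      · exact ⟨1, by norm_num, hall _ (by norm_num), by linarith⟩
      · exact ⟨-1, by norm_num, hall _ (by norm_num), by linarith⟩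
    obtain ⟨m, hm, hRm⟩ := hbig R
    refine hesc m (by omega) fun k hk => ⟨?_, hsgn k⟩
    induction k, hk using Nat.le_induction with
    | base => exact hRm.le
    | succ k hk ih =>
      obtain ⟨e, he, hu, hc⟩ := hsgn k
      exact ih.trans (hU e he hu k (by omega) ih hc).1
  push Not at hall
  obtain ⟨e', he', hb⟩ := hall
  by_cases hu : U (-e')
  · set e := -e' with hdef
    have he : e ^ 2 = 1 := hneg _ he'
    have hpos : ∀ n ≥ n₀, R < ν (n + 1) → 0 < e * c n := by
      intro n hn h1
      by_contra! h2
      exact absurd (hB e' he' hb n hn (by rw [hdef] at h2; linarith)) (not_le.2 h1)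
    obtain ⟨M₁, h1⟩ := hM R
    obtain ⟨M₂, h2⟩ := hM (max M₁ R)
    obtain ⟨n, hn, hbn⟩ := hbig (max M₂ R)
    obtain ⟨p, rfl⟩ : ∃ p, n = p + 2 := ⟨n - 2, by omega⟩
    have hp1 : max M₁ R < ν (p + 1) := by
      by_contra! h3
      exact absurd (h2 _ h3) (not_le.2 ((le_max_left _ _).trans_lt hbn))
    have hp0 : R < ν p := by
      by_contra! h3
      exact absurd (h1 _ h3) (not_le.2 ((le_max_left _ _).trans_lt hp1))
    have hc1 := hpos (p + 1) (by omega) ((le_max_right _ _).trans_lt hbn)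
    have hc0 := hpos p (by omega) ((le_max_right _ _).trans_lt hp1)
    have hs := (hU e he hu p (by omega) hp0.le hc0.le).2
    have hσe : σ e = e := by
      rcases sq_eq_sq_iff_eq_or_eq_neg.1 ((hσ e he hu).trans he.symm) with h3 | h3
      · exact h3
      · rw [h3] at hs; linarith
    refine hesc p (by omega) fun k hk => ?_
    have key : R ≤ ν k ∧ 0 ≤ e * c k := by
      induction k, hk using Nat.le_induction with
      | base => exact ⟨hp0.le, hc0.le⟩
      | succ k hk ih =>
        have := hU e he hu k (by omega) ih.1 ih.2
        exact ⟨ih.1.trans this.1, by rw [hσe] at this; exact this.2.le⟩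
    exact ⟨key.1, e, he, hu, key.2⟩
  · obtain ⟨n, hn, hRn⟩ := hbig R
    obtain ⟨p, rfl⟩ : ∃ p, n = p + 1 := ⟨n - 1, by omega⟩
    rcases le_total 0 (e' * c p) with h1 | h1
    · exact absurd (hB e' he' hb p (by omega) h1) (not_le.2 hRn)
    · exact absurd (hB (-e') (hneg _ he') hu p (by omega) (by linarith)) (not_le.2 hRn)

theorem RealB.bddOrbit_of_real (h : RealB f S R₀) {p : ℝ} (hp : (p : ℂ) ∈ FatouSet f) :
    BddOrbit f p := by
  have hgrow : ∃ R ≥ 2, ∀ e : ℝ, e ^ 2 = 1 → UEnd f R₀ e → ∃ σ : ℝ, σ ^ 2 = 1 ∧ ∀ t ≥ R,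
      2 * t ≤ ‖f ((e * t : ℝ) : ℂ)‖ ∧ 0 < σ * rl f (e * t) := by
    have hone : ∀ e : ℝ, e ^ 2 = 1 → ∃ R ≥ 2, UEnd f R₀ e → ∃ σ : ℝ, σ ^ 2 = 1 ∧ ∀ t ≥ R,
        2 * t ≤ ‖f ((e * t : ℝ) : ℂ)‖ ∧ 0 < σ * rl f (e * t) := by
      intro e he
      by_cases hu : UEnd f R₀ e
      · obtain ⟨T, hT, σ, hσ, hs⟩ := h.end_sign he hu
        obtain ⟨X, hX⟩ := eventually_atTop.1 (h.end_growth he hu 2)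
        refine ⟨max 2 (max T X), le_max_left _ _, fun _ => ⟨σ, hσ, fun t ht => ?_⟩⟩
        simp only [ge_iff_le, max_le_iff] at ht
        obtain ⟨ht2, htT, htX⟩ := ht
        refine ⟨?_, (hs t htT).2⟩
        have h1 := hX t htX
        rw [← Real.log_rpow (by linarith), Real.log_le_log_iff
          (Real.rpow_pos_of_pos (by linarith) _) (h.pos.trans (hs t htT).1)] at h1
        refine le_trans ?_ h1
        rw [Real.rpow_two]
        nlinarith
      · exact ⟨2, le_rfl, fun h1 => absurd h1 hu⟩
    obtain ⟨R1, hR1, h1⟩ := hone 1 (by norm_num)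
    obtain ⟨R2, hR2, h2⟩ := hone (-1) (by norm_num)
    refine ⟨max R1 R2, hR1.trans (le_max_left _ _), fun e he hu => ?_⟩
    rcases sq_eq_one_iff.1 he with rfl | rfl
    · obtain ⟨σ, hσ, h3⟩ := h1 hu
      exact ⟨σ, hσ, fun t ht => h3 t ((le_max_left _ _).trans ht)⟩
    · obtain ⟨σ, hσ, h3⟩ := h2 hu
      exact ⟨σ, hσ, fun t ht => h3 t ((le_max_right _ _).trans ht)⟩
  obtain ⟨R, hR2, hgrow⟩ := hgrow
  choose! σ hσ hgrow using hgrow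
  set x : ℕ → ℝ := fun n => (rl f)^[n] p with hx
  have hfx : ∀ n, f^[n] (p : ℂ) = (x n : ℝ) := fun n => h.iterate_ofReal n p
  have hsucc : ∀ n, x (n + 1) = rl f (x n) := fun n => Function.iterate_succ_apply' _ _ _
  have habs : ∀ e : ℝ, e ^ 2 = 1 → ∀ t : ℝ, 0 ≤ e * t → e * |t| = t := by
    intro e he t ht
    rcases sq_eq_one_iff.1 he with rfl | rfl
    · rw [abs_of_nonneg (by linarith)]; ring
    · rw [abs_of_nonpos (by linarith)]; ring
  have hstep : ∀ e : ℝ, e ^ 2 = 1 → UEnd f R₀ e → ∀ n, R ≤ |x n| → 0 ≤ e * x n →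
      2 * |x n| ≤ |x (n + 1)| ∧ 0 < σ e * x (n + 1) := by
    intro e he hu n hn hc
    have := hgrow e he hu |x n| hn
    rwa [habs e he _ hc, h.norm_eq_rl, ← hsucc] at this
  suffices hb : ∃ M, ∀ n, |x n| ≤ M by
    obtain ⟨M, hM⟩ := hb
    exact ⟨M, fun n => by rw [hfx, Complex.norm_real]; exact hM n⟩
  refine bounded_of_ends (ν := fun n => |x n|) (c := x) (U := UEnd f R₀) (σ := σ)
    (R := max R R₀) (n₀ := 0) hσ ?_ ?_ ?_ ?_
  · intro e he hu n _ hc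
    refine le_max_of_le_right ?_
    show |x (n + 1)| ≤ R₀
    rw [hsucc, ← h.norm_eq_rl]
    by_contra! hlt
    rcases eq_or_ne (x n) 0 with h0 | h0
    · rw [h0, Complex.ofReal_zero] at hlt
      exact absurd h.zero_bdd (not_lt.2 hlt.le)
    · exact hu ⟨|x n|, abs_pos.2 h0, by rwa [habs e he _ hc]⟩
  · intro e he hu n _ hn hc
    have := hstep e he hu n ((le_max_left _ _).trans hn) hc
    exact ⟨by have := abs_nonneg (x n); show |x n| ≤ |x (n + 1)|; linarith, this.2⟩
  · intro M
    obtain ⟨B, hB⟩ := (isCompact_Icc (a := -M) (b := M)).exists_bound_of_continuousOn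
      h.continuous_rl.continuousOn
    refine ⟨B, fun n hn => ?_⟩
    show |x (n + 1)| ≤ B
    rw [hsucc]
    exact hB _ (abs_le.1 hn)
  · intro m _ hall
    refine h.not_tendsto hp ?_
    rw [← tendsto_add_atTop_iff_nat m]
    have hlow : ∀ k, (2 : ℝ) ^ k ≤ |x (k + m)| := by
      intro k
      induction k with
      | zero =>
        have := (hall m le_rfl).1
        have h2 := le_max_left R R₀
        rw [pow_zero, zero_add]
        linarith
      | succ k ih =>
        obtain ⟨h1, e, he, hu, hc⟩ := hall (k + m) (by omega)
        have := (hstep e he hu _ ((le_max_left _ _).trans h1) hc).1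
        rw [show k + 1 + m = k + m + 1 by omega, pow_succ]
        linarith
    refine tendsto_atTop_mono (fun k => ?_) (tendsto_pow_atTop_atTop_of_one_lt one_lt_two)
    rw [hfx, Complex.norm_real]
    exact hlow k

end

section
variable {f : ℂ → ℂ} {S : Set ℂ} {R₀ : ℝ} {z₀ : ℂ} {δ : ℝ} {e : ℝ}

theorem rhp_affine {ψ : ℂ → ℂ} {c : ℂ} {ρ r : ℝ} (hρ : 0 < ρ)
    (hd : DifferentiableOn ℂ ψ (ball c ρ)) (hm : ∀ z ∈ ball c ρ, 0 < (ψ z).re)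
    (hr : 0 < r) (hrρ : r ≤ ρ / 8) {w : ℂ} (hw : w ∈ ball c r) :
    ‖ψ w - ψ c - deriv ψ c * (w - c)‖ ≤ 96 * ‖ψ c‖ / ρ ^ 2 * r * ‖w - c‖ := by
  have hsub : ∀ {u : ℂ} {a b d : ℝ}, u ∈ ball c a → a + b ≤ d → ball u b ⊆ ball c d :=
    fun {u a b d} hu hab => ball_subset_ball' (by have := mem_ball.1 hu; linarith)
  have h1 : ∀ u ∈ ball c (ρ / 2), ‖ψ u‖ ≤ 3 * ‖ψ c‖ := by
    intro u hu
    have := rhp_norm_le hd hm (t := 1 / 2) (ball_subset_ball (by linarith) hu)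
      (by have := mem_ball.1 hu; linarith)
    linarith
  have h2 : ∀ u ∈ ball c (ρ / 4), ‖deriv ψ u‖ ≤ 12 * ‖ψ c‖ / ρ := by
    intro u hu
    have := norm_deriv_le_of_forall_ball (f := ψ) (c := u) (ρ := ρ / 4) (by linarith)
      (hd.mono (hsub hu (by linarith))) (fun z hz => h1 z (hsub hu (by linarith) hz))
    rw [le_div_iff₀ hρ]
    linarith
  have hd' : DifferentiableOn ℂ (deriv ψ) (ball c ρ) := hd.deriv isOpen_ball
  have h3 : ∀ u ∈ ball c (ρ / 8), ‖deriv (deriv ψ) u‖ ≤ 96 * ‖ψ c‖ / ρ ^ 2 := by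
    intro u hu
    have := norm_deriv_le_of_forall_ball (f := deriv ψ) (c := u) (ρ := ρ / 8) (by linarith)
      (hd'.mono (hsub hu (by linarith))) (fun z hz => h2 z (hsub hu (by linarith) hz))
    rw [le_div_iff₀ hρ] at this
    rw [le_div_iff₀ (by positivity)]
    nlinarith
  have hat : ∀ u ∈ ball c r, u ∈ ball c ρ := fun u hu => ball_subset_ball (by linarith) hu
  have hc : c ∈ ball c r := mem_ball_self hr
  have h4 : ∀ u ∈ ball c r, ‖deriv ψ u - deriv ψ c‖ ≤ 96 * ‖ψ c‖ / ρ ^ 2 * r := by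
    intro u hu
    refine ((convex_ball c r).norm_image_sub_le_of_norm_deriv_le
      (fun v hv => (hd'.differentiableAt (isOpen_ball.mem_nhds (hat v hv))))
      (fun v hv => h3 v (ball_subset_ball hrρ hv)) hc hu).trans ?_
    refine mul_le_mul_of_nonneg_left ?_ (by positivity)
    exact (dist_eq_norm u c ▸ mem_ball.1 hu).le
  have hder : ∀ u ∈ ball c r, HasDerivAt (fun z => ψ z - deriv ψ c * z)
      (deriv ψ u - deriv ψ c) u := fun u hu => by
    have := ((hd.differentiableAt (isOpen_ball.mem_nhds (hat u hu))).hasDerivAt).fun_sub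
      ((hasDerivAt_id' u).const_mul (deriv ψ c))
    exact this.congr_deriv (by ring)
  have := (convex_ball c r).norm_image_sub_le_of_norm_hasDerivWithin_le
    (fun u hu => (hder u hu).hasDerivWithinAt) h4 hc hw
  refine le_trans (le_of_eq ?_) this
  congr 1
  ring

theorem abs_eq_one_of_sq (he : e ^ 2 = 1) : |e| = 1 := by
  rcases sq_eq_one_iff.1 he with rfl | rfl <;> norm_num

theorem exists_sin_eq_zero {g : ℝ → ℝ} {θ a : ℝ} (hθ : 0 < θ) (hg : ContinuousOn g (Icc θ (9 * θ)))
    (herr : ∀ τ ∈ Icc θ (9 * θ), |g τ - a * τ| ≤ |a| * τ / 2) (hπ : Real.pi ≤ 3 * |a| * θ) :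
    ∃ τ ∈ Icc θ (9 * θ), Real.sin (g τ) = 0 := by
  obtain ⟨s, hs1, hsa⟩ : ∃ s : ℝ, s ^ 2 = 1 ∧ s * a = |a| := by
    rcases le_total 0 a with h1 | h1
    · exact ⟨1, by norm_num, by rw [abs_of_nonneg h1, one_mul]⟩
    · exact ⟨-1, by norm_num, by rw [abs_of_nonpos h1]; ring⟩
  have herr' : ∀ τ ∈ Icc θ (9 * θ), |s * g τ - |a| * τ| ≤ |a| * τ / 2 := by
    intro τ hτ
    have h2 : s * g τ - |a| * τ = s * (g τ - a * τ) := by rw [← hsa]; ring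
    rw [h2, abs_mul, abs_eq_one_of_sq hs1, one_mul]
    exact herr τ hτ
  have h9 : θ ≤ 9 * θ := by linarith
  have hlo := (abs_le.1 (herr' θ ⟨le_rfl, h9⟩)).2
  have hhi := (abs_le.1 (herr' (9 * θ) ⟨h9, le_rfl⟩)).1
  set n : ℤ := ⌈s * g θ / Real.pi⌉ with hn
  have hn1 := Int.le_ceil (s * g θ / Real.pi)
  have hn2 := Int.ceil_lt_add_one (s * g θ / Real.pi)
  rw [← hn, div_le_iff₀ Real.pi_pos] at hn1
  rw [← hn, ← sub_lt_iff_lt_add, lt_div_iff₀ Real.pi_pos] at hn2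
  have hn3 : (n : ℝ) * Real.pi ≤ s * g (9 * θ) := by linarith
  obtain ⟨τ, hτ, hτn⟩ := intermediate_value_Icc h9 (continuousOn_const.mul hg) ⟨hn1, hn3⟩
  refine ⟨τ, hτ, ?_⟩
  have h3 : g τ = s * (n * Real.pi) := by
    have h4 : s * g τ = n * Real.pi := hτn
    rw [← h4, ← mul_assoc, ← sq, hs1, one_mul]
  rw [h3]
  rcases sq_eq_one_iff.1 hs1 with rfl | rfl
  · rw [one_mul, Real.sin_int_mul_pi]
  · rw [neg_one_mul, Real.sin_neg, Real.sin_int_mul_pi, neg_zero]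

set_option maxHeartbeats 800000 in
/-- The behaviour of `f` in a small sector around an unbounded real end. -/
theorem RealB.end_model (h : RealB f S R₀) (he : e ^ 2 = 1) (hu : UEnd f R₀ e) {r K : ℝ}
    (hK : 0 < K)
    (hlog : ∀ x : ℝ, r < |x| → r < ‖f (x : ℂ)‖ →
      ‖deriv f (x : ℂ)‖ / ‖f (x : ℂ)‖ ≤ K * Real.log ‖f (x : ℂ)‖ / |x|) :
    ∃ κ > 0, κ ≤ 1 ∧ ∃ σ : ℝ, σ ^ 2 = 1 ∧ ∀ M : ℝ, ∃ T > 0, ∀ t ≥ T,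
      (∀ β : ℝ, |β| ≤ κ →
        M ≤ Real.log ‖f ((e * t : ℝ) * Complex.exp (β * Complex.I))‖ ∧
        Real.log t ≤ Real.log ‖f ((e * t : ℝ) * Complex.exp (β * Complex.I))‖) ∧
      ∃ a > 0, M ≤ a ∧
        (∀ β : ℝ, |β| ≤ κ → 3 * a * |β| < Real.pi →
          0 < σ * (f ((e * t : ℝ) * Complex.exp (β * Complex.I))).re) ∧
        ∀ θ > 0, 9 * θ ≤ κ → Real.pi ≤ 3 * a * θ → ∃ τ ∈ Icc θ (9 * θ),
          (f ((e * t : ℝ) * Complex.exp (τ * Complex.I))).im = 0 := by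
  obtain ⟨T₁, hT₁, σ, hσ, hs⟩ := h.end_sign he hu
  have habs : |e| = 1 := (abs_eq_one_of_sq he)
  set ρ : ℝ := min (1 / (40 * K)) 1 with hρdef
  have hρ : 0 < ρ := lt_min (by positivity) one_pos
  have hρ1 : ρ ≤ 1 := min_le_right _ _
  have hρK : ρ * (40 * K) ≤ 1 := by
    have := min_le_left (1 / (40 * K)) 1
    rwa [← hρdef, le_div_iff₀ (by positivity)] at this
  set q : ℝ := ρ ^ 2 / 30000 with hq
  have hq0 : 0 < q := by positivity
  have hqρ : q ≤ ρ / 8 := by rw [hq]; nlinarith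
  refine ⟨q / 2, by positivity, by linarith, σ, hσ, fun M => ?_⟩
  have hlim : Tendsto (fun t : ℝ => Real.log ‖f ((e * t : ℝ) : ℂ)‖) atTop atTop :=
    tendsto_atTop_mono' atTop ((h.end_growth he hu 1).mono fun t ht => by simpa using ht)
      Real.tendsto_log_atTop
  obtain ⟨T, hT⟩ := eventually_atTop.1 ((h.end_growth he hu 2).and
    ((hlim.eventually_ge_atTop (max (2 * |M|) (max (40 * Real.pi * |M|)
      (max (2 * |Real.log R₀|) (|Real.log r| + 1))))).and (eventually_gt_atTop r)))
  refine ⟨max T (max T₁ 1), by positivity, fun t ht => ?_⟩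
  simp only [ge_iff_le, max_le_iff] at ht
  obtain ⟨htT, htT₁, ht1⟩ := ht
  have ht0 : 0 < t := by linarith
  obtain ⟨hg2, hbig, htr⟩ := hT t htT
  simp only [max_le_iff] at hbig
  obtain ⟨hb1, hb2, hb3, hb4⟩ := hbig
  obtain ⟨hfR, hσt⟩ := hs t htT₁
  set Λ : ℝ := Real.log ‖f ((e * t : ℝ) : ℂ)‖ with hΛ
  have hfpos : 0 < ‖f ((e * t : ℝ) : ℂ)‖ := h.pos.trans hfR
  have hΛ0 : 0 < Λ := by have := abs_nonneg (Real.log r); linarith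
  have hx0 : ((e * t : ℝ) : ℂ) ≠ 0 := by
    exact_mod_cast mul_ne_zero (ne_zero_of_sq_eq_one he) ht0.ne'
  have hxabs : |e * t| = t := by rw [abs_mul, habs, one_mul, abs_of_pos ht0]
  obtain ⟨c, hc⟩ : ∃ c, Complex.exp c = ((e * t : ℝ) : ℂ) := ⟨_, Complex.exp_log hx0⟩
  have hfr : r < ‖f ((e * t : ℝ) : ℂ)‖ := by
    by_contra! hle
    have := Real.log_le_log hfpos hle
    have h2 := le_abs_self (Real.log r)
    linarith
  have hK1 := hlog (e * t) (by rwa [hxabs]) hfr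
  rw [hxabs, ← hΛ, div_le_div_iff₀ hfpos ht0] at hK1
  have hsector : ∀ w ∈ ball c ρ, f (Complex.exp w) ≠ 0 ∧
      Λ / 2 < Real.log ‖f (Complex.exp w)‖ := by
    intro w hw
    have := h.koebe_log (ζ := c) (w := w) (r := Λ / 2) (by positivity)
      (by rw [hc, ← hΛ]; have := le_abs_self (Real.log R₀); linarith) (by rwa [hc]) (by
        rw [hc, Complex.norm_real, Real.norm_eq_abs, hxabs]
        have h1 : ‖w - c‖ < ρ := by rw [← dist_eq_norm]; exact hw
        calc 20 * ‖w - c‖ * (‖deriv f ((e * t : ℝ) : ℂ)‖ * t)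
            ≤ 20 * ‖w - c‖ * (K * Λ * ‖f ((e * t : ℝ) : ℂ)‖) := by gcongr
          _ < 20 * ρ * (K * Λ * ‖f ((e * t : ℝ) : ℂ)‖) := by gcongr
          _ = ρ * (40 * K) * (Λ / 2 * ‖f ((e * t : ℝ) : ℂ)‖) := by ring
          _ ≤ 1 * (Λ / 2 * ‖f ((e * t : ℝ) : ℂ)‖) := by gcongr
          _ = _ := one_mul _)
    rw [hc, ← hΛ, abs_lt] at this
    exact ⟨this.1, by linarith [this.2.1]⟩
  have hexp : ∀ β : ℝ, Complex.exp (c + β * Complex.I) =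
      (e * t : ℝ) * Complex.exp (β * Complex.I) := fun β => by rw [Complex.exp_add, hc]
  have hnormβ : ∀ β : ℝ, ‖(β : ℂ) * Complex.I‖ = |β| := fun β => by
    rw [norm_mul, Complex.norm_I, mul_one, Complex.norm_real, Real.norm_eq_abs]
  have hmemq : ∀ β : ℝ, |β| ≤ q / 2 → c + β * Complex.I ∈ ball c q := fun β hβ => by
    rw [mem_ball, dist_eq_norm, add_sub_cancel_left, hnormβ]
    linarith
  have hmem : ∀ β : ℝ, |β| ≤ q / 2 → c + β * Complex.I ∈ ball c ρ := fun β hβ =>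
    ball_subset_ball (by linarith) (hmemq β hβ)
  refine ⟨fun β hβ => ?_, ?_⟩
  · rw [← hexp]
    have := (hsector _ (hmem β hβ)).2
    have h1 := le_abs_self M
    constructor <;> linarith
  obtain ⟨G, hGd, hGe, hGre⟩ := exists_log_norm (h := fun w => f (Complex.exp w)) hρ
    (h.diff.comp Complex.differentiable_exp).differentiableOn (fun w hw => (hsector w hw).1)
  have hcρ : c ∈ ball c ρ := mem_ball_self hρ
  set G₁ : ℂ → ℂ := fun w => G w - (G c).im * Complex.I with hG₁
  have hG₁d : DifferentiableOn ℂ G₁ (ball c ρ) := hGd.sub_const _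
  have hG₁re : ∀ w ∈ ball c ρ, (G₁ w).re = Real.log ‖f (Complex.exp w)‖ := fun w hw => by
    rw [← hGre w hw]; simp [hG₁]
  have hG₁pos : ∀ w ∈ ball c ρ, 0 < (G₁ w).re := fun w hw => by
    rw [hG₁re w hw]; linarith [(hsector w hw).2]
  have hG₁c : G₁ c = (Λ : ℝ) := by
    apply Complex.ext
    · rw [hG₁re c hcρ, hc, Complex.ofReal_re]
    · simp [hG₁]
  have hσf : σ * rl f (e * t) = ‖f ((e * t : ℝ) : ℂ)‖ := by
    rw [h.norm_eq_rl, ← abs_of_pos hσt, abs_mul, abs_eq_one_of_sq hσ, one_mul]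
  have hexpG₁c : Complex.exp (G₁ c) = σ * f ((e * t : ℝ) : ℂ) := by
    rw [hG₁c, ← Complex.ofReal_exp, hΛ, Real.exp_log hfpos, ← hσf, Complex.ofReal_mul, h.ofReal_rl]
  have hfne : f ((e * t : ℝ) : ℂ) ≠ 0 := norm_pos_iff.1 hfpos
  have hu : Complex.exp (-((G c).im * Complex.I)) = σ := by
    have h1 : Complex.exp (G₁ c) = f ((e * t : ℝ) : ℂ) * Complex.exp (-((G c).im * Complex.I)) := by
      show Complex.exp (G c - (G c).im * Complex.I) = _
      rw [sub_eq_add_neg, Complex.exp_add, hGe c hcρ, hc]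
    rw [h1, mul_comm] at hexpG₁c
    exact mul_right_cancel₀ hfne hexpG₁c
  have hexpG₁ : ∀ w ∈ ball c ρ, Complex.exp (G₁ w) = σ * f (Complex.exp w) := fun w hw => by
    show Complex.exp (G w - (G c).im * Complex.I) = _
    rw [sub_eq_add_neg, Complex.exp_add, hGe w hw, hu, mul_comm]
  have hGder : HasDerivAt G₁ (deriv G₁ c) c :=
    (hG₁d.differentiableAt (isOpen_ball.mem_nhds hcρ)).hasDerivAt
  set a : ℝ := (deriv f ((e * t : ℝ) : ℂ)).re * (e * t) / rl f (e * t) with ha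
  have hda : deriv G₁ c = (a : ℝ) := by
    have h1 := hGder.cexp
    have h2 := (h.hasDerivAt_comp_exp c).const_mul (σ : ℂ)
    have h3 := h1.unique (h2.congr_of_eventuallyEq
      (eventually_of_mem (isOpen_ball.mem_nhds hcρ) hexpG₁))
    rw [hexpG₁c, hc, mul_assoc] at h3
    have hσ0 : (σ : ℂ) ≠ 0 := by exact_mod_cast ne_zero_of_sq_eq_one hσ
    have h4 := mul_left_cancel₀ hσ0 h3
    rw [ha, Complex.ofReal_div, h.ofReal_rl, Complex.ofReal_mul, h.ofReal_re_deriv,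
      eq_div_iff hfne, mul_comm, h4]
  have haΛ : Λ ≤ 40 * Real.pi * |a| := by
    have hel := h.eremenko_lyubich hfR hx0
    rw [← hΛ, Complex.norm_real, Real.norm_eq_abs, hxabs, ← h.ofReal_re_deriv, Complex.norm_real,
      Real.norm_eq_abs] at hel
    have h1 : |a| * ‖f ((e * t : ℝ) : ℂ)‖ = |(deriv f ((e * t : ℝ) : ℂ)).re| * t := by
      rw [ha, abs_div, abs_mul, hxabs, ← h.norm_eq_rl, div_mul_cancel₀ _ hfpos.ne']
    rw [← h1, ← mul_assoc] at hel
    have h2 := le_of_mul_le_mul_right hel hfpos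
    have h3 := le_abs_self (Real.log R₀)
    linarith
  have ha0 : 0 < |a| := by
    have := Real.pi_pos
    by_contra! hle
    nlinarith
  have herr : ∀ β : ℝ, |β| ≤ q / 2 → |(G₁ (c + β * Complex.I)).im - a * β| ≤ |a| * |β| / 2 := by
    intro β hβ
    have h1 := rhp_affine hρ hG₁d hG₁pos hq0 hqρ (hmemq β hβ)
    rw [add_sub_cancel_left, hnormβ, hda, hG₁c, Complex.norm_real, Real.norm_of_nonneg hΛ0.le] at h1
    have h2 := (Complex.abs_im_le_norm _).trans h1
    have h3 : (G₁ (c + β * Complex.I) - (Λ : ℝ) - (a : ℝ) * (β * Complex.I)).im =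
        (G₁ (c + β * Complex.I)).im - a * β := by simp
    rw [h3] at h2
    refine h2.trans ?_
    rw [mul_div_right_comm |a|]
    refine mul_le_mul_of_nonneg_right ?_ (abs_nonneg _)
    have h4 : 96 * Λ / ρ ^ 2 * q = 96 * Λ / 30000 := by rw [hq]; field_simp
    rw [h4]
    have := Real.pi_lt_d2
    nlinarith
  have hσfim : ∀ β : ℝ, |β| ≤ q / 2 → σ * (f ((e * t : ℝ) * Complex.exp (β * Complex.I))).re =
      Real.exp (G₁ (c + β * Complex.I)).re * Real.cos (G₁ (c + β * Complex.I)).im ∧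
      σ * (f ((e * t : ℝ) * Complex.exp (β * Complex.I))).im =
      Real.exp (G₁ (c + β * Complex.I)).re * Real.sin (G₁ (c + β * Complex.I)).im := by
    intro β hβ
    have h1 := hexpG₁ _ (hmem β hβ)
    rw [hexp] at h1
    rw [← Complex.exp_re, ← Complex.exp_im, h1, Complex.re_ofReal_mul, Complex.im_ofReal_mul]
    exact ⟨rfl, rfl⟩
  refine ⟨|a|, ha0, ?_, fun β hβ hlt => ?_, fun θ hθ hθq hπ => ?_⟩
  · have h1 := le_abs_self M
    have := Real.pi_pos
    nlinarith
  · rw [(hσfim β hβ).1]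
    refine mul_pos (Real.exp_pos _) (Real.cos_pos_of_mem_Ioo ?_)
    have h1 := herr β hβ
    have h2 : |a * β| = |a| * |β| := abs_mul _ _
    have h3 : |(G₁ (c + β * Complex.I)).im| < Real.pi / 2 := by
      have := abs_sub_abs_le_abs_sub (G₁ (c + β * Complex.I)).im (a * β)
      nlinarith
    exact abs_lt.1 h3
  · have hcont : ContinuousOn (fun τ : ℝ => (G₁ (c + τ * Complex.I)).im) (Icc θ (9 * θ)) := by
      refine Complex.continuous_im.comp_continuousOn ?_
      refine hG₁d.continuousOn.comp (by fun_prop) fun τ hτ => hmem τ ?_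
      rw [abs_of_nonneg (by linarith [hτ.1])]
      linarith [hτ.2]
    obtain ⟨τ, hτ, hτn⟩ := exists_sin_eq_zero hθ hcont (a := a) (fun τ hτ => by
      have h0 : |τ| = τ := abs_of_nonneg (by linarith [hτ.1])
      have := herr τ (by rw [h0]; linarith [hτ.2])
      rwa [h0] at this) hπ
    have h1 := (hσfim τ (by rw [abs_of_nonneg (by linarith [hτ.1])]; linarith [hτ.2])).2
    rw [hτn, mul_zero] at h1
    exact ⟨τ, hτ, (mul_eq_zero.1 h1).resolve_left (ne_zero_of_sq_eq_one hσ)⟩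

end

section
variable {f : ℂ → ℂ} {S : Set ℂ} {R₀ : ℝ} {z₀ : ℂ} {δ : ℝ} {e : ℝ}

/-- Polar coordinates centred at the half line in direction `e = ±1`. -/
theorem exists_polar (he : e ^ 2 = 1) {z : ℂ} (hz : z ≠ 0) (hc : 0 ≤ e * z.re) :
    ∃ β : ℝ, |β| * ‖z‖ ≤ Real.pi / 2 * |z.im| ∧ |β| ≤ Real.pi / 2 ∧
      |z.im| = ‖z‖ * Real.sin |β| ∧ z.re = e * ‖z‖ * Real.cos β ∧
      ((e * ‖z‖ : ℝ) : ℂ) * Complex.exp (β * Complex.I) = z := by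
  set u : ℂ := (e : ℂ) * z with hu
  have hun : ‖u‖ = ‖z‖ := by
    rw [hu, norm_mul, Complex.norm_real, Real.norm_eq_abs, abs_eq_one_of_sq he, one_mul]
  have hz0 : 0 < ‖z‖ := norm_pos_iff.2 hz
  have hβ : |u.arg| ≤ Real.pi / 2 :=
    Complex.abs_arg_le_pi_div_two_iff.2 (by rwa [hu, Complex.re_ofReal_mul])
  have hpol := Complex.norm_mul_exp_arg_mul_I u
  have hee : (e : ℂ) * e = 1 := by rw [← sq]; exact_mod_cast he
  have hz' : ((e * ‖z‖ : ℝ) : ℂ) * Complex.exp (u.arg * Complex.I) = z := by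
    rw [hun] at hpol
    rw [Complex.ofReal_mul, mul_assoc, hpol, hu, ← mul_assoc, hee, one_mul]
  have him : z.im = e * ‖z‖ * Real.sin u.arg := by
    conv_lhs => rw [← hz', Complex.im_ofReal_mul, Complex.exp_ofReal_mul_I_im]
  have hre : z.re = e * ‖z‖ * Real.cos u.arg := by
    conv_lhs => rw [← hz', Complex.re_ofReal_mul, Complex.exp_ofReal_mul_I_re]
  have hsin : |z.im| = ‖z‖ * Real.sin |u.arg| := by
    rw [him, abs_mul, abs_mul, abs_eq_one_of_sq he, one_mul, abs_of_pos hz0,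
      Real.abs_sin_eq_sin_abs_of_abs_le_pi (hβ.trans (by linarith [Real.pi_pos]))]
  refine ⟨u.arg, ?_, hβ, hsin, hre, hz'⟩
  have h1 := Real.mul_le_sin (abs_nonneg u.arg) hβ
  rw [hsin]
  have hp := Real.pi_pos
  have h2 : |u.arg| ≤ Real.pi / 2 * Real.sin |u.arg| := by
    have := mul_le_mul_of_nonneg_left h1 (by positivity : 0 ≤ Real.pi / 2)
    have h3 : Real.pi / 2 * (2 / Real.pi * |u.arg|) = |u.arg| := by field_simp
    linarith
  calc |u.arg| * ‖z‖ ≤ Real.pi / 2 * Real.sin |u.arg| * ‖z‖ := by gcongr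
    _ = _ := by ring

/-- Points near a bounded real end have bounded image, if `f` is not too expanding there. -/
theorem RealB.norm_le_of_not_uEnd (h : RealB f S R₀) (he : e ^ 2 = 1) (hu : ¬UEnd f R₀ e) {z : ℂ}
    (hz : z ≠ 0) (hc : 0 ≤ e * z.re) (hd : ‖deriv f z‖ * |z.im| ≤ 2 * |(f z).im|) :
    ‖f z‖ ≤ R₀ * Real.exp (20 * Real.pi) := by
  by_contra! hlt
  have hp := Real.pi_pos
  have hfR : R₀ < ‖f z‖ := by
    refine lt_of_le_of_lt ?_ hlt
    exact le_mul_of_one_le_right h.pos.le (Real.one_le_exp (by positivity))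
  have hz0 : 0 < ‖z‖ := norm_pos_iff.2 hz
  obtain ⟨β, hβ, -, -, -, hpol⟩ := exists_polar he hz hc
  have hx0 : ((e * ‖z‖ : ℝ) : ℂ) ≠ 0 := by
    exact_mod_cast mul_ne_zero (ne_zero_of_sq_eq_one he) hz0.ne'
  obtain ⟨c, hcx⟩ : ∃ c, Complex.exp c = ((e * ‖z‖ : ℝ) : ℂ) := ⟨_, Complex.exp_log hx0⟩
  have hexp : Complex.exp (c + β * Complex.I) = z := by rw [Complex.exp_add, hcx, hpol]
  have hfx : ‖f ((e * ‖z‖ : ℝ) : ℂ)‖ ≤ R₀ := by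
    by_contra! h1
    exact hu ⟨_, hz0, h1⟩
  have h1 := h.koebe_le (ζ := c + β * Complex.I) (w := c) (by rwa [hexp]) (by rwa [hcx])
  rw [hexp, sub_add_cancel_left, norm_neg, norm_mul, Complex.norm_I, mul_one, Complex.norm_real,
    Real.norm_eq_abs] at h1
  have h2 : (Real.log ‖f z‖ - Real.log R₀) * ‖f z‖ ≤ 20 * Real.pi * ‖f z‖ := by
    calc (Real.log ‖f z‖ - Real.log R₀) * ‖f z‖ ≤ 20 * |β| * (‖deriv f z‖ * ‖z‖) := h1
      _ = 20 * ‖deriv f z‖ * (|β| * ‖z‖) := by ring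
      _ ≤ 20 * ‖deriv f z‖ * (Real.pi / 2 * |z.im|) := by gcongr
      _ = 10 * Real.pi * (‖deriv f z‖ * |z.im|) := by ring
      _ ≤ 10 * Real.pi * (2 * |(f z).im|) := by gcongr
      _ ≤ 10 * Real.pi * (2 * ‖f z‖) := by gcongr; exact Complex.abs_im_le_norm _
      _ = _ := by ring
  have h3 := le_of_mul_le_mul_right h2 (h.pos.trans hfR)
  have h4 := Real.log_lt_log (mul_pos h.pos (Real.exp_pos _)) hlt
  rw [Real.log_mul h.pos.ne' (Real.exp_pos _).ne', Real.log_exp] at h4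
  linarith

theorem RealB.angle_growth (h : RealB f S R₀) {z : ℂ} (hz : z ≠ 0) (hfR : R₀ < ‖f z‖)
    (hd : ‖deriv f z‖ * |z.im| ≤ 2 * |(f z).im|) :
    (Real.log ‖f z‖ - Real.log R₀) * (|z.im| / ‖z‖) ≤ 40 * Real.pi * (|(f z).im| / ‖f z‖) := by
  have hp := Real.pi_pos
  have hz0 : 0 < ‖z‖ := norm_pos_iff.2 hz
  have hf0 : 0 < ‖f z‖ := h.pos.trans hfR
  have h1 := h.eremenko_lyubich hfR hz
  rw [mul_div_assoc', mul_div_assoc', div_le_div_iff₀ hz0 hf0]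
  calc (Real.log ‖f z‖ - Real.log R₀) * |z.im| * ‖f z‖
      = (Real.log ‖f z‖ - Real.log R₀) * ‖f z‖ * |z.im| := by ring
    _ ≤ 20 * Real.pi * (‖deriv f z‖ * ‖z‖) * |z.im| := by gcongr
    _ = 20 * Real.pi * ‖z‖ * (‖deriv f z‖ * |z.im|) := by ring
    _ ≤ 20 * Real.pi * ‖z‖ * (2 * |(f z).im|) := by gcongr
    _ = _ := by ring

theorem RealB.end_step (h : RealB f S R₀) (o : Orb f z₀ δ) (he : e ^ 2 = 1) (hu : UEnd f R₀ e)
    {r K : ℝ} (hK : 0 < K)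
    (hlog : ∀ x : ℝ, r < |x| → r < ‖f (x : ℂ)‖ →
      ‖deriv f (x : ℂ)‖ / ‖f (x : ℂ)‖ ≤ K * Real.log ‖f (x : ℂ)‖ / |x|) :
    ∃ R : ℝ, ∃ N : ℕ, ∃ σ : ℝ, σ ^ 2 = 1 ∧ ∀ n ≥ N, R ≤ ‖f^[n] z₀‖ → 0 ≤ e * (f^[n] z₀).re →
      ‖f^[n] z₀‖ ≤ ‖f^[n + 1] z₀‖ ∧ 0 < σ * (f^[n + 1] z₀).re ∧
      10 * (|(f^[n] z₀).im| / ‖f^[n] z₀‖) ≤ |(f^[n + 1] z₀).im| / ‖f^[n + 1] z₀‖ := by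
  obtain ⟨κ, hκ, hκ1, σ, hσ, hmodel⟩ := h.end_model he hu hK hlog
  have hp := Real.pi_pos
  have hp3 := Real.pi_gt_three
  have hp4 := Real.pi_lt_d2
  obtain ⟨T, hT, hmod⟩ := hmodel (max (3 * Real.pi / κ) (Real.log R₀ + 400 * Real.pi))
  obtain ⟨N₁, hN₁⟩ := o.deriv_iterate_le h
  obtain ⟨N₂, hN₂⟩ := o.box h (2 * (30 / κ)) (30 / κ) (ε := κ / 15) (by positivity)
  obtain ⟨N₃, hN₃⟩ := o.box h 13 15 (ε := 1) one_pos
  refine ⟨T, max N₁ (max N₂ N₃), σ, hσ, fun n hn hR hc => ?_⟩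
  simp only [ge_iff_le, max_le_iff] at hn
  obtain ⟨hn1, hn2, hn3⟩ := hn
  have hd := hN₁ n hn1 1
  have hs := o.abs_im_pos n
  have hB2 := hN₂ n hn2
  have hB3 := hN₃ n hn3
  rw [Function.iterate_succ_apply' f n z₀]
  rw [Function.iterate_one, Function.iterate_succ_apply' f n z₀] at hd
  set z : ℂ := f^[n] z₀ with hz
  set t : ℝ := ‖z‖ with ht
  have ht0 : 0 < t := hT.trans_le hR
  have hz0 : z ≠ 0 := norm_pos_iff.1 ht0
  have hst : |z.im| ≤ t := Complex.abs_im_le_norm z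
  obtain ⟨hlow, a, ha, hMa, hnear, hcross⟩ := hmod t hR
  simp only [max_le_iff] at hlow hMa
  have hre : ∀ τ : ℝ, (((e * t : ℝ) : ℂ) * Complex.exp (τ * Complex.I)).re = e * t * Real.cos τ :=
    fun τ => by rw [Complex.re_ofReal_mul, Complex.exp_ofReal_mul_I_re]
  have him : ∀ τ : ℝ, 0 < τ → τ ≤ 1 →
      |(((e * t : ℝ) : ℂ) * Complex.exp (τ * Complex.I)).im| = t * Real.sin τ := fun τ h0 h1 => by
    rw [Complex.im_ofReal_mul, Complex.exp_ofReal_mul_I_im, abs_mul, abs_mul, abs_eq_one_of_sq he,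
      one_mul, abs_of_pos ht0, abs_of_pos (Real.sin_pos_of_pos_of_lt_pi h0 (by linarith))]
  have het : |e * t| = t := by rw [abs_mul, abs_eq_one_of_sq he, one_mul, abs_of_pos ht0]
  have hangle : |z.im| < κ / 30 * t := by
    by_contra! hge
    have hts : t ≤ 30 / κ * |z.im| := by
      rw [div_mul_eq_mul_div, le_div_iff₀ hκ]; linarith
    obtain ⟨τ, ⟨hτ1, hτ2⟩, hτ0⟩ := hcross (κ / 9) (by positivity) (by linarith) (by
      have := hMa.1
      rw [div_le_iff₀ hκ] at this
      linarith)
    have hτpos : 0 < τ := lt_of_lt_of_le (by positivity) hτ1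
    have hτle : τ ≤ 1 := by linarith
    refine hB2 _ ?_ ?_ ?_ 1 hτ0
    · have h1 : |(((e * t : ℝ) : ℂ) * Complex.exp (τ * Complex.I)).re| ≤ t := by
        rw [hre, abs_mul, het]
        exact mul_le_of_le_one_right ht0.le (Real.abs_cos_le_one τ)
      have h2 : |z.re| ≤ t := Complex.abs_re_le_norm z
      have h3 := abs_sub (((e * t : ℝ) : ℂ) * Complex.exp (τ * Complex.I)).re z.re
      linarith
    · rw [him τ hτpos hτle]
      have h1 := Real.mul_le_sin hτpos.le (by linarith)
      have h2 : κ / 15 ≤ Real.sin τ := by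
        refine le_trans ?_ h1
        rw [div_mul_eq_mul_div, div_le_div_iff₀ (by norm_num) hp]
        nlinarith
      have h3 : 0 ≤ Real.sin τ := by linarith
      calc κ / 15 * |z.im| ≤ Real.sin τ * t := by gcongr
        _ = _ := mul_comm _ _
    · rw [him τ hτpos hτle]
      exact (mul_le_of_le_one_right ht0.le (Real.sin_le_one τ)).trans hts
  obtain ⟨β, hβ1, hβ2, hβs, hβre, hpol⟩ := exists_polar he hz0 hc
  have hβκ : 9 * |β| ≤ κ := by
    have h1 : |β| * t ≤ κ / 9 * t := by nlinarith
    have := le_of_mul_le_mul_right h1 ht0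
    linarith
  have hβκ' : |β| ≤ κ := by linarith [abs_nonneg β]
  obtain ⟨⟨hl1, hl2⟩, hl3⟩ := hlow β hβκ'
  rw [hpol] at hl1 hl2 hl3
  have hlpos : 0 < Real.log ‖f z‖ := lt_of_lt_of_le (by positivity) hl1
  have hfne : 0 < ‖f z‖ := by
    rcases (norm_nonneg (f z)).eq_or_lt with h0 | h0
    · rw [← h0, Real.log_zero] at hlpos
      exact absurd hlpos (lt_irrefl _)
    · exact h0
  have hfR : R₀ < ‖f z‖ := (Real.log_lt_log_iff h.pos hfne).1 (by linarith)
  refine ⟨(Real.log_le_log_iff ht0 hfne).1 hl3, ?_, ?_⟩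
  · rcases lt_or_ge (3 * a * |β|) Real.pi with h1 | h1
    · have := hnear β hβκ' h1
      rwa [hpol] at this
    · exfalso
      have hβ0 : 0 < |β| := by
        rcases (abs_nonneg β).eq_or_lt with h0 | h0
        · rw [← h0] at h1; linarith
        · exact h0
      obtain ⟨τ, ⟨hτ1, hτ2⟩, hτ0⟩ := hcross |β| hβ0 hβκ h1
      have hτpos : 0 < τ := hβ0.trans_le hτ1
      have hτle : τ ≤ 1 := by linarith
      refine hB3 _ ?_ ?_ ?_ 1 hτ0
      · rw [hre, hβre, ← mul_sub, abs_mul, het, ← Real.cos_abs β]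
        have h2 := Real.abs_cos_sub_cos_le τ (|β|)
        rw [abs_of_nonneg (sub_nonneg.2 hτ1)] at h2
        calc t * |Real.cos τ - Real.cos (|β|)| ≤ t * (8 * |β|) := by gcongr; linarith
          _ = 8 * (|β| * t) := by ring
          _ ≤ 8 * (Real.pi / 2 * |z.im|) := by gcongr
          _ ≤ 13 * |z.im| := by nlinarith
      · rw [him τ hτpos hτle, one_mul, hβs]
        gcongr
        exact Real.sin_le_sin_of_le_of_le_pi_div_two (by linarith) (by linarith) hτ1
      · rw [him τ hτpos hτle]
        calc t * Real.sin τ ≤ t * (9 * |β|) := by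
              gcongr; exact (Real.sin_le hτpos.le).trans hτ2
          _ = 9 * (|β| * t) := by ring
          _ ≤ 9 * (Real.pi / 2 * |z.im|) := by gcongr
          _ ≤ 15 * |z.im| := by nlinarith
  · have h1 := h.angle_growth hz0 hfR hd
    have h2 : 400 * Real.pi * (|z.im| / ‖z‖) ≤
        (Real.log ‖f z‖ - Real.log R₀) * (|z.im| / ‖z‖) := by gcongr; linarith
    nlinarith

theorem RealB.bddOrbit_of_orb (h : RealB f S R₀) (o : Orb f z₀ δ) {r K : ℝ} (hK : 0 < K)
    (hlog : ∀ x : ℝ, r < |x| → r < ‖f (x : ℂ)‖ →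
      ‖deriv f (x : ℂ)‖ / ‖f (x : ℂ)‖ ≤ K * Real.log ‖f (x : ℂ)‖ / |x|) : BddOrbit f z₀ := by
  have hone : ∀ e : ℝ, ∃ R : ℝ, ∃ N : ℕ, ∃ σ : ℝ, e ^ 2 = 1 → UEnd f R₀ e →
      σ ^ 2 = 1 ∧ ∀ n ≥ N, R ≤ ‖f^[n] z₀‖ → 0 ≤ e * (f^[n] z₀).re →
      ‖f^[n] z₀‖ ≤ ‖f^[n + 1] z₀‖ ∧ 0 < σ * (f^[n + 1] z₀).re ∧
      10 * (|(f^[n] z₀).im| / ‖f^[n] z₀‖) ≤ |(f^[n + 1] z₀).im| / ‖f^[n + 1] z₀‖ := by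
    intro e
    by_cases hu : e ^ 2 = 1 ∧ UEnd f R₀ e
    · obtain ⟨R, N, σ, h1⟩ := h.end_step o hu.1 hu.2 hK hlog
      exact ⟨R, N, σ, fun _ _ => h1⟩
    · exact ⟨0, 0, 0, fun h1 h2 => absurd ⟨h1, h2⟩ hu⟩
  choose R N σ hstep using hone
  obtain ⟨N₁, hN₁⟩ := o.deriv_iterate_le h
  set R' : ℝ := max (R₀ * Real.exp (20 * Real.pi)) (max (R 1) (R (-1)))
  set N' : ℕ := max N₁ (max (N 1) (N (-1)))
  have hRe : ∀ e : ℝ, e ^ 2 = 1 → R e ≤ R' ∧ N e ≤ N' := by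
    intro e he
    rcases sq_eq_one_iff.1 he with rfl | rfl
    · exact ⟨le_max_of_le_right (le_max_left _ _), le_max_of_le_right (le_max_left _ _)⟩
    · exact ⟨le_max_of_le_right (le_max_right _ _), le_max_of_le_right (le_max_right _ _)⟩
  have hz0 : ∀ n, f^[n] z₀ ≠ 0 := fun n h0 => o.im_ne_zero n (by rw [h0, Complex.zero_im])
  refine bounded_of_ends (ν := fun n => ‖f^[n] z₀‖) (c := fun n => (f^[n] z₀).re)
    (U := UEnd f R₀) (σ := σ) (R := R') (n₀ := N') (fun e he hu => (hstep e he hu).1) ?_ ?_ ?_ ?_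
  · intro e he hu n hn hc
    refine le_max_of_le_left ?_
    have hd := hN₁ n ((le_max_left _ _).trans hn) 1
    rw [Function.iterate_one, Function.iterate_succ_apply' f n z₀] at hd
    rw [Function.iterate_succ_apply' f n z₀]
    exact h.norm_le_of_not_uEnd he hu (hz0 n) hc hd
  · intro e he hu n hn hR hc
    have := (hstep e he hu).2 n ((hRe e he).2.trans hn) ((hRe e he).1.trans hR) hc
    exact ⟨this.1, this.2.1⟩
  · intro M
    obtain ⟨B, hB⟩ := (isCompact_closedBall (0 : ℂ) M).exists_bound_of_continuousOn
      h.diff.continuous.continuousOn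
    refine ⟨B, fun n hn => ?_⟩
    show ‖f^[n + 1] z₀‖ ≤ B
    rw [Function.iterate_succ_apply' f n z₀]
    exact hB _ (mem_closedBall_zero_iff.2 hn)
  · intro m hm hall
    set v : ℕ → ℝ := fun n => |(f^[n] z₀).im| / ‖f^[n] z₀‖
    have hv1 : ∀ n, v n ≤ 1 := fun n => div_le_one_of_le₀ (Complex.abs_im_le_norm _) (norm_nonneg _)
    have hv0 : 0 < v m := div_pos (o.abs_im_pos m) (norm_pos_iff.2 (hz0 m))
    have hgrow : ∀ k, (10 : ℝ) ^ k * v m ≤ v (m + k) := by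
      intro k
      induction k with
      | zero => simp
      | succ k ih =>
        obtain ⟨hR, e, he, hu, hc⟩ := hall (m + k) (by omega)
        have := ((hstep e he hu).2 (m + k) (by have := (hRe e he).2; omega)
          ((hRe e he).1.trans hR) hc).2.2
        calc (10 : ℝ) ^ (k + 1) * v m = 10 * (10 ^ k * v m) := by ring
          _ ≤ 10 * v (m + k) := by gcongr
          _ ≤ v (m + (k + 1)) := this
    obtain ⟨k, hk⟩ := pow_unbounded_of_one_lt (1 / v m) (by norm_num : (1 : ℝ) < 10)
    rw [div_lt_iff₀ hv0] at hk
    linarith [hgrow k, hv1 (m + k)]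

theorem RealB.not_wand (h : RealB f S R₀) {r K : ℝ} (hK : 0 < K)
    (hlog : ∀ x : ℝ, r < |x| → r < ‖f (x : ℂ)‖ →
      ‖deriv f (x : ℂ)‖ / ‖f (x : ℂ)‖ ≤ K * Real.log ‖f (x : ℂ)‖ / |x|) {z : ℂ}
    (hz : Wand f z) : False := by
  by_cases hI : ∀ n, ∀ w ∈ comp f (f^[n] z), w.im ≠ 0
  · obtain ⟨δ, hδ, hball⟩ := Metric.isOpen_iff.1 (isOpen_comp z) z (mem_comp hz.1)
    have o : Orb f z δ := ⟨hz, hδ, fun w hw n => hI n _ (h.image_comp n hz.1 ⟨w, hball hw, rfl⟩)⟩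
    exact h.false_of_nonreal hz (h.bddOrbit_of_orb o hK hlog) hI
  · push Not at hI
    obtain ⟨n, w, hw, hw0⟩ := hI
    have hp := h.wand_of_mem_comp (h.wand_iterate hz n) hw
    rw [← ofReal_re_of_im_eq_zero hw0] at hp
    exact h.false_of_real hp (h.bddOrbit_of_real hp.1)

theorem realB_of_isSingularValueSet (hf : TranscendentalEntire f) (hS : IsSingularValueSet f S)
    (hSbdd : Bornology.IsBounded S)
    (hreal : S ∪ f '' {z : ℂ | z.im = 0} ⊆ {z : ℂ | z.im = 0}) : ∃ R₀, RealB f S R₀ := by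
  obtain ⟨C, hC⟩ := hSbdd.exists_norm_le
  refine ⟨max C ‖f 0‖ + 1, hf.1, hf.2, hS.2.1, fun z hz => hreal (Or.inl hz),
    fun x => hreal (Or.inr ⟨x, Complex.ofReal_im x, rfl⟩), fun z hz => ?_, ?_⟩
  · linarith [hC z hz, le_max_left C ‖f 0‖]
  · linarith [le_max_right C ‖f 0‖]

end

end RealClassB

/-- **Theorem (Statement 1).** Let `f ∈ B` with `S(f) ∪ f(ℝ) ⊆ ℝ`, and suppose there are
`r, K > 0` such that `|f'(x)|/|f(x)| ≤ K log|f(x)| / |x|` whenever `x ∈ ℝ` with `|x| > r` and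
`|f(x)| > r`. Then `f` has no wandering domain. -/
theorem no_wandering_domains_real
    (f : ℂ → ℂ) (S : Set ℂ)
    (hf : TranscendentalEntire f)
    (hS : IsSingularValueSet f S)
    (hSbdd : Bornology.IsBounded S)
    (hreal : S ∪ f '' {z : ℂ | z.im = 0} ⊆ {z : ℂ | z.im = 0})
    (r K : ℝ) (hr : 0 < r) (hK : 0 < K)
    (hlog : ∀ x : ℝ, r < |x| → r < ‖f (x : ℂ)‖ →
      ‖deriv f (x : ℂ)‖ / ‖f (x : ℂ)‖ ≤ K * Real.log ‖f (x : ℂ)‖ / |x|) :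
    ¬∃ W : Set ℂ, IsWanderingDomain f W := by
  rintro ⟨W, hW⟩
  obtain ⟨R₀, h⟩ := RealClassB.realB_of_isSingularValueSet hf hS hSbdd hreal
  obtain ⟨z, hz⟩ := h.wand_of_isWanderingDomain hW
  exact h.not_wand hK hlog hz
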